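/- Suppose b_σ ≠ 0. Under the multi-layer network assumptions, for any fixed real numbers z₋₁, z₀, …, z_L with z_L ≠ 0, the empirical eigenvalue distribution of z₋₁ Id + z₀ X₀ᵀX₀ + ⋯ + z_L X_LᵀX_L converges weakly almost surely to the probability distribution ν whose Stieltjes transform is m_ν(z) = t_L((−z+z₋₁, z₀, …, z_L), (1,0,…,0)) for z ∈ ℂ⁺. In particular, the empirical eigenvalue distribution of the Neural Tangent Kernel K^NTK converges weakly almost surely to the probability distribution with Stieltjes transform m_NTK(z) = t_L((−z+r₊, q₀, …, q_{L−1}, 1), (1,0,…,0)), and there is a constant C > 0 such that ‖K^NTK‖ ≤ C almost surely for all large n. -/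

import Mathlib

/-!
Theorem (NTK spectrum): under the multi-layer network assumptions with `b_σ ≠ 0`, the
empirical eigenvalue distribution of any fixed linear combination
`z₋₁Id + z₀X₀ᵀX₀ + ⋯ + z_L X_LᵀX_L` (with `z_L ≠ 0`) converges weakly almost surely to the
probability distribution with Stieltjes transform given by the recursively defined function
`t_L`; in particular this holds for the Neural Tangent Kernel `K^NTK` with the vector
`(r₊, q₀, …, q_{L−1}, 1)`, and `‖K^NTK‖` is bounded almost surely for all large `n`.
-/

open MeasureTheory ProbabilityTheory Filter Topology Matrix

noncomputable abbrev stdGaussian : Measure ℝ := gaussianReal 0 1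

noncomputable abbrev gaussianVec (d : ℕ) : Measure (Fin d → ℝ) :=
  Measure.pi fun _ => stdGaussian

noncomputable abbrev gaussianMat (a b : ℕ) : Measure (Fin a → Fin b → ℝ) :=
  Measure.pi fun _ => gaussianVec b

/-- ℓ₂→ℓ₂ operator norm of a real matrix. -/
noncomputable def opNorm {m n : ℕ} (X : Matrix (Fin m) (Fin n) ℝ) : ℝ :=
  ‖LinearMap.toContinuousLinearMap (Matrix.toEuclideanLin X)‖

/-- Squared Frobenius norm. -/
def frobSq {m n : ℕ} (X : Matrix (Fin m) (Fin n) ℝ) : ℝ :=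
  ∑ i, ∑ j, (X i j) ^ 2

/-- `(ε,B)`-orthonormality of the columns of a matrix. -/
def IsOrthonormal {d n : ℕ} (ε B : ℝ) (X : Matrix (Fin d) (Fin n) ℝ) : Prop :=
  (∀ α : Fin n, |(∑ i, X i α ^ 2) - 1| ≤ ε) ∧
  (∀ α β : Fin n, α ≠ β → |∑ i, X i α * X i β| ≤ ε) ∧
  opNorm X ≤ B ∧
  ∑ α : Fin n, ((∑ i, X i α ^ 2) - 1) ^ 2 ≤ B ^ 2

open Classical in
/-- Integral of `f` against the empirical eigenvalue distribution of a symmetric matrix. -/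
noncomputable def esd {n : ℕ} (M : Matrix (Fin n) (Fin n) ℝ) (f : ℝ → ℝ) : ℝ :=
  if h : M.IsHermitian then (n : ℝ)⁻¹ * ∑ α, f (h.eigenvalues α) else 0

/-- The layers `X_ℓ = σ(W_ℓ X_{ℓ-1})/√d_ℓ` of the network. -/
noncomputable def netLayer (σ : ℝ → ℝ) (d : ℕ → ℕ) (n : ℕ)
    (W : (ℓ : ℕ) → Fin (d (ℓ + 1)) → Fin (d ℓ) → ℝ)
    (X0 : Matrix (Fin (d 0)) (Fin n) ℝ) : (ℓ : ℕ) → Matrix (Fin (d ℓ)) (Fin n) ℝ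
  | 0 => X0
  | ℓ + 1 => (Real.sqrt (d (ℓ + 1)))⁻¹ • ((Matrix.of (W ℓ) * netLayer σ d n W X0 ℓ).map σ)

/-- The pre-activations `W_{ℓ+1} X_ℓ` of the network. -/
noncomputable def preact (σ : ℝ → ℝ) (d : ℕ → ℕ) (n : ℕ)
    (W : (ℓ : ℕ) → Fin (d (ℓ + 1)) → Fin (d ℓ) → ℝ)
    (X0 : Matrix (Fin (d 0)) (Fin n) ℝ) (ℓ : ℕ) : Matrix (Fin (d (ℓ + 1))) (Fin n) ℝ :=
  Matrix.of (W ℓ) * netLayer σ d n W X0 ℓ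

/-- Stieltjes transform of a measure on ℝ. -/
noncomputable def stieltjesT (ν : Measure ℝ) (z : ℂ) : ℂ := ∫ x, ((x : ℂ) - z)⁻¹ ∂ν

/-- The domain `ℂ⁻ × ℝ^ℓ × ℂ*` for the argument `z = (z₋₁, z₀, …, z_ℓ)`. -/
def InDomZ {ℓ : ℕ} (zv : Fin (ℓ + 2) → ℂ) : Prop :=
  (zv 0).im < 0 ∧
  (∀ i : Fin (ℓ + 2), i ≠ 0 → i ≠ Fin.last (ℓ + 1) → (zv i).im = 0) ∧
  (zv (Fin.last (ℓ + 1))).im ≤ 0 ∧ zv (Fin.last (ℓ + 1)) ≠ 0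

/-- `z_prev(s, z) = (z₋₁ + (1−b²)/s, z₀, …, z_{ℓ−2}, z_{ℓ−1} + b²/s)`. -/
noncomputable def zprevVec (b : ℝ) {ℓ : ℕ} (s : ℂ) (zv : Fin (ℓ + 3) → ℂ) :
    Fin (ℓ + 2) → ℂ :=
  fun i => zv i.castSucc + (if i = 0 then (1 - (b : ℂ) ^ 2) / s else 0) +
    (if i = Fin.last (ℓ + 1) then (b : ℂ) ^ 2 / s else 0)

/-- `w_prev = (w₋₁, …, w_{ℓ−1}) − (w_ℓ / z_ℓ)·(z₋₁, …, z_{ℓ−1})`. -/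
noncomputable def wprevVec {ℓ : ℕ} (zv wv : Fin (ℓ + 3) → ℂ) : Fin (ℓ + 2) → ℂ :=
  fun i => wv i.castSucc - (wv (Fin.last (ℓ + 2)) / zv (Fin.last (ℓ + 2))) * zv i.castSucc

/-- The vector `(1 − b², 0, …, 0, b²)`. -/
noncomputable def eVec (b : ℝ) (ℓ : ℕ) : Fin (ℓ + 2) → ℂ :=
  fun i => if i = 0 then 1 - (b : ℂ) ^ 2 else if i = Fin.last (ℓ + 1) then (b : ℂ) ^ 2 else 0

section Helpers
open scoped NNReal ENNReal Matrix.Norms.L2Operator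
set_option linter.unusedSectionVars false

section Pisier
open scoped NNReal ENNReal

lemma lintegral_jensen {α : Type*} [MeasurableSpace α] (P : Measure α) [IsProbabilityMeasure P]
    {Ψ : ℝ → ℝ} (hΨ : ConvexOn ℝ Set.univ Ψ) (hΨ0 : ∀ t, 0 ≤ Ψ t) {h : α → ℝ}
    (hh : Integrable h P) :
    ENNReal.ofReal (Ψ (∫ x, h x ∂P)) ≤ ∫⁻ x, ENNReal.ofReal (Ψ (h x)) ∂P := by
  have hc : Continuous Ψ := by
    have := hΨ.continuousOn isOpen_univ
    exact continuousOn_univ.mp this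
  by_cases hint : Integrable (fun x => Ψ (h x)) P
  · have := hΨ.map_integral_le (μ := P) (f := h) hc.continuousOn isClosed_univ
      (by simp) hh hint
    calc ENNReal.ofReal (Ψ (∫ x, h x ∂P)) ≤ ENNReal.ofReal (∫ x, Ψ (h x) ∂P) :=
          ENNReal.ofReal_le_ofReal this
      _ = _ := by
          rw [ofReal_integral_eq_lintegral_ofReal hint (ae_of_all _ fun x => hΨ0 _)]
  · have : ∫⁻ x, ENNReal.ofReal (Ψ (h x)) ∂P = ⊤ := by
      by_contra hne
      apply hint
      refine ⟨hc.comp_aestronglyMeasurable hh.1, ?_⟩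
      rw [hasFiniteIntegral_iff_ofReal (ae_of_all _ fun x => hΨ0 _)]
      exact lt_top_iff_ne_top.mpr hne
    rw [this]; exact le_top

variable {E : Type*} [NormedAddCommGroup E] [NormedSpace ℝ E] [CompleteSpace E]
  [SecondCountableTopology E] [MeasurableSpace E] [BorelSpace E]

theorem pisier (μ : Measure E) [IsGaussian μ] (h0 : ∀ L : StrongDual ℝ E, μ[L] = 0)
    (f : E → ℝ) (hf : Measurable f) (G : E × E → ℝ) (hG : Measurable G)
    (hd : ∀ x y (θ : ℝ), HasDerivAt (fun θ => f (Real.cos θ • x + Real.sin θ • y))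
      (G (Real.cos θ • x + Real.sin θ • y, -Real.sin θ • x + Real.cos θ • y)) θ)
    (hi : ∀ x y, IntervalIntegrable
      (fun θ : ℝ => G (Real.cos θ • x + Real.sin θ • y, -Real.sin θ • x + Real.cos θ • y))
      volume 0 (Real.pi / 2))
    {Ψ : ℝ → ℝ} (hΨ : ConvexOn ℝ Set.univ Ψ) (hΨ0 : ∀ t, 0 ≤ Ψ t) :
    ∫⁻ p, ENNReal.ofReal (Ψ (f p.2 - f p.1)) ∂(μ.prod μ) ≤
      ∫⁻ p, ENNReal.ofReal (Ψ (Real.pi / 2 * G p)) ∂(μ.prod μ) := by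
  have hc : Continuous Ψ := continuousOn_univ.mp (hΨ.continuousOn isOpen_univ)
  have hpi : 0 < Real.pi / 2 := by positivity
  set P : Measure ℝ := (ENNReal.ofReal (Real.pi / 2))⁻¹ • volume.restrict (Set.Ioc 0 (Real.pi / 2))
    with hP
  have hPprob : IsProbabilityMeasure P := by
    constructor
    rw [hP, Measure.smul_apply, Measure.restrict_apply_univ, Real.volume_Ioc, sub_zero,
      smul_eq_mul]
    exact ENNReal.inv_mul_cancel (by simpa using hpi) (by simp)
  set rot : ℝ → E × E → E × E := fun θ p =>
    (Real.cos θ • p.1 + Real.sin θ • p.2, -Real.sin θ • p.1 + Real.cos θ • p.2) with hrot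
  have hrotm : Measurable (fun q : (E × E) × ℝ => rot q.2 q.1) := by
    apply Continuous.measurable
    simp only [hrot]
    fun_prop
  have hpt : ∀ p : E × E, ENNReal.ofReal (Ψ (f p.2 - f p.1)) ≤
      ∫⁻ θ, ENNReal.ofReal (Ψ (Real.pi / 2 * G (rot θ p))) ∂P := by
    intro p
    have h1 := intervalIntegral.integral_eq_sub_of_hasDerivAt
      (fun θ _ => hd p.1 p.2 θ) (hi p.1 p.2)
    have h2 : ∫ θ, Real.pi / 2 * G (rot θ p) ∂P = f p.2 - f p.1 := by
      rw [hP, integral_smul_measure, integral_const_mul,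
        ← intervalIntegral.integral_of_le hpi.le]
      simp only [hrot]
      rw [h1, ENNReal.toReal_inv, ENNReal.toReal_ofReal hpi.le, smul_eq_mul, ← mul_assoc,
        inv_mul_cancel₀ hpi.ne', one_mul]
      simp
    rw [← h2]
    apply lintegral_jensen P hΨ hΨ0
    apply Integrable.const_mul
    apply Integrable.smul_measure
    · exact (hi p.1 p.2).1
    · simpa using hpi
  calc ∫⁻ p, ENNReal.ofReal (Ψ (f p.2 - f p.1)) ∂(μ.prod μ)
      ≤ ∫⁻ p, ∫⁻ θ, ENNReal.ofReal (Ψ (Real.pi / 2 * G (rot θ p))) ∂P ∂(μ.prod μ) :=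
        lintegral_mono hpt
    _ = ∫⁻ θ, ∫⁻ p, ENNReal.ofReal (Ψ (Real.pi / 2 * G (rot θ p))) ∂(μ.prod μ) ∂P := by
        apply lintegral_lintegral_swap
        apply Measurable.aemeasurable
        exact ENNReal.measurable_ofReal.comp (hc.measurable.comp
          ((hG.comp hrotm).const_mul _))
    _ = ∫⁻ θ, ∫⁻ p, ENNReal.ofReal (Ψ (Real.pi / 2 * G p)) ∂(μ.prod μ) ∂P := by
        apply lintegral_congr
        intro θ
        have hr := IsGaussian.map_rotation_eq_self_of_forall_strongDual_eq_zero
          (μ := μ) h0 θ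
        have : ∀ p, rot θ p = ContinuousLinearMap.rotation θ p := by
          intro p; simp only [hrot, ContinuousLinearMap.rotation_apply]
        simp_rw [this]
        conv_rhs => rw [← hr]
        rw [lintegral_map]
        · exact ENNReal.measurable_ofReal.comp (hc.measurable.comp (hG.const_mul _))
        · exact (ContinuousLinearMap.rotation θ).continuous.measurable
    _ = _ := by simp

theorem pisier_mean (μ : Measure E) [IsGaussian μ] (h0 : ∀ L : StrongDual ℝ E, μ[L] = 0)
    (f : E → ℝ) (hf : Measurable f) (hfi : Integrable f μ) (G : E × E → ℝ) (hG : Measurable G)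
    (hd : ∀ x y (θ : ℝ), HasDerivAt (fun θ => f (Real.cos θ • x + Real.sin θ • y))
      (G (Real.cos θ • x + Real.sin θ • y, -Real.sin θ • x + Real.cos θ • y)) θ)
    (hi : ∀ x y, IntervalIntegrable
      (fun θ : ℝ => G (Real.cos θ • x + Real.sin θ • y, -Real.sin θ • x + Real.cos θ • y))
      volume 0 (Real.pi / 2))
    (v : E → ℝ≥0) (hv : ∀ x, μ.map (fun y => G (x, y)) = gaussianReal 0 (v x))
    {Ψ : ℝ → ℝ} (hΨ : ConvexOn ℝ Set.univ Ψ) (hΨ0 : ∀ t, 0 ≤ Ψ t) :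
    ∫⁻ y, ENNReal.ofReal (Ψ (f y - ∫ x, f x ∂μ)) ∂μ ≤
      ∫⁻ x, ∫⁻ ξ, ENNReal.ofReal (Ψ (Real.pi / 2 * ξ)) ∂(gaussianReal 0 (v x)) ∂μ := by
  have hc : Continuous Ψ := continuousOn_univ.mp (hΨ.continuousOn isOpen_univ)
  have hm1 : Measurable (fun p : E × E => ENNReal.ofReal (Ψ (f p.2 - f p.1))) :=
    ENNReal.measurable_ofReal.comp (hc.measurable.comp (by fun_prop))
  have hm2 : Measurable (fun p : E × E => ENNReal.ofReal (Ψ (Real.pi / 2 * G p))) :=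
    ENNReal.measurable_ofReal.comp (hc.measurable.comp (by fun_prop))
  calc ∫⁻ y, ENNReal.ofReal (Ψ (f y - ∫ x, f x ∂μ)) ∂μ
      ≤ ∫⁻ y, ∫⁻ x, ENNReal.ofReal (Ψ (f y - f x)) ∂μ ∂μ := by
        apply lintegral_mono
        intro y
        have h1 : f y - ∫ x, f x ∂μ = ∫ x, (f y - f x) ∂μ := by
          rw [integral_sub (integrable_const _) hfi]; simp
        simp only [h1]
        apply lintegral_jensen μ hΨ hΨ0
        exact (integrable_const _).sub hfi
    _ = ∫⁻ p, ENNReal.ofReal (Ψ (f p.2 - f p.1)) ∂(μ.prod μ) := by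
        rw [lintegral_prod_symm _ hm1.aemeasurable]
    _ ≤ _ := pisier μ h0 f hf G hG hd hi hΨ hΨ0
    _ = ∫⁻ x, ∫⁻ y, ENNReal.ofReal (Ψ (Real.pi / 2 * G (x, y))) ∂μ ∂μ := by
        rw [lintegral_prod _ hm2.aemeasurable]
    _ = _ := by
        apply lintegral_congr
        intro x
        rw [← hv x, lintegral_map]
        · exact ENNReal.measurable_ofReal.comp (hc.measurable.comp (by fun_prop))
        · fun_prop

end Pisier

section Gauss
open scoped NNReal ENNReal

lemma isGaussian_pi' {ι : Type*} [Fintype ι] {E : ι → Type*}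
    [∀ i, NormedAddCommGroup (E i)] [∀ i, NormedSpace ℝ (E i)] [∀ i, MeasurableSpace (E i)]
    [∀ i, CompleteSpace (E i)] [∀ i, BorelSpace (E i)] [∀ i, SecondCountableTopology (E i)]
    (μ : ∀ i, Measure (E i)) [∀ i, IsGaussian (μ i)] : IsGaussian (Measure.pi μ) := by
  have h1 : iIndepFun (fun i (x : ∀ i, E i) => x i) (Measure.pi μ) :=
    iIndepFun_pi (X := fun i x => x) (fun i => aemeasurable_id)
  have h2 := iIndepFun.hasGaussianLaw (X := fun i (x : ∀ i, E i) => x i) (P := Measure.pi μ)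
    (fun i => ⟨by rw [(measurePreserving_eval μ i).map_eq]; infer_instance⟩) h1
  have := h2.isGaussian_map
  rwa [show (fun (ω : ∀ i, E i) x => ω x) = id from rfl, Measure.map_id] at this

instance (d : ℕ) : IsGaussian (gaussianVec d) := isGaussian_pi' _
instance (a b : ℕ) : IsGaussian (gaussianMat a b) := isGaussian_pi' _

lemma pi_centered {ι : Type*} [Fintype ι] [DecidableEq ι] {E : ι → Type*}
    [∀ i, NormedAddCommGroup (E i)] [∀ i, NormedSpace ℝ (E i)] [∀ i, MeasurableSpace (E i)]
    [∀ i, CompleteSpace (E i)] [∀ i, BorelSpace (E i)] [∀ i, SecondCountableTopology (E i)]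
    (μ : ∀ i, Measure (E i)) [∀ i, IsGaussian (μ i)]
    (h : ∀ i, ∀ L : StrongDual ℝ (E i), (μ i)[L] = 0) (L : StrongDual ℝ (∀ i, E i)) :
    (Measure.pi μ)[L] = 0 := by
  have h1 : ∀ x : ∀ i, E i, L x = ∑ i, (L.comp (ContinuousLinearMap.single ℝ E i)) (x i) := by
    intro x
    have h2 : ∀ i, (L.comp (ContinuousLinearMap.single ℝ E i)) (x i) = L (Pi.single i (x i)) :=
      fun i => rfl
    simp_rw [h2, ← map_sum]
    congr 1
    exact (Finset.univ_sum_single x).symm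
  simp_rw [h1]
  have hint : ∀ i, Integrable (L.comp (ContinuousLinearMap.single ℝ E i)) (μ i) := by
    intro i
    have := (IsGaussian.memLp_id (μ i) 1 (by simp)).integrable le_rfl
    exact (L.comp (ContinuousLinearMap.single ℝ E i)).integrable_comp this
  rw [integral_finsetSum]
  · apply Finset.sum_eq_zero
    intro i _
    rw [integral_comp_eval (μ := μ) (f := fun y => (L.comp (ContinuousLinearMap.single ℝ E i)) y)
      (hint i).aestronglyMeasurable]
    exact h i _
  · intro i _
    exact integrable_comp_eval (hint i)

lemma std_centered (L : StrongDual ℝ ℝ) : stdGaussian[L] = 0 := by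
  have : ∀ x : ℝ, L x = x * L 1 := by
    intro x
    conv_lhs => rw [show x = x • (1 : ℝ) by simp]
    rw [map_smul, smul_eq_mul]
  rw [integral_congr_ae (ae_of_all _ this), integral_mul_const, integral_id_gaussianReal, zero_mul]

lemma vec_centered (d : ℕ) (L : StrongDual ℝ (Fin d → ℝ)) : (gaussianVec d)[L] = 0 :=
  pi_centered _ (fun _ => std_centered) L
lemma mat_centered (a b : ℕ) (L : StrongDual ℝ (Fin a → Fin b → ℝ)) : (gaussianMat a b)[L] = 0 :=
  pi_centered _ (fun _ => vec_centered b) L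

lemma vec_memLp (d : ℕ) (g : Fin d → ℝ) : MemLp (fun w : Fin d → ℝ => ∑ i, g i * w i) 2
    (gaussianVec d) := by
  apply memLp_finsetSum
  intro i _
  apply MemLp.const_mul
  have : MemLp (fun x : ℝ => x) 2 stdGaussian := memLp_id_gaussianReal 2
  exact this.comp_measurePreserving (measurePreserving_eval (fun _ : Fin d => stdGaussian) i)

lemma vec_var (d : ℕ) (g : Fin d → ℝ) :
    Var[fun w : Fin d → ℝ => ∑ i, g i * w i; gaussianVec d] = ∑ i, g i ^ 2 := by
  have h := variance_sum_pi (μ := fun _ : Fin d => stdGaussian) (X := fun i x => g i * x)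
    (fun i => (memLp_id_gaussianReal 2).const_mul _)
  have h2 : (∑ i, fun ω : Fin d → ℝ => g i * ω i) = fun w => ∑ i, g i * w i := by
    ext w; simp
  rw [h2] at h
  rw [h]
  refine Finset.sum_congr rfl fun i _ => ?_
  rw [variance_const_mul, variance_fun_id_gaussianReal]; simp

lemma vec_law (d : ℕ) (g : Fin d → ℝ) :
    (gaussianVec d).map (fun w => ∑ i, g i * w i) = gaussianReal 0 (∑ i, g i ^ 2).toNNReal := by
  let L : StrongDual ℝ (Fin d → ℝ) := ∑ i, g i • ContinuousLinearMap.proj (R := ℝ) i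
  have hL : ⇑L = fun w => ∑ i, g i * w i := by ext w; simp [L]
  have := IsGaussian.map_eq_gaussianReal (μ := gaussianVec d) L
  rw [vec_centered, hL, vec_var] at this
  exact this

lemma mat_law (a b : ℕ) (g : Fin a → Fin b → ℝ) :
    (gaussianMat a b).map (fun w => ∑ i, ∑ j, g i j * w i j) =
      gaussianReal 0 (∑ i, ∑ j, g i j ^ 2).toNNReal := by
  let L : StrongDual ℝ (Fin a → Fin b → ℝ) :=
    ∑ i, ∑ j, g i j • (ContinuousLinearMap.proj (R := ℝ) j).comp
      (ContinuousLinearMap.proj (R := ℝ) (φ := fun _ : Fin a => Fin b → ℝ) i)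
  have hL : ⇑L = fun w => ∑ i, ∑ j, g i j * w i j := by ext w; simp [L]
  have := IsGaussian.map_eq_gaussianReal (μ := gaussianMat a b) L
  have h := variance_sum_pi (μ := fun _ : Fin a => gaussianVec b)
    (X := fun i x => ∑ j, g i j * x j) (fun i => vec_memLp _ _)
  have h2 : (∑ i, fun ω : Fin a → Fin b → ℝ => ∑ j, g i j * ω i j) =
      fun w => ∑ i, ∑ j, g i j * w i j := by
    ext w; simp
  rw [h2] at h
  simp_rw [vec_var] at h
  rw [mat_centered, hL, h] at this
  exact this

/-- `f` has "gradient pairing" `G`. -/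
structure HasGrad {E : Type*} [NormedAddCommGroup E] [NormedSpace ℝ E] [MeasurableSpace E]
    (f : E → ℝ) (G : E × E → ℝ) : Prop where
  meas : Measurable f
  measG : Measurable G
  chain : ∀ (c : ℝ → E) (c' : E) (θ : ℝ), HasDerivAt c c' θ →
    HasDerivAt (fun θ => f (c θ)) (G (c θ, c')) θ
  bdd : ∃ h : E × E → ℝ, Continuous h ∧ ∀ p, |G p| ≤ h p

variable {E : Type*} [NormedAddCommGroup E] [NormedSpace ℝ E] [CompleteSpace E]
  [SecondCountableTopology E] [MeasurableSpace E] [BorelSpace E]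

theorem pisier_grad (μ : Measure E) [IsGaussian μ] (h0 : ∀ L : StrongDual ℝ E, μ[L] = 0)
    {f : E → ℝ} {G : E × E → ℝ} (hfG : HasGrad f G) (hfi : Integrable f μ)
    (v : E → ℝ≥0) (hv : ∀ x, μ.map (fun y => G (x, y)) = gaussianReal 0 (v x))
    {Ψ : ℝ → ℝ} (hΨ : ConvexOn ℝ Set.univ Ψ) (hΨ0 : ∀ t, 0 ≤ Ψ t) :
    ∫⁻ y, ENNReal.ofReal (Ψ (f y - ∫ x, f x ∂μ)) ∂μ ≤
      ∫⁻ x, ∫⁻ ξ, ENNReal.ofReal (Ψ (Real.pi / 2 * ξ)) ∂(gaussianReal 0 (v x)) ∂μ := by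
  have hcurve : ∀ x y : E, ∀ θ : ℝ, HasDerivAt (fun θ => Real.cos θ • x + Real.sin θ • y)
      (-Real.sin θ • x + Real.cos θ • y) θ := fun x y θ =>
    ((Real.hasDerivAt_cos θ).smul_const x).add ((Real.hasDerivAt_sin θ).smul_const y)
  refine pisier_mean μ h0 f hfG.meas hfi G hfG.measG (fun x y θ => ?_) (fun x y => ?_) v hv hΨ hΨ0
  · exact hfG.chain _ _ θ (hcurve x y θ)
  · obtain ⟨h, hc, hb⟩ := hfG.bdd
    have hcont : Continuous (fun θ : ℝ => (Real.cos θ • x + Real.sin θ • y,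
      -Real.sin θ • x + Real.cos θ • y)) := by fun_prop
    refine ((hc.comp hcont).intervalIntegrable 0 (Real.pi / 2)).mono_fun ?_ ?_
    · exact (hfG.measG.comp hcont.measurable).aestronglyMeasurable
    · refine ae_of_all _ fun θ => ?_
      simp only [Real.norm_eq_abs, Function.comp]
      exact (hb _).trans (le_abs_self _)

/-- Gaussian moment constant. -/
noncomputable def Cmom (k : ℕ) : ℝ := (Real.pi / 2) ^ (2 * k) * ∫ ξ, ξ ^ (2 * k) ∂stdGaussian

lemma int_pow_std (k : ℕ) : Integrable (fun ξ : ℝ => ξ ^ k) stdGaussian := by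
  have : MemLp (fun x : ℝ => x) k stdGaussian := memLp_id_gaussianReal k
  simpa using this.integrable_norm_pow' |>.mono' (by fun_prop) (by simp)

lemma Cmom_nonneg (k : ℕ) : 0 ≤ Cmom k := by
  unfold Cmom
  have : 0 ≤ ∫ ξ, ξ ^ (2 * k) ∂stdGaussian := integral_nonneg fun x => by
    simp only [Pi.zero_apply, pow_mul]; positivity
  positivity

lemma gauss_pow_lint (v : ℝ≥0) (k : ℕ) :
    ∫⁻ ξ, ENNReal.ofReal ((Real.pi / 2 * ξ) ^ (2 * k)) ∂(gaussianReal 0 v) =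
      ENNReal.ofReal (Cmom k) * ENNReal.ofReal ((v : ℝ) ^ k) := by
  have h1 : gaussianReal 0 v = stdGaussian.map (fun x => Real.sqrt v * x) := by
    rw [gaussianReal_map_const_mul]
    congr 1
    · simp
    · ext; simp [Real.sq_sqrt]
  rw [h1, lintegral_map (by fun_prop) (by fun_prop)]
  have h2 : ∀ ξ : ℝ, (Real.pi / 2 * (Real.sqrt v * ξ)) ^ (2 * k) =
      (Real.pi / 2) ^ (2 * k) * (v : ℝ) ^ k * ξ ^ (2 * k) := by
    intro ξ
    rw [mul_pow, mul_pow, pow_mul (Real.sqrt v), Real.sq_sqrt (by positivity)]; ring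
  simp_rw [h2]
  rw [← ofReal_integral_eq_lintegral_ofReal, integral_const_mul, ← ENNReal.ofReal_mul (Cmom_nonneg k)]
  · congr 1; unfold Cmom; ring
  · exact (int_pow_std _).const_mul _
  · refine ae_of_all _ fun ξ => ?_
    simp only [Pi.zero_apply, pow_mul ξ]
    positivity

theorem conc_moment (μ : Measure E) [IsGaussian μ] (h0 : ∀ L : StrongDual ℝ E, μ[L] = 0)
    {f : E → ℝ} {G : E × E → ℝ} (hfG : HasGrad f G) (hfi : Integrable f μ)
    (v : E → ℝ≥0) (hv : ∀ x, μ.map (fun y => G (x, y)) = gaussianReal 0 (v x))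
    (k : ℕ) (K : ℝ) (V : E → ℝ) (hVi : Integrable (fun x => V x ^ k) μ) (hvV : ∀ x, v x ≤ V x)
    (hK : ∫ x, V x ^ k ∂μ ≤ K) :
    ∫⁻ y, ENNReal.ofReal ((f y - ∫ x, f x ∂μ) ^ (2 * k)) ∂μ ≤ ENNReal.ofReal (Cmom k * K) := by
  have hV0 : ∀ x, 0 ≤ V x := fun x => (v x).2.trans (hvV x)
  refine (pisier_grad μ h0 hfG hfi v hv (Ψ := fun x => x ^ (2 * k))
    (Even.convexOn_pow (by simp)) (fun t => by rw [pow_mul]; positivity)).trans ?_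
  simp_rw [gauss_pow_lint]
  calc _ ≤ ∫⁻ x, ENNReal.ofReal (Cmom k) * ENNReal.ofReal (V x ^ k) ∂μ := by
        apply lintegral_mono
        intro x
        simp only
        gcongr
        exact hvV x
    _ = ENNReal.ofReal (Cmom k) * ENNReal.ofReal (∫ x, V x ^ k ∂μ) := by
        rw [lintegral_const_mul' _ _ (by simp), ofReal_integral_eq_lintegral_ofReal hVi]
        exact ae_of_all _ fun x => pow_nonneg (hV0 x) k
    _ ≤ _ := by
        rw [ENNReal.ofReal_mul (Cmom_nonneg k)]
        gcongr

lemma tail_of_moment {E : Type*} [MeasurableSpace E] (μ : Measure E) (g : E → ℝ) (hg : AEMeasurable g μ) (k : ℕ) (K t : ℝ)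
    (ht : 0 < t) (h : ∫⁻ y, ENNReal.ofReal (g y ^ (2 * k)) ∂μ ≤ ENNReal.ofReal K) :
    μ {y | t ≤ |g y|} ≤ ENNReal.ofReal (K / t ^ (2 * k)) := by
  have h1 : {y | t ≤ |g y|} ⊆ {y | ENNReal.ofReal (t ^ (2 * k)) ≤ ENNReal.ofReal (g y ^ (2 * k))} := by
    intro y hy
    simp only [Set.mem_ofPred_eq] at hy ⊢
    apply ENNReal.ofReal_le_ofReal
    calc t ^ (2 * k) ≤ |g y| ^ (2 * k) := by gcongr
      _ = _ := by rw [pow_mul, sq_abs, ← pow_mul]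
  refine (measure_mono h1).trans ?_
  have htk : 0 < t ^ (2 * k) := by positivity
  rw [ENNReal.ofReal_div_of_pos htk]
  refine (meas_ge_le_lintegral_div (by fun_prop) (by simpa using htk) (by simp)).trans ?_
  gcongr

theorem conc_tail (μ : Measure E) [IsGaussian μ] (h0 : ∀ L : StrongDual ℝ E, μ[L] = 0)
    {f : E → ℝ} {G : E × E → ℝ} (hfG : HasGrad f G) (hfi : Integrable f μ)
    (v : E → ℝ≥0) (hv : ∀ x, μ.map (fun y => G (x, y)) = gaussianReal 0 (v x))
    (k : ℕ) (K : ℝ) (V : E → ℝ) (hVi : Integrable (fun x => V x ^ k) μ) (hvV : ∀ x, v x ≤ V x)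
    (hK : ∫ x, V x ^ k ∂μ ≤ K) (t : ℝ) (ht : 0 < t) :
    μ {y | t ≤ |f y - ∫ x, f x ∂μ|} ≤ ENNReal.ofReal (Cmom k * K / t ^ (2 * k)) :=
  tail_of_moment μ (fun y => f y - ∫ x, f x ∂μ) (by have := hfG.meas; fun_prop) k _ t ht
    (conc_moment μ h0 hfG hfi v hv k K V hVi hvV hK)

theorem conc_exp (μ : Measure E) [IsGaussian μ] (h0 : ∀ L : StrongDual ℝ E, μ[L] = 0)
    {f : E → ℝ} {G : E × E → ℝ} (hfG : HasGrad f G) (hfi : Integrable f μ)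
    (v : E → ℝ≥0) (hv : ∀ x, μ.map (fun y => G (x, y)) = gaussianReal 0 (v x))
    (K : ℝ) (hK : 0 < K) (hvK : ∀ x, v x ≤ K) (t : ℝ) (ht : 0 < t) :
    μ {y | t ≤ f y - ∫ x, f x ∂μ} ≤ ENNReal.ofReal (Real.exp (-2 * t ^ 2 / (Real.pi ^ 2 * K))) := by
  set l : ℝ := 4 * t / (Real.pi ^ 2 * K) with hl
  have hl0 : 0 < l := by positivity
  have hconv : ConvexOn ℝ Set.univ (fun x : ℝ => Real.exp (l * x)) := by
    have := convexOn_exp.comp_linearMap (LinearMap.mul ℝ ℝ l)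
    simpa [Function.comp_def] using this
  have h1 := pisier_grad μ h0 hfG hfi v hv hconv (fun t => (Real.exp_pos _).le)
  have h2 : ∀ w : ℝ≥0, w ≤ K → ∫⁻ ξ, ENNReal.ofReal (Real.exp (l * (Real.pi / 2 * ξ)))
      ∂(gaussianReal 0 w) ≤ ENNReal.ofReal (Real.exp (l ^ 2 * Real.pi ^ 2 * K / 8)) := by
    intro w hw
    have e1 : ∀ ξ : ℝ, Real.exp (l * (Real.pi / 2 * ξ)) = Real.exp ((l * (Real.pi / 2)) * ξ) := by
      intro ξ; ring_nf
    simp_rw [e1]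
    rw [← ofReal_integral_eq_lintegral_ofReal (integrable_exp_mul_gaussianReal _)
      (ae_of_all _ fun x => (Real.exp_pos _).le)]
    apply ENNReal.ofReal_le_ofReal
    have := congrFun (mgf_id_gaussianReal (μ := 0) (v := w)) (l * (Real.pi / 2))
    simp only [mgf, id] at this
    rw [this]
    apply Real.exp_le_exp.mpr
    have : (w : ℝ) * (l * (Real.pi / 2)) ^ 2 ≤ K * (l * (Real.pi / 2)) ^ 2 := by gcongr
    nlinarith
  have h3 : ∫⁻ y, ENNReal.ofReal (Real.exp (l * (f y - ∫ x, f x ∂μ))) ∂μ ≤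
      ENNReal.ofReal (Real.exp (l ^ 2 * Real.pi ^ 2 * K / 8)) := by
    refine h1.trans ?_
    calc _ ≤ ∫⁻ x, ENNReal.ofReal (Real.exp (l ^ 2 * Real.pi ^ 2 * K / 8)) ∂μ :=
          lintegral_mono fun x => h2 _ (hvK x)
      _ = _ := by simp
  have h4 : {y | t ≤ f y - ∫ x, f x ∂μ} ⊆ {y | ENNReal.ofReal (Real.exp (l * t)) ≤
      ENNReal.ofReal (Real.exp (l * (f y - ∫ x, f x ∂μ)))} := by
    intro y hy
    simp only [Set.mem_ofPred_eq] at hy ⊢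
    gcongr
  refine (measure_mono h4).trans ?_
  have hm := hfG.meas
  refine (meas_ge_le_lintegral_div (by fun_prop) (by simp [Real.exp_pos]) (by simp)).trans ?_
  refine (ENNReal.div_le_div_right h3 _).trans ?_
  rw [← ENNReal.ofReal_div_of_pos (Real.exp_pos _), ← Real.exp_sub]
  apply ENNReal.ofReal_le_ofReal
  apply Real.exp_le_exp.mpr
  apply le_of_eq
  rw [hl]
  have : Real.pi ≠ 0 := Real.pi_ne_zero
  field_simp
  ring

end Gauss

section FubBC
open scoped NNReal ENNReal

theorem fub {ι : Type*} [Fintype ι] [DecidableEq ι] {X : ι → Type*} [∀ i, MeasurableSpace (X i)]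
    (μ : ∀ i, Measure (X i)) [∀ i, IsProbabilityMeasure (μ i)] (i : ι) (E : Set (∀ i, X i))
    (hE : MeasurableSet E) (p : ℝ≥0∞) (h : ∀ x, μ i {y | Function.update x i y ∈ E} ≤ p) :
    Measure.pi μ E ≤ p := by
  have h1 := lintegral_le_of_lmarginal_le (μ := μ) {i} (f := E.indicator 1) (g := fun _ => p)
    (measurable_one.indicator hE) measurable_const ?_
  · rw [lintegral_indicator_one hE] at h1
    simpa using h1
  · rw [lmarginal_singleton, lmarginal_singleton]
    intro x
    simp only [lintegral_const, measure_univ, mul_one]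
    refine le_trans (le_of_eq ?_) (h x)
    rw [← lintegral_indicator_one]
    · rfl
    · exact (measurable_update x) hE

theorem fub_fst {α β : Type*} [MeasurableSpace α] [MeasurableSpace β] (μ : Measure α)
    (ν : Measure β) [IsProbabilityMeasure μ] [IsProbabilityMeasure ν] (E : Set (α × β))
    (hE : MeasurableSet E) (p : ℝ≥0∞) (h : ∀ y, μ {x | (x, y) ∈ E} ≤ p) : μ.prod ν E ≤ p := by
  rw [Measure.prod_apply_symm hE]
  calc _ ≤ ∫⁻ y, p ∂ν := lintegral_mono fun y => h y
    _ = p := by simp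

theorem fub_snd {α β : Type*} [MeasurableSpace α] [MeasurableSpace β] (μ : Measure α)
    (ν : Measure β) [IsProbabilityMeasure μ] [IsProbabilityMeasure ν] (E : Set (α × β))
    (hE : MeasurableSet E) (p : ℝ≥0∞) (h : ∀ x, ν {y | (x, y) ∈ E} ≤ p) : μ.prod ν E ≤ p := by
  rw [Measure.prod_apply hE]
  calc _ ≤ ∫⁻ y, p ∂μ := lintegral_mono fun y => h y
    _ = p := by simp

theorem borel_cantelli_law {Ω : Type*} [MeasurableSpace Ω] (Pr : Measure Ω)
    [IsProbabilityMeasure Pr] {α : ℕ → Type*} [∀ n, MeasurableSpace (α n)]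
    (Z : ∀ n, Ω → α n) (μ : ∀ n, Measure (α n)) [∀ n, IsProbabilityMeasure (μ n)]
    (hZ : ∀ n, Pr.map (Z n) = μ n) (E : ∀ n, Set (α n)) (hE : ∀ n, MeasurableSet (E n)) (C : ℝ)
    (h : ∀ᶠ n : ℕ in atTop, μ n (E n) ≤ ENNReal.ofReal (C / (n : ℝ) ^ 2)) :
    ∀ᵐ ω ∂Pr, ∀ᶠ n in atTop, Z n ω ∉ E n := by
  obtain ⟨N, hN⟩ := eventually_atTop.mp h
  have haem : ∀ n, AEMeasurable (Z n) Pr := by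
    intro n
    by_contra hc
    have := hZ n
    rw [Measure.map_of_not_aemeasurable hc] at this
    exact (IsProbabilityMeasure.ne_zero (μ n)) this.symm
  have hs : ∑' n, Pr {ω | N ≤ n ∧ Z n ω ∈ E n} ≠ ∞ := by
    have hle : ∀ n, Pr {ω | N ≤ n ∧ Z n ω ∈ E n} ≤ ENNReal.ofReal (C / (n : ℝ) ^ 2) := by
      intro n
      by_cases hn : N ≤ n
      · refine le_trans ?_ (hN n hn)
        rw [← hZ n, Measure.map_apply_of_aemeasurable (haem n) (hE n)]
        apply measure_mono
        intro ω hω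
        exact hω.2
      · simp [hn]
    refine ne_top_of_le_ne_top ?_ (ENNReal.tsum_le_tsum hle)
    have hsum : Summable (fun n : ℕ => |C| / (n : ℝ) ^ 2) := by
      have := (Real.summable_one_div_nat_pow (p := 2)).mpr (by norm_num)
      simpa [div_eq_mul_inv] using this.mul_left |C|
    refine ne_top_of_le_ne_top (hsum.tsum_ofReal_ne_top) (ENNReal.tsum_le_tsum fun n => ?_)
    apply ENNReal.ofReal_le_ofReal
    gcongr
    exact le_abs_self C
  filter_upwards [ae_eventually_notMem hs] with ω hω
  filter_upwards [hω, eventually_ge_atTop N] with n hn hnN hmem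
  exact hn ⟨hnN, hmem⟩

end FubBC

/-- Assumptions on the activation. -/
structure Act (σ σ' σ'' : ℝ → ℝ) (lam b a : ℝ) : Prop where
  d1 : ∀ x, HasDerivAt σ (σ' x) x
  d2 : ∀ x, HasDerivAt σ' (σ'' x) x
  b1 : ∀ x, |σ' x| ≤ lam
  b2 : ∀ x, |σ'' x| ≤ lam
  mean : (∫ x, σ x ∂stdGaussian) = 0
  var : (∫ x, (σ x) ^ 2 ∂stdGaussian) = 1
  hb : b = ∫ x, σ' x ∂stdGaussian
  ha : a = ∫ x, (σ' x) ^ 2 ∂stdGaussian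

lemma act_id : Act id (fun _ => 1) (fun _ => 0) 1 1 1 where
  d1 := fun x => hasDerivAt_id x
  d2 := fun x => hasDerivAt_const x 1
  b1 := by simp
  b2 := by simp
  mean := by simp
  var := by
    have := variance_fun_id_gaussianReal (μ := 0) (v := 1)
    rw [variance_of_integral_eq_zero (by fun_prop) (by simp)] at this
    simpa using this
  hb := by simp
  ha := by simp

/-- integrability of anything with polynomial growth -/
lemma integrable_poly {F : ℝ → ℝ} (hF : Measurable F) (A : ℝ) (k : ℕ)
    (hb : ∀ x, |F x| ≤ A * (1 + |x|) ^ k) : Integrable F stdGaussian := by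
  have h1 : MemLp (fun x : ℝ => 1 + |x|) k stdGaussian := by
    have h2 : MemLp (fun x : ℝ => x) k stdGaussian := memLp_id_gaussianReal k
    exact (memLp_const (1 : ℝ)).add h2.norm
  have h3 : Integrable (fun x : ℝ => ‖1 + |x|‖ ^ k) stdGaussian := h1.integrable_norm_pow'
  refine (h3.const_mul A).mono' hF.aestronglyMeasurable (ae_of_all _ fun x => ?_)
  rw [Real.norm_eq_abs, Real.norm_eq_abs, abs_of_nonneg (by positivity : (0 : ℝ) ≤ 1 + |x|)]
  exact hb x

lemma int_abs_le : ∫ x, |x| ∂stdGaussian ≤ 1 := by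
  have v2 := act_id.var
  simp only [id] at v2
  have h1 : ∫ x, |x| ∂stdGaussian ≤ ∫ x, (1 + x ^ 2) / 2 ∂stdGaussian := by
    apply integral_mono
    · simpa using (int_pow_std 1).abs
    · exact ((integrable_const _).add (int_pow_std 2)).div_const 2
    · intro x
      have := sq_nonneg (|x| - 1)
      have h2 := sq_abs x
      simp only
      nlinarith
  rw [integral_div, integral_add (integrable_const _) (int_pow_std 2), v2] at h1
  norm_num at h1
  exact h1

lemma int_abs' : Integrable (fun x : ℝ => |x|) stdGaussian := by simpa using (int_pow_std 1).abs

namespace Act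
variable {σ σ' σ'' : ℝ → ℝ} {lam b a : ℝ} (h : Act σ σ' σ'' lam b a)
include h

lemma lam0 : 0 ≤ lam := (abs_nonneg _).trans (h.b1 0)
lemma cont : Continuous σ := continuous_iff_continuousAt.mpr fun x => (h.d1 x).continuousAt
lemma cont' : Continuous σ' := continuous_iff_continuousAt.mpr fun x => (h.d2 x).continuousAt
lemma meas'' : Measurable σ'' := by
  have : σ'' = deriv σ' := by ext x; exact (h.d2 x).deriv.symm
  rw [this]; exact measurable_deriv σ'
lemma lip (x y : ℝ) : |σ x - σ y| ≤ lam * |x - y| := by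
  have := Convex.norm_image_sub_le_of_norm_hasDerivWithin_le (f := σ) (f' := σ') (s := Set.univ)
    (C := lam) (fun x _ => (h.d1 x).hasDerivWithinAt) (fun x _ => h.b1 x) convex_univ
    (Set.mem_univ y) (Set.mem_univ x)
  simpa using this
lemma lip' (x y : ℝ) : |σ' x - σ' y| ≤ lam * |x - y| := by
  have := Convex.norm_image_sub_le_of_norm_hasDerivWithin_le (f := σ') (f' := σ'') (s := Set.univ)
    (C := lam) (fun x _ => (h.d2 x).hasDerivWithinAt) (fun x _ => h.b2 x) convex_univ
    (Set.mem_univ y) (Set.mem_univ x)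
  simpa using this
lemma growth (x : ℝ) : |σ x| ≤ |σ 0| + lam * |x| := by
  have := h.lip x 0
  have h2 := abs_sub_abs_le_abs_sub (σ x) (σ 0)
  simp only [sub_zero] at this
  linarith
lemma taylor (x t : ℝ) : |σ (x + t) - σ x - t * σ' x| ≤ lam * t ^ 2 := by
  have h1 : ∀ y ∈ Set.uIcc x (x + t), HasDerivWithinAt (fun y => σ y - y * σ' x) (σ' y - σ' x)
      (Set.uIcc x (x + t)) y := by
    intro y _
    have := (h.d1 y).sub ((hasDerivAt_id y).mul_const (σ' x))
    rw [one_mul] at this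
    exact this.hasDerivWithinAt
  have h2 : ∀ y ∈ Set.uIcc x (x + t), ‖σ' y - σ' x‖ ≤ lam * |t| := by
    intro y hy
    refine (h.lip' y x).trans ?_
    have := Set.abs_sub_left_of_mem_uIcc hy
    have : |y - x| ≤ |t| := by simpa using this
    exact mul_le_mul_of_nonneg_left this h.lam0
  have := (convex_uIcc x (x + t)).norm_image_sub_le_of_norm_hasDerivWithin_le h1 h2
    Set.left_mem_uIcc Set.right_mem_uIcc
  rw [Real.norm_eq_abs, Real.norm_eq_abs] at this
  have e : σ (x + t) - (x + t) * σ' x - (σ x - x * σ' x) = σ (x + t) - σ x - t * σ' x := by ring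
  rw [e] at this
  refine this.trans (le_of_eq ?_)
  rw [add_sub_cancel_left, mul_assoc, ← abs_mul, ← sq, abs_sq]

lemma growth1 (r x : ℝ) : |σ (r * x)| ≤ (|σ 0| + lam * |r|) * (1 + |x|) := by
  have := h.growth (r * x)
  rw [abs_mul] at this
  have h0 := h.lam0
  have : 0 ≤ |σ 0| * |x| := by positivity
  have : 0 ≤ lam * |r| := by positivity
  nlinarith

lemma int_pow (r : ℝ) (k : ℕ) : Integrable (fun x => σ (r * x) ^ k) stdGaussian := by
  have := h.cont.measurable
  refine integrable_poly (by fun_prop) ((|σ 0| + lam * |r|) ^ k) k fun x => ?_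
  rw [abs_pow, ← mul_pow]
  exact pow_le_pow_left₀ (abs_nonneg _) (h.growth1 r x) k

end Act

lemma stein {g g' : ℝ → ℝ} (hg : ∀ x, HasDerivAt g (g' x) x) (K : ℝ) (hK : ∀ x, |g' x| ≤ K) :
    ∫ x, x * g x ∂stdGaussian = ∫ x, g' x ∂stdGaussian := by
  have hgm : Measurable g := (continuous_iff_continuousAt.mpr fun x => (hg x).continuousAt).measurable
  have hg'm : Measurable g' := by
    have : g' = deriv g := by ext x; exact (hg x).deriv.symm
    rw [this]; exact measurable_deriv g
  have hK0 : 0 ≤ K := (abs_nonneg _).trans (hK 0)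
  have hgr : ∀ x, |g x| ≤ (|g 0| + K) * (1 + |x|) := by
    intro x
    have := Convex.norm_image_sub_le_of_norm_hasDerivWithin_le (f := g) (f' := g') (s := Set.univ)
      (C := K) (fun x _ => (hg x).hasDerivWithinAt) (fun x _ => hK x) convex_univ
      (Set.mem_univ 0) (Set.mem_univ x)
    simp only [sub_zero, Real.norm_eq_abs] at this
    have h2 := abs_sub_abs_le_abs_sub (g x) (g 0)
    have : 0 ≤ |g 0| * |x| := by positivity
    nlinarith
  have hI : ∀ F : ℝ → ℝ, Integrable F stdGaussian →
      Integrable (fun x => F x * gaussianPDFReal 0 1 x) volume := by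
    intro F hF
    change Integrable F (gaussianReal 0 1) at hF
    rw [gaussianReal_of_var_ne_zero _ one_ne_zero,
      integrable_withDensity_iff_integrable_smul' (by fun_prop) (by simp [gaussianPDF])] at hF
    refine hF.congr (ae_of_all _ fun x => ?_)
    simp [gaussianPDF, gaussianPDFReal_nonneg, mul_comm]
  have hd : ∀ x : ℝ, HasDerivAt (gaussianPDFReal 0 1) (-x * gaussianPDFReal 0 1 x) x := by
    intro x
    unfold gaussianPDFReal
    have h1 : HasDerivAt (fun x : ℝ => -(x - 0) ^ 2 / (2 * ((1 : NNReal) : ℝ))) (-x) x := by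
      have := (((hasDerivAt_id x).sub_const 0).pow 2).neg.div_const (2 * ((1 : NNReal) : ℝ))
      refine this.congr_deriv ?_
      simp; ring
    have := (h1.exp).const_mul ((Real.sqrt (2 * Real.pi * ((1 : NNReal) : ℝ)))⁻¹)
    refine this.congr_deriv ?_
    simp; ring
  have i1 : Integrable (fun x => x * g x) stdGaussian := by
    refine integrable_poly (by fun_prop) (|g 0| + K) 2 fun x => ?_
    rw [abs_mul]
    have := hgr x
    have h1 : 0 ≤ |g 0| + K := by positivity
    have h2 : |x| ≤ 1 + |x| := by linarith
    calc |x| * |g x| ≤ (1 + |x|) * ((|g 0| + K) * (1 + |x|)) := by gcongr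
      _ = _ := by ring
  have i2 : Integrable g' stdGaussian := integrable_poly hg'm K 0 (by simpa using hK)
  have i3 : Integrable g stdGaussian := integrable_poly hgm (|g 0| + K) 1 (by simpa using hgr)
  have := integral_mul_deriv_eq_deriv_mul_of_integrable (u := g) (v := gaussianPDFReal 0 1)
    (u' := g') (v' := fun x => -x * gaussianPDFReal 0 1 x) (fun x _ => hg x) (fun x _ => hd x)
    (by refine (hI _ i1).neg.congr (ae_of_all _ fun x => ?_)
        simp only [Pi.neg_apply, Pi.mul_apply]; ring) (hI _ i2) (hI _ i3)
  rw [integral_gaussianReal_eq_integral_smul one_ne_zero,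
    integral_gaussianReal_eq_integral_smul one_ne_zero]
  simp only [smul_eq_mul]
  have e1 : ∀ x, gaussianPDFReal 0 1 x * (x * g x) = -(g x * (-x * gaussianPDFReal 0 1 x)) := by
    intro x; ring
  simp_rw [e1, integral_neg, this, neg_neg]
  congr 1; ext x; ring

namespace Act
variable {σ σ' σ'' : ℝ → ℝ} {lam b a : ℝ} (h : Act σ σ' σ'' lam b a)
include h

lemma int_lin (r : ℝ) : Integrable (fun x => σ (r * x)) stdGaussian := by
  simpa using h.int_pow r 1

lemma int' (r : ℝ) : Integrable (fun x => σ' (r * x)) stdGaussian := by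
  have := h.cont'.measurable
  exact integrable_poly (by fun_prop) lam 0 (by simpa using fun x => h.b1 _)

lemma b_sq_le : b ^ 2 ≤ 1 := by
  have h1 := stein h.d1 lam h.b1
  rw [← h.hb] at h1
  have hs : Integrable (fun x => (x - b * σ x) ^ 2) stdGaussian := by
    have hm := h.cont.measurable
    refine integrable_poly (by fun_prop) ((1 + |b| * (|σ 0| + lam)) ^ 2) 2 fun x => ?_
    rw [abs_pow, ← mul_pow]
    refine pow_le_pow_left₀ (abs_nonneg _) ?_ 2
    have := h.growth1 1 x
    simp only [one_mul, abs_one, mul_one] at this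
    calc |x - b * σ x| ≤ |x| + |b| * |σ x| := by
          rw [← abs_mul]; exact abs_sub _ _
      _ ≤ (1 + |x|) + |b| * ((|σ 0| + lam) * (1 + |x|)) := by gcongr; linarith
      _ = _ := by ring
  have h2 : 0 ≤ ∫ x, (b * x - b * b * σ x) ^ 2 ∂stdGaussian := integral_nonneg fun x => sq_nonneg _
  have i1 : Integrable (fun x => x * σ x) stdGaussian := by
    have hm := h.cont.measurable
    refine integrable_poly (by fun_prop) (|σ 0| + lam) 2 fun x => ?_
    have := h.growth1 1 x
    simp only [one_mul, abs_one, mul_one] at this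
    have hl := h.lam0
    rw [abs_mul]
    calc |x| * |σ x| ≤ (1 + |x|) * ((|σ 0| + lam) * (1 + |x|)) := by gcongr; linarith
      _ = _ := by ring
  have i2 : Integrable (fun x => σ x ^ 2) stdGaussian := by simpa using h.int_pow 1 2
  have i3 := int_pow_std 2
  have e : ∫ x, (x - b * σ x) ^ 2 ∂stdGaussian = 1 - b ^ 2 := by
    have e1 : ∀ x, (x - b * σ x) ^ 2 = x ^ 2 - 2 * b * (x * σ x) + b ^ 2 * σ x ^ 2 := by
      intro x; ring
    simp_rw [e1]
    have v2 := act_id.var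
    simp only [id] at v2
    have i4 : Integrable (fun x => x ^ 2 - 2 * b * (x * σ x)) stdGaussian := i3.sub (i1.const_mul _)
    rw [integral_add i4 (i2.const_mul _), integral_sub i3 (i1.const_mul _),
      integral_const_mul, integral_const_mul, h.var, h1, v2]
    ring
  have h3 : 0 ≤ ∫ x, (x - b * σ x) ^ 2 ∂stdGaussian := integral_nonneg fun x => sq_nonneg _
  linarith

lemma k4 (r : ℝ) : |∫ x, σ (r * x) ∂stdGaussian| ≤ lam * |r - 1| := by
  have e : ∫ x, σ (r * x) ∂stdGaussian = ∫ x, (σ (r * x) - σ x) ∂stdGaussian := by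
    rw [integral_sub (h.int_lin r) (by simpa using h.int_lin 1), h.mean, sub_zero]
  rw [e]
  calc _ ≤ ∫ x, |σ (r * x) - σ x| ∂stdGaussian := abs_integral_le_integral_abs
    _ ≤ ∫ x, (lam * |r - 1|) * |x| ∂stdGaussian := by
        apply integral_mono
        · exact ((h.int_lin r).sub (by simpa using h.int_lin 1)).abs
        · exact int_abs'.const_mul _
        · intro x
          refine (h.lip _ _).trans (le_of_eq ?_)
          simp only
          rw [mul_assoc, ← abs_mul]; ring_nf
    _ ≤ _ := by
        rw [integral_const_mul]
        have := h.lam0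
        exact mul_le_of_le_one_right (by positivity) int_abs_le

lemma k4' (r : ℝ) : |(∫ x, σ' (r * x) ∂stdGaussian) - b| ≤ lam * |r - 1| := by
  have e : (∫ x, σ' (r * x) ∂stdGaussian) - b = ∫ x, (σ' (r * x) - σ' x) ∂stdGaussian := by
    rw [integral_sub (h.int' r) (by simpa using h.int' 1), h.hb]
  rw [e]
  calc _ ≤ ∫ x, |σ' (r * x) - σ' x| ∂stdGaussian := abs_integral_le_integral_abs
    _ ≤ ∫ x, (lam * |r - 1|) * |x| ∂stdGaussian := by
        apply integral_mono
        · exact ((h.int' r).sub (by simpa using h.int' 1)).abs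
        · exact int_abs'.const_mul _
        · intro x
          refine (h.lip' _ _).trans (le_of_eq ?_)
          simp only
          rw [mul_assoc, ← abs_mul]; ring_nf
    _ ≤ _ := by
        rw [integral_const_mul]
        have := h.lam0
        exact mul_le_of_le_one_right (by positivity) int_abs_le

lemma k3d (r : ℝ) : |(∫ x, σ' (r * x) ^ 2 ∂stdGaussian) - a| ≤ 2 * lam ^ 2 * |r - 1| := by
  have hm := h.cont'.measurable
  have hl := h.lam0
  have i1 : ∀ r, Integrable (fun x => σ' (r * x) ^ 2) stdGaussian := fun r =>
    integrable_poly (by fun_prop) (lam ^ 2) 0 (by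
      intro x; rw [abs_pow]; simpa using pow_le_pow_left₀ (abs_nonneg _) (h.b1 (r * x)) 2)
  have i2 : Integrable (fun x => σ' x ^ 2) stdGaussian := by simpa using i1 1
  rw [h.ha, ← integral_sub (i1 r) i2]
  calc _ ≤ ∫ x, |σ' (r * x) ^ 2 - σ' x ^ 2| ∂stdGaussian := abs_integral_le_integral_abs
    _ ≤ ∫ x, (2 * lam ^ 2 * |r - 1|) * |x| ∂stdGaussian := by
        apply integral_mono
        · exact ((i1 r).sub i2).abs
        · exact int_abs'.const_mul _
        · intro x
          have h1 := h.lip' (r * x) x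
          have h2 : |r * x - x| = |r - 1| * |x| := by rw [← abs_mul]; ring_nf
          have h3 : |σ' (r * x) + σ' x| ≤ 2 * lam :=
            (abs_add_le _ _).trans (by linarith [h.b1 (r * x), h.b1 x])
          simp only
          rw [sq_sub_sq, abs_mul]
          rw [h2] at h1
          calc _ ≤ (2 * lam) * (lam * (|r - 1| * |x|)) := by gcongr
            _ = _ := by ring
    _ ≤ _ := by
        rw [integral_const_mul]
        exact mul_le_of_le_one_right (by positivity) int_abs_le

/-- constant for second moments -/
lemma k2 : ∃ C, 0 ≤ C ∧ ∀ r, 0 ≤ r → r ≤ 2 → |(∫ x, σ (r * x) ^ 2 ∂stdGaussian) - 1| ≤ C * |r - 1| := by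
  have hl := h.lam0
  have hm := h.cont.measurable
  set A := 2 * (|σ 0| + lam * 2) with hA
  have hA0 : 0 ≤ A := by positivity
  refine ⟨lam * A * ∫ x, (1 + |x|) ^ 2 ∂stdGaussian, ?_, ?_⟩
  · have : 0 ≤ ∫ x, (1 + |x|) ^ 2 ∂stdGaussian := integral_nonneg fun x => sq_nonneg _
    positivity
  intro r hr0 hr2
  have i0 : Integrable (fun x : ℝ => (1 + |x|) ^ 2) stdGaussian :=
    integrable_poly (by fun_prop) 1 2 (by
      intro x; rw [abs_of_nonneg (by positivity)]; simp)
  have i2 : Integrable (fun x => σ x ^ 2) stdGaussian := by simpa using h.int_pow 1 2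
  have hv := h.var
  have e0 : (∫ x, σ (r * x) ^ 2 ∂stdGaussian) - 1 = ∫ x, (σ (r * x) ^ 2 - σ x ^ 2) ∂stdGaussian := by
    rw [integral_sub (h.int_pow r 2) i2, hv]
  rw [e0]
  calc _ ≤ ∫ x, |σ (r * x) ^ 2 - σ x ^ 2| ∂stdGaussian := abs_integral_le_integral_abs
    _ ≤ ∫ x, (lam * A * |r - 1|) * (1 + |x|) ^ 2 ∂stdGaussian := by
        apply integral_mono
        · exact ((h.int_pow r 2).sub i2).abs
        · exact i0.const_mul _
        · intro x
          have h1 := h.lip (r * x) x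
          have h2 : |r * x - x| = |r - 1| * |x| := by rw [← abs_mul]; ring_nf
          have h4 := h.growth1 r x
          have h5 := h.growth1 1 x
          simp only [one_mul, abs_one, mul_one] at h5
          rw [abs_of_nonneg hr0] at h4
          have h3 : |σ (r * x) + σ x| ≤ A * (1 + |x|) := by
            refine (abs_add_le _ _).trans ((add_le_add h4 h5).trans ?_)
            rw [← add_mul]
            gcongr
            rw [hA]
            nlinarith
          rw [h2] at h1
          simp only
          rw [sq_sub_sq, abs_mul]
          calc _ ≤ (A * (1 + |x|)) * (lam * (|r - 1| * (1 + |x|))) := by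
                gcongr
                exact h1.trans (by gcongr; linarith)
            _ = _ := by ring
    _ = _ := by rw [integral_const_mul]; ring

end Act

lemma gauss_scale (q : ℝ) (hq : 0 ≤ q) :
    gaussianReal 0 q.toNNReal = stdGaussian.map (fun x => Real.sqrt q * x) := by
  rw [gaussianReal_map_const_mul]
  congr 1
  · simp
  · ext; simp [Real.sq_sqrt hq, hq]

lemma dot_self_nonneg {d : ℕ} (x : Fin d → ℝ) : 0 ≤ x ⬝ᵥ x :=
  Finset.sum_nonneg fun i _ => mul_self_nonneg (x i)

lemma dot_law {d : ℕ} (x : Fin d → ℝ) :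
    (gaussianVec d).map (fun w => w ⬝ᵥ x) = stdGaussian.map (fun ξ => Real.sqrt (x ⬝ᵥ x) * ξ) := by
  have := vec_law d x
  rw [← gauss_scale _ (dot_self_nonneg x)]
  convert this using 3
  · exact dotProduct_comm _ x
  · simp [dotProduct, sq]

lemma meas_dot {d : ℕ} (x : Fin d → ℝ) : Measurable (fun w : Fin d → ℝ => w ⬝ᵥ x) := by
  unfold dotProduct; fun_prop

lemma dot_int {d : ℕ} (x : Fin d → ℝ) {F : ℝ → ℝ} (hF : Measurable F) :
    ∫ w, F (w ⬝ᵥ x) ∂(gaussianVec d) = ∫ ξ, F (Real.sqrt (x ⬝ᵥ x) * ξ) ∂stdGaussian := by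
  have h1 := integral_map (μ := gaussianVec d) (meas_dot x).aemeasurable
    (f := F) hF.aestronglyMeasurable
  rw [← h1, dot_law, integral_map (by fun_prop) hF.aestronglyMeasurable]

lemma dot_integrable {d : ℕ} (x : Fin d → ℝ) {F : ℝ → ℝ} (hF : Measurable F)
    (hi : Integrable (fun ξ => F (Real.sqrt (x ⬝ᵥ x) * ξ)) stdGaussian) :
    Integrable (fun w => F (w ⬝ᵥ x)) (gaussianVec d) := by
  have h2 : Integrable F ((gaussianVec d).map (fun w => w ⬝ᵥ x)) := by
    rw [dot_law, integrable_map_measure hF.aestronglyMeasurable (by fun_prop)]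
    exact hi
  exact (integrable_map_measure hF.aestronglyMeasurable (meas_dot x).aemeasurable).mp h2

lemma joint_law {d : ℕ} (x y : Fin d → ℝ) (hxy : x ⬝ᵥ y = 0) :
    (gaussianVec d).map (fun w => (w ⬝ᵥ x, w ⬝ᵥ y)) =
      (stdGaussian.map (fun ξ => Real.sqrt (x ⬝ᵥ x) * ξ)).prod
        (stdGaussian.map (fun ξ => Real.sqrt (y ⬝ᵥ y) * ξ)) := by
  have hL : ∀ x : Fin d → ℝ, ∃ L : StrongDual ℝ (Fin d → ℝ), ∀ w, L w = w ⬝ᵥ x := fun x =>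
    ⟨∑ i, x i • ContinuousLinearMap.proj (R := ℝ) i, fun w => by simp [dotProduct, mul_comm]⟩
  obtain ⟨Lx, hLx⟩ := hL x
  obtain ⟨Ly, hLy⟩ := hL y
  have hg : HasGaussianLaw (fun w => (w ⬝ᵥ x, w ⬝ᵥ y)) (gaussianVec d) := by
    have h1 : HasGaussianLaw (id : (Fin d → ℝ) → _) (gaussianVec d) :=
      ⟨by rw [Measure.map_id]; infer_instance⟩
    have := h1.map (Lx.prod Ly)
    have hfun : (fun w => (w ⬝ᵥ x, w ⬝ᵥ y)) = ⇑(Lx.prod Ly) ∘ id := by ext w <;> simp [hLx, hLy]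
    rw [hfun]; exact this
  have hv : ∀ x : Fin d → ℝ, Var[fun w => w ⬝ᵥ x; gaussianVec d] = x ⬝ᵥ x := by
    intro x
    have := vec_var d x
    convert this using 2
    · ext w; exact dotProduct_comm w x
    · simp [dotProduct, sq]
  have hm : ∀ x : Fin d → ℝ, MemLp (fun w => w ⬝ᵥ x) 2 (gaussianVec d) := by
    intro x
    have := vec_memLp d x
    convert this using 2
    exact dotProduct_comm _ x
  have hcov : cov[fun w => w ⬝ᵥ x, fun w => w ⬝ᵥ y; gaussianVec d] = 0 := by
    have h1 := variance_add (hm x) (hm y)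
    have h2 : (fun w => w ⬝ᵥ x) + (fun w => w ⬝ᵥ y) = fun w => w ⬝ᵥ (x + y) := by
      ext w; simp [dotProduct_add]
    rw [h2, hv, hv, hv] at h1
    simp only [dotProduct_add, add_dotProduct, hxy, dotProduct_comm y x] at h1
    linarith
  have hind := hg.indepFun_of_covariance_eq_zero hcov
  rw [(indepFun_iff_map_prod_eq_prod_map_map (meas_dot x).aemeasurable
    (meas_dot y).aemeasurable).mp hind, dot_law, dot_law]

lemma joint_int {d : ℕ} (x y : Fin d → ℝ) (ε : ℝ) (h1 : ε ≤ 1 / 2)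
    (hx : |x ⬝ᵥ x - 1| ≤ ε) (hy : |y ⬝ᵥ y - 1| ≤ ε) (hxy : |x ⬝ᵥ y| ≤ ε) :
    ∃ r r' c : ℝ, |c| ≤ 2 * ε ∧ |r - 1| ≤ ε ∧ |r' - 1| ≤ 4 * ε ∧ 0 ≤ r ∧ 0 ≤ r' ∧
      c * r ^ 2 = x ⬝ᵥ y ∧ ∀ F : ℝ × ℝ → ℝ, Continuous F →
      ∫ w, F (w ⬝ᵥ x, w ⬝ᵥ y) ∂(gaussianVec d) =
        ∫ p, F (r * p.1, r' * p.2 + c * (r * p.1)) ∂(stdGaussian.prod stdGaussian) := by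
  have hε : 0 ≤ ε := (abs_nonneg _).trans hx
  rw [abs_le] at hx hy
  have hxx : 1 / 2 ≤ x ⬝ᵥ x := by linarith
  set c := (x ⬝ᵥ y) / (x ⬝ᵥ x) with hc
  have hcx : c * (x ⬝ᵥ x) = x ⬝ᵥ y := by rw [hc]; field_simp
  set z := y - c • x with hz
  have hzx : x ⬝ᵥ z = 0 := by
    rw [hz, dotProduct_sub, dotProduct_smul, smul_eq_mul, hcx, sub_self]
  have hzz : z ⬝ᵥ z = y ⬝ᵥ y - c ^ 2 * (x ⬝ᵥ x) := by
    simp only [hz, dotProduct_sub, sub_dotProduct, dotProduct_smul, smul_dotProduct, smul_eq_mul,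
      dotProduct_comm y x, ← hcx]
    ring
  have hcb : |c| ≤ 2 * ε := by
    rw [hc, abs_div, abs_of_pos (by linarith : (0 : ℝ) < x ⬝ᵥ x), div_le_iff₀ (by linarith)]
    nlinarith
  have hsq : ∀ q : ℝ, 0 ≤ q → |Real.sqrt q - 1| ≤ |q - 1| := by
    intro q hq
    have h2 : q - 1 = (Real.sqrt q - 1) * (Real.sqrt q + 1) := by
      nlinarith [Real.sq_sqrt hq]
    rw [h2, abs_mul]
    apply le_mul_of_one_le_right (abs_nonneg _)
    rw [abs_of_nonneg (by positivity)]
    linarith [Real.sqrt_nonneg q]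
  have hzb : |z ⬝ᵥ z - 1| ≤ 4 * ε := by
    have hc2 : c ^ 2 ≤ (2 * ε) ^ 2 := by rw [← sq_abs c]; gcongr
    rw [abs_le, hzz]
    have h3 : 0 ≤ c ^ 2 * (x ⬝ᵥ x) := by positivity
    have h4 : c ^ 2 * (x ⬝ᵥ x) ≤ (2 * ε) ^ 2 * (3 / 2) := by
      gcongr; linarith
    constructor <;> nlinarith
  refine ⟨Real.sqrt (x ⬝ᵥ x), Real.sqrt (z ⬝ᵥ z), c, hcb,
    (hsq _ (dot_self_nonneg x)).trans (abs_le.mpr hx), (hsq _ (dot_self_nonneg z)).trans hzb,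
    Real.sqrt_nonneg _, Real.sqrt_nonneg _, ?_, ?_⟩
  · rw [Real.sq_sqrt (dot_self_nonneg x), hcx]
  · intro F hF
    have e : ∀ w : Fin d → ℝ, F (w ⬝ᵥ x, w ⬝ᵥ y) =
        (fun p : ℝ × ℝ => F (p.1, p.2 + c * p.1)) (w ⬝ᵥ x, w ⬝ᵥ z) := by
      intro w
      simp only [hz, dotProduct_sub, dotProduct_smul, smul_eq_mul]
      congr 2; ring
    have hF2 : Continuous (fun p : ℝ × ℝ => F (p.1, p.2 + c * p.1)) := by fun_prop
    rw [integral_congr_ae (ae_of_all _ e), ← integral_map (f := fun p : ℝ × ℝ => F (p.1, p.2 + c * p.1))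
      ((meas_dot x).prodMk (meas_dot z)).aemeasurable hF2.measurable.aestronglyMeasurable,
      joint_law x z hzx, Measure.map_prod_map _ _ (by fun_prop) (by fun_prop),
      integral_map (by fun_prop) hF2.measurable.aestronglyMeasurable]
    rfl

namespace Act
variable {σ σ' σ'' : ℝ → ℝ} {lam b a : ℝ} (h : Act σ σ' σ'' lam b a)
include h

lemma k3 : ∃ C, 0 ≤ C ∧ ∀ (d : ℕ) (x y : Fin d → ℝ) (ε : ℝ), ε ≤ 1 / 2 → |x ⬝ᵥ x - 1| ≤ ε →
    |y ⬝ᵥ y - 1| ≤ ε → |x ⬝ᵥ y| ≤ ε →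
    |∫ w, σ' (w ⬝ᵥ x) * σ' (w ⬝ᵥ y) ∂(gaussianVec d) - b ^ 2| ≤ C * ε := by
  have hl := h.lam0
  have hc' := h.cont'
  refine ⟨lam * lam * 4 + lam * lam * 4 + |b| * lam * 4, by positivity, ?_⟩
  intro d x y ε h1 hx hy hxy
  have hε : 0 ≤ ε := (abs_nonneg _).trans hx
  obtain ⟨r, r', c, hc, hr, hr', hr0, hr0', hcr, hF⟩ := joint_int x y ε h1 hx hy hxy
  rw [hF (fun p => σ' p.1 * σ' p.2) (by fun_prop)]
  simp only
  have ib : ∀ f g : ℝ × ℝ → ℝ, Continuous f → Continuous g → Integrable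
      (fun p => σ' (f p) * σ' (g p)) (stdGaussian.prod stdGaussian) := by
    intro f g hf hg
    refine (integrable_const (lam * lam)).mono' (by fun_prop) (ae_of_all _ fun p => ?_)
    rw [Real.norm_eq_abs, abs_mul]
    have := h.b1 (f p)
    have := h.b1 (g p)
    gcongr
  have e2 : ∫ p : ℝ × ℝ, σ' (r * p.1) * σ' (r' * p.2) ∂(stdGaussian.prod stdGaussian) =
      (∫ x, σ' (r * x) ∂stdGaussian) * ∫ x, σ' (r' * x) ∂stdGaussian :=
    integral_prod_mul (fun x => σ' (r * x)) (fun x => σ' (r' * x))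
  have e1 : |(∫ p : ℝ × ℝ, σ' (r * p.1) * σ' (r' * p.2 + c * (r * p.1)) ∂(stdGaussian.prod stdGaussian))
      - ∫ p : ℝ × ℝ, σ' (r * p.1) * σ' (r' * p.2) ∂(stdGaussian.prod stdGaussian)| ≤ lam * lam * (4 * ε) := by
    rw [← integral_sub (ib _ _ (by fun_prop) (by fun_prop)) (ib _ _ (by fun_prop) (by fun_prop))]
    have hia : Integrable (fun p : ℝ × ℝ => |p.1|) (stdGaussian.prod stdGaussian) :=
      int_abs'.comp_fst _
    calc _ ≤ ∫ p : ℝ × ℝ, |σ' (r * p.1) * σ' (r' * p.2 + c * (r * p.1)) - σ' (r * p.1) * σ' (r' * p.2)|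
          ∂(stdGaussian.prod stdGaussian) := abs_integral_le_integral_abs
      _ ≤ ∫ p : ℝ × ℝ, (lam * lam * (4 * ε)) * |p.1| ∂(stdGaussian.prod stdGaussian) := by
          apply integral_mono
          · exact ((ib _ _ (by fun_prop) (by fun_prop)).sub (ib _ _ (by fun_prop) (by fun_prop))).abs
          · exact hia.const_mul _
          · intro p
            simp only
            rw [← mul_sub, abs_mul]
            have h2 := h.lip' (r' * p.2 + c * (r * p.1)) (r' * p.2)
            rw [add_sub_cancel_left, abs_mul, abs_mul, abs_of_nonneg hr0] at h2
            have h3 : r ≤ 2 := by linarith [abs_le.mp hr]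
            have h4 := h.b1 (r * p.1)
            calc _ ≤ lam * (lam * (2 * ε * (2 * |p.1|))) := by
                  gcongr
                  exact h2.trans (by gcongr)
              _ = _ := by ring
      _ ≤ _ := by
          rw [integral_const_mul, integral_fun_fst (μ := stdGaussian) (ν := stdGaussian) (fun x : ℝ => |x|)]
          simp only [probReal_univ, one_smul]
          exact mul_le_of_le_one_right (by positivity) int_abs_le
  have e3 := h.k4' r
  have e4 := h.k4' r'
  have e5 : |∫ x, σ' (r * x) ∂stdGaussian| ≤ lam := by
    have := norm_integral_le_of_norm_le_const (μ := stdGaussian) (f := fun x => σ' (r * x)) (C := lam)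
      (ae_of_all _ fun x => h.b1 _)
    simpa using this
  rw [e2] at e1
  set I1 := ∫ x, σ' (r * x) ∂stdGaussian
  set I2 := ∫ x, σ' (r' * x) ∂stdGaussian
  have e6 : |I1 * I2 - b ^ 2| ≤ lam * (lam * (4 * ε)) + |b| * (lam * ε) := by
    have : I1 * I2 - b ^ 2 = I1 * (I2 - b) + b * (I1 - b) := by ring
    rw [this]
    refine (abs_add_le _ _).trans ?_
    rw [abs_mul, abs_mul]
    gcongr
    · exact e4.trans (by gcongr)
    · exact e3.trans (by gcongr)
  calc _ ≤ lam * lam * (4 * ε) + (lam * (lam * (4 * ε)) + |b| * (lam * ε)) := by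
        refine (abs_sub_le _ (I1 * I2) _).trans (add_le_add e1 e6)
    _ ≤ _ := by
        have : 0 ≤ |b| * lam * ε := by positivity
        nlinarith

lemma k1 : ∃ C, 0 ≤ C ∧ ∀ (d : ℕ) (x y : Fin d → ℝ) (ε : ℝ), ε ≤ 1 / 2 → |x ⬝ᵥ x - 1| ≤ ε →
    |y ⬝ᵥ y - 1| ≤ ε → |x ⬝ᵥ y| ≤ ε →
    |∫ w, σ (w ⬝ᵥ x) * σ (w ⬝ᵥ y) ∂(gaussianVec d) - b ^ 2 * (x ⬝ᵥ y)| ≤ C * ε ^ 2 := by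
  have hl := h.lam0
  have hcσ := h.cont
  have hc' := h.cont'
  set A := |σ 0| + lam * 2 with hA
  have hA0 : 0 ≤ A := by positivity
  set J := ∫ x, (1 + |x|) ^ 3 ∂stdGaussian with hJ
  have hJ0 : 0 ≤ J := integral_nonneg fun x => by positivity
  refine ⟨lam * 16 * A * J + (lam * lam * 4 + (lam * lam * 4 + |b| * lam)), by positivity, ?_⟩
  intro d x y ε h1 hx hy hxy
  have hε : 0 ≤ ε := (abs_nonneg _).trans hx
  obtain ⟨r, r', c, hc, hr, hr', hr0, hr0', hcr, hF⟩ := joint_int x y ε h1 hx hy hxy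
  have hr2 : r ≤ 2 := by linarith [abs_le.mp hr]
  rw [hF (fun p => σ p.1 * σ p.2) (by fun_prop)]
  simp only
  set P := stdGaussian.prod stdGaussian
  have i1 : Integrable (fun p : ℝ × ℝ => σ (r * p.1) * σ (r' * p.2)) P :=
    (h.int_lin r).mul_prod (h.int_lin r')
  have ixs : Integrable (fun x => c * (r * x) * σ (r * x)) stdGaussian := by
    refine integrable_poly (by fun_prop) (|c| * r * A) 2 fun x => ?_
    have := h.growth1 r x
    rw [abs_of_nonneg hr0] at this
    rw [abs_mul, abs_mul, abs_mul, abs_of_nonneg hr0]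
    calc _ ≤ |c| * (r * (1 + |x|)) * (A * (1 + |x|)) := by
          gcongr
          · linarith
          · exact this.trans (by rw [hA]; gcongr)
      _ = _ := by ring
  have i2 : Integrable (fun p : ℝ × ℝ => (c * (r * p.1) * σ (r * p.1)) * σ' (r' * p.2)) P :=
    ixs.mul_prod (h.int' r')
  have i0 : Integrable (fun x : ℝ => (1 + |x|) ^ 3) stdGaussian :=
    integrable_poly (by fun_prop) 1 3 (by
      intro x; rw [abs_of_nonneg (by positivity)]; simp)
  set rem : ℝ × ℝ → ℝ := fun p => σ (r * p.1) * σ (r' * p.2 + c * (r * p.1)) -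
      σ (r * p.1) * σ (r' * p.2) - (c * (r * p.1) * σ (r * p.1)) * σ' (r' * p.2) with hrem
  have hremb : ∀ p, |rem p| ≤ (lam * 16 * A * ε ^ 2) * (1 + |p.1|) ^ 3 := by
    intro p
    have h2 := h.taylor (r' * p.2) (c * (r * p.1))
    have h3 := h.growth1 r p.1
    rw [abs_of_nonneg hr0] at h3
    have h4 : rem p = σ (r * p.1) * (σ (r' * p.2 + c * (r * p.1)) - σ (r' * p.2) -
      c * (r * p.1) * σ' (r' * p.2)) := by simp only [hrem]; ring
    rw [h4, abs_mul]
    have h5 : (c * (r * p.1)) ^ 2 ≤ (2 * ε * (2 * (1 + |p.1|))) ^ 2 := by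
      rw [← sq_abs (c * (r * p.1)), abs_mul, abs_mul, abs_of_nonneg hr0]
      gcongr
      linarith
    calc _ ≤ (A * (1 + |p.1|)) * (lam * (2 * ε * (2 * (1 + |p.1|))) ^ 2) := by
          gcongr
          · exact h3.trans (by rw [hA]; gcongr)
          · exact h2.trans (by gcongr)
      _ = _ := by ring
  have i0' : Integrable (fun p : ℝ × ℝ => (1 + |p.1|) ^ 3) P := i0.comp_fst _
  have irem : Integrable rem P := (i0'.const_mul (lam * 16 * A * ε ^ 2)).mono'
    (by simp only [hrem]; fun_prop) (ae_of_all _ hremb)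
  have i12 : Integrable (fun p : ℝ × ℝ => σ (r * p.1) * σ (r' * p.2) +
    (c * (r * p.1) * σ (r * p.1)) * σ' (r' * p.2)) P := i1.add i2
  have e0 : ∫ p : ℝ × ℝ, σ (r * p.1) * σ (r' * p.2 + c * (r * p.1)) ∂P = (∫ p, rem p ∂P) +
      ((∫ x, σ (r * x) ∂stdGaussian) * (∫ x, σ (r' * x) ∂stdGaussian) +
      (∫ x, c * (r * x) * σ (r * x) ∂stdGaussian) * ∫ x, σ' (r' * x) ∂stdGaussian) := by
    rw [← integral_prod_mul (μ := stdGaussian) (ν := stdGaussian) (fun x => σ (r * x)) (fun x => σ (r' * x)),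
      ← integral_prod_mul (μ := stdGaussian) (ν := stdGaussian) (fun x => c * (r * x) * σ (r * x))
        (fun x => σ' (r' * x)), ← integral_add i1 i2, ← integral_add irem i12]
    congr 1; ext p; simp only [hrem]; ring
  have e1 : |∫ p, rem p ∂P| ≤ lam * 16 * A * ε ^ 2 * J := by
    refine abs_integral_le_integral_abs.trans ((integral_mono irem.abs
      (i0'.const_mul (lam * 16 * A * ε ^ 2)) hremb).trans (le_of_eq ?_))
    rw [integral_const_mul, integral_fun_fst (μ := stdGaussian) (ν := stdGaussian)
      (fun x : ℝ => (1 + |x|) ^ 3)]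
    simp [hJ]
  have e2 : ∫ x, c * (r * x) * σ (r * x) ∂stdGaussian = (x ⬝ᵥ y) * ∫ x, σ' (r * x) ∂stdGaussian := by
    have hs := stein (g := fun x => σ (r * x)) (g' := fun x => r * σ' (r * x)) (fun x => by
      have := (h.d1 (r * x)).comp x ((hasDerivAt_id x).const_mul r)
      simpa [mul_comm, Function.comp_def] using this) (r * lam) (fun x => by
        rw [abs_mul, abs_of_nonneg hr0]; exact mul_le_mul_of_nonneg_left (h.b1 _) hr0)
    have e3 : ∀ x, c * (r * x) * σ (r * x) = (c * r) * (x * σ (r * x)) := fun x => by ring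
    simp_rw [e3]
    rw [integral_const_mul, hs, integral_const_mul, ← hcr]; ring
  have k1 := h.k4 r
  have k2 := h.k4 r'
  have k3 := h.k4' r
  have k4 := h.k4' r'
  have e5 : |∫ x, σ' (r * x) ∂stdGaussian| ≤ lam := by
    have := norm_integral_le_of_norm_le_const (μ := stdGaussian) (f := fun x => σ' (r * x)) (C := lam)
      (ae_of_all _ fun x => h.b1 _)
    simpa using this
  rw [e0, e2]
  set I1 := ∫ x, σ' (r * x) ∂stdGaussian
  set I2 := ∫ x, σ' (r' * x) ∂stdGaussian
  set M1 := ∫ x, σ (r * x) ∂stdGaussian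
  set M2 := ∫ x, σ (r' * x) ∂stdGaussian
  have e6 : |I1 * I2 - b ^ 2| ≤ lam * (lam * (4 * ε)) + |b| * (lam * ε) := by
    have : I1 * I2 - b ^ 2 = I1 * (I2 - b) + b * (I1 - b) := by ring
    rw [this]
    refine (abs_add_le _ _).trans ?_
    rw [abs_mul, abs_mul]
    gcongr
    · exact k4.trans (by gcongr)
    · exact k3.trans (by gcongr)
  have e7 : |M1 * M2| ≤ (lam * ε) * (lam * (4 * ε)) := by
    rw [abs_mul]
    gcongr
    · exact k1.trans (by gcongr)
    · exact k2.trans (by gcongr)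
  have e8 : |(x ⬝ᵥ y) * (I1 * I2 - b ^ 2)| ≤ ε * (lam * (lam * (4 * ε)) + |b| * (lam * ε)) := by
    rw [abs_mul]; gcongr
  have e9 : (∫ p, rem p ∂P) + (M1 * M2 + (x ⬝ᵥ y) * I1 * I2) - b ^ 2 * (x ⬝ᵥ y) =
    (∫ p, rem p ∂P) + (M1 * M2 + (x ⬝ᵥ y) * (I1 * I2 - b ^ 2)) := by ring
  rw [e9]
  calc _ ≤ lam * 16 * A * ε ^ 2 * J + ((lam * ε) * (lam * (4 * ε)) +
        ε * (lam * (lam * (4 * ε)) + |b| * (lam * ε))) :=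
        (abs_add_le _ _).trans (add_le_add e1 ((abs_add_le _ _).trans (add_le_add e7 e8)))
    _ = _ := by ring

end Act

open scoped NNReal ENNReal

/-- Lipschitz functions with a measurable derivative and linear growth. -/
structure LipF (ψ ψ' : ℝ → ℝ) (lam A : ℝ) : Prop where
  d : ∀ x, HasDerivAt ψ (ψ' x) x
  b : ∀ x, |ψ' x| ≤ lam
  m : Measurable ψ'
  g : ∀ x, |ψ x| ≤ A * (1 + |x|)

lemma LipF.cont {ψ ψ' : ℝ → ℝ} {lam A : ℝ} (h : LipF ψ ψ' lam A) : Continuous ψ :=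
  continuous_iff_continuousAt.mpr fun x => (h.d x).continuousAt
lemma LipF.A0 {ψ ψ' : ℝ → ℝ} {lam A : ℝ} (h : LipF ψ ψ' lam A) : 0 ≤ A := by
  have := (abs_nonneg _).trans (h.g 0); simpa using this
lemma LipF.lam0 {ψ ψ' : ℝ → ℝ} {lam A : ℝ} (h : LipF ψ ψ' lam A) : 0 ≤ lam :=
  (abs_nonneg _).trans (h.b 0)

lemma LipF.sq {ψ ψ' : ℝ → ℝ} {lam A : ℝ} (h : LipF ψ ψ' lam A) (x : ℝ) : ψ' x ^ 2 ≤ lam ^ 2 :=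
  sq_le_sq.mpr ((h.b x).trans (le_abs_self _))

lemma Act.lipF {σ σ' σ'' : ℝ → ℝ} {lam b a : ℝ} (h : Act σ σ' σ'' lam b a) :
    LipF σ σ' lam (|σ 0| + lam) := ⟨h.d1, h.b1, h.cont'.measurable, fun x => by
  have := h.growth1 1 x; simpa using this⟩
lemma Act.lipF' {σ σ' σ'' : ℝ → ℝ} {lam b a : ℝ} (h : Act σ σ' σ'' lam b a) :
    LipF σ' σ'' lam lam := ⟨h.d2, h.b2, h.meas'', fun x =>
  (h.b1 x).trans (le_mul_of_one_le_right h.lam0 (by linarith [abs_nonneg x]))⟩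

/-- A centered Gaussian family `T k` (linear functionals) with covariance bounded by `β²`. -/
structure PreG {E : Type*} [NormedAddCommGroup E] [NormedSpace ℝ E] [MeasurableSpace E]
    (μ : Measure E) {ι : Type*} [Fintype ι] (T : ι → StrongDual ℝ E) (β : ℝ) : Prop where
  law : ∀ g : ι → ℝ, ∃ v : ℝ≥0, (v : ℝ) ≤ β ^ 2 * ∑ k, g k ^ 2 ∧
    μ.map (fun y => ∑ k, g k * T k y) = gaussianReal 0 v
  cent : ∀ L : StrongDual ℝ E, μ[L] = 0
  b0 : 0 ≤ β

namespace PreG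
variable {E : Type*} [NormedAddCommGroup E] [NormedSpace ℝ E] [CompleteSpace E]
  [SecondCountableTopology E] [MeasurableSpace E] [BorelSpace E] {μ : Measure E} [IsGaussian μ]
  {ι : Type*} [Fintype ι] {T : ι → StrongDual ℝ E} {β : ℝ} (hT : PreG μ T β)
  {φ : (ι → ℝ) → ℝ} {φ' : (ι → ℝ) → ι → ℝ}

lemma hasGrad (T : ι → StrongDual ℝ E) (hφ : Measurable φ) (hφ' : ∀ k, Measurable (fun x => φ' x k))
    (hc : ∀ (c : ℝ → ι → ℝ) (c' : ι → ℝ) (θ : ℝ), (∀ k, HasDerivAt (fun θ => c θ k) (c' k) θ) →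
      HasDerivAt (fun θ => φ (c θ)) (∑ k, φ' (c θ) k * c' k) θ)
    (hb : ∃ H : (ι → ℝ) → ℝ, Continuous H ∧ ∀ x k, |φ' x k| ≤ H x) :
    HasGrad (fun w => φ (fun k => T k w))
      (fun p : E × E => ∑ k, φ' (fun k => T k p.1) k * T k p.2) := by
  refine ⟨hφ.comp (by fun_prop), ?_, ?_, ?_⟩
  · refine Finset.measurable_sum _ fun k _ => Measurable.mul ?_ (by fun_prop)
    exact (hφ' k).comp (by fun_prop)
  · intro c c' θ h
    exact hc (fun θ k => T k (c θ)) (fun k => T k c') θ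
      fun k => (T k).hasFDerivAt.comp_hasDerivAt θ h
  · obtain ⟨H, hH, hb⟩ := hb
    refine ⟨fun p => ∑ k, H (fun k => T k p.1) * |T k p.2|, by fun_prop, fun p => ?_⟩
    refine (Finset.abs_sum_le_sum_abs _ _).trans (Finset.sum_le_sum fun k _ => ?_)
    rw [abs_mul]
    gcongr
    exact hb _ k

include hT

lemma one [DecidableEq ι] (k : ι) : ∃ v : ℝ≥0, (v : ℝ) ≤ β ^ 2 ∧ μ.map (T k) = gaussianReal 0 v := by
  obtain ⟨v, h1, h2⟩ := hT.law (Pi.single k 1)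
  refine ⟨v, ?_, ?_⟩
  · simpa [Pi.single_apply] using h1
  · rw [← h2]; congr 1; ext y; simp [Pi.single_apply]

/-- polynomial moments of one coordinate -/
lemma mom1 (k : ι) (p : ℕ) :
    Integrable (fun w => (1 + |T k w|) ^ p) μ ∧
      ∫ w, (1 + |T k w|) ^ p ∂μ ≤ ∫ ξ, (1 + β * |ξ|) ^ p ∂stdGaussian := by
  classical
  obtain ⟨v, h1, h2⟩ := hT.one k
  have hi : ∀ r : ℝ, Integrable (fun ξ : ℝ => (1 + |r * ξ|) ^ p) stdGaussian := by
    intro r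
    refine integrable_poly (by fun_prop) ((1 + |r|) ^ p) p fun x => ?_
    rw [abs_of_nonneg (by positivity), ← mul_pow, abs_mul]
    gcongr
    nlinarith [abs_nonneg r, abs_nonneg x]
  have h3 : gaussianReal 0 v = stdGaussian.map (fun x => Real.sqrt v * x) := by
    have := gauss_scale v v.2; simpa using this
  have hm : AEStronglyMeasurable (fun x : ℝ => (1 + |x|) ^ p) (μ.map (T k)) := by fun_prop
  have hm2 : AEStronglyMeasurable (fun x : ℝ => (1 + |x|) ^ p)
    (stdGaussian.map (fun x => Real.sqrt v * x)) := by fun_prop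
  constructor
  · have : Integrable (fun x : ℝ => (1 + |x|) ^ p) (μ.map (T k)) := by
      rw [h2, h3]
      exact (integrable_map_measure hm2 (by fun_prop)).mpr (hi _)
    exact (integrable_map_measure hm (by fun_prop)).mp this
  · have e : ∫ w, (1 + |T k w|) ^ p ∂μ = ∫ x, (1 + |x|) ^ p ∂(μ.map (T k)) :=
      (integral_map (by fun_prop) hm).symm
    rw [e, h2, h3, integral_map (by fun_prop) hm2]
    have hb := hT.b0
    apply integral_mono (hi _)
    · have := hi β
      simpa [abs_mul, abs_of_nonneg hb] using this
    · intro ξ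
      simp only
      have h0 : |Real.sqrt v * ξ| = Real.sqrt v * |ξ| := by
        rw [abs_mul, abs_of_nonneg (Real.sqrt_nonneg _)]
      rw [h0]
      gcongr
      exact Real.sqrt_le_iff.mpr ⟨hb, h1⟩

/-- weighted sums -/
lemma momS {ψ ψ' : ℝ → ℝ} {lam A : ℝ} (hψ : LipF ψ ψ' lam A) (c : ι → ℝ) (hc : ∀ k, 0 ≤ c k) (p : ℕ)
    (hp : 1 ≤ p) :
    Integrable (fun w => (∑ k, c k * ψ (T k w) ^ 2) ^ p) μ ∧
      ∫ w, (∑ k, c k * ψ (T k w) ^ 2) ^ p ∂μ ≤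
        (∑ k, c k) ^ p * (A ^ (2 * p) * ∫ ξ, (1 + β * |ξ|) ^ (2 * p) ∂stdGaussian) := by
  have hψc := hψ.cont
  have hA := hψ.A0
  set S := ∑ k, c k with hS
  have hS0 : 0 ≤ S := Finset.sum_nonneg fun k _ => hc k
  set V : E → ℝ := fun w => S ^ (p - 1) * ∑ k, c k * (A ^ (2 * p) * (1 + |T k w|) ^ (2 * p)) with hV
  have hVi : Integrable V μ := by
    refine Integrable.const_mul (integrable_finsetSum _ fun k _ => ?_) _
    exact ((hT.mom1 k _).1.const_mul _).const_mul _
  have hle : ∀ w, (∑ k, c k * ψ (T k w) ^ 2) ^ p ≤ V w := by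
    intro w
    have h1 : (∑ k, c k * ψ (T k w) ^ 2) ^ p ≤ S ^ (p - 1) * ∑ k, c k * (ψ (T k w) ^ 2) ^ p := by
      rcases hS0.eq_or_lt with h0 | h0
      · have : ∀ k, c k = 0 := fun k =>
          (Finset.sum_eq_zero_iff_of_nonneg (fun k _ => hc k)).mp h0.symm k (Finset.mem_univ _)
        simp [this, show p ≠ 0 by omega]
      · have := Real.pow_arith_mean_le_arith_mean_pow Finset.univ (fun k => c k / S)
          (fun k => ψ (T k w) ^ 2) (fun k _ => by have := hc k; positivity)
          (by rw [← Finset.sum_div]; exact div_self h0.ne') (fun k _ => by positivity) p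
        simp_rw [div_mul_eq_mul_div, ← Finset.sum_div, div_pow] at this
        rw [div_le_div_iff₀ (by positivity) h0] at this
        have e : S ^ p = S ^ (p - 1) * S := by rw [← pow_succ]; congr 1; omega
        rw [e] at this
        nlinarith
    refine h1.trans ?_
    simp only [hV]
    gcongr with k
    · exact hc k
    · rw [← mul_pow, ← pow_mul, ← Even.pow_abs (by simp : Even (2 * p))]
      gcongr
      exact hψ.g _
  have h0 : ∀ w, 0 ≤ (∑ k, c k * ψ (T k w) ^ 2) ^ p := fun w =>
    pow_nonneg (Finset.sum_nonneg fun k _ => mul_nonneg (hc k) (sq_nonneg _)) _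
  have hi : Integrable (fun w => (∑ k, c k * ψ (T k w) ^ 2) ^ p) μ :=
    hVi.mono' (by fun_prop) (ae_of_all _ fun w => by
      rw [Real.norm_eq_abs, abs_of_nonneg (h0 w)]; exact hle w)
  refine ⟨hi, (integral_mono hi hVi hle).trans ?_⟩
  simp only [hV]
  rw [integral_const_mul, integral_finsetSum _ fun k _ =>
    (((hT.mom1 k _).1.const_mul _).const_mul _)]
  simp_rw [integral_const_mul]
  calc _ ≤ S ^ (p - 1) * ∑ k, c k * (A ^ (2 * p) * ∫ ξ, (1 + β * |ξ|) ^ (2 * p) ∂stdGaussian) := by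
        gcongr with k
        · exact hc k
        · exact (hT.mom1 k _).2
    _ = _ := by
        rw [← Finset.sum_mul, ← mul_assoc, ← pow_succ]; congr 2; omega

omit hT in
lemma quadGrad {ψ ψ' : ℝ → ℝ} {lam A : ℝ} (hψ : LipF ψ ψ' lam A) (M : ι → ι → ℝ)
    (T : ι → StrongDual ℝ E) :
    HasGrad (fun w => ∑ k, ∑ l, M k l * (ψ (T k w) * ψ (T l w)))
      (fun p : E × E => ∑ k, (ψ' (T k p.1) * ∑ l, (M k l + M l k) * ψ (T l p.1)) * T k p.2) := by
  have hψc := hψ.cont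
  have hψm := hψ.m
  refine hasGrad (φ := fun x => ∑ k, ∑ l, M k l * (ψ (x k) * ψ (x l)))
    (φ' := fun x k => ψ' (x k) * ∑ l, (M k l + M l k) * ψ (x l)) T (by fun_prop) ?_ ?_ ?_
  · intro k; fun_prop
  · intro c c' θ hc
    have h1 : ∀ k, HasDerivAt (fun θ => ψ (c θ k)) (ψ' (c θ k) * c' k) θ := fun k =>
      (hψ.d (c θ k)).comp θ (hc k)
    have h2 := HasDerivAt.fun_sum (u := Finset.univ) fun k (_ : k ∈ Finset.univ) =>
      HasDerivAt.fun_sum (u := Finset.univ) fun l (_ : l ∈ Finset.univ) =>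
        (((h1 k).mul (h1 l)).const_mul (M k l))
    refine h2.congr_deriv ?_
    symm
    simp_rw [mul_add, Finset.sum_add_distrib]
    rw [Finset.sum_comm (f := fun k l => M k l * (ψ (c θ k) * (ψ' (c θ l) * c' l))),
      ← Finset.sum_add_distrib]
    refine Finset.sum_congr rfl fun k _ => ?_
    rw [← Finset.sum_add_distrib, Finset.mul_sum, Finset.sum_mul]
    exact Finset.sum_congr rfl fun l _ => by ring
  · refine ⟨fun x => ∑ k, lam * ∑ l, |M k l + M l k| * |ψ (x l)|, by fun_prop, fun x k => ?_⟩
    have hl := hψ.lam0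
    refine le_trans ?_ (Finset.single_le_sum (f := fun k => lam * ∑ l, |M k l + M l k| * |ψ (x l)|)
      (fun k _ => by positivity) (Finset.mem_univ k))
    rw [abs_mul]
    gcongr
    · exact hψ.b _
    · refine (Finset.abs_sum_le_sum_abs _ _).trans (le_of_eq ?_)
      simp_rw [abs_mul]

/-- The constant in the quadratic form concentration. -/
noncomputable def _root_.Cq (β lam A : ℝ) (p : ℕ) : ℝ :=
  Cmom p * ((β ^ 2 * lam ^ 2) ^ p * (A ^ (2 * p) * ∫ ξ, (1 + β * |ξ|) ^ (2 * p) ∂stdGaussian))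

omit [CompleteSpace E] [SecondCountableTopology E] [IsGaussian μ] in
lemma Cq_nonneg (lam A : ℝ) (p : ℕ) : 0 ≤ Cq β lam A p := by
  have := hT.b0
  have h1 : 0 ≤ ∫ ξ, (1 + β * |ξ|) ^ (2 * p) ∂stdGaussian := integral_nonneg fun x => by positivity
  have h2 : 0 ≤ A ^ (2 * p) := by rw [pow_mul]; positivity
  unfold Cq
  have := Cmom_nonneg p
  positivity

lemma mem2 {ψ ψ' : ℝ → ℝ} {lam A : ℝ} (hψ : LipF ψ ψ' lam A) (k : ι) : MemLp (fun w => ψ (T k w)) 2 μ := by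
  have := hψ.cont
  have hA := hψ.A0
  rw [memLp_two_iff_integrable_sq (by fun_prop)]
  refine ((hT.mom1 k 2).1.const_mul (A ^ 2)).mono' (by fun_prop) (ae_of_all _ fun w => ?_)
  rw [Real.norm_eq_abs, abs_of_nonneg (sq_nonneg _), ← mul_pow, ← sq_abs]
  gcongr
  exact hψ.g _

lemma quad_int {ψ ψ' : ℝ → ℝ} {lam A : ℝ} (hψ : LipF ψ ψ' lam A) (M : ι → ι → ℝ) :
    Integrable (fun w => ∑ k, ∑ l, M k l * (ψ (T k w) * ψ (T l w))) μ :=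
  integrable_finsetSum _ fun k _ => integrable_finsetSum _ fun l _ =>
    ((hT.mem2 hψ k).integrable_mul (hT.mem2 hψ l)).const_mul _

theorem quad_moment {ψ ψ' : ℝ → ℝ} {lam A : ℝ} (hψ : LipF ψ ψ' lam A) (M : ι → ι → ℝ)
    (c : ι → ℝ) (hc : ∀ k, 0 ≤ c k)
    (hM : ∀ y : ι → ℝ, ∑ k, (∑ l, (M k l + M l k) * y l) ^ 2 ≤ ∑ k, c k * y k ^ 2)
    (p : ℕ) (hp : 1 ≤ p) :
    ∫⁻ w, ENNReal.ofReal (((∑ k, ∑ l, M k l * (ψ (T k w) * ψ (T l w))) -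
      ∫ w, ∑ k, ∑ l, M k l * (ψ (T k w) * ψ (T l w)) ∂μ) ^ (2 * p)) ∂μ
      ≤ ENNReal.ofReal (Cq β lam A p * (∑ k, c k) ^ p) := by
  choose v hv1 hv2 using fun x : E => hT.law (fun k => ψ' (T k x) * ∑ l, (M k l + M l k) * ψ (T l x))
  have hm := hT.momS hψ c hc p hp
  have hl := hψ.lam0
  have := conc_moment μ hT.cent (quadGrad hψ M T) (hT.quad_int hψ M) v hv2 p
    ((β ^ 2 * lam ^ 2) ^ p * ((∑ k, c k) ^ p * (A ^ (2 * p) * ∫ ξ, (1 + β * |ξ|) ^ (2 * p) ∂stdGaussian)))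
    (fun w => β ^ 2 * lam ^ 2 * ∑ k, c k * ψ (T k w) ^ 2)
    (by simp_rw [mul_pow _ (∑ k, c k * ψ (T k _) ^ 2)]; exact hm.1.const_mul _) ?_ ?_
  · refine this.trans (le_of_eq ?_)
    unfold Cq; congr 1; ring
  · intro x
    refine (hv1 x).trans ?_
    rw [mul_assoc]
    gcongr
    refine le_trans ?_ (mul_le_mul_of_nonneg_left (hM (fun k => ψ (T k x))) (sq_nonneg lam))
    rw [Finset.mul_sum]
    gcongr with k
    rw [mul_pow]
    exact mul_le_mul_of_nonneg_right (hψ.sq _) (sq_nonneg _)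
  · simp_rw [mul_pow _ (∑ k, c k * ψ (T k _) ^ 2)]
    rw [integral_const_mul]
    have := hm.2
    gcongr

theorem quad_tail {ψ ψ' : ℝ → ℝ} {lam A : ℝ} (hψ : LipF ψ ψ' lam A) (M : ι → ι → ℝ)
    (c : ι → ℝ) (hc : ∀ k, 0 ≤ c k)
    (hM : ∀ y : ι → ℝ, ∑ k, (∑ l, (M k l + M l k) * y l) ^ 2 ≤ ∑ k, c k * y k ^ 2)
    (p : ℕ) (hp : 1 ≤ p) (t : ℝ) (ht : 0 < t) :
    μ {w | t ≤ |(∑ k, ∑ l, M k l * (ψ (T k w) * ψ (T l w))) -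
      ∫ w, ∑ k, ∑ l, M k l * (ψ (T k w) * ψ (T l w)) ∂μ|}
      ≤ ENNReal.ofReal (Cq β lam A p * (∑ k, c k) ^ p / t ^ (2 * p)) := by
  have := hψ.cont
  exact tail_of_moment μ _ (by fun_prop) p _ t ht (hT.quad_moment hψ M c hc hM p hp)

theorem lin_tail {ψ ψ' : ℝ → ℝ} {lam A : ℝ} (hψ : LipF ψ ψ' lam A) (u : ι → ℝ) (hu : ∑ k, u k ^ 2 ≤ 1)
    (K : ℝ) (hK : 0 < K) (hK2 : β ^ 2 * lam ^ 2 ≤ K) (t : ℝ) (ht : 0 < t) :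
    μ {w | t ≤ (∑ k, u k * ψ (T k w)) - ∑ k, u k * ∫ w, ψ (T k w) ∂μ} ≤
      ENNReal.ofReal (Real.exp (-2 * t ^ 2 / (Real.pi ^ 2 * K))) := by
  have hψc := hψ.cont
  have hψm := hψ.m
  have hl := hψ.lam0
  have hi : ∀ k, Integrable (fun w => u k * ψ (T k w)) μ := fun k =>
    ((hT.mem2 hψ k).integrable (by norm_num)).const_mul _
  have hG := hasGrad (φ := fun x => ∑ k, u k * ψ (x k))
    (φ' := fun x k => u k * ψ' (x k)) T (by fun_prop) (by fun_prop) (by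
      intro c c' θ hc
      have h2 := HasDerivAt.fun_sum (u := Finset.univ) fun k (_ : k ∈ Finset.univ) =>
        (((hψ.d (c θ k)).comp θ (hc k)).const_mul (u k))
      refine h2.congr_deriv ?_
      exact Finset.sum_congr rfl fun l _ => by ring) (by
      refine ⟨fun x => ∑ k, |u k| * lam, by fun_prop, fun x k => ?_⟩
      refine le_trans ?_ (Finset.single_le_sum (f := fun k => |u k| * lam)
        (fun k _ => by positivity) (Finset.mem_univ k))
      rw [abs_mul]
      gcongr
      exact hψ.b _)
  choose v hv1 hv2 using fun x : E => hT.law (fun k => u k * ψ' (T k x))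
  have := conc_exp μ hT.cent hG (integrable_finsetSum _ fun k _ => hi k) v hv2 K hK ?_ t ht
  · rw [integral_finsetSum _ fun k _ => hi k] at this
    simp_rw [integral_const_mul] at this
    exact this
  · intro x
    refine (hv1 x).trans (le_trans ?_ hK2)
    gcongr
    calc _ ≤ ∑ k, u k ^ 2 * lam ^ 2 := by
          gcongr with k
          rw [mul_pow]
          exact mul_le_mul_of_nonneg_left (hψ.sq _) (sq_nonneg _)
      _ ≤ _ := by
          rw [← Finset.sum_mul]
          exact mul_le_of_le_one_left (sq_nonneg _) hu

end PreG

section norms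
variable {𝕜 : Type*} [RCLike 𝕜] {m n l : Type*} [Fintype m] [Fintype n] [Fintype l] [DecidableEq m] [DecidableEq n] [DecidableEq l]

lemma eucl_sq (v : n → 𝕜) : ‖(WithLp.toLp 2 v : EuclideanSpace 𝕜 n)‖ ^ 2 = ∑ i, ‖v i‖ ^ 2 := by
  rw [EuclideanSpace.norm_sq_eq]

lemma nrm_mulVec (X : Matrix m n 𝕜) (v : n → 𝕜) : ∑ i, ‖(X *ᵥ v) i‖ ^ 2 ≤ ‖X‖ ^ 2 * ∑ i, ‖v i‖ ^ 2 := by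
  have := Matrix.l2_opNorm_mulVec X (WithLp.toLp 2 v)
  rw [← eucl_sq, ← eucl_sq, ← mul_pow]
  gcongr
  exact this

lemma nrm_le (X : Matrix m n 𝕜) (K : ℝ) (hK : 0 ≤ K)
    (h : ∀ v : n → 𝕜, ∑ i, ‖(X *ᵥ v) i‖ ^ 2 ≤ K ^ 2 * ∑ i, ‖v i‖ ^ 2) : ‖X‖ ≤ K := by
  rw [Matrix.l2_opNorm_def]
  refine ContinuousLinearMap.opNorm_le_bound _ hK fun v => ?_
  refine (sq_le_sq₀ (norm_nonneg _) (by positivity)).mp ?_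
  rw [mul_pow, EuclideanSpace.norm_sq_eq, EuclideanSpace.norm_sq_eq]
  exact h v.ofLp

lemma nrm_entry (X : Matrix m n 𝕜) (i : m) (j : n) : ‖X i j‖ ≤ ‖X‖ := by
  have h := nrm_mulVec X (Pi.single j 1)
  simp only [Matrix.mulVec_single_one, Pi.single_apply] at h
  have h2 : ‖X i j‖ ^ 2 ≤ ∑ i, ‖X i j‖ ^ 2 :=
    Finset.single_le_sum (f := fun i => ‖X i j‖ ^ 2) (fun i _ => sq_nonneg _) (Finset.mem_univ i)
  have h3 : ∑ i, ‖(if i = j then (1 : 𝕜) else 0)‖ ^ 2 = 1 := by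
    rw [Finset.sum_eq_single j] <;> simp +contextual
  rw [h3, mul_one] at h
  exact (sq_le_sq₀ (norm_nonneg _) (norm_nonneg _)).mp (h2.trans h)

/-- squared Frobenius norm -/
def fro (X : Matrix m n 𝕜) : ℝ := ∑ i, ∑ j, ‖X i j‖ ^ 2

lemma fro_nonneg (X : Matrix m n 𝕜) : 0 ≤ fro X :=
  Finset.sum_nonneg fun _ _ => Finset.sum_nonneg fun _ _ => sq_nonneg _

lemma fro_conjT (X : Matrix m n 𝕜) : fro Xᴴ = fro X := by
  unfold fro; rw [Finset.sum_comm]; simp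

lemma fro_mul (X : Matrix m n 𝕜) (Y : Matrix n l 𝕜) : fro (X * Y) ≤ ‖X‖ ^ 2 * fro Y := by
  unfold fro
  rw [Finset.sum_comm, Finset.sum_comm (f := fun i j => ‖Y i j‖ ^ 2), Finset.mul_sum]
  gcongr with j
  exact nrm_mulVec X (fun i => Y i j)

lemma fro_mul' (X : Matrix m n 𝕜) (Y : Matrix n l 𝕜) : fro (X * Y) ≤ fro X * ‖Y‖ ^ 2 := by
  rw [← fro_conjT, Matrix.conjTranspose_mul, mul_comm, ← fro_conjT X, ← Matrix.l2_opNorm_conjTranspose Y]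
  exact fro_mul _ _

lemma fro_le (X : Matrix m n 𝕜) : fro X ≤ Fintype.card n * ‖X‖ ^ 2 := by
  have := fro_mul X (1 : Matrix n n 𝕜)
  rw [Matrix.mul_one] at this
  refine this.trans (le_of_eq ?_)
  rw [mul_comm]
  congr 1
  unfold fro
  simp_rw [Matrix.one_apply]
  have : ∀ i : n, ∑ j, ‖(if i = j then (1 : 𝕜) else 0)‖ ^ 2 = 1 := fun i => by
    rw [Finset.sum_eq_single i] <;> simp +contextual [eq_comm]
  simp [this]

lemma tr_sq_le (X : Matrix m n 𝕜) (Y : Matrix n m 𝕜) : ‖(X * Y).trace‖ ^ 2 ≤ fro X * fro Y := by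
  unfold fro
  simp only [Matrix.trace, Matrix.diag, Matrix.mul_apply]
  rw [Finset.sum_comm (f := fun i j => ‖Y i j‖ ^ 2), ← Finset.sum_product', ← Finset.sum_product',
    ← Finset.sum_product']
  refine le_trans ?_ (Finset.sum_mul_sq_le_sq_mul_sq _ _ _)
  gcongr
  refine (norm_sum_le _ _).trans (le_of_eq ?_)
  simp_rw [norm_mul]

lemma tr_le (X : Matrix n n 𝕜) : ‖X.trace‖ ≤ Fintype.card n * ‖X‖ := by
  refine (norm_sum_le _ _).trans ((Finset.sum_le_sum fun i _ => nrm_entry X i i).trans ?_)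
  simp

lemma nrm_ofReal (X : Matrix m n ℝ) : ‖X.map (Complex.ofReal)‖ ≤ ‖X‖ := by
  refine nrm_le _ _ (norm_nonneg _) fun v => ?_
  have h1 := nrm_mulVec X (fun i => (v i).re)
  have h2 := nrm_mulVec X (fun i => (v i).im)
  have e : ∀ z : ℂ, ‖z‖ ^ 2 = z.re ^ 2 + z.im ^ 2 := fun z => by
    rw [Complex.sq_norm, Complex.normSq_apply]; ring
  simp only [Real.norm_eq_abs, sq_abs] at h1 h2
  have e1 : ∀ i, ((X.map Complex.ofReal *ᵥ v) i).re = (X *ᵥ fun i => (v i).re) i := fun i => by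
    simp [Matrix.mulVec, dotProduct]
  have e2 : ∀ i, ((X.map Complex.ofReal *ᵥ v) i).im = (X *ᵥ fun i => (v i).im) i := fun i => by
    simp [Matrix.mulVec, dotProduct]
  simp_rw [e, Finset.sum_add_distrib, mul_add, e1, e2]
  exact add_le_add h1 h2

lemma nrm_transpose (X : Matrix m n ℝ) : ‖Xᵀ‖ = ‖X‖ := by
  rw [← Matrix.l2_opNorm_conjTranspose X]; rfl

lemma nrm_diag (v : n → 𝕜) (K : ℝ) (hK : 0 ≤ K) (hv : ∀ i, ‖v i‖ ≤ K) : ‖Matrix.diagonal v‖ ≤ K := by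
  refine nrm_le _ _ hK fun w => ?_
  rw [Finset.mul_sum]
  gcongr with i
  rw [Matrix.mulVec_diagonal, norm_mul, mul_pow]
  have := hv i
  gcongr

lemma nrm_mulVec_r (X : Matrix m n ℝ) (v : n → ℝ) : ∑ i, (X *ᵥ v) i ^ 2 ≤ ‖X‖ ^ 2 * ∑ i, v i ^ 2 := by
  have := nrm_mulVec X v
  simpa only [Real.norm_eq_abs, sq_abs] using this
lemma nrm_le_r (X : Matrix m n ℝ) (K : ℝ) (hK : 0 ≤ K)
    (h : ∀ v : n → ℝ, ∑ i, (X *ᵥ v) i ^ 2 ≤ K ^ 2 * ∑ i, v i ^ 2) : ‖X‖ ≤ K :=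
  nrm_le X K hK (by simpa only [Real.norm_eq_abs, sq_abs] using h)
lemma opNorm_eq {a b : ℕ} (X : Matrix (Fin a) (Fin b) ℝ) : opNorm X = ‖X‖ := rfl
end norms

/-- the functional `w ↦ w ⬝ x` -/
noncomputable def dotL {d : ℕ} (x : Fin d → ℝ) : StrongDual ℝ (Fin d → ℝ) :=
  ∑ i, x i • ContinuousLinearMap.proj (R := ℝ) i
lemma dotL_apply {d : ℕ} (x w : Fin d → ℝ) : dotL x w = w ⬝ᵥ x := by
  simp [dotL, dotProduct, mul_comm]

/-- column -/
abbrev colV {m n : ℕ} (X : Matrix (Fin m) (Fin n) ℝ) (α : Fin n) : Fin m → ℝ := fun j => X j α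

noncomputable def vT {d n : ℕ} (X : Matrix (Fin d) (Fin n) ℝ) (α : Fin n) : StrongDual ℝ (Fin d → ℝ) :=
  dotL (colV X α)
noncomputable def mT {d e n : ℕ} (X : Matrix (Fin d) (Fin n) ℝ) (k : Fin e × Fin n) :
    StrongDual ℝ (Fin e → Fin d → ℝ) :=
  (dotL (colV X k.2)).comp (ContinuousLinearMap.proj (R := ℝ) (φ := fun _ : Fin e => Fin d → ℝ) k.1)
lemma vT_apply {d n : ℕ} (X : Matrix (Fin d) (Fin n) ℝ) (α : Fin n) (w) : vT X α w = w ⬝ᵥ colV X α :=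
  dotL_apply _ _
lemma mT_apply {d e n : ℕ} (X : Matrix (Fin d) (Fin n) ℝ) (k : Fin e × Fin n) (w) :
    mT X k w = w k.1 ⬝ᵥ colV X k.2 := dotL_apply _ _

lemma sum_dot {d n : ℕ} (X : Matrix (Fin d) (Fin n) ℝ) (g : Fin n → ℝ) (w : Fin d → ℝ) :
    ∑ α, g α * (w ⬝ᵥ colV X α) = ∑ j, (X *ᵥ g) j * w j := by
  simp only [dotProduct, Finset.mul_sum, Matrix.mulVec, Finset.sum_mul]
  rw [Finset.sum_comm]
  exact Finset.sum_congr rfl fun _ _ => Finset.sum_congr rfl fun _ _ => by ring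

lemma vecPre {d n : ℕ} (X : Matrix (Fin d) (Fin n) ℝ) (β : ℝ) (hβ : ‖X‖ ≤ β) :
    PreG (gaussianVec d) (vT X) β := by
  have h0 : 0 ≤ β := (norm_nonneg _).trans hβ
  refine ⟨fun g => ?_, vec_centered d, h0⟩
  have := vec_law d (X *ᵥ g)
  refine ⟨_, ?_, by simp_rw [vT_apply, sum_dot]; exact this⟩
  · rw [Real.coe_toNNReal _ (by positivity)]
    refine (nrm_mulVec_r X g).trans ?_
    gcongr

lemma matPre {d n : ℕ} (e : ℕ) (X : Matrix (Fin d) (Fin n) ℝ) (β : ℝ) (hβ : ‖X‖ ≤ β) :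
    PreG (gaussianMat e d) (mT (e := e) X) β := by
  have h0 : 0 ≤ β := (norm_nonneg _).trans hβ
  refine ⟨fun g => ?_, mat_centered e d, h0⟩
  have := mat_law e d (fun i => X *ᵥ (fun α => g (i, α)))
  refine ⟨_, ?_, by simp_rw [mT_apply, Fintype.sum_prod_type, sum_dot _ (fun α => g (_, α))]; exact this⟩
  · rw [Real.coe_toNNReal _ (by positivity), Fintype.sum_prod_type, Finset.mul_sum]
    gcongr with i
    refine (nrm_mulVec_r X _).trans ?_
    gcongr

/-- empirical average of `ψ(w·x)ψ(w·y)` over the rows of `W` -/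
noncomputable def avgP (ψ : ℝ → ℝ) {d e : ℕ} (x y : Fin d → ℝ) (W : Fin e → Fin d → ℝ) : ℝ :=
  (e : ℝ)⁻¹ * ∑ i, ψ (W i ⬝ᵥ x) * ψ (W i ⬝ᵥ y)
/-- its expectation -/
noncomputable def meanP (ψ : ℝ → ℝ) {d : ℕ} (x y : Fin d → ℝ) : ℝ :=
  ∫ w, ψ (w ⬝ᵥ x) * ψ (w ⬝ᵥ y) ∂(gaussianVec d)

lemma cont_dot {d : ℕ} (x : Fin d → ℝ) : Continuous (fun w : Fin d → ℝ => w ⬝ᵥ x) := by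
  unfold dotProduct; fun_prop

lemma LipF.prod_int {ψ ψ' : ℝ → ℝ} {lam A : ℝ} (hψ : LipF ψ ψ' lam A) {d n : ℕ}
    (X : Matrix (Fin d) (Fin n) ℝ) (α γ : Fin n) :
    Integrable (fun w => ψ (w ⬝ᵥ colV X α) * ψ (w ⬝ᵥ colV X γ)) (gaussianVec d) := by
  have hT := vecPre X _ le_rfl
  have := (hT.mem2 hψ α).integrable_mul (hT.mem2 hψ γ)
  simp_rw [vT_apply] at this
  exact this

lemma int_row {d e : ℕ} (i : Fin e) (f : (Fin d → ℝ) → ℝ) (hf : AEStronglyMeasurable f (gaussianVec d)) :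
    ∫ W, f (W i) ∂(gaussianMat e d) = ∫ w, f w ∂(gaussianVec d) :=
  integral_comp_eval (μ := fun _ : Fin e => gaussianVec d) (i := i) (f := f) hf

lemma integrable_row {d e : ℕ} (i : Fin e) {f : (Fin d → ℝ) → ℝ} (hf : Integrable f (gaussianVec d)) :
    Integrable (fun W : Fin e → Fin d → ℝ => f (W i)) (gaussianMat e d) :=
  integrable_comp_eval (μ := fun _ : Fin e => gaussianVec d) hf

lemma avg_mean {ψ ψ' : ℝ → ℝ} {lam A : ℝ} (hψ : LipF ψ ψ' lam A) {d n e : ℕ} (he : 0 < e)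
    (X : Matrix (Fin d) (Fin n) ℝ) (α γ : Fin n) :
    ∫ W, avgP ψ (e := e) (colV X α) (colV X γ) W ∂(gaussianMat e d) = meanP ψ (colV X α) (colV X γ) := by
  unfold avgP meanP
  have hi := hψ.prod_int X α γ
  rw [integral_const_mul, integral_finsetSum _ fun i _ => integrable_row i hi]
  simp_rw [fun i => int_row (e := e) i (fun w => ψ (w ⬝ᵥ colV X α) * ψ (w ⬝ᵥ colV X γ)) hi.1]
  simp; field_simp

lemma avg_moment {ψ ψ' : ℝ → ℝ} {lam A : ℝ} (hψ : LipF ψ ψ' lam A) {d n e : ℕ} (he : 0 < e)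
    (X : Matrix (Fin d) (Fin n) ℝ) (β : ℝ) (hβ : ‖X‖ ≤ β) (α γ : Fin n) (p : ℕ) (hp : 1 ≤ p) :
    ∫⁻ W, ENNReal.ofReal ((avgP ψ (colV X α) (colV X γ) W - meanP ψ (colV X α) (colV X γ)) ^ (2 * p))
      ∂(gaussianMat e d) ≤ ENNReal.ofReal (Cq β lam A p * (4 / e) ^ p) := by
  have hT := matPre e X β hβ
  have he' : (e : ℝ) ≠ 0 := by positivity
  set M : Fin e × Fin n → Fin e × Fin n → ℝ := fun k l =>
    if k.2 = α then if l = (k.1, γ) then (e : ℝ)⁻¹ else 0 else 0 with hM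
  have hM1 : ∀ (k : Fin e × Fin n) (y : Fin e × Fin n → ℝ), ∑ l, M k l * y l = if k.2 = α then (e : ℝ)⁻¹ * y (k.1, γ) else 0 := by
    intro k y
    by_cases h : k.2 = α <;> simp [hM, h]
  have hM2 : ∀ (k : Fin e × Fin n) (y : Fin e × Fin n → ℝ), ∑ l, M l k * y l = if k.2 = γ then (e : ℝ)⁻¹ * y (k.1, α) else 0 := by
    intro k y
    have : ∀ l, M l k = if l = (k.1, α) then (if k.2 = γ then (e : ℝ)⁻¹ else 0) else 0 := by
      intro l
      simp only [hM, Prod.ext_iff]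
      by_cases h1 : l.2 = α <;> by_cases h2 : l.1 = k.1 <;> by_cases h3 : k.2 = γ <;>
        simp [h1, h2, h3, eq_comm]
      rintro h4; exact absurd h4.symm h2
    simp_rw [this]
    by_cases h : k.2 = γ <;> simp [h]
  set c : Fin e × Fin n → ℝ := fun k =>
    2 / (e : ℝ) ^ 2 * ((if k.2 = α then 1 else 0) + (if k.2 = γ then 1 else 0)) with hc
  have hcs : ∑ k, c k = 4 / e := by
    simp only [hc, ← Finset.mul_sum, Fintype.sum_prod_type, Finset.sum_add_distrib]
    simp; field_simp; norm_num
  have hq : ∀ W : Fin e → Fin d → ℝ, ∑ k, ∑ l, M k l * (ψ (mT X k W) * ψ (mT X l W)) =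
      avgP ψ (colV X α) (colV X γ) W := by
    intro W
    have : ∀ k, ∑ l, M k l * (ψ (mT X k W) * ψ (mT X l W)) = ψ (mT X k W) * ∑ l, M k l * ψ (mT X l W) := by
      intro k; rw [Finset.mul_sum]; exact Finset.sum_congr rfl fun _ _ => by ring
    simp_rw [this, fun k => hM1 k (fun l => ψ (mT X l W)), Fintype.sum_prod_type, mT_apply]
    simp [avgP, Finset.mul_sum]
    exact Finset.sum_congr rfl fun _ _ => by ring
  have := hT.quad_moment hψ M c (fun k => by simp only [hc]; positivity) (fun y => ?_) p hp
  · simp_rw [hq, avg_mean hψ he, hcs] at this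
    exact this
  · simp_rw [add_mul, Finset.sum_add_distrib, hM1, hM2, Fintype.sum_prod_type, hc, mul_add, add_mul,
      Finset.sum_add_distrib]
    simp only [mul_ite, mul_one, mul_zero, ite_mul, zero_mul, Finset.sum_ite_eq', Finset.mem_univ, if_true]
    calc _ ≤ ∑ i : Fin e, ∑ k : Fin n, ((if k = α then 2 * ((e : ℝ)⁻¹ * y (i, γ)) ^ 2 else 0) +
          (if k = γ then 2 * ((e : ℝ)⁻¹ * y (i, α)) ^ 2 else 0)) := by
          gcongr with i _ k
          split_ifs <;>
            nlinarith [sq_nonneg ((e : ℝ)⁻¹ * y (i, γ) - (e : ℝ)⁻¹ * y (i, α)),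
              sq_nonneg ((e : ℝ)⁻¹ * y (i, γ)), sq_nonneg ((e : ℝ)⁻¹ * y (i, α)),
              sq_nonneg ((e : ℝ)⁻¹ * y (i, k)), sq_nonneg ((e : ℝ)⁻¹ * y (i, γ) - (e : ℝ)⁻¹ * y (i, k)),
              sq_nonneg ((e : ℝ)⁻¹ * y (i, α) - (e : ℝ)⁻¹ * y (i, k))]
      _ = _ := by
          simp only [Finset.sum_add_distrib, Finset.sum_ite_eq', Finset.mem_univ, if_true]
          rw [add_comm]
          congr 1 <;> exact Finset.sum_congr rfl fun _ _ => by field_simp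

lemma avg_meas {ψ ψ' : ℝ → ℝ} {lam A : ℝ} (hψ : LipF ψ ψ' lam A) {d e : ℕ} (x y : Fin d → ℝ) :
    Continuous (avgP ψ (e := e) x y) := by
  have := hψ.cont
  unfold avgP dotProduct; fun_prop

/-- union bound over all pairs of columns -/
lemma avg_tail {ψ ψ' : ℝ → ℝ} {lam A : ℝ} (hψ : LipF ψ ψ' lam A) (β κ : ℝ) (hκ : 0 < κ) :
    ∃ C, ∀ (d n e : ℕ) (X : Matrix (Fin d) (Fin n) ℝ), 1 ≤ n → (n : ℝ) ≤ κ * e → ‖X‖ ≤ β →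
      gaussianMat e d {W | ∃ α γ, (n : ℝ) ^ (-(3 / 8) : ℝ) ≤
        |avgP ψ (colV X α) (colV X γ) W - meanP ψ (colV X α) (colV X γ)|} ≤
        ENNReal.ofReal (C / (n : ℝ) ^ 2) := by
  refine ⟨Cq β lam A 16 * (4 * κ) ^ 16, ?_⟩
  intro d n e X hn hne hX
  have hn0 : (0 : ℝ) < n := by exact_mod_cast hn
  have he : 0 < e := by
    rcases Nat.eq_zero_or_pos e with h | h
    · simp [h] at hne; linarith
    · exact h
  have he0 : (0 : ℝ) < e := by exact_mod_cast he
  have hC := (matPre e X β hX).Cq_nonneg lam A 16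
  set t : ℝ := (n : ℝ) ^ (-(3 / 8) : ℝ) with ht
  have ht0 : 0 < t := by positivity
  have ht32 : t ^ (2 * 16) = ((n : ℝ) ^ 12)⁻¹ := by
    rw [ht, ← Real.rpow_natCast, ← Real.rpow_mul hn0.le, ← Real.rpow_natCast, ← Real.rpow_neg hn0.le]
    norm_num
  have hsub : {W | ∃ α γ, t ≤ |avgP ψ (colV X α) (colV X γ) W - meanP ψ (colV X α) (colV X γ)|} =
      ⋃ α, ⋃ γ, {W : Fin e → Fin d → ℝ | t ≤ |avgP ψ (colV X α) (colV X γ) W - meanP ψ (colV X α) (colV X γ)|} := by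
    ext W; simp
  rw [hsub]
  refine (measure_iUnion_fintype_le _ _).trans ?_
  refine (Finset.sum_le_sum fun α _ => measure_iUnion_fintype_le _ _).trans ?_
  refine (Finset.sum_le_sum fun α _ => Finset.sum_le_sum fun γ _ => tail_of_moment _ _
    (by have := avg_meas (e := e) hψ (colV X α) (colV X γ); fun_prop) 16 _ t ht0
      (avg_moment hψ he X β hX α γ 16 (by norm_num))).trans ?_
  simp only [Finset.sum_const, Finset.card_univ, Fintype.card_fin, nsmul_eq_mul]
  rw [← ENNReal.ofReal_natCast, ← ENNReal.ofReal_mul (by positivity), ← ENNReal.ofReal_mul (by positivity)]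
  apply ENNReal.ofReal_le_ofReal
  rw [ht32]
  have h4 : 4 / (e : ℝ) ≤ 4 * κ / n := by
    rw [div_le_div_iff₀ he0 hn0]; nlinarith
  calc _ ≤ (n : ℝ) * (n * (Cq β lam A 16 * (4 * κ / n) ^ 16 / ((n : ℝ) ^ 12)⁻¹)) := by gcongr
    _ = _ := by field_simp

/-- kernel facts in terms of `IsOrthonormal` -/
lemma Act.mean_bounds {σ σ' σ'' : ℝ → ℝ} {lam b a : ℝ} (h : Act σ σ' σ'' lam b a) :
    ∃ C, 1 ≤ C ∧ ∀ (d : ℕ) (x y : Fin d → ℝ) (ε : ℝ), ε ≤ 1 / 2 → |x ⬝ᵥ x - 1| ≤ ε →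
      |meanP σ x x - 1| ≤ C * |x ⬝ᵥ x - 1| ∧ |meanP σ' x x - a| ≤ C * |x ⬝ᵥ x - 1| ∧
      (|y ⬝ᵥ y - 1| ≤ ε → |x ⬝ᵥ y| ≤ ε →
        |meanP σ x y - b ^ 2 * (x ⬝ᵥ y)| ≤ C * ε ^ 2 ∧ |meanP σ' x y - b ^ 2| ≤ C * ε) := by
  obtain ⟨C1, h1, k1⟩ := h.k1
  obtain ⟨C2, h2, k2⟩ := h.k2
  obtain ⟨C3, h3, k3⟩ := h.k3
  have hcσ := h.cont
  have hc' := h.cont'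
  refine ⟨1 + C1 + C2 + C3 + 2 * lam ^ 2, by nlinarith [sq_nonneg lam], ?_⟩
  intro d x y ε hε hx
  have hε0 : 0 ≤ ε := (abs_nonneg _).trans hx
  have hx' := abs_le.mp hx
  have hsq : |Real.sqrt (x ⬝ᵥ x) - 1| ≤ |x ⬝ᵥ x - 1| := by
    have hq := dot_self_nonneg x
    have h2 : x ⬝ᵥ x - 1 = (Real.sqrt (x ⬝ᵥ x) - 1) * (Real.sqrt (x ⬝ᵥ x) + 1) := by
      nlinarith [Real.sq_sqrt hq]
    rw [h2, abs_mul]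
    apply le_mul_of_one_le_right (abs_nonneg _)
    rw [abs_of_nonneg (by positivity)]
    linarith [Real.sqrt_nonneg (x ⬝ᵥ x)]
  have hr := abs_le.mp (hsq.trans hx)
  have e1 : meanP σ x x = ∫ ξ, σ (Real.sqrt (x ⬝ᵥ x) * ξ) ^ 2 ∂stdGaussian := by
    unfold meanP
    simp_rw [← sq]
    exact dot_int x (F := fun t => σ t ^ 2) (by fun_prop)
  have e2 : meanP σ' x x = ∫ ξ, σ' (Real.sqrt (x ⬝ᵥ x) * ξ) ^ 2 ∂stdGaussian := by
    unfold meanP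
    simp_rw [← sq]
    exact dot_int x (F := fun t => σ' t ^ 2) (by fun_prop)
  refine ⟨?_, ?_, fun hy hxy => ⟨?_, ?_⟩⟩
  · rw [e1]
    refine (k2 _ (Real.sqrt_nonneg _) (by linarith)).trans ?_
    calc _ ≤ C2 * |x ⬝ᵥ x - 1| := by gcongr
      _ ≤ _ := by gcongr; nlinarith [sq_nonneg lam]
  · rw [e2]
    refine (h.k3d _).trans ?_
    calc _ ≤ 2 * lam ^ 2 * |x ⬝ᵥ x - 1| := by gcongr
      _ ≤ _ := by gcongr; nlinarith [sq_nonneg lam]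
  · refine (k1 d x y ε hε hx hy hxy).trans ?_
    gcongr; nlinarith [sq_nonneg lam]
  · refine (k3 d x y ε hε hx hy hxy).trans ?_
    gcongr; nlinarith [sq_nonneg lam]

lemma int_of_lint {α : Type*} [MeasurableSpace α] {μ : Measure α} {f : α → ℝ}
    (hf : AEStronglyMeasurable f μ) (h0 : ∀ x, 0 ≤ f x) (K : ℝ) (hK : 0 ≤ K)
    (h : ∫⁻ x, ENNReal.ofReal (f x) ∂μ ≤ ENNReal.ofReal K) : Integrable f μ ∧ ∫ x, f x ∂μ ≤ K := by
  constructor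
  · refine ⟨hf, ?_⟩
    rw [hasFiniteIntegral_iff_ofReal (ae_of_all _ h0)]
    exact h.trans_lt ENNReal.ofReal_lt_top
  · rw [integral_eq_lintegral_of_nonneg_ae (ae_of_all _ h0) hf]
    exact ENNReal.toReal_le_of_le_ofReal hK h

lemma F_tail {ψ ψ' : ℝ → ℝ} {lam A : ℝ} (hψ : LipF ψ ψ' lam A) (β κ P : ℝ) (hκ : 0 < κ) :
    ∃ C, ∀ (d n e : ℕ) (X : Matrix (Fin d) (Fin n) ℝ), 1 ≤ n → (n : ℝ) ≤ κ * e → ‖X‖ ≤ β →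
      (∀ α, |meanP ψ (colV X α) (colV X α)| ≤ P) →
      gaussianMat e d {W | C ≤ ∑ α, (avgP ψ (colV X α) (colV X α) W - meanP ψ (colV X α) (colV X α)) ^ 2} ≤
        ENNReal.ofReal (C / (n : ℝ) ^ 2) := by
  set C1 := Cq β lam A 1 * 4 * κ with hC1
  set K : ℝ := (16 * β ^ 2 * lam ^ 2 * κ) ^ 2 * (2 * (Cq β lam A 3 * (4 * κ) ^ 3 +
    P ^ 2 * (Cq β lam A 2 * (4 * κ) ^ 2))) with hK
  refine ⟨max (C1 + 1) (Cmom 2 * K), ?_⟩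
  intro d n e X hn hne hX hP
  have hn0 : (0 : ℝ) < n := by exact_mod_cast hn
  have hn1 : (1 : ℝ) ≤ n := by exact_mod_cast hn
  have he : 0 < e := by
    rcases Nat.eq_zero_or_pos e with h | h
    · simp [h] at hne; linarith
    · exact h
  have he0 : (0 : ℝ) < e := by exact_mod_cast he
  have hT := matPre e X β hX
  have hq := fun p => hT.Cq_nonneg lam A p
  have hψc := hψ.cont
  have hψm := hψ.m
  set Φ : Fin n → ℝ := fun α => meanP ψ (colV X α) (colV X α) with hΦ
  set g : Fin n → (Fin e × Fin n → ℝ) → ℝ := fun α x => (e : ℝ)⁻¹ * (∑ i, ψ (x (i, α)) ^ 2) - Φ α with hg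
  set φ : (Fin e × Fin n → ℝ) → ℝ := fun x => ∑ α, g α x ^ 2 with hφ
  set φ' : (Fin e × Fin n → ℝ) → Fin e × Fin n → ℝ := fun x k =>
    2 * g k.2 x * ((e : ℝ)⁻¹ * (2 * ψ (x k) * ψ' (x k))) with hφ'
  have hgc : ∀ α, Continuous (g α) := by intro α; simp only [hg]; fun_prop
  have hφc : Continuous φ := by simp only [hφ]; fun_prop
  have hchain : ∀ (c : ℝ → Fin e × Fin n → ℝ) (c' : Fin e × Fin n → ℝ) (θ : ℝ),
      (∀ k, HasDerivAt (fun θ => c θ k) (c' k) θ) →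
      HasDerivAt (fun θ => φ (c θ)) (∑ k, φ' (c θ) k * c' k) θ := by
    intro c c' θ hc
    have h1 : ∀ k, HasDerivAt (fun θ => ψ (c θ k)) (ψ' (c θ k) * c' k) θ := fun k =>
      (hψ.d _).comp θ (hc k)
    have h2 : ∀ α, HasDerivAt (fun θ => g α (c θ))
        ((e : ℝ)⁻¹ * ∑ i, 2 * ψ (c θ (i, α)) * (ψ' (c θ (i, α)) * c' (i, α))) θ := by
      intro α
      simp only [hg]
      refine HasDerivAt.sub_const _ (HasDerivAt.const_mul _ (HasDerivAt.fun_sum fun i _ => ?_))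
      refine ((h1 (i, α)).fun_pow 2).congr_deriv ?_
      norm_num
    have h3 : HasDerivAt (fun θ => φ (c θ)) (∑ α, 2 * g α (c θ) *
        ((e : ℝ)⁻¹ * ∑ i, 2 * ψ (c θ (i, α)) * (ψ' (c θ (i, α)) * c' (i, α)))) θ := by
      simp only [hφ]
      refine HasDerivAt.fun_sum fun α _ => ?_
      refine ((h2 α).fun_pow 2).congr_deriv ?_
      norm_num
    refine h3.congr_deriv ?_
    simp only [hφ', Fintype.sum_prod_type]
    rw [Finset.sum_comm]
    refine Finset.sum_congr rfl fun α _ => ?_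
    simp only [Finset.mul_sum]
    exact Finset.sum_congr rfl fun i _ => by ring
  have hgrad := PreG.hasGrad (φ := φ) (φ' := φ') (mT (e := e) X) hφc.measurable
    (fun k => by
      have := (hgc k.2).measurable
      simp only [hφ']
      fun_prop) hchain
    ⟨fun x => ∑ k : Fin e × Fin n, 2 * |g k.2 x| * ((e : ℝ)⁻¹ * (2 * |ψ (x k)| * lam)),
      continuous_finsetSum _ fun k _ => by have := hgc k.2; fun_prop, fun x k => by
      have h0 : |φ' x k| ≤ 2 * |g k.2 x| * ((e : ℝ)⁻¹ * (2 * |ψ (x k)| * lam)) := by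
        simp only [hφ', abs_mul, abs_inv, Nat.abs_cast, abs_two]
        gcongr
        exact hψ.b _
      refine h0.trans (Finset.single_le_sum (f := fun k : Fin e × Fin n => 2 * |g k.2 x| * ((e : ℝ)⁻¹ * (2 * |ψ (x k)| * lam)))
        (fun k _ => ?_) (Finset.mem_univ k))
      have := hψ.lam0
      positivity⟩
  have hgavg : ∀ α (W : Fin e → Fin d → ℝ), g α (fun k => mT X k W) =
      avgP ψ (colV X α) (colV X α) W - meanP ψ (colV X α) (colV X α) := by
    intro α W
    simp only [hg, mT_apply, avgP, hΦ, sq]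
  have hmom : ∀ α p, 1 ≤ p → Integrable (fun W => g α (fun k => mT X k W) ^ (2 * p)) (gaussianMat e d) ∧
      ∫ W, g α (fun k => mT X k W) ^ (2 * p) ∂(gaussianMat e d) ≤ Cq β lam A p * (4 * κ / n) ^ p := by
    intro α p hp
    refine int_of_lint ?_ (fun W => by rw [pow_mul]; positivity) _
      (mul_nonneg (hq p) (by positivity)) ?_
    · have := hgc α
      have : Continuous fun W : Fin e → Fin d → ℝ => g α (fun k => mT X k W) ^ (2 * p) := by fun_prop
      exact this.aestronglyMeasurable
    · simp_rw [hgavg]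
      refine (avg_moment hψ he X β hX α α p hp).trans (ENNReal.ofReal_le_ofReal ?_)
      have := hq p
      have h4 : 4 / (e : ℝ) ≤ 4 * κ / n := by rw [div_le_div_iff₀ he0 hn0]; nlinarith
      gcongr
  set U : (Fin e → Fin d → ℝ) → ℝ := fun W => (β ^ 2 * (16 * lam ^ 2 / e)) ^ 2 * (n * ∑ α,
    2 * (g α (fun k => mT X k W) ^ (2 * 3) + P ^ 2 * g α (fun k => mT X k W) ^ (2 * 2))) with hU
  have hVi : ∀ α, Integrable (fun W => 2 * (g α (fun k => mT X k W) ^ (2 * 3) +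
      P ^ 2 * g α (fun k => mT X k W) ^ (2 * 2))) (gaussianMat e d) := fun α =>
    ((hmom α 3 (by norm_num)).1.add ((hmom α 2 (by norm_num)).1.const_mul _)).const_mul _
  have hUi : Integrable U (gaussianMat e d) := by
    refine Integrable.const_mul (Integrable.const_mul (integrable_finsetSum _ fun α _ => hVi α) _) _
  have hUint : ∫ W, U W ∂(gaussianMat e d) ≤ K / n ^ 2 := by
    simp only [hU]
    rw [integral_const_mul, integral_const_mul, integral_finsetSum _ fun α _ => hVi α]
    have h1 : ∀ α, ∫ W, 2 * (g α (fun k => mT X k W) ^ (2 * 3) + P ^ 2 * g α (fun k => mT X k W) ^ (2 * 2)) ∂(gaussianMat e d)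
        ≤ 2 * (Cq β lam A 3 * (4 * κ / n) ^ 3 + P ^ 2 * (Cq β lam A 2 * (4 * κ / n) ^ 2)) := by
      intro α
      rw [integral_const_mul, integral_add (hmom α 3 (by norm_num)).1 ((hmom α 2 (by norm_num)).1.const_mul _),
        integral_const_mul]
      have := (hmom α 3 (by norm_num)).2
      have := (hmom α 2 (by norm_num)).2
      gcongr
    have h16 : 16 * lam ^ 2 / e ≤ 16 * lam ^ 2 * κ / n := by
      rw [div_le_div_iff₀ he0 hn0]; nlinarith [sq_nonneg lam]
    have h2 := hq 2
    have h3 := hq 3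
    have h5 : Cq β lam A 3 * (4 * κ / n) ^ 3 ≤ Cq β lam A 3 * (4 * κ) ^ 3 / n ^ 2 := by
      rw [div_pow, mul_div_assoc]
      gcongr
      · norm_num
    calc _ ≤ (β ^ 2 * (16 * lam ^ 2 * κ / n)) ^ 2 * (n * ∑ α : Fin n,
          2 * (Cq β lam A 3 * (4 * κ) ^ 3 / n ^ 2 + P ^ 2 * (Cq β lam A 2 * (4 * κ / n) ^ 2))) := by
          refine mul_le_mul (by gcongr) (mul_le_mul_of_nonneg_left (Finset.sum_le_sum fun α _ => ?_) hn0.le) ?_ (by positivity)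
          · exact (h1 α).trans (by gcongr)
          · exact mul_nonneg hn0.le (Finset.sum_nonneg fun α _ => integral_nonneg fun W => by simp only [pow_mul, Pi.zero_apply]; positivity)
      _ = _ := by
          simp only [Finset.sum_const, Finset.card_univ, Fintype.card_fin, nsmul_eq_mul, hK]
          field_simp
  choose v hv1 hv2 using fun x : Fin e → Fin d → ℝ => hT.law (φ' (fun k => mT X k x))
  have hvU : ∀ x, (v x : ℝ) ^ 2 ≤ U x := by
    intro x
    have h1 : ∑ k, φ' (fun k => mT X k x) k ^ 2 ≤ 16 * lam ^ 2 / e *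
        ∑ α, g α (fun k => mT X k x) ^ 2 * |g α (fun k => mT X k x) + Φ α| := by
      simp only [hφ', Fintype.sum_prod_type]
      rw [Finset.sum_comm, Finset.mul_sum]
      gcongr with α _
      set G := g α (fun k => mT X k x) with hG
      have hs : G + Φ α = (e : ℝ)⁻¹ * (∑ i, ψ (mT X (i, α) x) ^ 2) := by simp [hG, hg]
      have hs0 : 0 ≤ G + Φ α := by rw [hs]; positivity
      rw [abs_of_nonneg hs0, hs]
      calc _ ≤ ∑ i, 16 * G ^ 2 * (e : ℝ)⁻¹ ^ 2 * lam ^ 2 * ψ (mT X (i, α) x) ^ 2 := by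
            gcongr with i
            have := hψ.sq (mT X (i, α) x)
            calc _ = 16 * G ^ 2 * (e : ℝ)⁻¹ ^ 2 * (ψ' (mT X (i, α) x) ^ 2) * ψ (mT X (i, α) x) ^ 2 := by ring
              _ ≤ _ := by gcongr
        _ = _ := by rw [← Finset.mul_sum]; ring
    have h2 : (v x : ℝ) ≤ β ^ 2 * (16 * lam ^ 2 / e) *
        ∑ α, g α (fun k => mT X k x) ^ 2 * |g α (fun k => mT X k x) + Φ α| := by
      refine (hv1 x).trans ?_
      rw [mul_assoc]
      gcongr
    calc (v x : ℝ) ^ 2 ≤ (β ^ 2 * (16 * lam ^ 2 / e) *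
        ∑ α, g α (fun k => mT X k x) ^ 2 * |g α (fun k => mT X k x) + Φ α|) ^ 2 := by
          gcongr
      _ = (β ^ 2 * (16 * lam ^ 2 / e)) ^ 2 *
        (∑ α, g α (fun k => mT X k x) ^ 2 * |g α (fun k => mT X k x) + Φ α|) ^ 2 := by ring
      _ ≤ (β ^ 2 * (16 * lam ^ 2 / e)) ^ 2 * (n *
        ∑ α, (g α (fun k => mT X k x) ^ 2 * |g α (fun k => mT X k x) + Φ α|) ^ 2) := by
          gcongr
          have := sq_sum_le_card_mul_sum_sq (s := (Finset.univ : Finset (Fin n)))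
            (f := fun α => g α (fun k => mT X k x) ^ 2 * |g α (fun k => mT X k x) + Φ α|)
          simpa using this
      _ ≤ _ := by
          simp only [hU]
          gcongr with α
          set G := g α (fun k => mT X k x)
          rw [mul_pow, sq_abs]
          have hp2 : Φ α ^ 2 ≤ P ^ 2 := sq_le_sq' (by linarith [(abs_le.mp (hP α)).1]) (abs_le.mp (hP α)).2
          have h3 : (G + Φ α) ^ 2 ≤ 2 * (G ^ 2 + P ^ 2) := by nlinarith [sq_nonneg (G - Φ α)]
          calc _ ≤ (G ^ 2) ^ 2 * (2 * (G ^ 2 + P ^ 2)) := by gcongr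
            _ = _ := by ring
  have hvi : Integrable (fun W => Real.sqrt (U W) ^ 2) (gaussianMat e d) := by
    refine hUi.congr (ae_of_all _ fun W => ?_)
    exact (Real.sq_sqrt ((sq_nonneg _).trans (hvU W))).symm
  have hF2 : ∀ α, Integrable (fun W => g α (fun k => mT X k W) ^ 2) (gaussianMat e d) ∧
    ∫ W, g α (fun k => mT X k W) ^ 2 ∂(gaussianMat e d) ≤ Cq β lam A 1 * (4 * κ / n) := by
    intro α; simpa using hmom α 1 le_rfl
  have hFi : Integrable (fun W => φ (fun k => mT X k W)) (gaussianMat e d) :=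
    integrable_finsetSum _ fun α _ => (hF2 α).1
  have hEF : ∫ W, φ (fun k => mT X k W) ∂(gaussianMat e d) ≤ C1 := by
    simp only [hφ]
    rw [integral_finsetSum _ fun α _ => (hF2 α).1]
    refine (Finset.sum_le_sum fun α _ => (hF2 α).2).trans (le_of_eq ?_)
    simp only [Finset.sum_const, Finset.card_univ, Fintype.card_fin, nsmul_eq_mul, hC1]
    field_simp
  have := conc_tail (gaussianMat e d) (mat_centered e d) hgrad hFi v hv2 2 (K / n ^ 2) (fun W => Real.sqrt (U W))
    hvi (fun x => Real.le_sqrt_of_sq_le (hvU x))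
    (by
      refine le_trans (le_of_eq ?_) hUint
      exact integral_congr_ae (ae_of_all _ fun W => Real.sq_sqrt ((sq_nonneg _).trans (hvU W)))) 1 one_pos
  refine (measure_mono fun W hW => ?_).trans (this.trans (ENNReal.ofReal_le_ofReal ?_))
  · simp only [Set.mem_ofPred_eq] at hW ⊢
    have h2 : φ (fun k => mT X k W) = ∑ α, (avgP ψ (colV X α) (colV X α) W - meanP ψ (colV X α) (colV X α)) ^ 2 := by
      simp only [hφ, hgavg]
    refine le_trans ?_ (le_abs_self _)
    rw [h2]
    have := (le_max_left (C1 + 1) (Cmom 2 * K)).trans hW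
    linarith
  · have : Cmom 2 * K ≤ max (C1 + 1) (Cmom 2 * K) := le_max_right _ _
    rw [one_pow, div_one, ← mul_div_assoc]
    gcongr

lemma exists_net (n : ℕ) : ∃ N : Finset (EuclideanSpace ℝ (Fin n)), N.card ≤ 5 ^ n ∧ (∀ c ∈ N, ‖c‖ ≤ 1) ∧
    ∀ x : EuclideanSpace ℝ (Fin n), ‖x‖ ≤ 1 → ∃ c ∈ N, ‖x - c‖ ≤ 1 / 2 := by
  classical
  set Q : Finset (EuclideanSpace ℝ (Fin n)) → Prop := fun s => (∀ c ∈ s, ‖c‖ ≤ 2) ∧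
    ∀ c ∈ s, ∀ d ∈ s, c ≠ d → 1 ≤ ‖c - d‖ with hQ
  have hb : ∀ s, Q s → s.card ≤ 5 ^ n := fun s hs => by
    simpa using Besicovitch.card_le_of_separated s hs.1 hs.2
  have h1 := Nat.findGreatest_spec (P := fun k => ∃ s, Q s ∧ s.card = k) (m := 0) (n := 5 ^ n) (Nat.zero_le _)
    ⟨∅, by simp [hQ], rfl⟩
  obtain ⟨s, hs, hsc⟩ := h1
  refine ⟨s.image (fun c => (1 / 2 : ℝ) • c), Finset.card_image_le.trans (hb s hs), ?_, ?_⟩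
  · intro c hc
    obtain ⟨c, hc2, rfl⟩ := Finset.mem_image.mp hc
    rw [norm_smul]; have := hs.1 c hc2; norm_num; linarith
  · intro x hx
    by_contra hcon
    push Not at hcon
    have hfar : ∀ c ∈ s, 1 ≤ ‖(2 : ℝ) • x - c‖ := by
      intro c hc
      have h2 := hcon _ (Finset.mem_image_of_mem _ hc)
      have h3 : (2 : ℝ) • x - c = (2 : ℝ) • (x - (1 / 2 : ℝ) • c) := by
        rw [smul_sub, smul_smul]; norm_num
      rw [h3, norm_smul]; norm_num; linarith
    have hx2 : (2 : ℝ) • x ∉ s := fun h => by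
      have := hfar _ h
      simp at this; linarith
    have hQ2 : Q (insert ((2 : ℝ) • x) s) := by
      refine ⟨fun c hc => ?_, fun c hc d hd hne => ?_⟩
      · rcases Finset.mem_insert.mp hc with rfl | hc
        · rw [norm_smul]; norm_num; linarith
        · exact hs.1 c hc
      · rcases Finset.mem_insert.mp hc with rfl | hc <;> rcases Finset.mem_insert.mp hd with rfl | hd
        · exact absurd rfl hne
        · exact hfar _ hd
        · rw [norm_sub_rev]; exact hfar _ hc
        · exact hs.2 c hc d hd hne
    have h4 := Nat.le_findGreatest (P := fun k => ∃ s, Q s ∧ s.card = k) (hb _ hQ2) ⟨_, hQ2, rfl⟩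
    rw [Finset.card_insert_of_notMem hx2, hsc] at h4
    omega

lemma op_of_net {e n : ℕ} (N1 : Finset (EuclideanSpace ℝ (Fin e))) (N2 : Finset (EuclideanSpace ℝ (Fin n)))
    (h1 : ∀ x : EuclideanSpace ℝ (Fin e), ‖x‖ ≤ 1 → ∃ c ∈ N1, ‖x - c‖ ≤ 1 / 2)
    (h2 : ∀ x : EuclideanSpace ℝ (Fin n), ‖x‖ ≤ 1 → ∃ c ∈ N2, ‖x - c‖ ≤ 1 / 2)
    (Y : Matrix (Fin e) (Fin n) ℝ) (t : ℝ) (ht : 0 ≤ t)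
    (h : ∀ u ∈ N1, ∀ v ∈ N2, ∑ i, ∑ α, u i * v α * Y i α ≤ t) : ‖Y‖ ≤ 4 * t := by
  set T := LinearMap.toContinuousLinearMap (Matrix.toEuclideanLin Y) with hT
  have hin : ∀ u : EuclideanSpace ℝ (Fin e), ∀ v, inner ℝ u (T v) = ∑ i, ∑ α, u i * v α * Y i α := by
    intro u v
    simp only [PiLp.inner_apply, hT]
    refine Finset.sum_congr rfl fun i _ => ?_
    simp [Matrix.toEuclideanLin, Matrix.mulVec, dotProduct, Finset.sum_mul]
    exact Finset.sum_congr rfl fun α _ => by ring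
  have hnet : ∀ v ∈ N2, ‖T v‖ ≤ 2 * t := by
    intro v hv
    rcases eq_or_ne (T v) 0 with h0 | h0
    · rw [h0]; simp; linarith
    have hp : 0 < ‖T v‖ := norm_pos_iff.mpr h0
    obtain ⟨c, hc, hxc⟩ := h1 ((‖T v‖)⁻¹ • T v) (by rw [norm_smul]; simp [h0])
    have e1 : inner ℝ ((‖T v‖)⁻¹ • T v) (T v) = ‖T v‖ := by
      rw [real_inner_smul_left, real_inner_self_eq_norm_sq]; field_simp
    have e2 : inner ℝ ((‖T v‖)⁻¹ • T v) (T v) = inner ℝ c (T v) + inner ℝ ((‖T v‖)⁻¹ • T v - c) (T v) := by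
      rw [← inner_add_left]; simp
    have e3 := real_inner_le_norm ((‖T v‖)⁻¹ • T v - c) (T v)
    have e4 := h c hc v hv
    rw [← hin] at e4
    nlinarith
  have hT2 : ‖T‖ ≤ 2 * t + ‖T‖ / 2 := by
    refine ContinuousLinearMap.opNorm_le_of_unit_norm (by positivity) fun x hx => ?_
    obtain ⟨c, hc, hxc⟩ := h2 x hx.le
    have e1 : T x = T c + T (x - c) := by rw [← map_add]; simp
    have e2 := T.le_opNorm (x - c)
    have e3 := hnet c hc
    calc ‖T x‖ ≤ ‖T c‖ + ‖T (x - c)‖ := by rw [e1]; exact norm_add_le _ _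
      _ ≤ _ := by nlinarith [norm_nonneg T]
  have : ‖Y‖ = ‖T‖ := rfl
  rw [this]; linarith

lemma op_tail {ψ ψ' : ℝ → ℝ} {lam A : ℝ} (hψ : LipF ψ ψ' lam A) (β κ m0 : ℝ) (hκ : 0 < κ) (hm0 : 0 ≤ m0) :
    ∃ C, 0 < C ∧ ∀ (d n e : ℕ) (X : Matrix (Fin d) (Fin n) ℝ), 1 ≤ n → (n : ℝ) ≤ κ * e → ‖X‖ ≤ β →
      (∑ α, (∫ w, ψ (w ⬝ᵥ colV X α) ∂(gaussianVec d)) ^ 2 ≤ m0 ^ 2) →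
      gaussianMat e d {W | C < ‖(Real.sqrt e)⁻¹ • (Matrix.of W * X).map ψ‖} ≤
        ENNReal.ofReal (2 / (n : ℝ) ^ 2) := by
  set K : ℝ := β ^ 2 * lam ^ 2 + 1 with hK
  have hK0 : 0 < K := by positivity
  set τ : ℝ := Real.sqrt (Real.pi ^ 2 * K * (2 * (1 + κ) + κ) / 2) with hτ
  have hτ2 : τ ^ 2 = Real.pi ^ 2 * K * (2 * (1 + κ) + κ) / 2 := Real.sq_sqrt (by positivity)
  have hτ0 : 0 < τ := Real.sqrt_pos.mpr (by positivity)
  refine ⟨4 * (τ + m0), by positivity, ?_⟩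
  intro d n e X hn hne hX hmean
  have hn0 : (0 : ℝ) < n := by exact_mod_cast hn
  have he : 0 < e := by
    rcases Nat.eq_zero_or_pos e with h | h
    · simp [h] at hne; linarith
    · exact h
  have he0 : (0 : ℝ) < e := by exact_mod_cast he
  have hse : 0 < Real.sqrt e := Real.sqrt_pos.mpr he0
  have hT := matPre e X β hX
  obtain ⟨N1, hN1c, hN1, hN1x⟩ := exists_net e
  obtain ⟨N2, hN2c, hN2, hN2x⟩ := exists_net n
  set uv : EuclideanSpace ℝ (Fin e) → EuclideanSpace ℝ (Fin n) → Fin e × Fin n → ℝ := fun u v k => u k.1 * v k.2 with huv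
  have hintm : ∀ k : Fin e × Fin n, ∫ W, ψ (mT X k W) ∂(gaussianMat e d) = ∫ w, ψ (w ⬝ᵥ colV X k.2) ∂(gaussianVec d) := by
    intro k
    simp_rw [mT_apply]
    have hc := hψ.cont
    have hd := cont_dot (colV X k.2)
    exact int_row k.1 (fun w => ψ (w ⬝ᵥ colV X k.2)) (by fun_prop)
  have hnsq : ∀ {m : ℕ} (u : EuclideanSpace ℝ (Fin m)), ‖u‖ ≤ 1 → ∑ i, u i ^ 2 ≤ 1 := by
    intro m u hu
    have := EuclideanSpace.norm_sq_eq u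
    simp only [Real.norm_eq_abs, sq_abs] at this
    rw [← this]; exact pow_le_one₀ (norm_nonneg _) hu
  have hmb : ∀ u ∈ N1, ∀ v ∈ N2, ∑ k, uv u v k * ∫ W, ψ (mT X k W) ∂(gaussianMat e d) ≤ Real.sqrt e * m0 := by
    intro u hu v hv
    simp_rw [hintm, huv, Fintype.sum_prod_type]
    have e1 : ∀ m : Fin n → ℝ, ∑ i, ∑ α, u i * v α * m α = (∑ i, u i) * ∑ α, v α * m α := by
      intro m
      rw [Finset.sum_mul_sum]
      exact Finset.sum_congr rfl fun _ _ => Finset.sum_congr rfl fun _ _ => by ring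
    rw [e1]
    refine abs_le_of_sq_le_sq' ?_ (by positivity) |>.2
    rw [mul_pow, mul_pow, Real.sq_sqrt he0.le]
    have e2 : (∑ i, u i) ^ 2 ≤ e := by
      have := sq_sum_le_card_mul_sum_sq (s := (Finset.univ : Finset (Fin e))) (f := fun i => u i)
      have h3 := hnsq u (hN1 u hu)
      simp only [Finset.card_univ, Fintype.card_fin] at this
      nlinarith
    have e3 := Finset.sum_mul_sq_le_sq_mul_sq Finset.univ (fun α => v α) (fun α => ∫ w, ψ (w ⬝ᵥ colV X α) ∂(gaussianVec d))
    have e4 := hnsq v (hN2 v hv)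
    have e5 : (∑ α, v α * ∫ w, ψ (w ⬝ᵥ colV X α) ∂(gaussianVec d)) ^ 2 ≤ m0 ^ 2 := by
      refine e3.trans (le_trans ?_ hmean)
      exact mul_le_of_le_one_left (Finset.sum_nonneg fun _ _ => sq_nonneg _) e4
    gcongr
  have hsub : {W : Fin e → Fin d → ℝ | 4 * (τ + m0) < ‖(Real.sqrt e)⁻¹ • (Matrix.of W * X).map ψ‖} ⊆
      ⋃ u ∈ N1, ⋃ v ∈ N2, {W | Real.sqrt e * τ ≤ (∑ k, uv u v k * ψ (mT X k W)) -
        ∑ k, uv u v k * ∫ W, ψ (mT X k W) ∂(gaussianMat e d)} := by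
    intro W hW
    by_contra hcon
    simp only [Set.mem_iUnion, Set.mem_ofPred_eq, not_exists, not_le] at hcon hW
    have := op_of_net N1 N2 hN1x hN2x ((Matrix.of W * X).map ψ) (Real.sqrt e * (τ + m0)) (by positivity) ?_
    · rw [norm_smul, norm_inv, Real.norm_of_nonneg hse.le, lt_inv_mul_iff₀ hse] at hW
      linarith
    · intro u hu v hv
      have h1 := hcon u hu v hv
      have h2 := hmb u hu v hv
      have h3 : ∑ k, uv u v k * ψ (mT X k W) = ∑ i, ∑ α, u i * v α * ((Matrix.of W * X).map ψ) i α := by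
        rw [Fintype.sum_prod_type]
        simp only [huv, mT_apply]
        rfl
      rw [← h3]; linarith
  refine (measure_mono hsub).trans ?_
  have htail : ∀ u ∈ N1, ∀ v ∈ N2, gaussianMat e d {W | Real.sqrt e * τ ≤ (∑ k, uv u v k * ψ (mT X k W)) -
        ∑ k, uv u v k * ∫ W, ψ (mT X k W) ∂(gaussianMat e d)} ≤ ENNReal.ofReal (Real.exp (-(2 * (1 + κ) + κ) * e)) := by
    intro u hu v hv
    refine (hT.lin_tail hψ (uv u v) ?_ K hK0 (by simp [hK]) _ (by positivity)).trans (le_of_eq ?_)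
    · simp only [huv, mul_pow, Fintype.sum_prod_type, ← Finset.mul_sum, ← Finset.sum_mul]
      exact mul_le_one₀ (hnsq u (hN1 u hu)) (Finset.sum_nonneg fun _ _ => sq_nonneg _) (hnsq v (hN2 v hv))
    · congr 2
      rw [mul_pow, hτ2, Real.sq_sqrt he0.le]
      field_simp
  refine (measure_biUnion_finset_le _ _).trans ?_
  refine (Finset.sum_le_sum fun u hu => (measure_biUnion_finset_le _ _).trans
    (Finset.sum_le_sum fun v hv => htail u hu v hv)).trans ?_
  simp only [Finset.sum_const, nsmul_eq_mul]
  rw [← ENNReal.ofReal_natCast, ← ENNReal.ofReal_natCast, ← ENNReal.ofReal_mul (by positivity), ← ENNReal.ofReal_mul (by positivity)]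
  apply ENNReal.ofReal_le_ofReal
  have h5 : ∀ m : ℕ, (5 : ℝ) ^ m ≤ Real.exp (2 * m) := by
    intro m
    rw [mul_comm, Real.exp_nat_mul]
    gcongr
    have h2 := Real.exp_one_gt_d9
    have : Real.exp 2 = Real.exp 1 * Real.exp 1 := by rw [← Real.exp_add]; norm_num
    nlinarith
  have hc1 : (N1.card : ℝ) ≤ Real.exp (2 * e) := le_trans (by exact_mod_cast hN1c) (h5 e)
  have hc2 : (N2.card : ℝ) ≤ Real.exp (2 * n) := le_trans (by exact_mod_cast hN2c) (h5 n)
  calc _ ≤ Real.exp (2 * e) * (Real.exp (2 * n) * Real.exp (-(2 * (1 + κ) + κ) * e)) := by gcongr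
    _ = Real.exp (2 * e + (2 * n + -(2 * (1 + κ) + κ) * e)) := by rw [← Real.exp_add, ← Real.exp_add]
    _ ≤ Real.exp (-n) := by apply Real.exp_le_exp.mpr; nlinarith
    _ ≤ _ := by
      rw [Real.exp_neg, inv_eq_one_div, div_le_div_iff₀ (Real.exp_pos _) (by positivity)]
      have := Real.quadratic_le_exp_of_nonneg hn0.le
      nlinarith

/-- one layer -/
noncomputable def nextX (σ : ℝ → ℝ) {e d n : ℕ} (W : Fin e → Fin d → ℝ) (X : Matrix (Fin d) (Fin n) ℝ) :
    Matrix (Fin e) (Fin n) ℝ := (Real.sqrt e)⁻¹ • ((Matrix.of W * X).map σ)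

lemma nextX_apply (σ : ℝ → ℝ) {e d n : ℕ} (W : Fin e → Fin d → ℝ) (X : Matrix (Fin d) (Fin n) ℝ) (i α) :
    nextX σ W X i α = (Real.sqrt e)⁻¹ * σ (W i ⬝ᵥ colV X α) := rfl

lemma nextX_dot (σ : ℝ → ℝ) {e d n : ℕ} (W : Fin e → Fin d → ℝ) (X : Matrix (Fin d) (Fin n) ℝ) (α γ) :
    ∑ i, nextX σ W X i α * nextX σ W X i γ = avgP σ (colV X α) (colV X γ) W := by
  simp only [nextX_apply, avgP, Finset.mul_sum]
  refine Finset.sum_congr rfl fun i _ => ?_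
  have : (Real.sqrt e)⁻¹ * (Real.sqrt e)⁻¹ = (e : ℝ)⁻¹ := by
    rw [← mul_inv, Real.mul_self_sqrt (by positivity)]
  rw [← this]; ring

lemma dot_colV {d n : ℕ} (X : Matrix (Fin d) (Fin n) ℝ) (α γ : Fin n) :
    colV X α ⬝ᵥ colV X γ = ∑ i, X i α * X i γ := rfl

set_option maxHeartbeats 800000 in
lemma one_step {σ σ' σ'' : ℝ → ℝ} {lam b a : ℝ} (h : Act σ σ' σ'' lam b a) (B κ : ℝ) (hκ : 0 < κ) :
    ∃ C, 1 ≤ C ∧ ∃ B', 0 < B' ∧ ∀ (d n e : ℕ) (X : Matrix (Fin d) (Fin n) ℝ) (ε : ℝ), 1 ≤ n → (n : ℝ) ≤ κ * e →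
      ε ≤ 1 / 2 → IsOrthonormal ε B X →
      gaussianMat e d {W | ¬ IsOrthonormal (C * (ε + (n : ℝ) ^ (-(3 / 8) : ℝ))) B' (nextX σ W X)} ≤
        ENNReal.ofReal (C / (n : ℝ) ^ 2) := by
  obtain ⟨C0, hC0, hmean⟩ := h.mean_bounds
  obtain ⟨C1, h1⟩ := avg_tail h.lipF B κ hκ
  obtain ⟨C2, h2⟩ := F_tail h.lipF B κ (1 + C0) hκ
  obtain ⟨C3, hC3, h3⟩ := op_tail h.lipF B κ (lam * |B|) hκ (mul_nonneg h.lam0 (abs_nonneg _))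
  set C := 1 + |C1| + |C2| + 2 + C0 + b ^ 2 with hC
  refine ⟨C, by rw [hC]; nlinarith [abs_nonneg C1, abs_nonneg C2, sq_nonneg b],
    1 + C3 + 2 * |C2| + 2 * C0 ^ 2 * B ^ 2, by positivity, ?_⟩
  intro d n e X ε hn hne hε ⟨hX1, hX2, hX3, hX4⟩
  have hn0 : (0 : ℝ) < n := by exact_mod_cast hn
  have hB : ‖X‖ ≤ B := hX3
  have hx1 : ∀ α, |colV X α ⬝ᵥ colV X α - 1| ≤ ε := by
    intro α; simpa only [dot_colV, sq] using hX1 α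
  have hε0 : 0 ≤ ε := by
    have : Nonempty (Fin n) := ⟨⟨0, hn⟩⟩
    exact (abs_nonneg _).trans (hx1 (Classical.arbitrary _))
  have hd : ∀ α, |meanP σ (colV X α) (colV X α) - 1| ≤ C0 * |colV X α ⬝ᵥ colV X α - 1| := fun α =>
    (hmean d _ 0 ε hε (hx1 α)).1
  have hdε : ∀ α, |meanP σ (colV X α) (colV X α) - 1| ≤ C0 * ε := fun α =>
    (hd α).trans (by have := hx1 α; gcongr)
  have hP : ∀ α, |meanP σ (colV X α) (colV X α)| ≤ 1 + C0 := by
    intro α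
    have := abs_le.mp (hdε α)
    rw [abs_le]; constructor <;> nlinarith
  have hX4' : ∑ α, (colV X α ⬝ᵥ colV X α - 1) ^ 2 ≤ B ^ 2 := by
    simpa only [dot_colV, sq] using hX4
  have hmn : ∑ α, (∫ w, σ (w ⬝ᵥ colV X α) ∂(gaussianVec d)) ^ 2 ≤ (lam * |B|) ^ 2 := by
    rw [mul_pow, sq_abs]
    refine le_trans ?_ (mul_le_mul_of_nonneg_left hX4' (sq_nonneg _))
    rw [Finset.mul_sum]
    refine Finset.sum_le_sum fun α _ => ?_
    set x := colV X α
    have hcσ := h.cont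
    rw [dot_int x (F := σ) (by fun_prop)]
    have hk := h.k4 (Real.sqrt (x ⬝ᵥ x))
    have hsq : |Real.sqrt (x ⬝ᵥ x) - 1| ≤ |x ⬝ᵥ x - 1| := by
      have hq := dot_self_nonneg x
      have h2 : x ⬝ᵥ x - 1 = (Real.sqrt (x ⬝ᵥ x) - 1) * (Real.sqrt (x ⬝ᵥ x) + 1) := by
        nlinarith [Real.sq_sqrt hq]
      rw [h2, abs_mul]
      apply le_mul_of_one_le_right (abs_nonneg _)
      rw [abs_of_nonneg (by positivity)]
      linarith [Real.sqrt_nonneg (x ⬝ᵥ x)]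
    rw [← mul_pow]
    refine sq_le_sq.mpr (hk.trans ?_)
    rw [abs_mul, abs_of_nonneg h.lam0]
    exact mul_le_mul_of_nonneg_left hsq h.lam0
  set δ : ℝ := (n : ℝ) ^ (-(3 / 8) : ℝ) with hδ
  have hδ0 : 0 < δ := by positivity
  refine (measure_mono (t := {W | ∃ α γ, δ ≤ |avgP σ (colV X α) (colV X γ) W - meanP σ (colV X α) (colV X γ)|} ∪
    {W | C2 ≤ ∑ α, (avgP σ (colV X α) (colV X α) W - meanP σ (colV X α) (colV X α)) ^ 2} ∪
    {W | C3 < ‖(Real.sqrt e)⁻¹ • (Matrix.of W * X).map σ‖}) ?_).trans ?_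
  · intro W hW
    by_contra hcon
    simp only [Set.mem_union, Set.mem_ofPred_eq, not_or, not_exists, not_le, not_lt] at hcon hW
    obtain ⟨⟨g1, g2⟩, g3⟩ := hcon
    apply hW
    have hCn := abs_nonneg C1
    have hCn2 := abs_nonneg C2
    refine ⟨fun α => ?_, fun α γ hne => ?_, ?_, ?_⟩
    · have e1 := nextX_dot σ W X α α
      simp_rw [← sq] at e1
      rw [e1]
      have t1 := abs_le.mp (g1 α α).le
      have t2 := abs_le.mp (hdε α)
      have : δ + C0 * ε ≤ C * (ε + δ) := by
        rw [hC]; nlinarith [mul_nonneg hCn hε0, mul_nonneg hCn2 hε0, mul_nonneg hCn hδ0.le, mul_nonneg hCn2 hδ0.le,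
          mul_nonneg (sq_nonneg b) hε0, mul_nonneg (sq_nonneg b) hδ0.le, mul_nonneg (zero_le_one.trans hC0) hδ0.le]
      rw [abs_le]; constructor <;> linarith
    · rw [nextX_dot]
      have t1 := abs_le.mp (g1 α γ).le
      have hxy : |colV X α ⬝ᵥ colV X γ| ≤ ε := hX2 α γ hne
      have t2 := abs_le.mp ((hmean d _ _ ε hε (hx1 α)).2.2 (hx1 γ) hxy).1
      have t3 : |b ^ 2 * (colV X α ⬝ᵥ colV X γ)| ≤ b ^ 2 * ε := by
        rw [abs_mul, abs_of_nonneg (sq_nonneg b)]; gcongr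
      have t4 := abs_le.mp t3
      have t5 : C0 * ε ^ 2 ≤ C0 * ε := by
        have : ε ^ 2 ≤ ε := by nlinarith
        gcongr
      have : δ + C0 * ε + b ^ 2 * ε ≤ C * (ε + δ) := by
        rw [hC]; nlinarith [mul_nonneg hCn hε0, mul_nonneg hCn2 hε0, mul_nonneg hCn hδ0.le, mul_nonneg hCn2 hδ0.le,
          mul_nonneg (sq_nonneg b) hε0, mul_nonneg (sq_nonneg b) hδ0.le, mul_nonneg (zero_le_one.trans hC0) hδ0.le]
      rw [abs_le]; constructor <;> linarith
    · rw [opNorm_eq]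
      refine g3.trans ?_
      nlinarith [mul_nonneg (sq_nonneg C0) (sq_nonneg B)]
    · have e1 := fun α => nextX_dot σ W X α α
      simp_rw [← sq] at e1
      simp_rw [e1]
      calc _ ≤ ∑ α, (2 * (avgP σ (colV X α) (colV X α) W - meanP σ (colV X α) (colV X α)) ^ 2 +
            2 * (C0 ^ 2 * (colV X α ⬝ᵥ colV X α - 1) ^ 2)) := by
            gcongr with α
            have : (meanP σ (colV X α) (colV X α) - 1) ^ 2 ≤ C0 ^ 2 * (colV X α ⬝ᵥ colV X α - 1) ^ 2 := by
              rw [← mul_pow]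
              refine sq_le_sq.mpr ((hd α).trans ?_)
              rw [abs_mul]; gcongr; exact le_abs_self _
            nlinarith [sq_nonneg ((avgP σ (colV X α) (colV X α) W - meanP σ (colV X α) (colV X α)) - (meanP σ (colV X α) (colV X α) - 1))]
        _ = 2 * ∑ α, (avgP σ (colV X α) (colV X α) W - meanP σ (colV X α) (colV X α)) ^ 2 +
            2 * (C0 ^ 2 * ∑ α, (colV X α ⬝ᵥ colV X α - 1) ^ 2) := by
            simp only [Finset.sum_add_distrib, ← Finset.mul_sum]
        _ ≤ 2 * |C2| + 2 * (C0 ^ 2 * B ^ 2) := by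
            have := g2.le.trans (le_abs_self C2)
            gcongr
        _ ≤ 1 + C3 + 2 * |C2| + 2 * C0 ^ 2 * B ^ 2 := by linarith
        _ ≤ _ := by
            refine le_self_pow₀ ?_ (by norm_num)
            nlinarith [mul_nonneg (sq_nonneg C0) (sq_nonneg B)]
  · refine (measure_union_le _ _).trans ((add_le_add ((measure_union_le _ _).trans (add_le_add
      (h1 d n e X hn hne hB) (h2 d n e X hn hne hB hP))) (h3 d n e X hn hne hB hmn)).trans ?_)
    calc _ ≤ ENNReal.ofReal (|C1| / n ^ 2) + ENNReal.ofReal (|C2| / n ^ 2) + ENNReal.ofReal (2 / n ^ 2) := by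
          have hh : ∀ c : ℝ, ENNReal.ofReal (c / (n : ℝ) ^ 2) ≤ ENNReal.ofReal (|c| / (n : ℝ) ^ 2) := fun c =>
            ENNReal.ofReal_le_ofReal (div_le_div_of_nonneg_right (le_abs_self c) (by positivity))
          exact add_le_add (add_le_add (hh C1) (hh C2)) le_rfl
      _ = ENNReal.ofReal ((|C1| + |C2| + 2) / n ^ 2) := by
          rw [← ENNReal.ofReal_add (by positivity) (by positivity), ← ENNReal.ofReal_add (by positivity) (by positivity)]
          congr 1; ring
      _ ≤ _ := by
          apply ENNReal.ofReal_le_ofReal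
          gcongr
          rw [hC]; nlinarith [sq_nonneg b]

noncomputable def Phi (b : ℝ) {d n : ℕ} (X : Matrix (Fin d) (Fin n) ℝ) : Matrix (Fin n) (Fin n) ℝ :=
  (1 - b ^ 2) • 1 + b ^ 2 • (Xᵀ * X)

lemma Phi_apply (b : ℝ) {d n : ℕ} (X : Matrix (Fin d) (Fin n) ℝ) (k l : Fin n) :
    Phi b X k l = (if k = l then 1 - b ^ 2 else 0) + b ^ 2 * (colV X k ⬝ᵥ colV X l) := by
  simp [Phi, Matrix.add_apply, Matrix.one_apply, Matrix.mul_apply, dotProduct]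

lemma Phi_symm (b : ℝ) {d n : ℕ} (X : Matrix (Fin d) (Fin n) ℝ) : (Phi b X)ᵀ = Phi b X := by
  simp [Phi]

lemma sum_le_fro {n : ℕ} (M N : Matrix (Fin n) (Fin n) ℝ) :
    |∑ k, ∑ l, M k l * N k l| ≤ Real.sqrt (fro M) * Real.sqrt (fro N) := by
  have h := tr_sq_le M Nᵀ
  have e : (M * Nᵀ).trace = ∑ k, ∑ l, M k l * N k l := by
    simp [Matrix.trace, Matrix.mul_apply]
  have e2 : fro Nᵀ = fro N := by
    rw [← fro_conjT N, Matrix.conjTranspose_eq_transpose_of_trivial]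
  rw [e, e2, Real.norm_eq_abs] at h
  rw [← Real.sqrt_mul (fro_nonneg _)]
  exact Real.le_sqrt_of_sq_le h

lemma quad_row_r {σ σ' σ'' : ℝ → ℝ} {lam b a : ℝ} (h : Act σ σ' σ'' lam b a) (B : ℝ) (p : ℕ) (hp : 1 ≤ p) :
    ∃ C, 1 ≤ C ∧ ∀ (d n : ℕ) (X : Matrix (Fin d) (Fin n) ℝ) (ε δ K : ℝ) (M : Matrix (Fin n) (Fin n) ℝ), 1 ≤ n →
      ε ≤ 1 / 2 → IsOrthonormal ε B X → 0 < K → 0 < δ → ‖M‖ ≤ K → C * K * (ε + Real.sqrt n * ε ^ 2) ≤ δ →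
      gaussianVec d {w | n * δ ≤ |(∑ k, ∑ l, M k l * (σ (w ⬝ᵥ colV X k) * σ (w ⬝ᵥ colV X l))) -
        ∑ k, ∑ l, M k l * Phi b X k l|} ≤ ENNReal.ofReal (C * K ^ (2 * p) / (δ ^ (2 * p) * n ^ p)) := by
  obtain ⟨C0, hC0, hmean⟩ := h.mean_bounds
  set C1 := C0 + b ^ 2 with hC1
  set Q := |Cq B lam (|σ 0| + lam) p| * 16 ^ p with hQ
  have hQ0 : 0 ≤ Q := by positivity
  have hC10 : 0 < C1 := by positivity
  refine ⟨2 * C1 + Q, by nlinarith [sq_nonneg b], ?_⟩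
  intro d n X ε δ K M hn hε ⟨hX1, hX2, hX3, _⟩ hK hδ hM hs
  have hn0 : (0 : ℝ) < n := by exact_mod_cast hn
  have hB : ‖X‖ ≤ B := hX3
  have hx1 : ∀ α, |colV X α ⬝ᵥ colV X α - 1| ≤ ε := by
    intro α; simpa only [dot_colV, sq] using hX1 α
  have hε0 : 0 ≤ ε := by
    have : Nonempty (Fin n) := ⟨⟨0, hn⟩⟩
    exact (abs_nonneg _).trans (hx1 (Classical.arbitrary _))
  have hT := vecPre X B hB
  set N : Matrix (Fin n) (Fin n) ℝ := fun k l => meanP σ (colV X k) (colV X l) - Phi b X k l with hN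
  have hNfro : Real.sqrt (fro N) ≤ Real.sqrt n * (C1 * (ε + Real.sqrt n * ε ^ 2)) := by
    rw [← Real.sqrt_sq (by positivity : 0 ≤ C1 * (ε + Real.sqrt n * ε ^ 2)), ← Real.sqrt_mul hn0.le]
    apply Real.sqrt_le_sqrt
    calc fro N ≤ ∑ k : Fin n, ∑ l : Fin n, ((if k = l then C1 ^ 2 * ε ^ 2 else 0) + C1 ^ 2 * ε ^ 4) := by
          unfold fro
          gcongr with k _ l _
          rw [Real.norm_eq_abs]
          by_cases hkl : k = l
          · subst hkl
            have t1 := abs_le.mp ((hmean d (colV X k) 0 ε hε (hx1 k)).1)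
            have t2 := abs_le.mp (hx1 k)
            have : |N k k| ≤ C1 * ε := by
              simp only [hN, Phi_apply, if_true]
              have t3 : |meanP σ (colV X k) (colV X k) - 1| ≤ C0 * ε :=
                ((hmean d (colV X k) 0 ε hε (hx1 k)).1).trans (by have := hx1 k; gcongr)
              have t4 := abs_le.mp t3
              rw [abs_le]; constructor <;> nlinarith [mul_nonneg (sq_nonneg b) (sub_nonneg.2 t2.1), mul_nonneg (sq_nonneg b) (sub_nonneg.2 t2.2)]
            simp only [if_true]
            calc |N k k| ^ 2 ≤ (C1 * ε) ^ 2 := by gcongr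
              _ ≤ _ := by rw [mul_pow]; exact le_add_of_nonneg_right (by positivity)
          · have hxy : |colV X k ⬝ᵥ colV X l| ≤ ε := hX2 k l hkl
            have t1 := ((hmean d _ _ ε hε (hx1 k)).2.2 (hx1 l) hxy).1
            have : |N k l| ≤ C1 * ε ^ 2 := by
              simp only [hN, Phi_apply, hkl, if_false, zero_add]
              refine t1.trans ?_
              gcongr
              rw [hC1]; nlinarith [sq_nonneg b]
            simp only [hkl, if_false, zero_add]
            calc |N k l| ^ 2 ≤ (C1 * ε ^ 2) ^ 2 := by gcongr
              _ = _ := by ring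
      _ = n * (C1 ^ 2 * ε ^ 2) + n * (n * (C1 ^ 2 * ε ^ 4)) := by
          simp only [Finset.sum_add_distrib, Finset.sum_ite_eq, Finset.mem_univ, if_true, Finset.sum_const, Finset.card_univ, Fintype.card_fin, nsmul_eq_mul]
      _ ≤ _ := by
          have : n * (C1 * (ε + Real.sqrt n * ε ^ 2)) ^ 2 = n * (C1 ^ 2 * ε ^ 2) + n * (Real.sqrt n ^ 2 * (C1 ^ 2 * ε ^ 4)) + 2 * (n * C1 ^ 2 * ε ^ 3 * Real.sqrt n) := by ring
          rw [this, Real.sq_sqrt hn0.le]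
          have : 0 ≤ 2 * (n * C1 ^ 2 * ε ^ 3 * Real.sqrt n) := by positivity
          linarith
  have hMfro : Real.sqrt (fro M) ≤ Real.sqrt n * K := by
    rw [← Real.sqrt_sq hK.le, ← Real.sqrt_mul hn0.le]
    apply Real.sqrt_le_sqrt
    refine (fro_le M).trans ?_
    rw [Fintype.card_fin]
    gcongr
  have hdev : |∑ k, ∑ l, M k l * N k l| ≤ n * δ / 2 := by
    refine (sum_le_fro M N).trans ((mul_le_mul hMfro hNfro (Real.sqrt_nonneg _) (by positivity)).trans ?_)
    have e1 : Real.sqrt n * K * (Real.sqrt n * (C1 * (ε + Real.sqrt n * ε ^ 2))) = (Real.sqrt n * Real.sqrt n) * (C1 * K * (ε + Real.sqrt n * ε ^ 2)) := by ring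
    rw [e1, Real.mul_self_sqrt hn0.le]
    have : 0 ≤ Q * (K * (ε + Real.sqrt n * ε ^ 2)) := by positivity
    have : C1 * K * (ε + Real.sqrt n * ε ^ 2) ≤ δ / 2 := by nlinarith
    nlinarith
  have hmn : ∫ w, ∑ k, ∑ l, M k l * (σ (vT X k w) * σ (vT X l w)) ∂(gaussianVec d) =
      ∑ k, ∑ l, M k l * meanP σ (colV X k) (colV X l) := by
    simp_rw [vT_apply]
    refine (integral_finsetSum _ fun k _ => integrable_finsetSum _ fun l _ => (h.lipF.prod_int X k l).const_mul (M k l)).trans ?_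
    refine Finset.sum_congr rfl fun k _ => ?_
    refine (integral_finsetSum _ fun l _ => (h.lipF.prod_int X k l).const_mul (M k l)).trans ?_
    refine Finset.sum_congr rfl fun l _ => ?_
    rw [integral_const_mul]; rfl
  have hq := hT.quad_tail h.lipF M (fun _ => 4 * K ^ 2) (fun _ => by positivity) (by
    intro y
    rw [← Finset.mul_sum]
    have e : ∀ k, ∑ l, (M k l + M l k) * y l = ((M + Mᵀ) *ᵥ y) k := fun k => rfl
    simp_rw [e]
    refine (nrm_mulVec_r _ y).trans ?_
    have : ‖M + Mᵀ‖ ≤ 2 * K := (norm_add_le _ _).trans (by rw [nrm_transpose]; linarith)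
    calc _ ≤ (2 * K) ^ 2 * ∑ i, y i ^ 2 := by gcongr
      _ = _ := by ring) p hp (n * δ / 2) (by positivity)
  rw [hmn] at hq
  simp_rw [vT_apply] at hq
  refine (measure_mono ?_).trans (hq.trans (ENNReal.ofReal_le_ofReal ?_))
  · intro w hw
    simp only [Set.mem_ofPred_eq] at hw ⊢
    have e : ∑ k, ∑ l, M k l * N k l = (∑ k, ∑ l, M k l * meanP σ (colV X k) (colV X l)) - ∑ k, ∑ l, M k l * Phi b X k l := by
      simp only [hN, mul_sub, Finset.sum_sub_distrib]
    rw [e] at hdev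
    have := abs_sub_le (∑ k, ∑ l, M k l * (σ (w ⬝ᵥ colV X k) * σ (w ⬝ᵥ colV X l))) (∑ k, ∑ l, M k l * meanP σ (colV X k) (colV X l)) (∑ k, ∑ l, M k l * Phi b X k l)
    linarith
  · simp only [Finset.sum_const, Finset.card_univ, Fintype.card_fin, nsmul_eq_mul]
    have e : Cq B lam (|σ 0| + lam) p * (n * (4 * K ^ 2)) ^ p / (n * δ / 2) ^ (2 * p) =
        (Cq B lam (|σ 0| + lam) p * 16 ^ p) * K ^ (2 * p) / (δ ^ (2 * p) * n ^ p) := by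
      have : (16 : ℝ) ^ p = 4 ^ p * 2 ^ (2 * p) := by rw [pow_mul, ← mul_pow]; norm_num
      have e3 : (n : ℝ) ^ (2 * p) = n ^ p * n ^ p := by rw [two_mul, pow_add]
      rw [this, div_pow, mul_pow, mul_pow, mul_pow, e3, ← pow_mul]
      field_simp
    rw [e]
    gcongr
    have : Cq B lam (|σ 0| + lam) p * 16 ^ p ≤ Q := by rw [hQ]; gcongr; exact le_abs_self _
    linarith

/-- the quadratic form `yᵀ M y` for a complex matrix and a real vector -/
noncomputable def qf {n : ℕ} (M : Matrix (Fin n) (Fin n) ℂ) (y : Fin n → ℝ) : ℂ :=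
  ∑ k, ∑ l, M k l * ((y k * y l : ℝ) : ℂ)

lemma nrm_re {m n : ℕ} (M : Matrix (Fin m) (Fin n) ℂ) (c : ℂ) (hc : ‖c‖ ≤ 1) : ‖M.map (fun z => (c * z).re)‖ ≤ ‖M‖ := by
  refine nrm_le_r _ _ (norm_nonneg _) fun v => ?_
  have h := nrm_mulVec M (fun i => (v i : ℂ))
  simp only [Complex.norm_real, Real.norm_eq_abs, sq_abs] at h
  refine le_trans ?_ h
  refine Finset.sum_le_sum fun i _ => ?_
  have e : (M.map (fun z => (c * z).re) *ᵥ v) i = (c * (M *ᵥ fun i => (v i : ℂ)) i).re := by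
    simp [Matrix.mulVec, dotProduct, Finset.mul_sum, ← mul_assoc]
  rw [e, ← sq_abs]
  gcongr
  refine (Complex.abs_re_le_norm _).trans ?_
  rw [norm_mul]
  exact mul_le_of_le_one_left (norm_nonneg _) hc

lemma quad_row {σ σ' σ'' : ℝ → ℝ} {lam b a : ℝ} (h : Act σ σ' σ'' lam b a) (B : ℝ) (p : ℕ) (hp : 1 ≤ p) :
    ∃ C, 1 ≤ C ∧ ∀ (d n : ℕ) (X : Matrix (Fin d) (Fin n) ℝ) (ε δ K : ℝ) (M : Matrix (Fin n) (Fin n) ℂ), 1 ≤ n →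
      ε ≤ 1 / 2 → IsOrthonormal ε B X → 0 < K → 0 < δ → ‖M‖ ≤ K → C * K * (ε + Real.sqrt n * ε ^ 2) ≤ δ →
      gaussianVec d {w | n * δ ≤ ‖qf M (fun k => σ (w ⬝ᵥ colV X k)) - (M * (Phi b X).map Complex.ofReal).trace‖} ≤
        ENNReal.ofReal (C * K ^ (2 * p) / (δ ^ (2 * p) * n ^ p)) := by
  obtain ⟨C, hC, hq⟩ := quad_row_r h B p hp
  refine ⟨2 * C * 2 ^ (2 * p), by
    have : (1 : ℝ) ≤ 2 ^ (2 * p) := one_le_pow₀ (by norm_num)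
    nlinarith, ?_⟩
  intro d n X ε δ K M hn hε hX hK hδ hM hs
  have hn0 : (0 : ℝ) < n := by exact_mod_cast hn
  have hs2 : C * K * (ε + Real.sqrt n * ε ^ 2) ≤ δ / 2 := by
    by_cases h0 : 0 ≤ C * K * (ε + Real.sqrt n * ε ^ 2)
    · have : (4 : ℝ) ≤ 2 ^ (2 * p) := by
        rw [pow_mul]; exact le_self_pow₀ (by norm_num) (by omega) |>.trans' (by norm_num)
      nlinarith
    · linarith
  have hg : ∀ c : ℂ, ‖c‖ ≤ 1 → _ := fun c hc =>
    hq d n X ε (δ / 2) K (M.map (fun z => (c * z).re)) hn hε hX hK (by positivity) ((nrm_re M c hc).trans hM) hs2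
  have he : ∀ (c : ℂ) (w : Fin d → ℝ), (∑ k, ∑ l, M.map (fun z => (c * z).re) k l * (σ (w ⬝ᵥ colV X k) * σ (w ⬝ᵥ colV X l))) -
      ∑ k, ∑ l, M.map (fun z => (c * z).re) k l * Phi b X k l =
      (c * (qf M (fun k => σ (w ⬝ᵥ colV X k)) - (M * (Phi b X).map Complex.ofReal).trace)).re := by
    intro c w
    have e1 : (M * (Phi b X).map Complex.ofReal).trace = ∑ k, ∑ l, M k l * ((Phi b X k l : ℝ) : ℂ) := by
      simp only [Matrix.trace, Matrix.diag_apply, Matrix.mul_apply, Matrix.map_apply]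
      refine Finset.sum_congr rfl fun k _ => Finset.sum_congr rfl fun l _ => ?_
      rw [show Phi b X l k = Phi b X k l from congrFun (congrFun (Phi_symm b X) k) l]
    rw [e1]
    simp only [qf, mul_sub, Finset.mul_sum, Complex.sub_re, Complex.re_sum, Matrix.map_apply, ← mul_assoc, Complex.re_mul_ofReal]
  have h1 := hg 1 (by simp)
  have h2 := hg Complex.I (by simp)
  simp_rw [he] at h1 h2
  refine (measure_mono (t := _ ∪ _) ?_).trans ((measure_union_le _ _).trans ((add_le_add h1 h2).trans ?_))
  · intro w hw
    simp only [Set.mem_union, Set.mem_ofPred_eq] at hw ⊢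
    by_contra hc
    push Not at hc
    set q := qf M (fun k => σ (w ⬝ᵥ colV X k)) - (M * (Phi b X).map Complex.ofReal).trace
    have := Complex.norm_le_abs_re_add_abs_im q
    simp only [one_mul, Complex.I_mul_re, abs_neg] at hc
    linarith
  · rw [← ENNReal.ofReal_add (by positivity) (by positivity)]
    apply ENNReal.ofReal_le_ofReal
    rw [div_pow]
    apply le_of_eq
    field_simp
    ring

/-- The imaginary part of the quadratic form is at most `-η‖v‖²`. -/
def NegI {n : ℕ} (η : ℝ) (A : Matrix (Fin n) (Fin n) ℂ) : Prop :=
  ∀ v : Fin n → ℂ, (star v ⬝ᵥ A *ᵥ v).im ≤ -η * ∑ i, ‖v i‖ ^ 2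

section
variable {n m : ℕ} {η : ℝ} {A : Matrix (Fin n) (Fin n) ℂ}

lemma star_dot_self (v : Fin n → ℂ) : star v ⬝ᵥ v = ((∑ i, ‖v i‖ ^ 2 : ℝ) : ℂ) := by
  simp only [dotProduct, Pi.star_apply, Complex.ofReal_sum]
  refine Finset.sum_congr rfl fun i _ => ?_
  rw [Complex.star_def, mul_comm, Complex.mul_conj, Complex.normSq_eq_norm_sq]

lemma dot_le (u v : Fin n → ℂ) : ‖star u ⬝ᵥ v‖ ^ 2 ≤ (∑ i, ‖u i‖ ^ 2) * ∑ i, ‖v i‖ ^ 2 := by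
  refine le_trans ?_ (Finset.sum_mul_sq_le_sq_mul_sq Finset.univ (fun i => ‖u i‖) (fun i => ‖v i‖))
  gcongr
  refine (norm_sum_le _ _).trans (le_of_eq ?_)
  simp

lemma quad_BB (B : Matrix (Fin m) (Fin n) ℂ) (u : Fin n → ℂ) :
    star u ⬝ᵥ (Bᴴ * B) *ᵥ u = ((∑ i, ‖(B *ᵥ u) i‖ ^ 2 : ℝ) : ℂ) := by
  rw [← star_dot_self, ← Matrix.mulVec_mulVec, Matrix.dotProduct_mulVec, Matrix.star_mulVec]

lemma NegI.add (hA : NegI η A) (c : ℂ) (hc : c.im ≤ 0) (B : Matrix (Fin m) (Fin n) ℂ) :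
    NegI η (A + c • (Bᴴ * B)) := by
  intro v
  have := hA v
  rw [Matrix.add_mulVec, dotProduct_add, Matrix.smul_mulVec, dotProduct_smul, quad_BB, Complex.add_im,
    smul_eq_mul, Complex.im_mul_ofReal]
  have h2 : 0 ≤ ∑ i, ‖(B *ᵥ v) i‖ ^ 2 := by positivity
  nlinarith

lemma NegI.isUnit (hη : 0 < η) (hA : NegI η A) : IsUnit A := by
  rw [← Matrix.mulVec_injective_iff_isUnit]
  rw [← Matrix.coe_mulVecLin, injective_iff_map_eq_zero]
  intro v hv
  rw [Matrix.mulVecLin_apply] at hv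
  have := hA v
  rw [hv] at this
  simp only [dotProduct_zero, Complex.zero_im] at this
  have h0 : ∑ i, ‖v i‖ ^ 2 ≤ 0 := by nlinarith
  have h1 := (Finset.sum_eq_zero_iff_of_nonneg (fun i _ => sq_nonneg ‖v i‖)).mp (le_antisymm h0 (by positivity))
  funext i
  simpa using h1 i (Finset.mem_univ i)

lemma NegI.mul_inv (hη : 0 < η) (hA : NegI η A) : A * A⁻¹ = 1 :=
  Matrix.mul_nonsing_inv _ ((Matrix.isUnit_iff_isUnit_det _).mp (hA.isUnit hη))
lemma NegI.inv_mul (hη : 0 < η) (hA : NegI η A) : A⁻¹ * A = 1 :=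
  Matrix.nonsing_inv_mul _ ((Matrix.isUnit_iff_isUnit_det _).mp (hA.isUnit hη))

lemma NegI.norm_inv (hη : 0 < η) (hA : NegI η A) : ‖A⁻¹‖ ≤ η⁻¹ := by
  refine nrm_le _ _ (by positivity) fun v => ?_
  set u := A⁻¹ *ᵥ v with hu
  have e : A *ᵥ u = v := by rw [hu, Matrix.mulVec_mulVec, hA.mul_inv hη, Matrix.one_mulVec]
  have h := hA u
  rw [e] at h
  have h2 := dot_le u v
  have h3 : |(star u ⬝ᵥ v).im| ≤ ‖star u ⬝ᵥ v‖ := Complex.abs_im_le_norm _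
  have h4 := abs_le.mp h3
  have ha : 0 ≤ ∑ i, ‖u i‖ ^ 2 := Finset.sum_nonneg fun _ _ => sq_nonneg _
  have hc : 0 ≤ ∑ i, ‖v i‖ ^ 2 := Finset.sum_nonneg fun _ _ => sq_nonneg _
  generalize ∑ i, ‖u i‖ ^ 2 = a at *
  generalize ∑ i, ‖v i‖ ^ 2 = c at *
  have h5 : η * a ≤ ‖star u ⬝ᵥ v‖ := by linarith
  have h6 : (η * a) ^ 2 ≤ a * c := (pow_le_pow_left₀ (by positivity) h5 2).trans h2
  rcases ha.eq_or_lt with h0 | h0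
  · rw [← h0]; positivity
  · have : η ^ 2 * a ≤ c := by
      by_contra hcon
      push Not at hcon
      nlinarith
    rw [inv_pow, inv_mul_eq_div, le_div_iff₀ (by positivity)]
    linarith

lemma NegI.im_quad (hη : 0 < η) (B : Matrix (Fin m) (Fin n) ℂ) (s : ℂ) 
    (hA : NegI η A) (hM : NegI η (A + s⁻¹ • (Bᴴ * B))) (v : Fin n → ℂ) :
    η * ∑ i, ‖((A + s⁻¹ • (Bᴴ * B))⁻¹ *ᵥ v) i‖ ^ 2 + s.im / ‖s‖ ^ 2 * ∑ i, ‖(B *ᵥ ((A + s⁻¹ • (Bᴴ * B))⁻¹ *ᵥ v)) i‖ ^ 2 ≤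
      (star v ⬝ᵥ (A + s⁻¹ • (Bᴴ * B))⁻¹ *ᵥ v).im := by
  set M := A + s⁻¹ • (Bᴴ * B) with hMd
  set u := M⁻¹ *ᵥ v with hu
  have e : M *ᵥ u = v := by rw [hu, Matrix.mulVec_mulVec, hM.mul_inv hη, Matrix.one_mulVec]
  have e2 : (star v ⬝ᵥ u).im = -(star u ⬝ᵥ M *ᵥ u).im := by
    rw [e, ← Complex.conj_im, ← Complex.star_def, star_dotProduct, dotProduct_comm]
  rw [e2, hMd, Matrix.add_mulVec, dotProduct_add, Matrix.smul_mulVec, dotProduct_smul, quad_BB, Complex.add_im,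
    smul_eq_mul, Complex.im_mul_ofReal, Complex.inv_im, Complex.normSq_eq_norm_sq]
  have := hA u
  have e3 : -s.im / ‖s‖ ^ 2 = -(s.im / ‖s‖ ^ 2) := by ring
  rw [e3]
  linarith

lemma trace_BMB (M : Matrix (Fin n) (Fin n) ℂ) (B : Matrix (Fin m) (Fin n) ℂ) :
    (M * (Bᴴ * B)).trace = ∑ j, star (fun i => Bᴴ i j) ⬝ᵥ M *ᵥ (fun i => Bᴴ i j) := by
  rw [← Matrix.mul_assoc, Matrix.trace_mul_comm, Matrix.trace]
  refine Finset.sum_congr rfl fun j _ => ?_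
  simp only [Matrix.diag_apply, Matrix.mul_apply, dotProduct, Matrix.mulVec, Pi.star_apply, Matrix.conjTranspose_apply,
    star_star]

lemma fro_cols {l : ℕ} (X : Matrix (Fin l) (Fin n) ℂ) (B : Matrix (Fin n) (Fin m) ℂ) :
    ∑ j, ∑ i, ‖(X *ᵥ (fun k => B k j)) i‖ ^ 2 = fro (X * B) := by
  rw [fro, Finset.sum_comm]; rfl

lemma NegI.im_trace (hη : 0 < η) (hA : NegI η A) (B : Matrix (Fin m) (Fin n) ℂ) (s : ℂ) (hs : 0 ≤ s.im) :
    η * fro ((A + s⁻¹ • (Bᴴ * B))⁻¹ * Bᴴ) + s.im / ‖s‖ ^ 2 * fro (B * (A + s⁻¹ • (Bᴴ * B))⁻¹ * Bᴴ) ≤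
      ((A + s⁻¹ • (Bᴴ * B))⁻¹ * (Bᴴ * B)).trace.im := by
  have hM : NegI η (A + s⁻¹ • (Bᴴ * B)) := hA.add _ (by
    rw [Complex.inv_im]; exact div_nonpos_of_nonpos_of_nonneg (by linarith) (Complex.normSq_nonneg _)) B
  rw [trace_BMB, Complex.im_sum, ← fro_cols, ← fro_cols, Finset.mul_sum, Finset.mul_sum, ← Finset.sum_add_distrib]
  refine Finset.sum_le_sum fun j _ => ?_
  have := hA.im_quad hη B s hM (fun i => Bᴴ i j)
  rw [Matrix.mulVec_mulVec] at this
  exact this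

lemma fro_inv_lower (hη : 0 < η) (hA : NegI η A) (B : Matrix (Fin n) (Fin m) ℂ) : fro B ≤ ‖A‖ ^ 2 * fro (A⁻¹ * B) := by
  have := fro_mul A (A⁻¹ * B)
  rwa [← Matrix.mul_assoc, hA.mul_inv hη, Matrix.one_mul] at this

lemma fro_trace (B : Matrix (Fin m) (Fin n) ℂ) : fro Bᴴ = (Bᴴ * B).trace.re := by
  have : (Bᴴ * B).trace = ((fro Bᴴ : ℝ) : ℂ) := by
    rw [← Matrix.one_mul (Bᴴ * B), trace_BMB, fro, Finset.sum_comm]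
    simp only [Matrix.one_mulVec, star_dot_self, Complex.ofReal_sum]
  rw [this, Complex.ofReal_re]

lemma NegI.im_trace' (hη : 0 < η) (hA : NegI η A) (B : Matrix (Fin m) (Fin n) ℂ) (K : ℝ) (hK : ‖A‖ ≤ K) :
    η * (Bᴴ * B).trace.re ≤ K ^ 2 * (A⁻¹ * (Bᴴ * B)).trace.im := by
  have h := hA.im_trace hη B 0 (by simp)
  simp only [_root_.inv_zero, zero_smul, add_zero, Complex.zero_im, zero_div, zero_mul] at h
  have h2 := fro_inv_lower hη hA Bᴴ
  rw [← fro_trace]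
  have h3 : ‖A‖ ^ 2 ≤ K ^ 2 := by gcongr
  have := fro_nonneg (A⁻¹ * Bᴴ)
  calc η * fro Bᴴ ≤ η * (K ^ 2 * fro (A⁻¹ * Bᴴ)) := by
        gcongr; exact h2.trans (by gcongr)
    _ = K ^ 2 * (η * fro (A⁻¹ * Bᴴ)) := by ring
    _ ≤ _ := by gcongr

lemma minv_sub {A B : Matrix (Fin n) (Fin n) ℂ} (hA : IsUnit A) (hB : IsUnit B) :
    A⁻¹ - B⁻¹ = A⁻¹ * (B - A) * B⁻¹ := by
  have h1 := Matrix.nonsing_inv_mul _ ((Matrix.isUnit_iff_isUnit_det _).mp hA)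
  have h2 := Matrix.mul_nonsing_inv _ ((Matrix.isUnit_iff_isUnit_det _).mp hB)
  rw [mul_sub, sub_mul, h1, mul_assoc, h2, mul_one, one_mul]
end

/-- complexification -/
abbrev cx {m n : ℕ} (M : Matrix (Fin m) (Fin n) ℝ) : Matrix (Fin m) (Fin n) ℂ := M.map Complex.ofReal

lemma cx_conjT {m n : ℕ} (M : Matrix (Fin m) (Fin n) ℝ) : (cx M)ᴴ = cx Mᵀ := by
  ext i j; simp
lemma cx_mul {l m n : ℕ} (M : Matrix (Fin l) (Fin m) ℝ) (N : Matrix (Fin m) (Fin n) ℝ) : cx (M * N) = cx M * cx N := by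
  ext i j; simp [Matrix.mul_apply]
lemma cx_gram {m n : ℕ} (M : Matrix (Fin m) (Fin n) ℝ) : cx (Mᵀ * M) = (cx M)ᴴ * cx M := by
  rw [cx_mul, cx_conjT]
lemma cx_add {m n : ℕ} (M N : Matrix (Fin m) (Fin n) ℝ) : cx (M + N) = cx M + cx N := by
  ext i j; simp
lemma cx_smul {m n : ℕ} (c : ℝ) (N : Matrix (Fin m) (Fin n) ℝ) : cx (c • N) = (c : ℂ) • cx N := by
  ext i j; simp

/-- rank one projection on row -/
noncomputable def rk {n : ℕ} (y : Fin n → ℝ) : Matrix (Fin n) (Fin n) ℂ :=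
  Matrix.of fun k l => (y k : ℂ) * y l

lemma qf_eq {n : ℕ} (M : Matrix (Fin n) (Fin n) ℂ) (y : Fin n → ℝ) : qf M y = (M * rk y).trace := by
  simp only [qf, rk, Matrix.trace, Matrix.diag_apply, Matrix.mul_apply, Matrix.of_apply]
  refine Finset.sum_congr rfl fun k _ => Finset.sum_congr rfl fun l _ => ?_
  push_cast; ring

lemma rk_mul_rk {n : ℕ} (M : Matrix (Fin n) (Fin n) ℂ) (y : Fin n → ℝ) : rk y * M * rk y = qf M y • rk y := by
  ext k l
  simp only [qf, rk, Matrix.mul_apply, Matrix.of_apply, Matrix.smul_apply, smul_eq_mul, Finset.sum_mul]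
  rw [Finset.sum_comm]
  refine Finset.sum_congr rfl fun j _ => Finset.sum_congr rfl fun i _ => ?_
  push_cast; ring

lemma qf_le {n : ℕ} (M : Matrix (Fin n) (Fin n) ℂ) (y : Fin n → ℝ) : ‖qf M y‖ ≤ ‖M‖ * ∑ k, y k ^ 2 := by
  have e : qf M y = star (fun k => (y k : ℂ)) ⬝ᵥ M *ᵥ (fun k => (y k : ℂ)) := by
    simp only [qf, dotProduct, Matrix.mulVec, Finset.mul_sum]
    refine Finset.sum_congr rfl fun j _ => Finset.sum_congr rfl fun i _ => ?_
    simp; ring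
  have h := dot_le (fun k => (y k : ℂ)) (M *ᵥ (fun k => (y k : ℂ)))
  rw [← e] at h
  have h2 := nrm_mulVec M (fun k => (y k : ℂ))
  simp only [Complex.norm_real, Real.norm_eq_abs, sq_abs] at h h2
  have h0 : 0 ≤ ∑ k, y k ^ 2 := Finset.sum_nonneg fun _ _ => sq_nonneg _
  refine (sq_le_sq₀ (norm_nonneg _) (by positivity)).mp (h.trans ?_)
  calc _ ≤ (∑ k, y k ^ 2) * (‖M‖ ^ 2 * ∑ k, y k ^ 2) := by gcongr
    _ = _ := by ring

/-- leave one row out -/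
def loo {e n : ℕ} (y : Matrix (Fin e) (Fin n) ℝ) (i : Fin e) : Matrix (Fin e) (Fin n) ℝ :=
  fun j k => if j = i then 0 else y j k

lemma gram_loo {e n : ℕ} (y : Matrix (Fin e) (Fin n) ℝ) (i : Fin e) :
    cx (yᵀ * y) = cx ((loo y i)ᵀ * loo y i) + rk (y i) := by
  ext k l
  simp only [rk, loo, Matrix.map_apply, Matrix.mul_apply, Matrix.transpose_apply, Matrix.add_apply, Matrix.of_apply]
  rw [← Finset.add_sum_erase _ _ (Finset.mem_univ i), ← Finset.add_sum_erase _ (fun j => (if j = i then 0 else y j k) * (if j = i then 0 else y j l)) (Finset.mem_univ i)]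
  simp only [if_true, zero_mul, zero_add]
  have hsum : ∑ x ∈ Finset.univ.erase i, (if x = i then 0 else y x k) * (if x = i then 0 else y x l) = ∑ x ∈ Finset.univ.erase i, y x k * y x l :=
    Finset.sum_congr rfl fun j hj => by simp [(Finset.mem_erase.mp hj).1]
  rw [hsum]
  push_cast; ring

lemma gram_sum {e n : ℕ} (y : Matrix (Fin e) (Fin n) ℝ) : cx (yᵀ * y) = ∑ i, rk (y i) := by
  ext k l
  simp only [Matrix.map_apply, Matrix.mul_apply, Matrix.transpose_apply, rk, Matrix.sum_apply, Matrix.of_apply]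
  push_cast; rfl

lemma norm_loo {e n : ℕ} (y : Matrix (Fin e) (Fin n) ℝ) (i : Fin e) : ‖loo y i‖ ≤ ‖y‖ := by
  have : loo y i = Matrix.diagonal (fun j => if j = i then (0 : ℝ) else 1) * y := by
    ext j k; simp [loo, Matrix.diagonal_mul]
  rw [this]
  refine (Matrix.l2_opNorm_mul _ _).trans (mul_le_of_le_one_left (norm_nonneg _) (nrm_diag _ _ zero_le_one fun j => ?_))
  split_ifs <;> simp

/-- the resolvent matrix with the layer added -/
noncomputable def MM {e n : ℕ} (A : Matrix (Fin n) (Fin n) ℂ) (c : ℂ) (y : Matrix (Fin e) (Fin n) ℝ) :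
    Matrix (Fin n) (Fin n) ℂ := A + c • cx (yᵀ * y)
/-- the empirical `s` -/
noncomputable def sE {e n : ℕ} (A P : Matrix (Fin n) (Fin n) ℂ) (z : ℂ) (y : Matrix (Fin e) (Fin n) ℝ) : ℂ :=
  z⁻¹ + (e : ℂ)⁻¹ * ((MM A (z / e) y)⁻¹ * P).trace
/-- deterministic equivalent -/
noncomputable def Rt {n : ℕ} (A P : Matrix (Fin n) (Fin n) ℂ) (s : ℂ) : Matrix (Fin n) (Fin n) ℂ := (A + s⁻¹ • P)⁻¹

lemma MM_neg {e n : ℕ} {η : ℝ} {A : Matrix (Fin n) (Fin n) ℂ} (hA : NegI η A) (c : ℂ) (hc : c.im ≤ 0)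
    (y : Matrix (Fin e) (Fin n) ℝ) : NegI η (MM A c y) := by
  rw [MM, cx_gram]; exact hA.add c hc _

lemma inv_im_nonpos {s : ℂ} (hs : 0 ≤ s.im) : (s⁻¹).im ≤ 0 := by
  rw [Complex.inv_im]; exact div_nonpos_of_nonpos_of_nonneg (by linarith) (Complex.normSq_nonneg _)
lemma inv_im_nonneg {s : ℂ} (hs : s.im ≤ 0) : 0 ≤ (s⁻¹).im := by
  rw [Complex.inv_im]; exact div_nonneg (by linarith) (Complex.normSq_nonneg _)

lemma Rt_sub {n : ℕ} {η : ℝ} {A B : Matrix (Fin n) (Fin n) ℂ} (hη : 0 < η) (hA : NegI η A) (s s' : ℂ) (hs : 0 ≤ s.im) (hs' : 0 ≤ s'.im)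
    (h0 : s ≠ 0) (h0' : s' ≠ 0) :
    Rt A (Bᴴ * B) s - Rt A (Bᴴ * B) s' = ((s - s') / (s * s')) • (Rt A (Bᴴ * B) s * (Bᴴ * B) * Rt A (Bᴴ * B) s') := by
  have h1 := (hA.add s⁻¹ (inv_im_nonpos hs) B).isUnit hη
  have h2 := (hA.add s'⁻¹ (inv_im_nonpos hs') B).isUnit hη
  unfold Rt
  rw [minv_sub h1 h2, add_sub_add_left_eq_sub, ← sub_smul, Matrix.mul_smul, Matrix.smul_mul]
  congr 1
  field_simp

lemma Rt_norm {n : ℕ} {η : ℝ} {A B : Matrix (Fin n) (Fin n) ℂ} (hη : 0 < η) (hA : NegI η A) (s : ℂ) (hs : 0 ≤ s.im) :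
    ‖Rt A (Bᴴ * B) s‖ ≤ η⁻¹ := (hA.add s⁻¹ (inv_im_nonpos hs) B).norm_inv hη

lemma sE_im {e n : ℕ} {η K : ℝ} {A B : Matrix (Fin n) (Fin n) ℂ} {z : ℂ} {y : Matrix (Fin e) (Fin n) ℝ} (hη : 0 < η) (hA : NegI η A)
    (hz : z.im ≤ 0) (he : 0 < e) (hK : 1 ≤ K) (heK : (e : ℝ) ≤ K * n) (hηK : η⁻¹ ≤ K) (hM : ‖MM A (z / e) y‖ ≤ K)
    (hP : (n : ℝ) ≤ K * (Bᴴ * B).trace.re) : (K ^ 5)⁻¹ ≤ (sE A (Bᴴ * B) z y).im := by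
  have hK0 : 0 < K := by linarith
  have hz' : (z / e).im ≤ 0 := by
    rw [Complex.div_natCast_im]; exact div_nonpos_of_nonpos_of_nonneg hz (by positivity)
  have h := (MM_neg hA _ hz' y).im_trace' hη B K hM
  have hzi := inv_im_nonneg hz
  have e1 : (sE A (Bᴴ * B) z y).im = (z⁻¹).im + (e : ℝ)⁻¹ * ((MM A (z / e) y)⁻¹ * (Bᴴ * B)).trace.im := by
    rw [sE, Complex.add_im]
    congr 1
    rw [show ((e : ℂ))⁻¹ = (((e : ℝ)⁻¹ : ℝ) : ℂ) by push_cast; rfl, Complex.im_ofReal_mul]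
  rw [e1]
  set τ := ((MM A (z / e) y)⁻¹ * (Bᴴ * B)).trace.im
  set q := (Bᴴ * B).trace.re
  have he' : (0 : ℝ) < e := by exact_mod_cast he
  have h1 : (e : ℝ) ≤ K ^ 2 * q := by nlinarith
  have h2 : 1 ≤ K * η := by
    rw [inv_le_iff_one_le_mul₀ hη] at hηK; linarith
  have hq : 0 < q := by
    by_contra hc; push Not at hc
    nlinarith [sq_nonneg K]
  have h3 : (e : ℝ) ≤ K ^ 5 * τ := by
    calc (e : ℝ) ≤ K ^ 2 * q := h1
      _ ≤ K ^ 2 * q * (K * η) := le_mul_of_one_le_right (by positivity) h2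
      _ = K ^ 3 * (η * q) := by ring
      _ ≤ K ^ 3 * (K ^ 2 * τ) := by gcongr
      _ = _ := by ring
  have h4 : (K ^ 5)⁻¹ ≤ (e : ℝ)⁻¹ * τ := by
    rw [inv_mul_eq_div, le_div_iff₀ he', inv_mul_le_iff₀ (by positivity)]
    exact h3
  linarith

lemma cdiv_im {z : ℂ} (hz : z.im ≤ 0) (e : ℕ) : (z / e).im ≤ 0 := by
  rw [Complex.div_natCast_im]; exact div_nonpos_of_nonpos_of_nonneg hz (by positivity)

lemma nm2 {n : ℕ} {X Y : Matrix (Fin n) (Fin n) ℂ} {a b : ℝ} (hX : ‖X‖ ≤ a) (hY : ‖Y‖ ≤ b) : ‖X * Y‖ ≤ a * b :=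
  (norm_mul_le _ _).trans (mul_le_mul hX hY (norm_nonneg _) ((norm_nonneg _).trans hX))

lemma loo_sub {e n : ℕ} {η : ℝ} {A : Matrix (Fin n) (Fin n) ℂ} (hη : 0 < η) (hA : NegI η A) (c : ℂ) (hc : c.im ≤ 0)
    (y : Matrix (Fin e) (Fin n) ℝ) (i : Fin e) :
    (MM A c (loo y i))⁻¹ - (MM A c y)⁻¹ = c • ((MM A c (loo y i))⁻¹ * rk (y i) * (MM A c y)⁻¹) := by
  have h1 := (MM_neg hA c hc (loo y i)).isUnit hη
  have h2 := (MM_neg hA c hc y).isUnit hη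
  rw [minv_sub h1 h2]
  have : MM A c y - MM A c (loo y i) = c • rk (y i) := by
    unfold MM
    rw [gram_loo y i, smul_add]; abel
  rw [this, Matrix.mul_smul, Matrix.smul_mul]

/-- all hypotheses of the deterministic part -/
structure Good {e n : ℕ} (K η : ℝ) (A B D : Matrix (Fin n) (Fin n) ℂ) (z : ℂ) (y : Matrix (Fin e) (Fin n) ℝ) : Prop where
  hK : 1 ≤ K
  hη : 0 < η
  hA : NegI η A
  hz : z.im ≤ 0
  hz0 : z ≠ 0
  he : 0 < e
  heK : (e : ℝ) ≤ K * n
  hnK : (n : ℝ) ≤ K * e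
  hηK : η⁻¹ ≤ K
  hzK : ‖z‖ ≤ K
  hP : (n : ℝ) ≤ K * (Bᴴ * B).trace.re
  hPK : ‖Bᴴ * B‖ ≤ K
  hD : ‖D‖ ≤ K
  hM : ‖MM A (z / e) y‖ ≤ K
  hMi : ∀ i, ‖MM A (z / e) (loo y i)‖ ≤ K
  hy : ∀ i, ∑ k, y i k ^ 2 ≤ K * n

section
variable {e n : ℕ} {K η : ℝ} {A B D : Matrix (Fin n) (Fin n) ℂ} {z : ℂ} {y : Matrix (Fin e) (Fin n) ℝ}
  (h : Good K η A B D z y)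
include h

lemma Good.R : ‖(MM A (z / e) y)⁻¹‖ ≤ K := ((MM_neg h.hA _ (cdiv_im h.hz e) y).norm_inv h.hη).trans h.hηK
lemma Good.Ri (i) : ‖(MM A (z / e) (loo y i))⁻¹‖ ≤ K :=
  ((MM_neg h.hA _ (cdiv_im h.hz e) _).norm_inv h.hη).trans h.hηK
lemma Good.im : (K ^ 5)⁻¹ ≤ (sE A (Bᴴ * B) z y).im := sE_im h.hη h.hA h.hz h.he h.hK h.heK h.hηK h.hM h.hP
lemma Good.imi (i) : (K ^ 5)⁻¹ ≤ (sE A (Bᴴ * B) z (loo y i)).im :=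
  sE_im h.hη h.hA h.hz h.he h.hK h.heK h.hηK (h.hMi i) h.hP

lemma Good.K0 : 0 < K := by linarith [h.hK]
lemma Good.e0 : (0 : ℝ) < e := by exact_mod_cast h.he

lemma Good.loo_tr (i) (X : Matrix (Fin n) (Fin n) ℂ) :
    ‖((MM A (z / e) (loo y i))⁻¹ * X).trace - ((MM A (z / e) y)⁻¹ * X).trace‖ ≤ K ^ 5 * ‖X‖ := by
  rw [← Matrix.trace_sub, ← sub_mul, loo_sub h.hη h.hA _ (cdiv_im h.hz e), Matrix.smul_mul, Matrix.trace_smul, smul_eq_mul,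
    mul_assoc, Matrix.mul_assoc, Matrix.trace_mul_comm, Matrix.mul_assoc, Matrix.trace_mul_comm, ← qf_eq, norm_mul, norm_div, Complex.norm_natCast]
  have hK := h.K0
  have he := h.e0
  calc _ ≤ K / e * (K * ‖X‖ * K * (K * n)) := by
        gcongr
        · exact h.hzK
        · refine (qf_le _ _).trans (mul_le_mul (nm2 (nm2 h.R le_rfl) (h.Ri i)) (h.hy i) (Finset.sum_nonneg fun _ _ => sq_nonneg _) (by positivity))
    _ = n * (K ^ 4 * ‖X‖ / e) := by ring
    _ ≤ (K * e) * (K ^ 4 * ‖X‖ / e) := by gcongr; exact h.hnK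
    _ = _ := by field_simp

lemma Good.s_sub (i) : ‖sE A (Bᴴ * B) z (loo y i) - sE A (Bᴴ * B) z y‖ ≤ K ^ 6 / e := by
  unfold sE
  rw [add_sub_add_left_eq_sub, ← mul_sub, norm_mul, norm_inv, Complex.norm_natCast, inv_mul_eq_div]
  have := h.e0
  have := h.K0
  gcongr
  refine (h.loo_tr i _).trans ?_
  rw [pow_succ K 5]
  gcongr
  exact h.hPK

lemma inv_s {s : ℂ} (hs : (K ^ 5)⁻¹ ≤ s.im) : ‖s⁻¹‖ ≤ K ^ 5 ∧ 0 < s.im ∧ s ≠ 0 := by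
  have hK := h.K0
  have h1 : 0 < s.im := lt_of_lt_of_le (by positivity) hs
  refine ⟨?_, h1, fun h0 => by simp [h0] at h1⟩
  rw [norm_inv, inv_le_comm₀ (norm_pos_iff.mpr fun h0 => by simp [h0] at h1) (by positivity)]
  exact hs.trans ((le_abs_self _).trans (Complex.abs_im_le_norm _))

lemma Good.Rt_le {s : ℂ} (hs : (K ^ 5)⁻¹ ≤ s.im) : ‖Rt A (Bᴴ * B) s‖ ≤ K :=
  (Rt_norm h.hη h.hA _ (inv_s h hs).2.1.le).trans h.hηK

lemma Good.Rt_sub {s s' : ℂ} (hs : (K ^ 5)⁻¹ ≤ s.im) (hs' : (K ^ 5)⁻¹ ≤ s'.im) :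
    ‖Rt A (Bᴴ * B) s - Rt A (Bᴴ * B) s'‖ ≤ K ^ 13 * ‖s - s'‖ := by
  obtain ⟨a1, a2, a3⟩ := inv_s h hs
  obtain ⟨b1, b2, b3⟩ := inv_s h hs'
  have hK := h.K0
  rw [_root_.Rt_sub h.hη h.hA s s' a2.le b2.le a3 b3, norm_smul, div_eq_mul_inv, mul_inv, norm_mul, norm_mul]
  calc _ ≤ ‖s - s'‖ * (K ^ 5 * K ^ 5) * (K * K * K) := by
        gcongr
        exact nm2 (nm2 (h.Rt_le hs) h.hPK) (h.Rt_le hs')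
    _ = _ := by ring

lemma Good.qloo (i) (N : Matrix (Fin n) (Fin n) ℂ) :
    qf ((MM A (z / e) (loo y i))⁻¹ * N) (y i) =
      (1 + z / e * qf ((MM A (z / e) (loo y i))⁻¹) (y i)) * qf ((MM A (z / e) y)⁻¹ * N) (y i) := by
  have h1 := loo_sub h.hη h.hA _ (cdiv_im h.hz e) y i
  rw [sub_eq_iff_eq_add] at h1
  set R := (MM A (z / e) y)⁻¹
  set Ri := (MM A (z / e) (loo y i))⁻¹
  have h2 : Ri * N = R * N + (z / e) • (Ri * rk (y i) * R * N) := by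
    conv_lhs => rw [h1]
    rw [add_mul, Matrix.smul_mul, add_comm]
  rw [h2, qf_eq, qf_eq (R * N), add_mul, Matrix.trace_add, Matrix.smul_mul, Matrix.trace_smul]
  have h3 : Ri * rk (y i) * R * N * rk (y i) = Ri * (rk (y i) * (R * N) * rk (y i)) := by
    simp only [Matrix.mul_assoc]
  rw [h3, rk_mul_rk, Matrix.mul_smul, Matrix.trace_smul, ← qf_eq, ← qf_eq, smul_eq_mul, smul_eq_mul]
  ring

lemma Good.row (i) (δ : ℝ) (hδ : 0 ≤ δ)
    (e1 : ‖qf (MM A (z / e) (loo y i))⁻¹ (y i) - ((MM A (z / e) (loo y i))⁻¹ * (Bᴴ * B)).trace‖ ≤ n * δ)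
    (e2 : ‖qf ((MM A (z / e) (loo y i))⁻¹ * (D * Rt A (Bᴴ * B) (sE A (Bᴴ * B) z (loo y i)))) (y i) -
      ((MM A (z / e) (loo y i))⁻¹ * (D * Rt A (Bᴴ * B) (sE A (Bᴴ * B) z (loo y i))) * (Bᴴ * B)).trace‖ ≤ n * δ) :
    ‖((MM A (z / e) y)⁻¹ * (D * Rt A (Bᴴ * B) (sE A (Bᴴ * B) z y)) * (Bᴴ * B)).trace -
      z * sE A (Bᴴ * B) z y * qf ((MM A (z / e) y)⁻¹ * (D * Rt A (Bᴴ * B) (sE A (Bᴴ * B) z y))) (y i)‖ ≤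
      6 * K ^ 23 * (n * δ + 1) := by
  have hK := h.K0
  have hK1 := h.hK
  have he := h.e0
  have heC : (e : ℂ) ≠ 0 := by exact_mod_cast h.he.ne'
  have hS := h.s_sub i
  have hRt := h.Rt_sub (h.imi i) h.im
  have hRn := h.Rt_le h.im
  have hq := h.qloo i (D * Rt A (Bᴴ * B) (sE A (Bᴴ * B) z y))
  have hRi := h.Ri i
  have hR := h.R
  have hsi : sE A (Bᴴ * B) z (loo y i) = z⁻¹ + (e : ℂ)⁻¹ * ((MM A (z / e) (loo y i))⁻¹ * (Bᴴ * B)).trace := rfl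
  have hlt := h.loo_tr i (D * Rt A (Bᴴ * B) (sE A (Bᴴ * B) z y) * (Bᴴ * B))
  set P := Bᴴ * B
  set s := sE A P z y
  set si := sE A P z (loo y i)
  set R := (MM A (z / e) y)⁻¹
  set Ri := (MM A (z / e) (loo y i))⁻¹
  set E := Rt A P si - Rt A P s with hE
  have hEn : ‖E‖ ≤ K ^ 19 / e := hRt.trans (by
    calc _ ≤ K ^ 13 * (K ^ 6 / e) := by gcongr
      _ = _ := by ring)
  set a := qf (R * (D * Rt A P s)) (y i)
  have ha : ‖a‖ ≤ K ^ 4 * n := by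
    refine (qf_le _ _).trans ?_
    calc _ ≤ K * (K * K) * (K * n) := mul_le_mul (nm2 hR (nm2 h.hD hRn)) (h.hy i) (Finset.sum_nonneg fun _ _ => sq_nonneg _) (by positivity)
      _ = _ := by ring
  -- decomposition
  have t1 : ‖(R * (D * Rt A P s) * P).trace - (Ri * (D * Rt A P s) * P).trace‖ ≤ K ^ 8 := by
    rw [norm_sub_rev, Matrix.mul_assoc Ri, Matrix.mul_assoc R]
    refine hlt.trans ?_
    calc _ ≤ K ^ 5 * (K * K * K) := by gcongr; exact nm2 (nm2 h.hD hRn) h.hPK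
      _ = _ := by ring
  have hne : (n : ℝ) / e ≤ K := by rw [div_le_iff₀ he]; exact h.hnK
  have t2 : ‖(Ri * (D * Rt A P s) * P).trace - (Ri * (D * Rt A P si) * P).trace‖ ≤ K ^ 23 := by
    rw [← Matrix.trace_sub, ← sub_mul, ← mul_sub, ← mul_sub, ← neg_sub, ← hE, mul_neg, mul_neg, neg_mul, Matrix.trace_neg, norm_neg]
    refine (tr_le _).trans ?_
    rw [Fintype.card_fin]
    calc _ ≤ n * (K * (K * (K ^ 19 / e)) * K) := by gcongr; exact nm2 (nm2 hRi (nm2 h.hD hEn)) h.hPK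
      _ = n / e * K ^ 22 := by ring
      _ ≤ K * K ^ 22 := by gcongr
      _ = _ := by ring
  have t4 : ‖qf (Ri * (D * Rt A P si)) (y i) - qf (Ri * (D * Rt A P s)) (y i)‖ ≤ K ^ 23 := by
    rw [qf_eq, qf_eq, ← Matrix.trace_sub, ← sub_mul, ← mul_sub, ← mul_sub, ← hE, ← qf_eq]
    refine (qf_le _ _).trans ?_
    calc _ ≤ (K * (K * (K ^ 19 / e))) * (K * n) := mul_le_mul (nm2 hRi (nm2 h.hD hEn)) (h.hy i) (Finset.sum_nonneg fun _ _ => sq_nonneg _) (by positivity)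
      _ = n / e * K ^ 22 := by ring
      _ ≤ K * K ^ 22 := by gcongr
      _ = _ := by ring
  have t5 : ‖(1 + z / e * qf Ri (y i)) - z * s‖ ≤ K * (K ^ 6 / e + n * δ / e) := by
    have : (1 + z / e * qf Ri (y i)) - z * s = z * ((si - s) + (e : ℂ)⁻¹ * (qf Ri (y i) - (Ri * P).trace)) := by
      rw [hsi]; have := h.hz0; field_simp; ring
    rw [this, norm_mul]
    refine mul_le_mul h.hzK ((norm_add_le _ _).trans (add_le_add hS ?_)) (norm_nonneg _) hK.le
    rw [norm_mul, norm_inv, Complex.norm_natCast, inv_mul_eq_div]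
    gcongr
  have t6 : ‖((1 + z / e * qf Ri (y i)) - z * s) * a‖ ≤ K ^ 12 + K ^ 6 * (n * δ) := by
    rw [norm_mul]
    calc _ ≤ K * (K ^ 6 / e + n * δ / e) * (K ^ 4 * n) := by gcongr
      _ = n / e * (K ^ 11 + K ^ 5 * (n * δ)) := by ring
      _ ≤ K * (K ^ 11 + K ^ 5 * (n * δ)) := by gcongr
      _ = _ := by ring
  have key : (R * (D * Rt A P s) * P).trace - z * s * a =
      ((R * (D * Rt A P s) * P).trace - (Ri * (D * Rt A P s) * P).trace) +
      ((Ri * (D * Rt A P s) * P).trace - (Ri * (D * Rt A P si) * P).trace) -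
      (qf (Ri * (D * Rt A P si)) (y i) - (Ri * (D * Rt A P si) * P).trace) +
      (qf (Ri * (D * Rt A P si)) (y i) - qf (Ri * (D * Rt A P s)) (y i)) +
      ((1 + z / e * qf Ri (y i)) - z * s) * a := by
    rw [hq]; ring
  rw [key]
  have hp : ∀ j, j ≤ 23 → K ^ j ≤ K ^ 23 := fun j hj => pow_le_pow_right₀ hK1 hj
  have hnd : 0 ≤ n * δ := by positivity
  refine (norm_add_le_of_le (norm_add_le_of_le (norm_sub_le_of_le (norm_add_le_of_le t1 t2) e2) t4) t6).trans ?_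
  nlinarith [hp 8 (by norm_num), hp 12 (by norm_num), hp 6 (by norm_num), one_le_pow₀ hK1 (n := 23), mul_nonneg hnd (sub_nonneg.2 (hp 6 (by norm_num))), mul_nonneg hnd (sub_nonneg.2 (one_le_pow₀ hK1 (n := 23)))]

theorem Good.main (δ : ℝ) (hδ : 0 ≤ δ)
    (e1 : ∀ i, ‖qf (MM A (z / e) (loo y i))⁻¹ (y i) - ((MM A (z / e) (loo y i))⁻¹ * (Bᴴ * B)).trace‖ ≤ n * δ)
    (e2 : ∀ i, ‖qf ((MM A (z / e) (loo y i))⁻¹ * (D * Rt A (Bᴴ * B) (sE A (Bᴴ * B) z (loo y i)))) (y i) -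
      ((MM A (z / e) (loo y i))⁻¹ * (D * Rt A (Bᴴ * B) (sE A (Bᴴ * B) z (loo y i))) * (Bᴴ * B)).trace‖ ≤ n * δ) :
    ‖((MM A (z / e) y)⁻¹ * D).trace - (Rt A (Bᴴ * B) (sE A (Bᴴ * B) z y) * D).trace‖ ≤ 6 * K ^ 28 * (n * δ + 1) := by
  have hr := fun i => h.row i δ hδ (e1 i) (e2 i)
  have heC : (e : ℂ) ≠ 0 := by exact_mod_cast h.he.ne'
  have hK := h.K0
  have he := h.e0
  obtain ⟨a1, a2, a3⟩ := inv_s h h.im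
  have h1 := (h.hA.add (sE A (Bᴴ * B) z y)⁻¹ (inv_im_nonpos a2.le) B).isUnit h.hη
  have h2 := (MM_neg h.hA _ (cdiv_im h.hz e) y).isUnit h.hη
  have h3 := minv_sub h1 h2
  set P := Bᴴ * B
  set s := sE A P z y
  change Rt A P s - _ = Rt A P s * _ * _ at h3
  have h4 : MM A (z / e) y - (A + s⁻¹ • P) = (z / e) • (∑ i, rk (y i)) - s⁻¹ • P := by
    unfold MM; rw [gram_sum]; abel
  rw [h4] at h3
  set R := (MM A (z / e) y)⁻¹
  have h5 : (R * D).trace - (Rt A P s * D).trace = s⁻¹ * (e : ℂ)⁻¹ * ∑ i, ((R * (D * Rt A P s) * P).trace - z * s * qf (R * (D * Rt A P s)) (y i)) := by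
    have h6 : (R * D).trace - (Rt A P s * D).trace = -((Rt A P s - R) * D).trace := by
      rw [sub_mul, Matrix.trace_sub]; ring
    have h7 : ∀ Q : Matrix (Fin n) (Fin n) ℂ, (Rt A P s * Q * R * D).trace = (R * (D * Rt A P s) * Q).trace := by
      intro Q
      rw [Matrix.mul_assoc, Matrix.trace_mul_comm, ← Matrix.mul_assoc, ← Matrix.mul_assoc]
    rw [h6, h3, h7, mul_sub, Matrix.trace_sub, Matrix.mul_smul, Matrix.mul_smul, Matrix.trace_smul, Matrix.trace_smul, Finset.mul_sum,
      Matrix.trace_sum]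
    simp only [← qf_eq, smul_eq_mul, Finset.sum_sub_distrib, Finset.sum_const, Finset.card_univ, Fintype.card_fin, nsmul_eq_mul, ← Finset.mul_sum]
    field_simp
    ring
  rw [h5, norm_mul, norm_mul, norm_inv (e : ℂ), Complex.norm_natCast]
  have hs : ‖∑ i, ((R * (D * Rt A P s) * P).trace - z * s * qf (R * (D * Rt A P s)) (y i))‖ ≤ e * (6 * K ^ 23 * (n * δ + 1)) := by
    refine (norm_sum_le _ _).trans ((Finset.sum_le_sum fun i _ => hr i).trans (le_of_eq ?_))
    simp
  calc _ ≤ K ^ 5 * (e : ℝ)⁻¹ * (e * (6 * K ^ 23 * (n * δ + 1))) := by gcongr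
    _ = _ := by field_simp

end

section
variable {e n : ℕ} {K η : ℝ} {A B D : Matrix (Fin n) (Fin n) ℂ} {z : ℂ} {y : Matrix (Fin e) (Fin n) ℝ}

lemma Good.kappa (h : Good K η A B D z y) (hAK : ‖A‖ ≤ K) (hz1 : ‖z⁻¹‖ ≤ K) (s : ℂ) (hs : (K ^ 5)⁻¹ ≤ s.im) (τ : ℝ)
    (hτ : ‖s - z⁻¹ - (e : ℂ)⁻¹ * (Rt A (Bᴴ * B) s * (Bᴴ * B)).trace‖ ≤ τ) (hτc : τ ≤ (8 * K ^ 15)⁻¹) :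
    fro (B * Rt A (Bᴴ * B) s * Bᴴ) ≤ (1 - (24 * K ^ 18)⁻¹) * (e * ‖s‖ ^ 2) := by
  have hK := h.K0
  have hK1 := h.hK
  have he := h.e0
  obtain ⟨a1, a2, a3⟩ := inv_s h hs
  have him := h.hA.im_trace h.hη B s a2.le
  have hlow := fro_inv_lower h.hη (h.hA.add s⁻¹ (inv_im_nonpos a2.le) B) Bᴴ
  have hRt := h.Rt_le hs
  change _ * fro (Rt A (Bᴴ * B) s * Bᴴ) + _ * fro (B * Rt A (Bᴴ * B) s * Bᴴ) ≤ (Rt A (Bᴴ * B) s * (Bᴴ * B)).trace.im at him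
  change _ ≤ _ * fro (Rt A (Bᴴ * B) s * Bᴴ) at hlow
  rw [fro_trace] at hlow
  have hT : ‖(Rt A (Bᴴ * B) s * (Bᴴ * B)).trace‖ ≤ n * (K * K) :=
    (tr_le _).trans (by rw [Fintype.card_fin]; gcongr; exact nm2 hRt h.hPK)
  have hn2 : ‖A + s⁻¹ • (Bᴴ * B)‖ ≤ 2 * K ^ 6 := by
    refine (norm_add_le _ _).trans ?_
    rw [norm_smul]
    have := h.hPK
    calc _ ≤ K ^ 1 + K ^ 5 * K := by gcongr; simpa using hAK
      _ ≤ K ^ 6 + K ^ 6 := by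
        have := pow_le_pow_right₀ hK1 (show 1 ≤ 6 by norm_num)
        have : K ^ 5 * K = K ^ 6 := by ring
        linarith
      _ = _ := by ring
  have hP := h.hP
  have heK := h.heK
  have hηK := h.hηK
  have hη := h.hη
  have hnK := h.hnK
  have hzi := inv_im_nonneg h.hz
  generalize fro (Rt A (Bᴴ * B) s * Bᴴ) = G at *
  generalize fro (B * Rt A (Bᴴ * B) s * Bᴴ) = F at *
  generalize (Rt A (Bᴴ * B) s * (Bᴴ * B)).trace = T at *
  generalize (Bᴴ * B).trace.re = q at *
  have hG : (e : ℝ) ≤ 4 * K ^ 14 * G := by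
    have hq0 : 0 ≤ G := by
      by_contra hc; push Not at hc
      have : ‖A + s⁻¹ • (Bᴴ * B)‖ ^ 2 * G ≤ 0 := mul_nonpos_of_nonneg_of_nonpos (sq_nonneg _) hc.le
      nlinarith
    calc (e : ℝ) ≤ K * n := heK
      _ ≤ K * (K * q) := by gcongr
      _ ≤ K * (K * ((2 * K ^ 6) ^ 2 * G)) := by gcongr; exact hlow.trans (by gcongr)
      _ = _ := by ring
  have hG0 : 0 < G := by by_contra hc; push Not at hc; nlinarith [pow_pos hK 14]
  have h1 : (e : ℝ) / (4 * K ^ 15) ≤ η * G := by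
    rw [div_le_iff₀ (by positivity)]
    have : 1 ≤ K * η := by rw [inv_le_iff_one_le_mul₀ hη] at hηK; linarith
    calc (e : ℝ) ≤ 4 * K ^ 14 * G * 1 := by linarith
      _ ≤ 4 * K ^ 14 * G * (K * η) := by gcongr
      _ = _ := by ring
  have h2 : (e : ℝ)⁻¹ * T.im - τ ≤ s.im := by
    have := (Complex.abs_im_le_norm _).trans hτ
    rw [Complex.sub_im, Complex.sub_im, show ((e : ℂ))⁻¹ = (((e : ℝ)⁻¹ : ℝ) : ℂ) by push_cast; rfl, Complex.im_ofReal_mul] at this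
    linarith [(abs_le.mp this).1]
  have hsn : s.im ≤ 3 * K ^ 3 := by
    have h3 : ‖s‖ ≤ ‖s - z⁻¹ - (e : ℂ)⁻¹ * T‖ + ‖z⁻¹‖ + ‖(e : ℂ)⁻¹ * T‖ := by
      refine le_trans (le_of_eq ?_) (norm_add₃_le (a := s - z⁻¹ - (e : ℂ)⁻¹ * T) (b := z⁻¹) (c := (e : ℂ)⁻¹ * T))
      congr 1; ring
    have h4 : ‖(e : ℂ)⁻¹ * T‖ ≤ K ^ 3 := by
      rw [norm_mul, norm_inv, Complex.norm_natCast, inv_mul_le_iff₀ he]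
      calc _ ≤ n * (K * K) := hT
        _ ≤ K * e * (K * K) := by gcongr
        _ = _ := by ring
    have h5 : (8 * K ^ 15)⁻¹ ≤ 1 := inv_le_one_of_one_le₀ (by have := one_le_pow₀ hK1 (n := 15); linarith)
    have h6 := one_le_pow₀ hK1 (n := 3)
    have h7 : K ≤ K ^ 3 := le_self_pow₀ hK1 (by norm_num)
    have := (le_abs_self _).trans (Complex.abs_im_le_norm s)
    linarith
  have hs0 : 0 < ‖s‖ ^ 2 := by have := norm_pos_iff.mpr a3; positivity
  have h8 : (e : ℝ) / (4 * K ^ 15) + s.im / ‖s‖ ^ 2 * F ≤ e * s.im + e * τ := by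
    have : e * ((e : ℝ)⁻¹ * T.im - τ) ≤ e * s.im := by gcongr
    rw [mul_sub, mul_inv_cancel_left₀ he.ne'] at this
    linarith
  have h9 : (e : ℝ) * τ ≤ e / (8 * K ^ 15) := by rw [div_eq_mul_inv]; gcongr
  have h10 : e * s.im * (24 * K ^ 18)⁻¹ ≤ e / (8 * K ^ 15) := by
    rw [← div_eq_mul_inv, div_le_div_iff₀ (by positivity) (by positivity)]
    calc _ ≤ e * (3 * K ^ 3) * (8 * K ^ 15) := by gcongr
      _ = _ := by ring
  have h11 : (e : ℝ) / (4 * K ^ 15) = e / (8 * K ^ 15) + e / (8 * K ^ 15) := by field_simp; norm_num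
  have h12 : s.im / ‖s‖ ^ 2 * F ≤ s.im * (e * (1 - (24 * K ^ 18)⁻¹)) := by nlinarith
  rw [div_mul_eq_mul_div, mul_div_assoc] at h12
  have := le_of_mul_le_mul_left h12 a2
  rw [div_le_iff₀ hs0] at this
  linarith

lemma Good.contr (h : Good K η A B D z y) (hAK : ‖A‖ ≤ K) (hz1 : ‖z⁻¹‖ ≤ K) (s s' : ℂ) (hs : (K ^ 5)⁻¹ ≤ s.im) (hs' : (K ^ 5)⁻¹ ≤ s'.im) (τ : ℝ)
    (hτ : ‖s - z⁻¹ - (e : ℂ)⁻¹ * (Rt A (Bᴴ * B) s * (Bᴴ * B)).trace‖ ≤ τ)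
    (hτ' : ‖s' - z⁻¹ - (e : ℂ)⁻¹ * (Rt A (Bᴴ * B) s' * (Bᴴ * B)).trace‖ ≤ τ) (hτc : τ ≤ (8 * K ^ 15)⁻¹) :
    ‖s - s'‖ ≤ 48 * K ^ 18 * τ := by
  have k1 := h.kappa hAK hz1 s hs τ hτ hτc
  have k2 := h.kappa hAK hz1 s' hs' τ hτ' hτc
  have hK := h.K0
  have he := h.e0
  obtain ⟨a1, a2, a3⟩ := inv_s h hs
  obtain ⟨b1, b2, b3⟩ := inv_s h hs'
  have hR := _root_.Rt_sub (B := B) h.hη h.hA s s' a2.le b2.le a3 b3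
  have hsn := norm_pos_iff.mpr a3
  have hsn' := norm_pos_iff.mpr b3
  set ρ := (24 * K ^ 18)⁻¹ with hρ
  have hρ0 : 0 < ρ := by positivity
  have heC : (e : ℂ) ≠ 0 := by exact_mod_cast h.he.ne'
  have hρ1 : 0 ≤ 1 - ρ := by
    have : 0 ≤ (1 - ρ) * (e * ‖s‖ ^ 2) := (fro_nonneg _).trans k1
    exact nonneg_of_mul_nonneg_left this (by positivity)
  set X := (B * Rt A (Bᴴ * B) s * Bᴴ) * (B * Rt A (Bᴴ * B) s' * Bᴴ)
  have hX : ‖X.trace‖ ≤ (1 - ρ) * (e * ‖s‖ * ‖s'‖) := by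
    refine (sq_le_sq₀ (norm_nonneg _) (by positivity)).mp ((tr_sq_le _ _).trans ?_)
    calc _ ≤ ((1 - ρ) * (e * ‖s‖ ^ 2)) * ((1 - ρ) * (e * ‖s'‖ ^ 2)) := mul_le_mul k1 k2 (fro_nonneg _) (by positivity)
      _ = _ := by ring
  have htr : (Rt A (Bᴴ * B) s * (Bᴴ * B)).trace - (Rt A (Bᴴ * B) s' * (Bᴴ * B)).trace = (s - s') / (s * s') * X.trace := by
    rw [← Matrix.trace_sub, ← sub_mul, hR, Matrix.smul_mul, Matrix.trace_smul, smul_eq_mul]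
    congr 1
    have : Rt A (Bᴴ * B) s * (Bᴴ * B) * Rt A (Bᴴ * B) s' * (Bᴴ * B) = (Rt A (Bᴴ * B) s * Bᴴ * B * Rt A (Bᴴ * B) s' * Bᴴ) * B := by
      simp only [Matrix.mul_assoc]
    rw [this, Matrix.trace_mul_comm]
    simp only [X, Matrix.mul_assoc]
  have key : s - s' = (s - z⁻¹ - (e : ℂ)⁻¹ * (Rt A (Bᴴ * B) s * (Bᴴ * B)).trace) -
      (s' - z⁻¹ - (e : ℂ)⁻¹ * (Rt A (Bᴴ * B) s' * (Bᴴ * B)).trace) + (e : ℂ)⁻¹ * ((s - s') / (s * s') * X.trace) := by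
    rw [← htr]; ring
  have hθ : ‖(e : ℂ)⁻¹ * ((s - s') / (s * s') * X.trace)‖ ≤ (1 - ρ) * ‖s - s'‖ := by
    rw [norm_mul, norm_mul, norm_div, norm_inv, norm_mul, Complex.norm_natCast]
    calc _ ≤ (e : ℝ)⁻¹ * (‖s - s'‖ / (‖s‖ * ‖s'‖) * ((1 - ρ) * (e * ‖s‖ * ‖s'‖))) := by gcongr
      _ = _ := by field_simp
  have h1 : ‖s - s'‖ ≤ τ + τ + (1 - ρ) * ‖s - s'‖ := by
    conv_lhs => rw [key]
    exact norm_add_le_of_le (norm_sub_le_of_le hτ hτ') hθ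
  have h2 : ‖s - s'‖ * ρ ≤ 2 * τ := by linarith
  rw [hρ, ← div_eq_mul_inv, div_le_iff₀ (by positivity)] at h2
  linarith

theorem Good.final (h : Good K η A B D z y) (hAK : ‖A‖ ≤ K) (hz1 : ‖z⁻¹‖ ≤ K) (s : ℂ) (hs : (K ^ 5)⁻¹ ≤ s.im) (δ : ℝ) (hδ : 0 ≤ δ)
    (e1 : ∀ i, ‖qf (MM A (z / e) (loo y i))⁻¹ (y i) - ((MM A (z / e) (loo y i))⁻¹ * (Bᴴ * B)).trace‖ ≤ n * δ)
    (e2 : ∀ i, ‖qf ((MM A (z / e) (loo y i))⁻¹ * (D * Rt A (Bᴴ * B) (sE A (Bᴴ * B) z (loo y i)))) (y i) -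
      ((MM A (z / e) (loo y i))⁻¹ * (D * Rt A (Bᴴ * B) (sE A (Bᴴ * B) z (loo y i))) * (Bᴴ * B)).trace‖ ≤ n * δ)
    (e3 : ∀ i, ‖qf ((MM A (z / e) (loo y i))⁻¹ * ((Bᴴ * B) * Rt A (Bᴴ * B) (sE A (Bᴴ * B) z (loo y i)))) (y i) -
      ((MM A (z / e) (loo y i))⁻¹ * ((Bᴴ * B) * Rt A (Bᴴ * B) (sE A (Bᴴ * B) z (loo y i))) * (Bᴴ * B)).trace‖ ≤ n * δ) :
    ‖((MM A (z / e) y)⁻¹ * D).trace - (Rt A (Bᴴ * B) s * D).trace‖ ≤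
      n * (49 * K ^ 32 * (6 * K ^ 29 * (δ + (n : ℝ)⁻¹) + ‖s - z⁻¹ - (e : ℂ)⁻¹ * (Rt A (Bᴴ * B) s * (Bᴴ * B)).trace‖)) := by
  have m1 := h.main δ hδ e1 e2
  have h' : Good K η A B (Bᴴ * B) z y := { h with hD := h.hPK }
  have m2 := h'.main δ hδ e1 e3
  have hK := h.K0
  have hK1 := h.hK
  have he := h.e0
  have hn : (0 : ℝ) < n := by
    by_contra hc; push Not at hc
    have := h.heK; nlinarith
  set ξ := ‖s - z⁻¹ - (e : ℂ)⁻¹ * (Rt A (Bᴴ * B) s * (Bᴴ * B)).trace‖ with hξ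
  set τ := 6 * K ^ 29 * (δ + (n : ℝ)⁻¹) + ξ with hτ
  have hξ0 : 0 ≤ ξ := norm_nonneg _
  have hτ0 : 0 ≤ τ := by positivity
  have hp : ∀ j, j ≤ 32 → K ^ j ≤ K ^ 32 := fun j hj => pow_le_pow_right₀ hK1 hj
  by_cases hc : τ ≤ (8 * K ^ 15)⁻¹
  · have hs2 : ‖sE A (Bᴴ * B) z y - z⁻¹ - (e : ℂ)⁻¹ * (Rt A (Bᴴ * B) (sE A (Bᴴ * B) z y) * (Bᴴ * B)).trace‖ ≤ τ := by
      have : sE A (Bᴴ * B) z y - z⁻¹ - (e : ℂ)⁻¹ * (Rt A (Bᴴ * B) (sE A (Bᴴ * B) z y) * (Bᴴ * B)).trace =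
        (e : ℂ)⁻¹ * (((MM A (z / e) y)⁻¹ * (Bᴴ * B)).trace - (Rt A (Bᴴ * B) (sE A (Bᴴ * B) z y) * (Bᴴ * B)).trace) := by
        conv_lhs => enter [1, 1]; rw [sE]
        ring
      rw [this, norm_mul, norm_inv, Complex.norm_natCast, inv_mul_le_iff₀ he]
      refine m2.trans ?_
      have hnK := h.hnK
      calc 6 * K ^ 28 * (n * δ + 1) = n * (6 * K ^ 28 * (δ + (n : ℝ)⁻¹)) := by field_simp
        _ ≤ (K * e) * (6 * K ^ 28 * (δ + (n : ℝ)⁻¹)) := by gcongr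
        _ = e * (6 * K ^ 29 * (δ + (n : ℝ)⁻¹)) := by ring
        _ ≤ e * τ := by gcongr; linarith
    have hcon := h.contr hAK hz1 _ s h.im hs τ hs2 (by rw [hτ]; have : 0 ≤ 6 * K ^ 29 * (δ + (n : ℝ)⁻¹) := by positivity
                                                       linarith) hc
    have h3 : ‖(Rt A (Bᴴ * B) (sE A (Bᴴ * B) z y) * D).trace - (Rt A (Bᴴ * B) s * D).trace‖ ≤ n * (48 * K ^ 32 * τ) := by
      rw [← Matrix.trace_sub, ← sub_mul]
      refine (tr_le _).trans ?_
      rw [Fintype.card_fin]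
      have := h.Rt_sub h.im hs
      calc _ ≤ n * (K ^ 13 * (48 * K ^ 18 * τ) * K) := by
            gcongr; exact nm2 (this.trans (by gcongr)) h.hD
        _ = _ := by ring
    have h4 : 6 * K ^ 28 * (n * δ + 1) ≤ n * (K ^ 32 * τ) := by
      calc 6 * K ^ 28 * (n * δ + 1) = n * (1 * (6 * K ^ 28 * (δ + (n : ℝ)⁻¹))) := by field_simp
        _ ≤ n * (K ^ 32 * (6 * K ^ 29 * (δ + (n : ℝ)⁻¹))) := by
          gcongr
          · exact one_le_pow₀ hK1
          · norm_num
        _ ≤ _ := by gcongr; linarith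
    refine (norm_sub_le_norm_sub_add_norm_sub _ (Rt A (Bᴴ * B) (sE A (Bᴴ * B) z y) * D).trace _).trans ?_
    calc _ ≤ n * (K ^ 32 * τ) + n * (48 * K ^ 32 * τ) := add_le_add (m1.trans h4) h3
      _ = _ := by ring
  · push Not at hc
    have h1 : ‖((MM A (z / e) y)⁻¹ * D).trace - (Rt A (Bᴴ * B) s * D).trace‖ ≤ n * (2 * K ^ 2) := by
      rw [← Matrix.trace_sub, ← sub_mul]
      refine (tr_le _).trans ?_
      rw [Fintype.card_fin]
      have := nm2 (norm_sub_le_of_le h.R (h.Rt_le hs)) h.hD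
      gcongr
      linarith
    refine h1.trans ?_
    have h2 : 1 ≤ 8 * K ^ 15 * τ := by
      rw [inv_lt_iff_one_lt_mul₀ (by positivity)] at hc; linarith
    refine mul_le_mul_of_nonneg_left ?_ hn.le
    calc 2 * K ^ 2 ≤ 2 * K ^ 2 * (8 * K ^ 15 * τ) := le_mul_of_one_le_right (by positivity) h2
      _ = 16 * K ^ 17 * τ := by ring
      _ ≤ 49 * K ^ 32 * τ := by
        gcongr
        · norm_num
        · norm_num
end

lemma cont_inv {T : Type*} [TopologicalSpace T] {n : ℕ} {f : T → Matrix (Fin n) (Fin n) ℂ} (hf : Continuous f) (hu : ∀ t, IsUnit (f t)) :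
    Continuous fun t => (f t)⁻¹ := by
  simp only [Matrix.inv_def, Ring.inverse_eq_inv']
  refine Continuous.smul (Continuous.inv₀ hf.matrix_det fun t => ?_) hf.matrix_adjugate
  exact ((Matrix.isUnit_iff_isUnit_det _).mp (hu t)).ne_zero

lemma cont_cx {T : Type*} [TopologicalSpace T] {m n : ℕ} {f : T → Matrix (Fin m) (Fin n) ℝ} (hf : Continuous f) :
    Continuous fun t => cx (f t) := hf.matrix_map Complex.continuous_ofReal

lemma cont_qf {T : Type*} [TopologicalSpace T] {n : ℕ} {f : T → Matrix (Fin n) (Fin n) ℂ} (hf : Continuous f)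
    {y : T → Fin n → ℝ} (hy : Continuous y) : Continuous fun t => qf (f t) (y t) := by
  unfold qf
  refine continuous_finsetSum _ fun k _ => continuous_finsetSum _ fun l _ => ?_
  refine (hf.matrix_elem k l).mul (Complex.continuous_ofReal.comp ?_)
  exact ((continuous_apply k).comp hy).mul ((continuous_apply l).comp hy)

lemma quad_union {σ σ' σ'' : ℝ → ℝ} {lam b a : ℝ} (h : Act σ σ' σ'' lam b a) (B : ℝ) (p : ℕ) (hp : 1 ≤ p) :
    ∃ C, 1 ≤ C ∧ ∀ (d n e : ℕ) (X : Matrix (Fin d) (Fin n) ℝ) (ε δ K : ℝ) (M : Fin e → (Fin e → Fin d → ℝ) → Matrix (Fin n) (Fin n) ℂ), 1 ≤ n →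
      ε ≤ 1 / 2 → IsOrthonormal ε B X → 0 < K → 0 < δ → (∀ i, Continuous (M i)) → (∀ i W w, M i (Function.update W i w) = M i W) →
      (∀ i W, ‖M i W‖ ≤ K) → C * K * (ε + Real.sqrt n * ε ^ 2) ≤ δ →
      gaussianMat e d {W | ∃ i, n * δ ≤ ‖qf (M i W) (fun k => σ (W i ⬝ᵥ colV X k)) - (M i W * cx (Phi b X)).trace‖} ≤
        e * ENNReal.ofReal (C * K ^ (2 * p) / (δ ^ (2 * p) * n ^ p)) := by
  obtain ⟨C, hC, hq⟩ := quad_row h B p hp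
  refine ⟨C, hC, fun d n e X ε δ K M hn hε hX hK hδ hc hu hM hs => ?_⟩
  rw [Set.ofPred_exists]
  refine (measure_iUnion_le _).trans ?_
  rw [tsum_fintype]
  refine (Finset.sum_le_sum (g := fun _ => ENNReal.ofReal (C * K ^ (2 * p) / (δ ^ (2 * p) * n ^ p))) fun i _ => ?_).trans (by simp)
  have hσ := h.cont
  refine fub _ i _ (IsClosed.measurableSet (isClosed_le continuous_const ?_)) _ fun W => ?_
  · refine ((cont_qf (hc i) (continuous_pi fun k => hσ.comp ?_)).sub ((hc i).matrix_mul continuous_const).matrix_trace).norm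
    exact Continuous.dotProduct (continuous_apply i) continuous_const
  · have := hq d n X ε δ K (M i W) hn hε hX hK hδ (hM i W) hs
    simpa only [Set.mem_ofPred_eq, hu, Function.update_self] using this

lemma norm_Phi {b B ε : ℝ} {d n : ℕ} {X : Matrix (Fin d) (Fin n) ℝ} (hb : b ^ 2 ≤ 1) (hX : IsOrthonormal ε B X) : ‖Phi b X‖ ≤ 1 + B ^ 2 := by
  have hB : ‖X‖ ≤ B := by rw [← opNorm_eq]; exact hX.2.2.1
  unfold Phi
  refine (norm_add_le _ _).trans ?_
  rw [norm_smul, norm_smul, Real.norm_of_nonneg (by linarith), Real.norm_of_nonneg (sq_nonneg b)]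
  have h1 : ‖(1 : Matrix (Fin n) (Fin n) ℝ)‖ ≤ 1 := by
    rw [← Matrix.diagonal_one]; exact nrm_diag _ _ zero_le_one fun i => by simp
  have h2 : ‖Xᵀ * X‖ ≤ B ^ 2 := by
    refine (Matrix.l2_opNorm_mul _ _).trans ?_
    rw [nrm_transpose, sq]
    exact mul_le_mul hB hB (norm_nonneg _) ((norm_nonneg _).trans hB)
  have h3 : 0 ≤ b ^ 2 := sq_nonneg b
  calc _ ≤ (1 - b ^ 2) * 1 + b ^ 2 * B ^ 2 := by gcongr
    _ ≤ _ := by nlinarith [sq_nonneg B]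

open scoped MatrixOrder in
lemma Phi_fac {b : ℝ} {d n : ℕ} (X : Matrix (Fin d) (Fin n) ℝ) (hb : b ^ 2 ≤ 1) :
    ∃ B0 : Matrix (Fin n) (Fin n) ℝ, cx (Phi b X) = (cx B0)ᴴ * cx B0 := by
  have : (Phi b X).PosSemidef := by
    refine (Matrix.PosSemidef.one.smul (by linarith)).add (Matrix.PosSemidef.smul ?_ (sq_nonneg b))
    exact Matrix.posSemidef_conjTranspose_mul_self X
  obtain ⟨B0, hB0⟩ := CStarAlgebra.nonneg_iff_eq_star_mul_self.mp this.nonneg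
  exact ⟨B0, by rw [hB0, ← cx_gram]; rfl⟩

lemma tr_Phi {b B ε : ℝ} {d n : ℕ} {X : Matrix (Fin d) (Fin n) ℝ} (hb : b ^ 2 ≤ 1) (hε : ε ≤ 1 / 2) (hX : IsOrthonormal ε B X) :
    (n : ℝ) ≤ 2 * (cx (Phi b X)).trace.re := by
  have e1 : (cx (Phi b X)).trace.re = ∑ k, Phi b X k k := by
    simp [Matrix.trace]
  rw [e1, Finset.mul_sum]
  refine le_trans (le_of_eq ?_) (Finset.sum_le_sum fun k _ => (?_ : (1 : ℝ) ≤ 2 * Phi b X k k))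
  · simp
  · rw [Phi_apply, if_pos rfl]
    have := abs_le.mp ((hX.1 k).trans hε)
    have e2 : colV X k ⬝ᵥ colV X k = ∑ i, X i k ^ 2 := by simp only [dot_colV, sq]
    rw [e2]
    nlinarith [sq_nonneg b]

lemma nextX_gram (σ : ℝ → ℝ) {e d n : ℕ} (W : Fin e → Fin d → ℝ) (X : Matrix (Fin d) (Fin n) ℝ) :
    (nextX σ W X)ᵀ * nextX σ W X = (e : ℝ)⁻¹ • (((of W * X).map σ)ᵀ * (of W * X).map σ) := by
  unfold nextX
  rw [Matrix.transpose_smul, Matrix.smul_mul, Matrix.mul_smul, smul_smul, ← mul_inv, Real.mul_self_sqrt (by positivity)]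

lemma cont_loo {e n : ℕ} (i : Fin e) : Continuous fun y : Matrix (Fin e) (Fin n) ℝ => loo y i := by
  refine continuous_pi fun j => continuous_pi fun k => ?_
  unfold loo
  split_ifs
  · exact continuous_const
  · fun_prop

lemma cont_MM {T : Type*} [TopologicalSpace T] {e n : ℕ} (A : Matrix (Fin n) (Fin n) ℂ) (c : ℂ) {f : T → Matrix (Fin e) (Fin n) ℝ} (hf : Continuous f) :
    Continuous fun t => MM A c (f t) :=
  continuous_const.add ((cont_cx (hf.matrix_transpose.matrix_mul hf)).const_smul c)

lemma sE_pos {e n : ℕ} {η : ℝ} {A B : Matrix (Fin n) (Fin n) ℂ} {z : ℂ} (hη : 0 < η) (hA : NegI η A)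
    (hz : z.im ≤ 0) (he : 0 < e) (hP : 0 < (Bᴴ * B).trace.re) (y : Matrix (Fin e) (Fin n) ℝ) : 0 < (sE A (Bᴴ * B) z y).im := by
  have h := (MM_neg hA _ (cdiv_im hz e) y).im_trace' hη B (‖MM A (z / e) y‖ + 1) (by linarith)
  have hzi := inv_im_nonneg hz
  have he' : (0 : ℝ) < e := by exact_mod_cast he
  rw [sE, Complex.add_im, show ((e : ℂ))⁻¹ = (((e : ℝ)⁻¹ : ℝ) : ℂ) by push_cast; rfl, Complex.im_ofReal_mul]
  have h1 : 0 < ((MM A (z / e) y)⁻¹ * (Bᴴ * B)).trace.im :=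
    pos_of_mul_pos_right (lt_of_lt_of_le (mul_pos hη hP) h) (sq_nonneg _)
  have := mul_pos (inv_pos.mpr he') h1
  linarith

set_option maxHeartbeats 1000000 in
theorem layer_de {σ σ' σ'' : ℝ → ℝ} {lam b a : ℝ} (h : Act σ σ' σ'' lam b a) (B B' K : ℝ) (hK : 1 ≤ K) :
    ∃ C, 1 ≤ C ∧ ∀ (d n e : ℕ) (X : Matrix (Fin d) (Fin n) ℝ) (ε η δ : ℝ) (A D : Matrix (Fin n) (Fin n) ℂ) (z s : ℂ), 1 ≤ n →
      0 < e → (e : ℝ) ≤ K * n → (n : ℝ) ≤ K * e → ε ≤ 1 / 2 → IsOrthonormal ε B X → 0 < η → NegI η A → z.im ≤ 0 → z ≠ 0 → η⁻¹ ≤ K →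
      ‖z‖ ≤ K → ‖z⁻¹‖ ≤ K → ‖A‖ ≤ K → ‖D‖ ≤ K → (K ^ 5)⁻¹ ≤ s.im → 0 < δ → C * (ε + Real.sqrt n * ε ^ 2) ≤ δ →
      gaussianMat e d {W | ‖nextX σ W X‖ ≤ B' ∧
        n * (C * (δ + (n : ℝ)⁻¹ + ‖s - z⁻¹ - (e : ℂ)⁻¹ * (Rt A (cx (Phi b X)) s * cx (Phi b X)).trace‖)) <
          ‖((A + z • cx ((nextX σ W X)ᵀ * nextX σ W X))⁻¹ * D).trace - (Rt A (cx (Phi b X)) s * D).trace‖} ≤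
        ENNReal.ofReal (C / (δ ^ 6 * n ^ 2)) := by
  obtain ⟨C0, hC0, hq⟩ := quad_union h B 3 (by norm_num)
  have hb : b ^ 2 ≤ 1 := h.b_sq_le
  obtain ⟨K2, hK2⟩ : ∃ K2, K2 = 3 + K + B' ^ 2 + K * B' ^ 2 + B ^ 2 := ⟨_, rfl⟩
  have hBB : 0 ≤ K * B' ^ 2 := by positivity
  have hB0' := sq_nonneg B
  have hB1' := sq_nonneg B'
  have hKK : K ≤ K2 := by linarith
  have hK2' : 3 ≤ K2 := by linarith
  have hk3 : K + K * B' ^ 2 ≤ K2 := by linarith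
  have hk4 : K * B' ^ 2 ≤ K2 := by linarith
  have hk5 : 1 + B ^ 2 ≤ K2 := by linarith
  clear hB0' hB1' hK2
  have hK20 : 0 < K2 := by linarith
  obtain ⟨C, hC⟩ : ∃ C, C = 49 * K2 ^ 32 * (6 * K2 ^ 29) + 3 * K * C0 * (K2 ^ 3) ^ 6 + C0 * K2 ^ 3 := ⟨_, rfl⟩
  have hc1 : 49 * K2 ^ 32 * (6 * K2 ^ 29) ≤ C := by rw [hC, add_assoc]; exact le_add_of_nonneg_right (by positivity)
  have hc2 : 3 * K * C0 * (K2 ^ 3) ^ 6 ≤ C := by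
    rw [hC, add_assoc, add_left_comm]; exact le_add_of_nonneg_right (by positivity)
  have hc3 : C0 * K2 ^ 3 ≤ C := by rw [hC]; exact le_add_of_nonneg_left (by positivity)
  have hc4 : 49 * K2 ^ 32 ≤ C := by
    refine le_trans (le_mul_of_one_le_right (by positivity) ?_) hc1
    have := one_le_pow₀ (n := 29) (show 1 ≤ K2 by linarith)
    linarith
  refine ⟨C, le_trans (by have := one_le_pow₀ (n := 32) (show 1 ≤ K2 by linarith)
                          linarith) hc4, ?_⟩
  intro d n e X ε η δ A D z s hn he heK hnK hε hX hη hA hz hz0 hηK hzK hz1 hAK hDK hs hδ hsm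
  obtain ⟨B0, hB0⟩ := Phi_fac (b := b) X hb
  have hPn := (nrm_ofReal _).trans (norm_Phi hb hX)
  have hPt := tr_Phi hb hε hX
  change ‖cx (Phi b X)‖ ≤ _ at hPn
  have hεn : 0 ≤ ε := (abs_nonneg _).trans (hX.1 ⟨0, hn⟩)
  have hn0 : (0 : ℝ) < n := by exact_mod_cast hn
  have he0 : (0 : ℝ) < e := by exact_mod_cast he
  -- the three families
  let y : (Fin e → Fin d → ℝ) → Matrix (Fin e) (Fin n) ℝ := fun W => (of W * X).map σ
  let P := cx (Phi b X)
  let R : Fin e → (Fin e → Fin d → ℝ) → Matrix (Fin n) (Fin n) ℂ := fun i W => (MM A (z / e) (loo (y W) i))⁻¹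
  let T : Fin e → (Fin e → Fin d → ℝ) → Matrix (Fin n) (Fin n) ℂ := fun i W => Rt A P (sE A P z (loo (y W) i))
  have hy : Continuous y := by
    refine Continuous.matrix_map ?_ h.cont
    exact Continuous.matrix_mul continuous_id continuous_const
  have hRc : ∀ i, Continuous (R i) := fun i =>
    cont_inv (cont_MM A _ ((cont_loo i).comp hy)) fun W => (MM_neg hA _ (cdiv_im hz e) _).isUnit hη
  have hspos : ∀ Y : Matrix (Fin e) (Fin n) ℝ, 0 < (sE A P z Y).im := fun Y => by
    simp only [P, hB0]
    exact sE_pos hη hA hz he (by rw [← hB0]; linarith) Y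
  have hRn : ∀ i W, ‖R i W‖ ≤ K2 := fun i W => ((MM_neg hA _ (cdiv_im hz e) _).norm_inv hη).trans (hηK.trans hKK)
  have hTn : ∀ i W, ‖T i W‖ ≤ K2 := fun i W => by
    have := Rt_norm (B := cx B0) hη hA _ (hspos (loo (y W) i)).le
    rw [← hB0] at this
    exact this.trans (hηK.trans hKK)
  have hTc : ∀ i, Continuous (T i) := fun i => by
    refine cont_inv (continuous_const.add (Continuous.smul (f := fun W => (sE A P z (loo (y W) i))⁻¹) (Continuous.inv₀ ?_ fun W h0 => ?_) continuous_const)) fun W => ?_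
    · exact continuous_const.add (continuous_const.mul ((hRc i).matrix_mul continuous_const).matrix_trace)
    · have := hspos (loo (y W) i); rw [h0] at this; simp at this
    · have := (hA.add _ (inv_im_nonpos (hspos (loo (y W) i)).le) (cx B0)).isUnit hη
      rwa [← hB0] at this
  have hloo : ∀ i W w, loo (y (Function.update W i w)) i = loo (y W) i := by
    intro i W w
    ext j k
    simp only [loo, y]
    split_ifs with hj
    · rfl
    · simp [Matrix.mul_apply, Function.update_of_ne hj]
  have hK23 : K2 ≤ K2 ^ 3 := le_self_pow₀ (by linarith) (by norm_num)
  have hsm' : C0 * K2 ^ 3 * (ε + Real.sqrt n * ε ^ 2) ≤ δ := le_trans (by gcongr) hsm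
  have hb3 : ∀ {U V Z : Matrix (Fin n) (Fin n) ℂ}, ‖U‖ ≤ K2 → ‖V‖ ≤ K2 → ‖Z‖ ≤ K2 → ‖U * (V * Z)‖ ≤ K2 ^ 3 := by
    intro U V Z hU hV hZ
    exact (nm2 hU (nm2 hV hZ)).trans (le_of_eq (by ring))
  have hPK : ‖P‖ ≤ K2 := hPn.trans hk5
  have q1 := hq d n e X ε δ (K2 ^ 3) R hn hε hX (by positivity) hδ hRc (fun i W w => by simp only [R, hloo]) (fun i W => (hRn i W).trans hK23) hsm'
  have q2 := hq d n e X ε δ (K2 ^ 3) (fun i W => R i W * (D * T i W)) hn hε hX (by positivity) hδ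
    (fun i => (hRc i).matrix_mul (continuous_const.matrix_mul (hTc i))) (fun i W w => by simp only [R, T, hloo])
    (fun i W => hb3 (hRn i W) (hDK.trans hKK) (hTn i W)) hsm'
  have q3 := hq d n e X ε δ (K2 ^ 3) (fun i W => R i W * (P * T i W)) hn hε hX (by positivity) hδ
    (fun i => (hRc i).matrix_mul (continuous_const.matrix_mul (hTc i))) (fun i W w => by simp only [R, T, hloo])
    (fun i W => hb3 (hRn i W) hPK (hTn i W)) hsm'
  refine (measure_mono (t := (_ ∪ _) ∪ _) ?_).trans ((measure_union_le _ _).trans ((add_le_add ((measure_union_le _ _).trans (add_le_add q1 q2)) q3).trans ?_))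
  · intro W hW
    obtain ⟨hW1, hW2⟩ := hW
    by_contra hcon
    simp only [Set.mem_union, Set.mem_ofPred_eq, not_or, not_exists, not_le] at hcon
    obtain ⟨⟨c1, c2⟩, c3⟩ := hcon
    refine absurd hW2 (not_lt.mpr ?_)
    have hyn : ‖y W‖ ^ 2 ≤ e * B' ^ 2 := by
      have e1 : y W = Real.sqrt e • nextX σ W X := by
        rw [nextX, smul_smul, mul_inv_cancel₀ (by positivity), one_smul]
      rw [e1, norm_smul, Real.norm_of_nonneg (by positivity), mul_pow, Real.sq_sqrt he0.le]
      gcongr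
    have hMb : ∀ Y : Matrix (Fin e) (Fin n) ℝ, ‖Y‖ ≤ ‖y W‖ → ‖MM A (z / e) Y‖ ≤ K2 := by
      intro Y hY
      refine (norm_add_le _ _).trans ?_
      rw [norm_smul, norm_div, Complex.norm_natCast]
      have h1 : ‖cx (Yᵀ * Y)‖ ≤ e * B' ^ 2 := by
        refine (nrm_ofReal _).trans ((Matrix.l2_opNorm_mul _ _).trans ?_)
        rw [nrm_transpose]
        exact le_trans (by rw [← sq]; gcongr) hyn
      have h2 : ‖z‖ / e * ‖cx (Yᵀ * Y)‖ ≤ K * B' ^ 2 := by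
        calc _ ≤ K / e * (e * B' ^ 2) := by gcongr
          _ = _ := by field_simp
      exact (add_le_add hAK h2).trans hk3
    have hgood : Good K2 η A (cx B0) D z (y W) :=
      { hK := by linarith
        hη := hη
        hA := hA
        hz := hz
        hz0 := hz0
        he := he
        heK := heK.trans (by gcongr)
        hnK := hnK.trans (by gcongr)
        hηK := hηK.trans hKK
        hzK := hzK.trans hKK
        hP := by rw [← hB0]; exact hPt.trans (mul_le_mul_of_nonneg_right (by linarith) (by linarith))
        hPK := by rw [← hB0]; exact hPK
        hD := hDK.trans hKK
        hM := hMb _ le_rfl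
        hMi := fun i => hMb _ (norm_loo _ _)
        hy := fun i => by
          have h1 : ∑ k, y W i k ^ 2 ≤ ‖y W‖ ^ 2 := by
            have h2 := nrm_mulVec_r (y W)ᵀ (Pi.single i 1)
            simpa [Pi.single_apply, nrm_transpose] using h2
          calc _ ≤ e * B' ^ 2 := h1.trans hyn
            _ ≤ (K * n) * B' ^ 2 := by gcongr
            _ = (K * B' ^ 2) * n := by ring
            _ ≤ K2 * n := by gcongr }
    have hfin := hgood.final (hAK.trans hKK) (hz1.trans hKK) s (le_trans (by gcongr) hs) δ hδ.le
      (fun i => by rw [← hB0]; exact (c1 i).le) (fun i => by rw [← hB0]; exact (c2 i).le) (fun i => by rw [← hB0]; exact (c3 i).le)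
    rw [← hB0] at hfin
    have e2 : A + z • cx ((nextX σ W X)ᵀ * nextX σ W X) = MM A (z / e) (y W) := by
      rw [MM, nextX_gram, cx_smul, smul_smul]
      congr 2
      push_cast
      rfl
    rw [e2]
    refine hfin.trans ?_
    refine mul_le_mul_of_nonneg_left ?_ hn0.le
    rw [mul_add (49 * K2 ^ 32), mul_add C, ← mul_assoc]
    gcongr
  · have hE : ∀ v : ℝ, 0 ≤ v → (e : ℝ≥0∞) * ENNReal.ofReal v + e * ENNReal.ofReal v + e * ENNReal.ofReal v = ENNReal.ofReal (3 * e * v) := by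
      intro v hv
      rw [mul_assoc, ENNReal.ofReal_mul (by norm_num), ENNReal.ofReal_mul (by positivity), ENNReal.ofReal_natCast, ENNReal.ofReal_ofNat]
      ring
    rw [hE _ (by positivity)]
    refine ENNReal.ofReal_le_ofReal ?_
    rw [mul_div_assoc', div_le_div_iff₀ (by positivity) (by positivity)]
    calc _ ≤ 3 * (K * n) * (C0 * (K2 ^ 3) ^ (2 * 3)) * (δ ^ 6 * n ^ 2) := by gcongr
      _ = (3 * K * C0 * (K2 ^ 3) ^ 6) * (δ ^ 6 * n ^ 3) := by ring
      _ ≤ C * (δ ^ 6 * n ^ 3) := by gcongr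
      _ = _ := by ring

/-- configuration space -/
abbrev Cfg (d : ℕ → ℕ) (Lm : ℕ) := ((ℓ : Fin (Lm + 1)) → Fin (d ((ℓ : ℕ) + 1)) → Fin (d (ℓ : ℕ)) → ℝ) × (Fin (d (Lm + 1)) → ℝ)
/-- law of the configuration -/
noncomputable abbrev cmu (d : ℕ → ℕ) (Lm : ℕ) : Measure (Cfg d Lm) :=
  (Measure.pi fun ℓ : Fin (Lm + 1) => gaussianMat (d ((ℓ : ℕ) + 1)) (d (ℓ : ℕ))).prod (gaussianVec (d (Lm + 1)))
/-- extend weights by zero -/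
def extW {d : ℕ → ℕ} {Lm : ℕ} (c : Cfg d Lm) (ℓ : ℕ) : Fin (d (ℓ + 1)) → Fin (d ℓ) → ℝ :=
  if h : ℓ < Lm + 1 then c.1 ⟨ℓ, h⟩ else 0
/-- replace layer -/
def updW {d : ℕ → ℕ} {Lm : ℕ} (c : Cfg d Lm) (ℓ : Fin (Lm + 1)) (w : Fin (d ((ℓ : ℕ) + 1)) → Fin (d (ℓ : ℕ)) → ℝ) : Cfg d Lm :=
  (Function.update c.1 ℓ w, c.2)
/-- layers as function of configuration -/
noncomputable def cL (σ : ℝ → ℝ) {d : ℕ → ℕ} {Lm n : ℕ} (X0 : Matrix (Fin (d 0)) (Fin n) ℝ) (c : Cfg d Lm) (ℓ : ℕ) : Matrix (Fin (d ℓ)) (Fin n) ℝ :=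
  netLayer σ d n (extW c) X0 ℓ

section
variable {σ : ℝ → ℝ} {d : ℕ → ℕ} {Lm n : ℕ} {X0 : Matrix (Fin (d 0)) (Fin n) ℝ}

lemma netLayer_congr {W W' : (ℓ : ℕ) → Fin (d (ℓ + 1)) → Fin (d ℓ) → ℝ} (ℓ : ℕ) (h : ∀ m < ℓ, W m = W' m) :
    netLayer σ d n W X0 ℓ = netLayer σ d n W' X0 ℓ := by
  induction ℓ with
  | zero => rfl
  | succ k ih => rw [netLayer, netLayer, ih fun m hm => h m (by omega), h k (by omega)]

lemma extW_upd_ne (c : Cfg d Lm) (ℓ : Fin (Lm + 1)) (w) (m : ℕ) (hm : m ≠ ℓ) : extW (updW c ℓ w) m = extW c m := by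
  unfold extW updW
  split_ifs with h
  · exact Function.update_of_ne (fun h' => hm (by rw [← h'])) _ _
  · rfl

lemma extW_upd (c : Cfg d Lm) (ℓ : Fin (Lm + 1)) (w) : extW (updW c ℓ w) ℓ = w := by
  unfold extW updW
  rw [dif_pos ℓ.2]; exact Function.update_self _ _ _

lemma cL_upd (c : Cfg d Lm) (ℓ : Fin (Lm + 1)) (w) (m : ℕ) (hm : m ≤ ℓ) : cL σ X0 (updW c ℓ w) m = cL σ X0 c m :=
  netLayer_congr m fun k hk => extW_upd_ne c ℓ w k (by omega)

lemma cL_upd_succ (c : Cfg d Lm) (ℓ : Fin (Lm + 1)) (w) : cL σ X0 (updW c ℓ w) (ℓ + 1) = nextX σ w (cL σ X0 c ℓ) := by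
  have := cL_upd (σ := σ) (X0 := X0) c ℓ w ℓ le_rfl
  unfold cL at this ⊢
  rw [netLayer, this, extW_upd]; rfl

lemma cont_extW (ℓ : ℕ) : Continuous fun c : Cfg d Lm => extW c ℓ := by
  unfold extW
  split_ifs with h
  · exact (continuous_apply _).comp continuous_fst
  · exact continuous_const

lemma cont_cL (hσ : Continuous σ) (ℓ : ℕ) : Continuous fun c : Cfg d Lm => cL σ X0 c ℓ := by
  induction ℓ with
  | zero => exact continuous_const
  | succ k ih =>
    unfold cL at ih ⊢
    simp only [netLayer]
    have h1 : Continuous fun c : Cfg d Lm => Matrix.of (extW c k) := cont_extW k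
    exact ((h1.matrix_mul ih).matrix_map hσ).const_smul (Real.sqrt (d (k + 1)))⁻¹

lemma closed_orth {d n : ℕ} (ε B : ℝ) : IsClosed {X : Matrix (Fin d) (Fin n) ℝ | IsOrthonormal ε B X} := by
  have hc : ∀ i j, Continuous fun X : Matrix (Fin d) (Fin n) ℝ => X i j := fun i j => continuous_id.matrix_elem i j
  have e : {X : Matrix (Fin d) (Fin n) ℝ | IsOrthonormal ε B X} = {X | ∀ α, |(∑ i, X i α ^ 2) - 1| ≤ ε} ∩
      ({X | ∀ α β : Fin n, α ≠ β → |∑ i, X i α * X i β| ≤ ε} ∩ ({X | ‖X‖ ≤ B} ∩ {X | ∑ α : Fin n, ((∑ i, X i α ^ 2) - 1) ^ 2 ≤ B ^ 2})) := rfl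
  rw [e]
  refine IsClosed.inter ?_ (IsClosed.inter ?_ (IsClosed.inter (isClosed_le continuous_norm continuous_const) ?_))
  · simp only [Set.ofPred_forall]
    exact isClosed_iInter fun α => isClosed_le (by fun_prop) continuous_const
  · simp only [Set.ofPred_forall]
    exact isClosed_iInter fun α => isClosed_iInter fun β => isClosed_iInter fun _ => isClosed_le (by fun_prop) continuous_const
  · exact isClosed_le (by fun_prop) continuous_const

lemma slice_bound (ℓ : Fin (Lm + 1)) (E : Set (Cfg d Lm)) (hE : MeasurableSet E) (p : ℝ≥0∞)
    (h : ∀ c, gaussianMat (d ((ℓ : ℕ) + 1)) (d (ℓ : ℕ)) {w | updW c ℓ w ∈ E} ≤ p) : cmu d Lm E ≤ p := by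
  refine fub_fst _ _ E hE p fun y => ?_
  refine fub _ ℓ _ (hE.preimage (measurable_id.prodMk measurable_const)) p fun x => ?_
  exact h (x, y)
end

/-- all hypotheses of the theorem about the network -/
structure Net {Ω : Type*} [MeasurableSpace Ω] (Pr : Measure Ω) (Lm : ℕ) (d : ℕ → ℕ → ℕ) (σ σ' σ'' : ℝ → ℝ) (lam b a : ℝ)
    (W : (n : ℕ) → (ℓ : ℕ) → Ω → Fin (d n (ℓ + 1)) → Fin (d n ℓ) → ℝ) (wOut : (n : ℕ) → Ω → Fin (d n (Lm + 1)) → ℝ)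
    (X0 : (n : ℕ) → Matrix (Fin (d n 0)) (Fin n) ℝ) (ε : ℕ → ℝ) (B : ℝ) (γ : ℕ → ℝ) : Prop where
  prob : IsProbabilityMeasure Pr
  act : Act σ σ' σ'' lam b a
  hW : ∀ n : ℕ, Measure.map (fun ω => (fun ℓ : Fin (Lm + 1) => W n ℓ ω, wOut n ω)) Pr = cmu (d n) Lm
  orth : ∀ n, IsOrthonormal (ε n) B (X0 n)
  hε : Tendsto (fun n : ℕ => ε n * (n : ℝ) ^ ((1 : ℝ) / 4)) atTop (𝓝 0)
  hγ : ∀ ℓ, 1 ≤ ℓ → ℓ ≤ Lm + 1 → 0 < γ ℓ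
  hdim : ∀ ℓ, 1 ≤ ℓ → ℓ ≤ Lm + 1 → Tendsto (fun n : ℕ => (n : ℝ) / (d n ℓ : ℝ)) atTop (𝓝 (γ ℓ))

section
variable {Ω : Type*} [MeasurableSpace Ω] {Pr : Measure Ω} {Lm : ℕ} {d : ℕ → ℕ → ℕ} {σ σ' σ'' : ℝ → ℝ} {lam b a : ℝ}
    {W : (n : ℕ) → (ℓ : ℕ) → Ω → Fin (d n (ℓ + 1)) → Fin (d n ℓ) → ℝ} {wOut : (n : ℕ) → Ω → Fin (d n (Lm + 1)) → ℝ}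
    {X0 : (n : ℕ) → Matrix (Fin (d n 0)) (Fin n) ℝ} {ε : ℕ → ℝ} {B : ℝ} {γ : ℕ → ℝ}
    (N : Net Pr Lm d σ σ' σ'' lam b a W wOut X0 ε B γ)

/-- random configuration -/
def Zc (W : (n : ℕ) → (ℓ : ℕ) → Ω → Fin (d n (ℓ + 1)) → Fin (d n ℓ) → ℝ) (wOut : (n : ℕ) → Ω → Fin (d n (Lm + 1)) → ℝ) (n : ℕ) (ω : Ω) : Cfg (d n) Lm :=
  (fun ℓ : Fin (Lm + 1) => W n ℓ ω, wOut n ω)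

include N

lemma Net.as (E : ∀ n, Set (Cfg (d n) Lm)) (hE : ∀ n, MeasurableSet (E n)) (C : ℝ)
    (h : ∀ᶠ n : ℕ in atTop, cmu (d n) Lm (E n) ≤ ENNReal.ofReal (C / (n : ℝ) ^ 2)) :
    ∀ᵐ ω ∂Pr, ∀ᶠ n in atTop, Zc W wOut n ω ∉ E n := by
  have := N.prob
  exact borel_cantelli_law Pr (Zc W wOut) (fun n => cmu (d n) Lm) N.hW E hE C h

lemma Net.as_step (ℓ : Fin (Lm + 1)) (G E : ∀ n, Set (Cfg (d n) Lm)) (hGm : ∀ n, MeasurableSet (G n)) (hE : ∀ n, MeasurableSet (E n)) (C : ℝ)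
    (hu : ∀ n c w, updW c ℓ w ∈ G n → c ∈ G n) (hG : ∀ᵐ ω ∂Pr, ∀ᶠ n in atTop, Zc W wOut n ω ∈ G n)
    (h : ∀ᶠ n : ℕ in atTop, ∀ c ∈ G n, gaussianMat (d n ((ℓ : ℕ) + 1)) (d n (ℓ : ℕ)) {w | updW c ℓ w ∈ E n} ≤ ENNReal.ofReal (C / (n : ℝ) ^ 2)) :
    ∀ᵐ ω ∂Pr, ∀ᶠ n in atTop, Zc W wOut n ω ∉ E n := by
  have := N.as (fun n => G n ∩ E n) (fun n => (hGm n).inter (hE n)) C (h.mono fun n hn => slice_bound ℓ _ ((hGm n).inter (hE n)) _ fun c => ?_)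
  · filter_upwards [hG, this] with ω a1 a2
    filter_upwards [a1, a2] with n c1 c2 c3
    exact c2 ⟨c1, c3⟩
  · by_cases hc : c ∈ G n
    · exact (measure_mono fun w hw => hw.2).trans (hn c hc)
    · rw [show {w | updW c ℓ w ∈ G n ∩ E n} = ∅ from Set.eq_empty_iff_forall_notMem.mpr fun w hw => hc (hu n c w hw.1), measure_empty]
      exact bot_le

lemma Net.dims : ∃ K, 1 ≤ K ∧ ∀ ℓ, 1 ≤ ℓ → ℓ ≤ Lm + 1 → ∀ᶠ n : ℕ in atTop, 1 ≤ n ∧ 0 < d n ℓ ∧ (d n ℓ : ℝ) ≤ K * n ∧ (n : ℝ) ≤ K * d n ℓ := by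
  have key : ∀ ℓ, 1 ≤ ℓ → ℓ ≤ Lm + 1 → ∃ K : ℝ, 1 ≤ K ∧ ∀ᶠ n : ℕ in atTop, 1 ≤ n ∧ 0 < d n ℓ ∧ (d n ℓ : ℝ) ≤ K * n ∧ (n : ℝ) ≤ K * d n ℓ := by
    intro ℓ h1 h2
    have hg := N.hγ ℓ h1 h2
    refine ⟨1 + 2 * γ ℓ + 2 / γ ℓ, by have : 0 < 2 / γ ℓ := by positivity
                                      linarith, ?_⟩
    filter_upwards [(N.hdim ℓ h1 h2).eventually (lt_mem_nhds (show γ ℓ / 2 < γ ℓ by linarith)),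
      (N.hdim ℓ h1 h2).eventually (gt_mem_nhds (show γ ℓ < 2 * γ ℓ by linarith)), eventually_ge_atTop 1] with n e1 e2 e3
    have hd : 0 < d n ℓ := by
      by_contra hc
      have : d n ℓ = 0 := by omega
      rw [this] at e1
      simp at e1; linarith
    have hd' : (0 : ℝ) < d n ℓ := by exact_mod_cast hd
    rw [lt_div_iff₀ hd'] at e1
    rw [div_lt_iff₀ hd'] at e2
    have hq : 0 < 2 / γ ℓ := by positivity
    have hn : (0 : ℝ) ≤ n := by positivity
    refine ⟨e3, hd, ?_, ?_⟩
    · have : (d n ℓ : ℝ) ≤ 2 / γ ℓ * n := by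
        rw [div_mul_eq_mul_div, le_div_iff₀ hg]; linarith
      nlinarith [mul_nonneg hg.le hn]
    · nlinarith [mul_nonneg hq.le hd'.le]
  choose! K hK1 hK2 using key
  refine ⟨1 + ∑ ℓ ∈ Finset.Icc 1 (Lm + 1), K ℓ, ?_, fun ℓ h1 h2 => ?_⟩
  · have : 0 ≤ ∑ ℓ ∈ Finset.Icc 1 (Lm + 1), K ℓ := Finset.sum_nonneg fun ℓ hℓ => by
      rw [Finset.mem_Icc] at hℓ
      linarith [hK1 ℓ hℓ.1 hℓ.2]
    linarith
  · have hle : K ℓ ≤ 1 + ∑ ℓ ∈ Finset.Icc 1 (Lm + 1), K ℓ := by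
      have := Finset.single_le_sum (f := K) (fun i hi => by
        rw [Finset.mem_Icc] at hi
        linarith [hK1 i hi.1 hi.2]) (Finset.mem_Icc.mpr ⟨h1, h2⟩)
      linarith
    filter_upwards [hK2 ℓ h1 h2] with n ⟨a1, a2, a3, a4⟩
    exact ⟨a1, a2, a3.trans (by gcongr), a4.trans (by gcongr)⟩

omit N in
lemma eps_half {ε : ℕ → ℝ} (hε : Tendsto (fun n : ℕ => ε n * (n : ℝ) ^ ((1 : ℝ) / 4)) atTop (𝓝 0)) (τ : ℝ) (hτ : 0 < τ) :
    ∀ᶠ n : ℕ in atTop, |ε n| * (n : ℝ) ^ ((1 : ℝ) / 4) ≤ τ ∧ |ε n| ≤ τ := by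
  have h := hε.abs.eventually (gt_mem_nhds (show |(0 : ℝ)| < τ by simpa using hτ))
  filter_upwards [h, eventually_ge_atTop 1] with n hn h1
  rw [abs_mul, abs_of_nonneg (by positivity : (0 : ℝ) ≤ (n : ℝ) ^ ((1 : ℝ) / 4))] at hn
  refine ⟨hn.le, le_trans (le_mul_of_one_le_right (abs_nonneg _) ?_) hn.le⟩
  exact Real.one_le_rpow (by exact_mod_cast h1) (by norm_num)

theorem Net.orth_as (ℓ : ℕ) (hℓ : ℓ ≤ Lm + 1) : ∃ (εl : ℕ → ℝ) (Bl : ℝ), Tendsto (fun n : ℕ => εl n * (n : ℝ) ^ ((1 : ℝ) / 4)) atTop (𝓝 0) ∧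
    ∀ᵐ ω ∂Pr, ∀ᶠ n in atTop, IsOrthonormal (εl n) Bl (cL σ (X0 n) (Zc W wOut n ω) ℓ) := by
  induction ℓ with
  | zero => exact ⟨ε, B, N.hε, Eventually.of_forall fun ω => Eventually.of_forall fun n => N.orth n⟩
  | succ k ih =>
    obtain ⟨εl, Bl, h1, h2⟩ := ih (by omega)
    obtain ⟨K, hK, hd⟩ := N.dims
    obtain ⟨C, hC, B', hB', hs⟩ := one_step N.act Bl K (by linarith)
    refine ⟨fun n => C * (εl n + (n : ℝ) ^ (-(3 / 8) : ℝ)), B', ?_, ?_⟩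
    · have h3 : Tendsto (fun n : ℕ => (n : ℝ) ^ (-(1 / 8) : ℝ)) atTop (𝓝 0) :=
        (tendsto_rpow_neg_atTop (by norm_num)).comp tendsto_natCast_atTop_atTop
      have h4 := (h1.add h3).const_mul C
      rw [add_zero, mul_zero] at h4
      refine h4.congr' ?_
      filter_upwards [eventually_ge_atTop 1] with n hn
      have hn' : (0 : ℝ) < n := by exact_mod_cast hn
      rw [mul_assoc, add_mul, ← Real.rpow_add hn']
      norm_num
    · have hc := fun (n : ℕ) (j : ℕ) => cont_cL (d := d n) (Lm := Lm) (X0 := X0 n) N.act.cont j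
      have := N.as_step ⟨k, by omega⟩ (fun n => {c | IsOrthonormal (εl n) Bl (cL σ (X0 n) c k)})
        (fun n => {c | IsOrthonormal (C * (εl n + (n : ℝ) ^ (-(3 / 8) : ℝ))) B' (cL σ (X0 n) c (k + 1))}ᶜ)
        (fun n => ((closed_orth _ _).preimage (hc n k)).measurableSet) (fun n => ((closed_orth _ _).preimage (hc n (k + 1))).measurableSet.compl) C
        (fun n c w hw => ?_) h2 ?_
      · simpa using this
      · have e := cL_upd (σ := σ) (X0 := X0 n) c ⟨k, by omega⟩ w k le_rfl
        rwa [Set.mem_ofPred_eq, e] at hw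
      · filter_upwards [hd (k + 1) (by omega) (by omega), eps_half h1 (1 / 2) (by norm_num)] with n ⟨d1, d2, d3, d4⟩ hε2 c ho
        refine (measure_mono ?_).trans (hs (d n k) n (d n (k + 1)) _ (εl n) d1 d4 ((le_abs_self _).trans hε2.2) ho)
        intro w hw
        have e := cL_upd_succ (σ := σ) (X0 := X0 n) c ⟨k, by omega⟩ w
        simp only [Set.mem_compl_iff, Set.mem_ofPred_eq] at e hw ⊢
        rwa [e] at hw
end

/-- linear combination of Gram matrices -/
noncomputable def Yv {d : ℕ → ℕ} {n : ℕ} (X : (ℓ : ℕ) → Matrix (Fin (d ℓ)) (Fin n) ℝ) (ℓ : ℕ) (zv : Fin (ℓ + 2) → ℂ) : Matrix (Fin n) (Fin n) ℂ :=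
  zv 0 • 1 + ∑ i : Fin (ℓ + 1), zv i.succ • cx ((X i)ᵀ * X i)

section
variable {d : ℕ → ℕ} {n : ℕ} (X : (ℓ : ℕ) → Matrix (Fin (d ℓ)) (Fin n) ℝ) {ℓ : ℕ}

lemma Yv_succ (zv : Fin (ℓ + 3) → ℂ) :
    Yv X (ℓ + 1) zv = Yv X ℓ (fun i => zv i.castSucc) + zv (Fin.last (ℓ + 2)) • cx ((X (ℓ + 1))ᵀ * X (ℓ + 1)) := by
  unfold Yv
  rw [Fin.sum_univ_castSucc, ← add_assoc]
  rfl

lemma Yv_lin (c : ℂ) (u v : Fin (ℓ + 2) → ℂ) : Yv X ℓ (fun i => u i + c * v i) = Yv X ℓ u + c • Yv X ℓ v := by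
  unfold Yv
  simp only [add_smul, mul_smul, Finset.sum_add_distrib, ← Finset.smul_sum, smul_add]
  abel

lemma Yv_eVec (b : ℝ) : Yv X ℓ (eVec b ℓ) = cx (Phi b (X ℓ)) := by
  unfold Yv
  rw [Fin.sum_univ_castSucc, Finset.sum_eq_zero, zero_add, Phi, cx_add, cx_smul, cx_smul]
  · have e : cx (1 : Matrix (Fin n) (Fin n) ℝ) = 1 := by simp [cx]
    rw [e]
    simp [eVec, Fin.ext_iff]
  · intro i _
    have := i.2
    simp [eVec, Fin.ext_iff, this.ne]

lemma Yv_zprev (b : ℝ) (s : ℂ) (zv : Fin (ℓ + 3) → ℂ) :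
    Yv X ℓ (zprevVec b s zv) = Yv X ℓ (fun i => zv i.castSucc) + s⁻¹ • cx (Phi b (X ℓ)) := by
  rw [← Yv_eVec, ← Yv_lin]
  congr 1; ext i
  unfold zprevVec eVec
  by_cases h : i = 0
  · subst h; simp [Fin.ext_iff]; ring
  · simp [h]; split_ifs <;> ring

lemma Yv_wprev (zv wv : Fin (ℓ + 3) → ℂ) (hz : zv (Fin.last (ℓ + 2)) ≠ 0) :
    Yv X (ℓ + 1) wv = (wv (Fin.last (ℓ + 2)) / zv (Fin.last (ℓ + 2))) • Yv X (ℓ + 1) zv + Yv X ℓ (wprevVec zv wv) := by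
  have : wprevVec zv wv = fun i => wv i.castSucc + (-(wv (Fin.last (ℓ + 2)) / zv (Fin.last (ℓ + 2)))) * zv i.castSucc := by
    ext i; unfold wprevVec; ring
  rw [this, Yv_lin, Yv_succ, Yv_succ, smul_add, smul_smul, div_mul_cancel₀ _ hz, neg_smul]
  abel

lemma NegI.smul_one (c : ℂ) : NegI (-c.im) (c • (1 : Matrix (Fin n) (Fin n) ℂ)) := by
  intro v
  rw [Matrix.smul_mulVec, Matrix.one_mulVec, dotProduct_smul, star_dot_self, smul_eq_mul, Complex.mul_im, Complex.ofReal_re, Complex.ofReal_im]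
  simp

lemma Yv_neg (zv : Fin (ℓ + 2) → ℂ) (h : ∀ i, i ≠ 0 → (zv i).im ≤ 0) : NegI (-(zv 0).im) (Yv X ℓ zv) := by
  unfold Yv
  generalize (Finset.univ : Finset (Fin (ℓ + 1))) = S
  induction S using Finset.induction_on with
  | empty => simpa using NegI.smul_one (zv 0)
  | insert i S hi ih =>
    rw [Finset.sum_insert hi, add_comm (_ • _) (∑ _ ∈ _, _), ← add_assoc, cx_gram]
    exact ih.add _ (h _ (Fin.succ_ne_zero i)) _

lemma norm_one_le : ‖(1 : Matrix (Fin n) (Fin n) ℂ)‖ ≤ 1 := by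
  rw [← Matrix.diagonal_one]; exact nrm_diag _ _ zero_le_one fun i => by simp

lemma norm_gram {m n : ℕ} (X : Matrix (Fin m) (Fin n) ℝ) {B : ℝ} (h : ‖X‖ ≤ B) : ‖cx (Xᵀ * X)‖ ≤ B ^ 2 := by
  refine (nrm_ofReal _).trans ((Matrix.l2_opNorm_mul _ _).trans ?_)
  rw [nrm_transpose, ← sq]
  gcongr

lemma Yv_norm (zv : Fin (ℓ + 2) → ℂ) (B : ℝ) (h : ∀ i ≤ ℓ, ‖X i‖ ≤ B) : ‖Yv X ℓ zv‖ ≤ ‖zv 0‖ + ∑ i : Fin (ℓ + 1), ‖zv i.succ‖ * B ^ 2 := by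
  unfold Yv
  refine (norm_add_le _ _).trans (add_le_add ?_ ((norm_sum_le _ _).trans (Finset.sum_le_sum fun i _ => ?_)))
  · rw [norm_smul]; exact mul_le_of_le_one_right (norm_nonneg _) norm_one_le
  · rw [norm_smul]; exact mul_le_mul_of_nonneg_left (norm_gram _ (h i (by omega))) (norm_nonneg _)
end

lemma InDomZ.im {ℓ : ℕ} {zv : Fin (ℓ + 2) → ℂ} (h : InDomZ zv) (i) (hi : i ≠ 0) : (zv i).im ≤ 0 := by
  by_cases hl : i = Fin.last (ℓ + 1)
  · rw [hl]; exact h.2.2.1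
  · exact (h.2.1 i hi hl).le

lemma InDomZ.prev {ℓ : ℕ} {zv : Fin (ℓ + 3) → ℂ} (h : InDomZ zv) {b : ℝ} (hb : b ≠ 0) (hb1 : b ^ 2 ≤ 1) {s : ℂ} (hs : 0 < s.im) :
    InDomZ (zprevVec b s zv) := by
  have key : ∀ r : ℝ, ((r : ℂ) / s).im = r * (s⁻¹).im := fun r => by rw [div_eq_mul_inv, Complex.im_ofReal_mul]
  have hsi : (s⁻¹).im < 0 := by
    rw [Complex.inv_im]
    exact div_neg_of_neg_of_pos (by linarith) (Complex.normSq_pos.mpr fun h0 => by simp [h0] at hs)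
  have h1 : ((1 - (b : ℂ) ^ 2) / s).im ≤ 0 := by
    have := key (1 - b ^ 2)
    push_cast at this
    rw [this]; exact mul_nonpos_of_nonneg_of_nonpos (by linarith) hsi.le
  have h2 : ((b : ℂ) ^ 2 / s).im < 0 := by
    have := key (b ^ 2)
    push_cast at this
    rw [this]; exact mul_neg_of_pos_of_neg (by positivity) hsi
  have hl : (zprevVec b s zv (Fin.last (ℓ + 1))).im < 0 := by
    have := h.2.1 (Fin.last (ℓ + 1)).castSucc (by simp [Fin.ext_iff]) (by simp [Fin.ext_iff])
    simp only [zprevVec, if_true, Complex.add_im, this]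
    simp [Fin.ext_iff]
    exact h2
  refine ⟨?_, fun i h0 hi => ?_, hl.le, fun h0 => by rw [h0] at hl; simp at hl⟩
  · have := h.1
    simp only [zprevVec, Complex.add_im, if_true, Fin.castSucc_zero]
    simp [Fin.ext_iff]
    linarith
  · have := h.2.1 i.castSucc (fun e => h0 (Fin.castSucc_injective _ e)) (Fin.castSucc_lt_last i).ne
    simp [zprevVec, h0, hi, this]

section
variable {σ : ℝ → ℝ} {d : ℕ → ℕ} {Lm n : ℕ} {X0 : Matrix (Fin (d 0)) (Fin n) ℝ}

lemma cont_Yv (hσ : Continuous σ) (ℓ : ℕ) (zv : Fin (ℓ + 2) → ℂ) : Continuous fun c : Cfg d Lm => Yv (cL σ X0 c) ℓ zv := by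
  unfold Yv
  refine continuous_const.add (continuous_finsetSum _ fun i _ => ?_)
  have := cont_cL (d := d) (Lm := Lm) (X0 := X0) hσ i
  exact (cont_cx (this.matrix_transpose.matrix_mul this)).const_smul (zv i.succ)

lemma Yv_upd (c : Cfg d Lm) (ℓ : Fin (Lm + 1)) (w) (zv) : Yv (cL σ X0 (updW c ℓ w)) ℓ zv = Yv (cL σ X0 c) ℓ zv := by
  unfold Yv
  congr 1
  refine Finset.sum_congr rfl fun i _ => ?_
  rw [cL_upd c ℓ w i (by have := i.2; omega)]
end

section
variable {Ω : Type*} [MeasurableSpace Ω] {Pr : Measure Ω} {Lm : ℕ} {d : ℕ → ℕ → ℕ} {σ σ' σ'' : ℝ → ℝ} {lam b a : ℝ}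
    {W : (n : ℕ) → (ℓ : ℕ) → Ω → Fin (d n (ℓ + 1)) → Fin (d n ℓ) → ℝ} {wOut : (n : ℕ) → Ω → Fin (d n (Lm + 1)) → ℝ}
    {X0 : (n : ℕ) → Matrix (Fin (d n 0)) (Fin n) ℝ} {ε : ℕ → ℝ} {B : ℝ} {γ : ℕ → ℝ}
    (N : Net Pr Lm d σ σ' σ'' lam b a W wOut X0 ε B γ)
include N

lemma Net.norm_as : ∃ B1, 1 ≤ B1 ∧ ∀ᵐ ω ∂Pr, ∀ᶠ n in atTop, ∀ ℓ ≤ Lm + 1, ‖cL σ (X0 n) (Zc W wOut n ω) ℓ‖ ≤ B1 := by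
  have key := fun ℓ (h : ℓ ≤ Lm + 1) => N.orth_as ℓ h
  choose! εl Bl _ h2 using key
  refine ⟨1 + ∑ ℓ ∈ Finset.range (Lm + 2), |Bl ℓ|, ?_, ?_⟩
  · have : 0 ≤ ∑ ℓ ∈ Finset.range (Lm + 2), |Bl ℓ| := Finset.sum_nonneg fun _ _ => abs_nonneg _
    linarith
  have h3 : ∀ᵐ ω ∂Pr, ∀ ℓ ∈ Finset.range (Lm + 2), ∀ᶠ n in atTop, IsOrthonormal (εl ℓ n) (Bl ℓ) (cL σ (X0 n) (Zc W wOut n ω) ℓ) := by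
    rw [eventually_all_finset]
    exact fun ℓ hℓ => h2 ℓ (by rw [Finset.mem_range] at hℓ; omega)
  filter_upwards [h3] with ω hω
  rw [← eventually_all_finset] at hω
  filter_upwards [hω] with n hn ℓ hℓ
  have hm : ℓ ∈ Finset.range (Lm + 2) := by rw [Finset.mem_range]; omega
  have := (hn ℓ hm).2.2.1
  rw [opNorm_eq] at this
  have h4 := Finset.single_le_sum (f := fun ℓ => |Bl ℓ|) (fun i _ => abs_nonneg _) hm
  have := le_abs_self (Bl ℓ)
  linarith

theorem Net.de_step (hb : b ≠ 0) (ℓ : ℕ) (hℓ : ℓ ≤ Lm) (zv : Fin (ℓ + 3) → ℂ) (hz : InDomZ zv) (wv : Fin (ℓ + 3) → ℂ) (s te tw : ℂ) (hs : 0 < s.im)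
    (hs2 : s = (zv (Fin.last (ℓ + 2)))⁻¹ + (γ (ℓ + 1) : ℂ) * te)
    (h1 : ∀ᵐ ω ∂Pr, Tendsto (fun n : ℕ => (n : ℂ)⁻¹ * ((Yv (cL σ (X0 n) (Zc W wOut n ω)) ℓ (zprevVec b s zv))⁻¹ *
      Yv (cL σ (X0 n) (Zc W wOut n ω)) ℓ (eVec b ℓ)).trace) atTop (𝓝 te))
    (h2 : ∀ᵐ ω ∂Pr, Tendsto (fun n : ℕ => (n : ℂ)⁻¹ * ((Yv (cL σ (X0 n) (Zc W wOut n ω)) ℓ (zprevVec b s zv))⁻¹ *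
      Yv (cL σ (X0 n) (Zc W wOut n ω)) ℓ (wprevVec zv wv)).trace) atTop (𝓝 tw)) :
    ∀ᵐ ω ∂Pr, Tendsto (fun n : ℕ => (n : ℂ)⁻¹ * ((Yv (cL σ (X0 n) (Zc W wOut n ω)) (ℓ + 1) zv)⁻¹ *
      Yv (cL σ (X0 n) (Zc W wOut n ω)) (ℓ + 1) wv).trace) atTop (𝓝 (wv (Fin.last (ℓ + 2)) / zv (Fin.last (ℓ + 2)) + tw)) := by
  obtain ⟨B1, hB1, hn⟩ := N.norm_as
  obtain ⟨εl, Bl, hε1, ho⟩ := N.orth_as ℓ (by omega)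
  obtain ⟨K0, hK0, hd⟩ := N.dims
  have hd := hd (ℓ + 1) (by omega) (by omega)
  set z := zv (Fin.last (ℓ + 2)) with hzdef
  set η := -(zv 0).im with hηd
  have hη : 0 < η := by have := hz.1; linarith
  have hz0 : z ≠ 0 := hz.2.2.2
  have hzi : z.im ≤ 0 := hz.2.2.1
  obtain ⟨KA, hKA⟩ : ∃ KA : ℝ, KA = ‖zv (Fin.castSucc 0)‖ + ∑ i : Fin (ℓ + 1), ‖zv i.succ.castSucc‖ * B1 ^ 2 := ⟨_, rfl⟩
  obtain ⟨KD, hKD⟩ : ∃ KA : ℝ, KA = ‖wprevVec zv wv 0‖ + ∑ i : Fin (ℓ + 1), ‖wprevVec zv wv i.succ‖ * B1 ^ 2 := ⟨_, rfl⟩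
  have p1 : 0 ≤ KA := by rw [hKA]; positivity
  have p2 : 0 ≤ KD := by rw [hKD]; positivity
  have p3 : 0 < η⁻¹ := by positivity
  have p4 : 0 < (s.im)⁻¹ := by positivity
  have p5 := norm_nonneg z
  have p6 := norm_nonneg z⁻¹
  obtain ⟨K, hK⟩ : ∃ K : ℝ, K = K0 + KA + KD + η⁻¹ + (s.im)⁻¹ + ‖z‖ + ‖z⁻¹‖ := ⟨_, rfl⟩
  have hK1 : 1 ≤ K := by rw [hK]; linarith
  have hKK : K0 ≤ K := by rw [hK]; linarith
  have hKs : (K ^ 5)⁻¹ ≤ s.im := by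
    have e1 : (s.im)⁻¹ ≤ K ^ 5 := by
      refine le_trans ?_ (le_self_pow₀ hK1 (by norm_num))
      rw [hK]; linarith
    exact inv_le_of_inv_le₀ hs e1
  obtain ⟨C, hC, hde⟩ := layer_de N.act Bl B1 K hK1
  have hcY := fun (n : ℕ) (j : ℕ) zv => cont_Yv (d := d n) (Lm := Lm) (X0 := X0 n) N.act.cont j zv
  have hcc := fun (n : ℕ) (j : ℕ) => cont_cL (d := d n) (Lm := Lm) (X0 := X0 n) N.act.cont j
  have hzp := hz.prev hb N.act.b_sq_le hs
  have hη2 : 0 < -(zprevVec b s zv 0).im := by have := hzp.1; linarith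
  let F1 := fun (n : ℕ) (c : Cfg (d n) Lm) => ((Yv (cL σ (X0 n) c) (ℓ + 1) zv)⁻¹ * Yv (cL σ (X0 n) c) ℓ (wprevVec zv wv)).trace
  let F2 := fun (n : ℕ) (c : Cfg (d n) Lm) (v : Fin (ℓ + 2) → ℂ) => ((Yv (cL σ (X0 n) c) ℓ (zprevVec b s zv))⁻¹ * Yv (cL σ (X0 n) c) ℓ v).trace
  let F3 := fun (n : ℕ) (c : Cfg (d n) Lm) => s - z⁻¹ - (d n (ℓ + 1) : ℂ)⁻¹ * F2 n c (eVec b ℓ)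
  have hc1 : ∀ n, Continuous (F1 n) := fun n =>
    ((cont_inv (hcY n (ℓ + 1) zv) fun c => (Yv_neg _ zv hz.im).isUnit hη).matrix_mul (hcY n ℓ _)).matrix_trace
  have hc2 : ∀ n v, Continuous fun c => F2 n c v := fun n v =>
    ((cont_inv (hcY n ℓ _) fun c => (Yv_neg _ _ hzp.im).isUnit hη2).matrix_mul (hcY n ℓ _)).matrix_trace
  have hc3 : ∀ n, Continuous (F3 n) := fun n => continuous_const.sub (continuous_const.mul (hc2 n _))
  let G := fun (n : ℕ) => {c : Cfg (d n) Lm | IsOrthonormal (εl n) Bl (cL σ (X0 n) c ℓ)} ∩ {c | ∀ i ≤ ℓ, ‖cL σ (X0 n) c i‖ ≤ B1}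
  have hGm : ∀ n, MeasurableSet (G n) := fun n => by
    refine (((closed_orth _ _).preimage (hcc n ℓ)).inter ?_).measurableSet
    simp only [Set.ofPred_forall]
    exact isClosed_iInter fun i => isClosed_iInter fun _ => isClosed_le (hcc n i).norm continuous_const
  have hGa : ∀ᵐ ω ∂Pr, ∀ᶠ n in atTop, Zc W wOut n ω ∈ G n := by
    filter_upwards [ho, hn] with ω a1 a2
    filter_upwards [a1, a2] with n b1 b2
    exact ⟨b1, fun i hi => b2 i (by omega)⟩
  have key : ∀ k : ℕ, ∀ᵐ ω ∂Pr, ∀ᶠ n in atTop, Zc W wOut n ω ∉ {c : Cfg (d n) Lm | ‖cL σ (X0 n) c (ℓ + 1)‖ ≤ B1} ∩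
      {c | n * (C * (((k : ℝ) + 1)⁻¹ + (n : ℝ)⁻¹ + ‖F3 n c‖)) < ‖F1 n c - F2 n c (wprevVec zv wv)‖} := by
    intro k
    have hδ : (0 : ℝ) < ((k : ℝ) + 1)⁻¹ := by positivity
    refine N.as_step ⟨ℓ, by omega⟩ G _ hGm (fun n => ?_) (C / (((k : ℝ) + 1)⁻¹) ^ 6) (fun n c w hw => ?_) hGa ?_
    · refine (isClosed_le (hcc n _).norm continuous_const).measurableSet.inter (isOpen_lt ?_ ?_).measurableSet
      · exact continuous_const.mul (continuous_const.mul (continuous_const.add (hc3 n).norm))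
      · exact ((hc1 n).sub (hc2 n _)).norm
    · have e := fun i (hi : i ≤ ℓ) => cL_upd (σ := σ) (X0 := X0 n) c ⟨ℓ, by omega⟩ w i hi
      have h1 := hw.1
      rw [Set.mem_ofPred_eq, e ℓ le_rfl] at h1
      refine ⟨h1, fun i hi => ?_⟩
      rw [← e i hi]; exact hw.2 i hi
    · obtain ⟨τ, hτ⟩ : ∃ τ : ℝ, τ = min (1 / 2) (((k : ℝ) + 1)⁻¹ / (2 * C)) := ⟨_, rfl⟩
      have hτ0 : 0 < τ := by rw [hτ]; positivity
      have hτ1 : τ ≤ 1 / 2 := by rw [hτ]; exact min_le_left _ _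
      have hτ2 : τ * (2 * C) ≤ ((k : ℝ) + 1)⁻¹ := by
        rw [← le_div_iff₀ (by positivity), hτ]; exact min_le_right _ _
      filter_upwards [hd, eps_half hε1 τ hτ0] with n ⟨d1, d2, d3, d4⟩ hε2 c hc
      have hn0 : (0 : ℝ) ≤ n := by positivity
      have q1 : εl n ≤ τ := (le_abs_self _).trans hε2.2
      have q2 : Real.sqrt n * εl n ^ 2 ≤ τ := by
        have e : Real.sqrt n * εl n ^ 2 = (|εl n| * (n : ℝ) ^ ((1 : ℝ) / 4)) ^ 2 := by
          rw [mul_pow, sq_abs, ← Real.rpow_natCast ((n : ℝ) ^ ((1 : ℝ) / 4)), ← Real.rpow_mul hn0, Real.sqrt_eq_rpow]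
          norm_num [mul_comm]
        rw [e, sq]
        nlinarith [hε2.1, mul_nonneg (abs_nonneg (εl n)) (Real.rpow_nonneg hn0 ((1 : ℝ) / 4))]
      have e := hde (d n ℓ) n (d n (ℓ + 1)) (cL σ (X0 n) c ℓ) (εl n) η (((k : ℝ) + 1)⁻¹) (Yv (cL σ (X0 n) c) ℓ fun i => zv i.castSucc)
        (Yv (cL σ (X0 n) c) ℓ (wprevVec zv wv)) z s d1 d2 (d3.trans (by gcongr)) (d4.trans (by gcongr)) (q1.trans hτ1) hc.1 hη
        (Yv_neg _ _ fun i hi => hz.im _ fun e => hi (Fin.castSucc_injective _ e))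
        hzi hz0 (by rw [hK]; linarith) (by rw [hK]; linarith) (by rw [hK]; linarith)
        ((Yv_norm _ _ B1 hc.2).trans (by rw [hK, ← hKA]; linarith))
        ((Yv_norm _ _ B1 hc.2).trans (by rw [hK, ← hKD]; linarith)) hKs hδ (by nlinarith)
      refine (measure_mono fun w hw => ?_).trans (e.trans (le_of_eq (by rw [div_div])))
      have e1 := cL_upd_succ (σ := σ) (X0 := X0 n) c ⟨ℓ, by omega⟩ w
      have e2 := fun v : Fin (ℓ + 2) → ℂ => Yv_upd (σ := σ) (X0 := X0 n) c ⟨ℓ, by omega⟩ w v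
      simp only at e1 e2
      have w1 := hw.1
      have w2 := hw.2
      simp only [F1, F2, F3, Set.mem_ofPred_eq, Yv_succ, e1, e2] at w1 w2
      rw [Yv_zprev, Yv_eVec] at w2
      exact ⟨w1, w2⟩
  rw [← ae_all_iff] at key
  filter_upwards [h1, h2, hn, key] with ω a1 a2 a3 a4
  have b1 : Tendsto (fun n => F3 n (Zc W wOut n ω)) atTop (𝓝 0) := by
    have := ((Complex.continuous_ofReal.tendsto _).comp (N.hdim (ℓ + 1) (by omega) (by omega))).mul a1
    have := (tendsto_const_nhds (x := s - z⁻¹)).sub this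
    rw [show s - z⁻¹ - (γ (ℓ + 1) : ℂ) * te = 0 by linear_combination hs2] at this
    refine this.congr' ?_
    filter_upwards [eventually_ge_atTop 1] with n hn
    have : (n : ℂ) ≠ 0 := by exact_mod_cast (by omega : n ≠ 0)
    simp only [F3, F2, Function.comp]
    push_cast
    field_simp
  have b2 : Tendsto (fun n : ℕ => (n : ℂ)⁻¹ * (F1 n (Zc W wOut n ω) - F2 n (Zc W wOut n ω) (wprevVec zv wv))) atTop (𝓝 0) := by
    rw [tendsto_zero_iff_norm_tendsto_zero, Metric.tendsto_nhds]
    intro τ hτ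
    obtain ⟨k, hk⟩ := exists_nat_one_div_lt (show 0 < τ / (2 * C) by positivity)
    have b3 : Tendsto (fun n : ℕ => C * (((k : ℝ) + 1)⁻¹ + (n : ℝ)⁻¹ + ‖F3 n (Zc W wOut n ω)‖)) atTop (𝓝 (C * (((k : ℝ) + 1)⁻¹ + 0 + ‖(0 : ℂ)‖))) :=
      (((tendsto_const_nhds (x := ((k : ℝ) + 1)⁻¹)).add tendsto_inv_atTop_nhds_zero_nat).add b1.norm).const_mul C
    have b4 : C * (((k : ℝ) + 1)⁻¹ + 0 + ‖(0 : ℂ)‖) < τ := by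
      rw [one_div, lt_div_iff₀ (by positivity)] at hk
      rw [norm_zero]; nlinarith
    filter_upwards [a3, a4 k, b3.eventually (gt_mem_nhds b4), eventually_ge_atTop 1] with n c1 c2 c3 c4
    have hn0 : (0 : ℝ) < n := by exact_mod_cast c4
    have c5 : ‖F1 n (Zc W wOut n ω) - F2 n (Zc W wOut n ω) (wprevVec zv wv)‖ ≤ n * (C * (((k : ℝ) + 1)⁻¹ + (n : ℝ)⁻¹ + ‖F3 n (Zc W wOut n ω)‖)) := by
      by_contra hcon
      exact c2 ⟨c1 _ (by omega), not_le.mp hcon⟩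
    rw [Real.dist_eq, sub_zero, abs_of_nonneg (norm_nonneg _), norm_mul, norm_inv, Complex.norm_natCast, inv_mul_lt_iff₀ hn0]
    exact c5.trans_lt (by gcongr)
  have b5 := (b2.add a2).const_add (wv (Fin.last (ℓ + 2)) / z)
  rw [zero_add] at b5
  refine b5.congr' ?_
  filter_upwards [eventually_ge_atTop 1] with n hn
  have : (n : ℂ) ≠ 0 := by exact_mod_cast (by omega : n ≠ 0)
  rw [Yv_wprev _ zv wv hz0, Matrix.mul_add, Matrix.mul_smul, (Yv_neg _ zv hz.im).inv_mul hη, Matrix.trace_add, Matrix.trace_smul, Matrix.trace_one]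
  simp only [F1, F2, Fintype.card_fin, smul_eq_mul, ← hzdef]
  field_simp
  ring
end

lemma tr_spec {n : ℕ} {H : Matrix (Fin n) (Fin n) ℝ} (hH : H.IsHermitian) (z z' w w' : ℂ) (h : ∀ i, z + z' * hH.eigenvalues i ≠ 0) :
    ((z • 1 + z' • cx H)⁻¹ * (w • 1 + w' • cx H)).trace = ∑ i, (w + w' * hH.eigenvalues i) / (z + z' * hH.eigenvalues i) := by
  obtain ⟨V, V', hV, hV', hs⟩ : ∃ V V' : Matrix (Fin n) (Fin n) ℂ, V * V' = 1 ∧ V' * V = 1 ∧ cx H = V * diagonal (fun i => (hH.eigenvalues i : ℂ)) * V' := by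
    have hs := hH.spectral_theorem
    rw [Unitary.conjStarAlgAut_apply] at hs
    have e1 : cx (1 : Matrix (Fin n) (Fin n) ℝ) = 1 := by simp [cx]
    refine ⟨cx (hH.eigenvectorUnitary : Matrix (Fin n) (Fin n) ℝ), cx (star (hH.eigenvectorUnitary : Matrix (Fin n) (Fin n) ℝ)), ?_, ?_, ?_⟩
    · rw [← cx_mul, ← e1]; exact congrArg cx (Unitary.coe_mul_star_self _)
    · rw [← cx_mul, ← e1]; exact congrArg cx (Unitary.coe_star_mul_self _)
    · have e2 : cx (diagonal ((RCLike.ofReal : ℝ → ℝ) ∘ hH.eigenvalues)) = diagonal (fun i => (hH.eigenvalues i : ℂ)) := by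
        unfold cx
        rw [Matrix.diagonal_map Complex.ofReal_zero]; rfl
      rw [← e2, ← cx_mul, ← cx_mul]
      exact congrArg cx hs
  have key : ∀ u u' : ℂ, u • 1 + u' • cx H = V * diagonal (fun i => u + u' * (hH.eigenvalues i : ℂ)) * V' := by
    intro u u'
    have e : diagonal (fun i => u + u' * (hH.eigenvalues i : ℂ)) = u • 1 + u' • diagonal (fun i => (hH.eigenvalues i : ℂ)) := by
      rw [← Matrix.diagonal_one, ← Matrix.diagonal_smul, ← Matrix.diagonal_smul, Matrix.diagonal_add]
      congr 1; ext i; simp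
    rw [e, hs, Matrix.mul_add, Matrix.add_mul, Matrix.mul_smul, Matrix.mul_smul, Matrix.mul_one, Matrix.smul_mul, Matrix.smul_mul, hV]
  have hinv : (z • 1 + z' • cx H)⁻¹ = V * diagonal (fun i => (z + z' * (hH.eigenvalues i : ℂ))⁻¹) * V' := by
    refine Matrix.inv_eq_left_inv ?_
    rw [key, Matrix.mul_assoc, ← Matrix.mul_assoc V' (V * _), ← Matrix.mul_assoc V' V, hV', Matrix.one_mul, Matrix.mul_assoc, ← Matrix.mul_assoc (diagonal _), Matrix.diagonal_mul_diagonal,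
      ← Matrix.mul_assoc, ← hV]
    have : (fun i => (z + z' * (hH.eigenvalues i : ℂ))⁻¹ * (z + z' * (hH.eigenvalues i : ℂ))) = fun _ => 1 := by
      ext i; exact inv_mul_cancel₀ (h i)
    rw [this, Matrix.diagonal_one, Matrix.mul_one]
  rw [hinv, key, Matrix.mul_assoc, ← Matrix.mul_assoc V' (V * _), ← Matrix.mul_assoc V' V, hV', Matrix.one_mul, Matrix.trace_mul_comm, Matrix.mul_assoc, ← Matrix.mul_assoc V', hV', Matrix.one_mul,
    Matrix.diagonal_mul_diagonal, Matrix.trace_diagonal]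
  refine Finset.sum_congr rfl fun i _ => ?_
  rw [div_eq_mul_inv]

lemma cx_limit {H : ∀ n : ℕ, Matrix (Fin n) (Fin n) ℝ} (hH : ∀ n, (H n).IsHermitian) {μ : Measure ℝ} [IsProbabilityMeasure μ]
    (h : ∀ f : BoundedContinuousFunction ℝ ℝ, Tendsto (fun n : ℕ => esd (H n) f) atTop (𝓝 (∫ x, f x ∂μ)))
    (F : ℝ → ℂ) (hF : Continuous F) (C : ℝ) (hC : ∀ x, ‖F x‖ ≤ C) :
    Tendsto (fun n : ℕ => (n : ℂ)⁻¹ * ∑ i, F ((hH n).eigenvalues i)) atTop (𝓝 (∫ x, F x ∂μ)) := by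
  have hi : Integrable F μ := Integrable.of_bound hF.aestronglyMeasurable C (Eventually.of_forall hC)
  have hr := h (BoundedContinuousFunction.ofNormedAddCommGroup (fun x => (F x).re) (Complex.continuous_re.comp hF) C
    fun x => (Complex.abs_re_le_norm _).trans (hC x))
  have hm := h (BoundedContinuousFunction.ofNormedAddCommGroup (fun x => (F x).im) (Complex.continuous_im.comp hF) C
    fun x => (Complex.abs_im_le_norm _).trans (hC x))
  have e1 := integral_re_add_im hi
  simp only [RCLike.re_eq_complex_re, RCLike.im_eq_complex_im, RCLike.I_to_complex, Complex.coe_algebraMap] at e1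
  rw [← e1]
  refine Tendsto.congr ?_ (((Complex.continuous_ofReal.tendsto _).comp hr).add (((Complex.continuous_ofReal.tendsto _).comp hm).mul_const Complex.I))
  intro n
  simp only [Function.comp, esd, dif_pos (hH n), BoundedContinuousFunction.coe_ofNormedAddCommGroup]
  push_cast
  rw [mul_assoc, ← mul_add, Finset.sum_mul, ← Finset.sum_add_distrib]
  congr 1
  exact Finset.sum_congr rfl fun i _ => Complex.re_add_im _

section
variable {Ω : Type*} [MeasurableSpace Ω] {Pr : Measure Ω} {Lm : ℕ} {d : ℕ → ℕ → ℕ} {σ σ' σ'' : ℝ → ℝ} {lam b a : ℝ}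
    {W : (n : ℕ) → (ℓ : ℕ) → Ω → Fin (d n (ℓ + 1)) → Fin (d n ℓ) → ℝ} {wOut : (n : ℕ) → Ω → Fin (d n (Lm + 1)) → ℝ}
    {X0 : (n : ℕ) → Matrix (Fin (d n 0)) (Fin n) ℝ} {ε : ℕ → ℝ} {B : ℝ} {γ : ℕ → ℝ}

lemma de_base (μ0 : Measure ℝ) [IsProbabilityMeasure μ0] (hμ0supp : μ0 (Set.Iio 0) = 0)
    (hμ0conv : ∀ f : BoundedContinuousFunction ℝ ℝ, Tendsto (fun n : ℕ => esd ((X0 n)ᵀ * X0 n) f) atTop (𝓝 (∫ x, f x ∂μ0)))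
    (zv wv : Fin 2 → ℂ) (hz : InDomZ zv) (ω : Ω) : Tendsto (fun n : ℕ => (n : ℂ)⁻¹ * ((Yv (cL σ (X0 n) (Zc W wOut n ω)) 0 zv)⁻¹ *
      Yv (cL σ (X0 n) (Zc W wOut n ω)) 0 wv).trace) atTop (𝓝 (∫ x, (wv 0 + wv 1 * x) / (zv 0 + zv 1 * x) ∂μ0)) := by
  have hps : ∀ n, ((X0 n)ᵀ * X0 n).PosSemidef := fun n => Matrix.posSemidef_conjTranspose_mul_self (X0 n)
  have h0 := hz.1
  have h1 : (zv 1).im ≤ 0 := hz.2.2.1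
  have h2 : zv 1 ≠ 0 := hz.2.2.2
  have him : ∀ y : ℝ, 0 ≤ y → (zv 0 + zv 1 * y).im ≤ (zv 0).im := fun y hy => by
    simp; nlinarith
  have hne : ∀ y : ℝ, 0 ≤ y → zv 0 + zv 1 * y ≠ 0 := fun y hy e => by
    have := him y hy
    rw [e] at this; simp at this; linarith
  have hFc : Continuous fun x : ℝ => (wv 0 + wv 1 * (max x 0 : ℝ)) / (zv 0 + zv 1 * (max x 0 : ℝ)) :=
    Continuous.div (by fun_prop) (by fun_prop) fun x => hne _ (le_max_right _ _)
  have := cx_limit (fun n => (hps n).1) hμ0conv _ hFc (‖wv 1 / zv 1‖ + ‖wv 0 - wv 1 * zv 0 / zv 1‖ / -(zv 0).im) fun x => ?_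
  · have e1 : ∫ x : ℝ, (wv 0 + wv 1 * (max x 0 : ℝ)) / (zv 0 + zv 1 * (max x 0 : ℝ)) ∂μ0 = ∫ x : ℝ, (wv 0 + wv 1 * x) / (zv 0 + zv 1 * x) ∂μ0 := by
      refine integral_congr_ae ?_
      have : ∀ᵐ x ∂μ0, x ∉ Set.Iio (0 : ℝ) := measure_eq_zero_iff_ae_notMem.mp hμ0supp
      filter_upwards [this] with x hx
      rw [max_eq_left (by simpa using hx)]
    rw [e1] at this
    refine this.congr fun n => ?_
    have e2 : ∀ u : Fin 2 → ℂ, Yv (cL σ (X0 n) (Zc W wOut n ω)) 0 u = u 0 • 1 + u 1 • cx ((X0 n)ᵀ * X0 n) := fun u => by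
      unfold Yv; simp; rfl
    rw [e2, e2, tr_spec (hps n).1 _ _ _ _ fun i => hne _ ((hps n).eigenvalues_nonneg i)]
    congr 1
    refine Finset.sum_congr rfl fun i _ => ?_
    rw [max_eq_left ((hps n).eigenvalues_nonneg i)]
  · have hn := hne _ (le_max_right x 0)
    have e : (wv 0 + wv 1 * (max x 0 : ℝ)) / (zv 0 + zv 1 * (max x 0 : ℝ)) = wv 1 / zv 1 + (wv 0 - wv 1 * zv 0 / zv 1) / (zv 0 + zv 1 * (max x 0 : ℝ)) := by
      rw [div_add_div _ _ h2 hn, div_eq_div_iff hn (mul_ne_zero h2 hn)]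
      field_simp
      ring
    rw [e]
    refine (norm_add_le _ _).trans (add_le_add le_rfl ?_)
    rw [norm_div]
    have h3 := him _ (le_max_right x 0)
    have h4 := (neg_le_abs _).trans (Complex.abs_im_le_norm (zv 0 + zv 1 * (max x 0 : ℝ)))
    exact div_le_div_of_nonneg_left (norm_nonneg _) (by linarith) (by linarith)

theorem Net.de (N : Net Pr Lm d σ σ' σ'' lam b a W wOut X0 ε B γ) (hb : b ≠ 0) (μ0 : Measure ℝ) [IsProbabilityMeasure μ0] (hμ0supp : μ0 (Set.Iio 0) = 0)
    (hμ0conv : ∀ f : BoundedContinuousFunction ℝ ℝ, Tendsto (fun n : ℕ => esd ((X0 n)ᵀ * X0 n) f) atTop (𝓝 (∫ x, f x ∂μ0)))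
    (t : (ℓ : ℕ) → (Fin (ℓ + 2) → ℂ) → (Fin (ℓ + 2) → ℂ) → ℂ) (s : (ℓ : ℕ) → (Fin (ℓ + 2) → ℂ) → ℂ)
    (ht0 : ∀ zv : Fin 2 → ℂ, InDomZ zv → ∀ wv : Fin 2 → ℂ, t 0 zv wv = ∫ x, (wv 0 + wv 1 * x) / (zv 0 + zv 1 * x) ∂μ0)
    (hs : ∀ ℓ : ℕ, ℓ ≤ Lm → ∀ zv : Fin (ℓ + 3) → ℂ, InDomZ zv → 0 < (s (ℓ + 1) zv).im ∧
        s (ℓ + 1) zv = (zv (Fin.last (ℓ + 2)))⁻¹ + (γ (ℓ + 1) : ℂ) * t ℓ (zprevVec b (s (ℓ + 1) zv) zv) (eVec b ℓ))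
    (ht : ∀ ℓ : ℕ, ℓ ≤ Lm → ∀ zv : Fin (ℓ + 3) → ℂ, InDomZ zv → ∀ wv : Fin (ℓ + 3) → ℂ,
        t (ℓ + 1) zv wv = wv (Fin.last (ℓ + 2)) / zv (Fin.last (ℓ + 2)) + t ℓ (zprevVec b (s (ℓ + 1) zv) zv) (wprevVec zv wv)) (ℓ : ℕ) (hℓ : ℓ ≤ Lm + 1) :
    ∀ (zv : Fin (ℓ + 2) → ℂ), InDomZ zv → ∀ wv, ∀ᵐ ω ∂Pr, Tendsto (fun n : ℕ => (n : ℂ)⁻¹ * ((Yv (cL σ (X0 n) (Zc W wOut n ω)) ℓ zv)⁻¹ *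
      Yv (cL σ (X0 n) (Zc W wOut n ω)) ℓ wv).trace) atTop (𝓝 (t ℓ zv wv)) := by
  induction ℓ with
  | zero =>
    intro zv hz wv
    refine Eventually.of_forall fun ω => ?_
    rw [ht0 zv hz]
    exact de_base μ0 hμ0supp hμ0conv zv wv hz ω
  | succ k ih =>
    intro zv hz wv
    obtain ⟨h1, h2⟩ := hs k (by omega) zv hz
    have hp := hz.prev hb N.act.b_sq_le h1
    rw [ht k (by omega) zv hz]
    exact N.de_step hb k (by omega) zv hz wv _ _ _ h1 h2 (ih (by omega) _ hp _) (ih (by omega) _ hp _)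
end

/-- points on the imaginary axis -/
noncomputable def zj (j : ℕ) : ℂ := ((j + 1 : ℝ) : ℂ) * Complex.I

lemma sub_z_norm (z : ℂ) (x : ℝ) : |z.im| ≤ ‖(x : ℂ) - z‖ := by
  have := Complex.abs_im_le_norm ((x : ℂ) - z)
  simpa using this

lemma zj_im (j : ℕ) : (zj j).im = j + 1 := by simp [zj]

lemma sub_z_ne {z : ℂ} (hz : 0 < z.im) (x : ℝ) : (x : ℂ) - z ≠ 0 := by
  intro h
  have := sub_z_norm z x
  rw [h, norm_zero, abs_of_pos hz] at this; linarith

lemma sub_z_cont {z : ℂ} (hz : 0 < z.im) : Continuous fun x : ℝ => ((x : ℂ) - z)⁻¹ :=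
  Continuous.inv₀ (by fun_prop) (sub_z_ne hz)

lemma sub_z_bd {z : ℂ} (hz : 0 < z.im) (x : ℝ) : ‖((x : ℂ) - z)⁻¹‖ ≤ z.im⁻¹ := by
  rw [norm_inv]
  exact inv_anti₀ hz (le_trans (le_abs_self _) (sub_z_norm z x))

lemma stieltjes_uniq {μ ν : Measure ℝ} [IsProbabilityMeasure μ] [IsProbabilityMeasure ν] (K : ℝ) (hμ : ∀ᵐ x ∂μ, |x| ≤ K) (hν : ∀ᵐ x ∂ν, |x| ≤ K)
    (h : ∀ j, ∫ x, ((x : ℂ) - zj j)⁻¹ ∂μ = ∫ x, ((x : ℂ) - zj j)⁻¹ ∂ν) : μ = ν := by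
  have hp : ∀ j, 0 < (zj j).im := fun j => by rw [zj_im]; positivity
  have hI : ∀ (ρ : Measure ℝ) [IsProbabilityMeasure ρ], (∀ᵐ x ∂ρ, |x| ≤ K) → ∀ f : ℝ → ℂ, Continuous f → Integrable f ρ := by
    intro ρ _ hρ f hf
    obtain ⟨C, hC⟩ := (isCompact_Icc (a := -K) (b := K)).exists_bound_of_continuousOn hf.continuousOn
    exact Integrable.of_bound hf.aestronglyMeasurable C (hρ.mono fun x hx => hC x (abs_le.mp hx))
  have hL : ∀ (ρ : Measure ℝ) [IsProbabilityMeasure ρ], (∀ᵐ x ∂ρ, |x| ≤ K) → ∀ k : ℕ,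
      Tendsto (fun j => -(zj j) * ∫ x, (x : ℂ) ^ k * ((x : ℂ) - zj j)⁻¹ ∂ρ) atTop (𝓝 (∫ x, (x : ℂ) ^ k ∂ρ)) := by
    intro ρ _ hρ k
    simp only [← integral_const_mul]
    refine tendsto_integral_of_dominated_convergence (fun _ => K ^ k) (fun j => ?_) (integrable_const _) (fun j => ?_) (Eventually.of_forall fun x => ?_)
    · exact (continuous_const.mul ((by fun_prop : Continuous fun x : ℝ => (x : ℂ) ^ k).mul (sub_z_cont (hp j)))).aestronglyMeasurable
    · refine hρ.mono fun x hx => ?_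
      have e : ‖zj j‖ = (zj j).im := by rw [zj_im]; simp [zj]; norm_cast
      rw [norm_mul, norm_neg, e, norm_mul, norm_pow, Complex.norm_real, Real.norm_eq_abs, mul_comm, mul_assoc]
      have h1 : ‖((x : ℂ) - zj j)⁻¹‖ * (zj j).im ≤ 1 := by
        have := mul_le_mul_of_nonneg_right (sub_z_bd (hp j) x) (hp j).le
        rwa [inv_mul_cancel₀ (hp j).ne'] at this
      calc |x| ^ k * (‖((x : ℂ) - zj j)⁻¹‖ * (zj j).im) ≤ |x| ^ k * 1 := by gcongr
        _ ≤ K ^ k := by rw [mul_one]; gcongr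
    · have h1 : Tendsto (fun j : ℕ => (zj j)⁻¹) atTop (𝓝 0) := by
        rw [tendsto_zero_iff_norm_tendsto_zero]
        have : ∀ j : ℕ, ‖(zj j)⁻¹‖ = 1 / ((j : ℝ) + 1) := fun j => by
          simp [zj]; norm_cast
        simp only [this]; exact tendsto_one_div_add_atTop_nhds_zero_nat
      have h2 : Tendsto (fun j : ℕ => (x : ℂ) ^ k * (1 - (x : ℂ) * (zj j)⁻¹)⁻¹) atTop (𝓝 ((x : ℂ) ^ k * (1 - (x : ℂ) * 0)⁻¹)) :=
        tendsto_const_nhds.mul ((tendsto_const_nhds.sub (tendsto_const_nhds.mul h1)).inv₀ (by simp))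
      rw [mul_zero, sub_zero, inv_one, mul_one] at h2
      refine h2.congr fun j => ?_
      have h3 : zj j ≠ 0 := fun h => by have := hp j; simp [h] at this
      have h4 := sub_z_ne (hp j) x
      have h5 : 1 - (x : ℂ) * (zj j)⁻¹ = ((x : ℂ) - zj j) * (-(zj j)⁻¹) := by field_simp; ring
      rw [h5, mul_inv, inv_neg, inv_inv]; ring
  have hM : ∀ k : ℕ, ∀ j, ∫ x, (x : ℂ) ^ k * ((x : ℂ) - zj j)⁻¹ ∂μ = ∫ x, (x : ℂ) ^ k * ((x : ℂ) - zj j)⁻¹ ∂ν := by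
    intro k
    induction k with
    | zero => simpa using h
    | succ k ih =>
      intro j
      have e0 : ∫ x, (x : ℂ) ^ k ∂μ = ∫ x, (x : ℂ) ^ k ∂ν :=
        tendsto_nhds_unique (hL μ hμ k) ((hL ν hν k).congr fun j => by rw [ih j])
      have e1 : ∀ x : ℝ, (x : ℂ) ^ (k + 1) * ((x : ℂ) - zj j)⁻¹ = (x : ℂ) ^ k + zj j * ((x : ℂ) ^ k * ((x : ℂ) - zj j)⁻¹) := fun x => by
        have := sub_z_ne (hp j) x
        field_simp; ring
      have c1 : Continuous fun x : ℝ => (x : ℂ) ^ k := by fun_prop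
      have c2 : Continuous fun x : ℝ => zj j * ((x : ℂ) ^ k * ((x : ℂ) - zj j)⁻¹) := continuous_const.mul (c1.mul (sub_z_cont (hp j)))
      simp only [e1]
      rw [integral_add (hI μ hμ _ c1) (hI μ hμ _ c2), integral_add (hI ν hν _ c1) (hI ν hν _ c2), e0, integral_const_mul, integral_const_mul, ih j]
  have hP : ∀ p : Polynomial ℝ, ∫ x, p.eval x ∂μ = ∫ x, p.eval x ∂ν := by
    have hIr : ∀ (ρ : Measure ℝ) [IsProbabilityMeasure ρ], (∀ᵐ x ∂ρ, |x| ≤ K) → ∀ f : ℝ → ℝ, Continuous f → Integrable f ρ := fun ρ _ hρ f hf => by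
      simpa using (hI ρ hρ (fun x => (f x : ℂ)) (by fun_prop)).re
    intro p
    induction p using Polynomial.induction_on' with
    | add p q h1 h2 =>
      simp only [Polynomial.eval_add]
      rw [integral_add (hIr μ hμ _ p.continuous) (hIr μ hμ _ q.continuous), integral_add (hIr ν hν _ p.continuous) (hIr ν hν _ q.continuous), h1, h2]
    | monomial k c =>
      simp only [Polynomial.eval_monomial, integral_const_mul]
      congr 1
      have e0 : ∫ x, (x : ℂ) ^ k ∂μ = ∫ x, (x : ℂ) ^ k ∂ν :=
        tendsto_nhds_unique (hL μ hμ k) ((hL ν hν k).congr fun j => by rw [hM k j])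
      have : ∀ ρ : Measure ℝ, ∫ x, (x : ℂ) ^ k ∂ρ = ((∫ x, x ^ k ∂ρ : ℝ) : ℂ) := fun ρ => by
        rw [← integral_complex_ofReal]; simp
      rw [this, this] at e0
      exact_mod_cast e0
  refine ext_of_forall_integral_eq_of_IsFiniteMeasure fun f => ?_
  refine eq_of_forall_dist_le fun ε hε => ?_
  obtain ⟨p, hp⟩ := exists_polynomial_near_of_continuousOn (-K) K f f.continuous.continuousOn (ε / 2) (by positivity)
  have key : ∀ (ρ : Measure ℝ) [IsProbabilityMeasure ρ], (∀ᵐ x ∂ρ, |x| ≤ K) → |∫ x, p.eval x ∂ρ - ∫ x, f x ∂ρ| ≤ ε / 2 := by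
    intro ρ _ hρ
    have hi : Integrable (fun x => p.eval x) ρ := by
      simpa using (hI ρ hρ (fun x => ((p.eval x : ℝ) : ℂ)) (by have := p.continuous; fun_prop)).re
    rw [← integral_sub hi (f.integrable ρ)]
    have := norm_integral_le_of_norm_le_const (μ := ρ) (f := fun x => p.eval x - f x) (C := ε / 2) (hρ.mono fun x hx => (hp x (abs_le.mp hx)).le)
    simpa using this
  have k1 := abs_le.mp (key μ hμ)
  have k2 := abs_le.mp (key ν hν)
  rw [hP p] at k1
  rw [Real.dist_eq, abs_le]
  constructor <;> linarith

lemma eig_le {n : ℕ} {H : Matrix (Fin n) (Fin n) ℝ} (hH : H.IsHermitian) (i : Fin n) : |hH.eigenvalues i| ≤ ‖H‖ := by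
  have : Nonempty (Fin n) := ⟨i⟩
  exact spectrum.norm_le_norm_of_mem (hH.eigenvalues_mem_spectrum_real i)

lemma emp_exists (n : ℕ) (v : Fin n → ℝ) : ∃ μ : ProbabilityMeasure ℝ, 1 ≤ n →
    (∀ F : ℝ → ℂ, ∫ x, F x ∂(μ : Measure ℝ) = (n : ℂ)⁻¹ * ∑ i, F (v i)) ∧ ∀ K, (∀ i, |v i| ≤ K) → μ (Set.Icc (-K) K)ᶜ = 0 := by
  by_cases hn : 1 ≤ n
  · have h0 : (n : ℝ≥0∞) ≠ 0 := by exact_mod_cast (by omega : n ≠ 0)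
    obtain ⟨P, hP⟩ : ∃ P : Measure ℝ, P = (n : ℝ≥0∞)⁻¹ • ∑ i, Measure.dirac (v i) := ⟨_, rfl⟩
    have hp : IsProbabilityMeasure P := ⟨by simp [hP, ENNReal.inv_mul_cancel h0]⟩
    refine ⟨⟨P, hp⟩, fun _ => ⟨fun F => ?_, fun K hK => ?_⟩⟩
    · simp only [ProbabilityMeasure.coe_mk]
      rw [hP, integral_smul_measure, integral_finsetSum_measure fun i _ => ?_]
      · simp
      · exact integrable_dirac (by simp)
    · have e := ProbabilityMeasure.ennreal_coeFn_eq_coeFn_toMeasure (⟨P, hp⟩ : ProbabilityMeasure ℝ) (Set.Icc (-K) K)ᶜ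
      rw [← ENNReal.coe_eq_zero]
      refine e.trans ?_
      simp only [ProbabilityMeasure.coe_mk, hP, Measure.smul_apply, Measure.finsetSum_apply, smul_eq_mul, mul_eq_zero]
      right
      refine Finset.sum_eq_zero fun i _ => ?_
      rw [Measure.dirac_apply' _ measurableSet_Icc.compl]
      simpa using abs_le.mp (hK i)
  · exact ⟨⟨Measure.dirac 0, inferInstance⟩, fun h => absurd h hn⟩

lemma wc_det {H : ∀ n : ℕ, Matrix (Fin n) (Fin n) ℝ} (hH : ∀ n, (H n).IsHermitian) (K : ℝ) (hK : ∀ᶠ n in atTop, ‖H n‖ ≤ K) (m : ℂ → ℂ)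
    (hm : ∀ j, Tendsto (fun n : ℕ => (n : ℂ)⁻¹ * ∑ i, (((hH n).eigenvalues i : ℂ) - zj j)⁻¹) atTop (𝓝 (m (zj j)))) :
    ∃ ν : ProbabilityMeasure ℝ, (∀ᵐ x ∂(ν : Measure ℝ), |x| ≤ K) ∧ (∀ j, ∫ x, ((x : ℂ) - zj j)⁻¹ ∂(ν : Measure ℝ) = m (zj j)) ∧
      ∀ f : BoundedContinuousFunction ℝ ℝ, Tendsto (fun n : ℕ => esd (H n) f) atTop (𝓝 (∫ x, f x ∂(ν : Measure ℝ))) := by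
  choose μ hμ using fun n => emp_exists n (hH n).eigenvalues
  have hp : ∀ j, 0 < (zj j).im := fun j => by rw [zj_im]; positivity
  have hc := isCompact_setOfPred_probabilityMeasure_mass_eq_compl_isCompact_le (E := ℝ) (u := fun _ => 0) (K := fun _ => Set.Icc (-K) K) tendsto_const_nhds
    (fun _ => isCompact_Icc) (Or.inl inferInstance)
  have hev : ∀ᶠ n in atTop, μ n ∈ {ν : ProbabilityMeasure ℝ | ∀ _ : ℕ, ν (Set.Icc (-K) K)ᶜ ≤ (0 : ℝ≥0)} := by
    filter_upwards [hK, eventually_ge_atTop 1] with n h1 h2 _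
    exact ((hμ n h2).2 K fun i => (eig_le _ i).trans h1).le
  have hs : ∀ ν ∈ {ν : ProbabilityMeasure ℝ | ∀ _ : ℕ, ν (Set.Icc (-K) K)ᶜ ≤ (0 : ℝ≥0)}, ∀ᵐ x ∂(ν : Measure ℝ), |x| ≤ K := by
    intro ν hν
    have h1 : ν (Set.Icc (-K) K)ᶜ = 0 := le_antisymm (hν 0) bot_le
    rw [← ENNReal.coe_eq_zero, ProbabilityMeasure.ennreal_coeFn_eq_coeFn_toMeasure] at h1
    filter_upwards [compl_mem_ae_iff.mpr h1] with x hx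
    rw [compl_compl] at hx
    exact abs_le.mpr hx
  have hcl : ∀ ν, MapClusterPt ν atTop μ → ∀ j, ∫ x, ((x : ℂ) - zj j)⁻¹ ∂(ν : Measure ℝ) = m (zj j) := by
    intro ν hν j
    obtain ⟨U, hU, hU2⟩ := mapClusterPt_iff_ultrafilter.mp hν
    have h1 := (ProbabilityMeasure.tendsto_iff_forall_integral_rclike_tendsto ℂ).mp hU2
      (BoundedContinuousFunction.ofNormedAddCommGroup _ (sub_z_cont (hp j)) _ (sub_z_bd (hp j)))
    simp only [BoundedContinuousFunction.coe_ofNormedAddCommGroup] at h1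
    refine tendsto_nhds_unique h1 (((hm j).mono_left hU).congr' (hU ?_))
    filter_upwards [eventually_ge_atTop 1] with n hn
    rw [(hμ n hn).1]
  obtain ⟨ν, hν1, hν2⟩ := hc.exists_mapClusterPt (f := atTop) (u := μ) (by rwa [le_principal_iff])
  have hlim : Tendsto μ atTop (𝓝 ν) := by
    refine hc.tendsto_nhds_of_unique_mapClusterPt hev fun ρ hρ1 hρ2 => ?_
    exact Subtype.ext (@stieltjes_uniq _ _ ρ.2 ν.2 K (hs ρ hρ1) (hs ν hν1) fun j => (hcl ρ hρ2 j).trans (hcl ν hν2 j).symm)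
  refine ⟨ν, hs ν hν1, hcl ν hν2, fun f => ?_⟩
  refine (ProbabilityMeasure.tendsto_iff_forall_integral_tendsto.mp hlim f).congr' ?_
  filter_upwards [eventually_ge_atTop 1] with n hn
  have := (hμ n hn).1 fun x => (f x : ℂ)
  rw [integral_complex_ofReal] at this
  rw [esd, dif_pos (hH n)]
  apply Complex.ofReal_injective
  rw [this]
  push_cast; rfl

theorem wc {Ω : Type*} [MeasurableSpace Ω] {Pr : Measure Ω} [IsProbabilityMeasure Pr] {H : ∀ n : ℕ, Ω → Matrix (Fin n) (Fin n) ℝ}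
    (hH : ∀ n ω, (H n ω).IsHermitian) (K : ℝ) (hK : ∀ᵐ ω ∂Pr, ∀ᶠ n in atTop, ‖H n ω‖ ≤ K) (m : ℂ → ℂ)
    (hm : ∀ z : ℂ, 0 < z.im → ∀ᵐ ω ∂Pr, Tendsto (fun n : ℕ => (n : ℂ)⁻¹ * ((-z) • (1 : Matrix (Fin n) (Fin n) ℂ) + cx (H n ω))⁻¹.trace) atTop (𝓝 (m z))) :
    ∃ ν : Measure ℝ, IsProbabilityMeasure ν ∧ (∀ z : ℂ, 0 < z.im → stieltjesT ν z = m z) ∧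
      ∀ᵐ ω ∂Pr, ∀ f : BoundedContinuousFunction ℝ ℝ, Tendsto (fun n : ℕ => esd (H n ω) f) atTop (𝓝 (∫ x, f x ∂ν)) := by
  have hm' : ∀ z : ℂ, 0 < z.im → ∀ᵐ ω ∂Pr, Tendsto (fun n : ℕ => (n : ℂ)⁻¹ * ∑ i, (((hH n ω).eigenvalues i : ℂ) - z)⁻¹) atTop (𝓝 (m z)) := by
    intro z hz
    filter_upwards [hm z hz] with ω hω
    refine hω.congr fun n => ?_
    have := tr_spec (hH n ω) (-z) 1 1 0 fun i => by
      have := sub_z_ne hz ((hH n ω).eigenvalues i)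
      rwa [one_mul, neg_add_eq_sub]
    simp only [one_smul, zero_smul, add_zero, mul_one] at this
    rw [this]
    congr 1
    refine Finset.sum_congr rfl fun i _ => ?_
    rw [one_mul, zero_mul, add_zero, neg_add_eq_sub, one_div]
  have hz : ∀ᵐ ω ∂Pr, ∀ j, Tendsto (fun n : ℕ => (n : ℂ)⁻¹ * ∑ i, (((hH n ω).eigenvalues i : ℂ) - zj j)⁻¹) atTop (𝓝 (m (zj j))) :=
    ae_all_iff.mpr fun j => hm' _ (by rw [zj_im]; positivity)
  obtain ⟨ω0, h1, h2⟩ := (hK.and hz).exists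
  obtain ⟨ν, hν1, hν2, hν3⟩ := wc_det (hH · ω0) K h1 m h2
  have hall : ∀ᵐ ω ∂Pr, ∀ f : BoundedContinuousFunction ℝ ℝ, Tendsto (fun n : ℕ => esd (H n ω) f) atTop (𝓝 (∫ x, f x ∂(ν : Measure ℝ))) := by
    filter_upwards [hK, hz] with ω g1 g2
    obtain ⟨ρ, k1, k2, k3⟩ := wc_det (hH · ω) K g1 m g2
    rwa [stieltjes_uniq K k1 hν1 fun j => (k2 j).trans (hν2 j).symm] at k3
  refine ⟨ν, inferInstance, fun z hz => ?_, hall⟩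
  obtain ⟨ω, g1, g2⟩ := (hall.and (hm' z hz)).exists
  exact tendsto_nhds_unique (cx_limit (hH · ω) g1 _ (sub_z_cont hz) _ (sub_z_bd hz)) g2

lemma orth_one (d : ℕ) : IsOrthonormal 0 1 (1 : Matrix (Fin d) (Fin d) ℝ) := by
  have h1 : ∀ α : Fin d, ∑ i, (1 : Matrix (Fin d) (Fin d) ℝ) i α ^ 2 = 1 := fun α => by simp [Matrix.one_apply]
  refine ⟨fun α => by simp [h1], fun α β h => by simp [Matrix.one_apply, h.symm], ?_, by simp [h1]⟩
  rw [opNorm_eq, ← Matrix.diagonal_one]; exact nrm_diag _ _ zero_le_one fun i => by simp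

lemma gq : ∃ C, 1 ≤ C ∧ ∀ (d : ℕ) (δ K : ℝ) (M : Matrix (Fin d) (Fin d) ℝ), 1 ≤ d → 0 < K → 0 < δ → ‖M‖ ≤ K →
    gaussianVec d {w | d * δ ≤ |w ⬝ᵥ M *ᵥ w - M.trace|} ≤ ENNReal.ofReal (C * K ^ 10 / (δ ^ 10 * d ^ 5)) := by
  obtain ⟨C, hC, h⟩ := quad_row_r act_id 1 5 (by norm_num)
  refine ⟨C, hC, fun d δ K M hd hK hδ hM => ?_⟩
  have := h d d 1 0 δ K M hd (by norm_num) (orth_one d) hK hδ hM (by simpa using hδ.le)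
  refine (measure_mono fun w hw => ?_).trans this
  have e : ∀ k, colV (1 : Matrix (Fin d) (Fin d) ℝ) k = Pi.single k 1 := fun k => by
    ext i; simp [colV, Matrix.one_apply, Pi.single_apply]
  have e2 : ∑ k, ∑ l, M k l * (w k * w l) = w ⬝ᵥ M *ᵥ w := by
    simp only [dotProduct, mulVec, Finset.mul_sum]
    exact Finset.sum_congr rfl fun k _ => Finset.sum_congr rfl fun l _ => by ring
  have e3 : ∑ k, ∑ l, M k l * Phi 1 (1 : Matrix (Fin d) (Fin d) ℝ) k l = M.trace := by
    simp [Phi, Matrix.one_apply, Matrix.trace]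
  simpa [e, e2, e3] using hw

lemma gqm : ∃ C, 1 ≤ C ∧ ∀ (d e n : ℕ) (δ K : ℝ) (M : Fin n → Fin n → Matrix (Fin d) (Fin d) ℝ), 1 ≤ d → 0 < K → 0 < δ → (∀ α β, ‖M α β‖ ≤ K) →
    gaussianMat e d {W | ∃ α β i, d * δ ≤ |W i ⬝ᵥ M α β *ᵥ W i - (M α β).trace|} ≤ ENNReal.ofReal (n * (n * (e * (C * K ^ 10 / (δ ^ 10 * d ^ 5))))) := by
  obtain ⟨C, hC, h⟩ := gq
  refine ⟨C, hC, fun d e n δ K M hd hK hδ hM => ?_⟩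
  have un : ∀ {ι : ℕ} (A : Fin ι → Set (Fin e → Fin d → ℝ)) (p : ℝ), 0 ≤ p → (∀ i, gaussianMat e d (A i) ≤ ENNReal.ofReal p) → gaussianMat e d (⋃ i, A i) ≤ ENNReal.ofReal (ι * p) := by
    intro ι A p hp hA
    refine (measure_iUnion_le _).trans ?_
    rw [tsum_fintype, ENNReal.ofReal_mul (by positivity), ENNReal.ofReal_natCast]
    exact (Finset.sum_le_sum fun i _ => hA i).trans (by simp)
  simp only [Set.ofPred_exists]
  refine un _ _ (by positivity) fun α => un _ _ (by positivity) fun β => un _ _ (by positivity) fun i => ?_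
  have hc : Continuous fun w : Fin d → ℝ => |w ⬝ᵥ M α β *ᵥ w - (M α β).trace| := by
    unfold dotProduct mulVec dotProduct; fun_prop
  exact fub _ i _ (isClosed_le continuous_const (hc.comp (continuous_apply i))).measurableSet _ fun W => by
    simpa using h d δ K (M α β) hd hK hδ (hM α β)

lemma wn_tail (κ : ℝ) (hκ : 0 < κ) : ∃ C B', 0 < B' ∧ ∀ d e : ℕ, 1 ≤ d → (d : ℝ) ≤ κ * e →
    gaussianMat e d {W | B' * Real.sqrt e < ‖Matrix.of W‖} ≤ ENNReal.ofReal (C / (d : ℝ) ^ 2) := by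
  obtain ⟨C, hC, B', hB', h⟩ := one_step act_id 1 κ hκ
  refine ⟨C, B', hB', fun d e hd he => (measure_mono fun W hW => ?_).trans (h d d e 1 0 hd he (by norm_num) (orth_one d))⟩
  rintro ⟨_, _, h3, _⟩
  have he0 : (0 : ℝ) < e := by
    have : (1 : ℝ) ≤ d := by exact_mod_cast hd
    exact pos_of_mul_pos_right (by linarith) hκ.le
  have e1 : nextX id W (1 : Matrix (Fin d) (Fin d) ℝ) = (Real.sqrt e)⁻¹ • Matrix.of W := by
    ext i j
    rw [nextX_apply]
    simp [colV, Matrix.one_apply, dotProduct, mul_comm]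
  rw [opNorm_eq, e1, norm_smul, norm_inv, Real.norm_of_nonneg (Real.sqrt_nonneg _), inv_mul_le_iff₀ (Real.sqrt_pos.mpr he0), mul_comm] at h3
  exact absurd h3 (not_le.mpr hW)

section
variable {d : ℕ → ℕ} {Lm n : ℕ}

/-- derivative of the activation at preactivations -/
noncomputable def Dg (σ σ' : ℝ → ℝ) (X0 : Matrix (Fin (d 0)) (Fin n) ℝ) (c : Cfg d Lm) (k : ℕ) (α : Fin n) : Fin (d (k + 1)) → ℝ :=
  fun i => σ' ((Matrix.of (extW c k) * cL σ X0 c k) i α)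

/-- backpropagated quadratic form -/
noncomputable def QM (σ σ' : ℝ → ℝ) (X0 : Matrix (Fin (d 0)) (Fin n) ℝ) (c : Cfg d Lm) (ℓ : ℕ) (α β : Fin n) :
    (k : ℕ) → Matrix (Fin (d (k + 1))) (Fin (d (k + 1))) ℝ
  | 0 => Matrix.diagonal (Dg σ σ' X0 c 0 α) * 1 * Matrix.diagonal (Dg σ σ' X0 c 0 β)
  | k + 1 => Matrix.diagonal (Dg σ σ' X0 c (k + 1) α) * (if k < ℓ then 1 else
      (d (k + 1) : ℝ)⁻¹ • (Matrix.of (extW c (k + 1)) * QM σ σ' X0 c ℓ α β k * (Matrix.of (extW c (k + 1)))ᵀ)) *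
      Matrix.diagonal (Dg σ σ' X0 c (k + 1) β)

variable {σ σ' : ℝ → ℝ} {X0 : Matrix (Fin (d 0)) (Fin n) ℝ}

lemma Dg_upd (c : Cfg d Lm) (m : Fin (Lm + 1)) (w) (k : ℕ) (hk : k < m) : Dg σ σ' X0 (updW c m w) k = Dg σ σ' X0 c k := by
  unfold Dg
  rw [extW_upd_ne c m w k (by omega), cL_upd c m w k hk.le]

lemma QM_upd (c : Cfg d Lm) (m : Fin (Lm + 1)) (w) (ℓ : ℕ) (α β : Fin n) (k : ℕ) (hk : k < m) :
    QM σ σ' X0 (updW c m w) ℓ α β k = QM σ σ' X0 c ℓ α β k := by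
  induction k with
  | zero => rw [QM, QM, Dg_upd c m w 0 hk]
  | succ k ih => rw [QM, QM, Dg_upd c m w (k + 1) hk, ih (by omega), extW_upd_ne c m w _ (by omega)]

lemma cont_Dg (h : Continuous σ) (h' : Continuous σ') (k : ℕ) (α : Fin n) : Continuous fun c : Cfg d Lm => Dg σ σ' X0 c k α := by
  have h1 : Continuous fun c : Cfg d Lm => Matrix.of (extW c k) := cont_extW k
  exact continuous_pi fun i => h'.comp ((h1.matrix_mul (cont_cL h k)).matrix_elem i α)

lemma cont_QM (h : Continuous σ) (h' : Continuous σ') (ℓ : ℕ) (α β : Fin n) (k : ℕ) : Continuous fun c : Cfg d Lm => QM σ σ' X0 c ℓ α β k := by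
  induction k with
  | zero => exact ((cont_Dg h h' 0 α).matrix_diagonal.matrix_mul continuous_const).matrix_mul (cont_Dg h h' 0 β).matrix_diagonal
  | succ k ih =>
    have h1 : Continuous fun c : Cfg d Lm => Matrix.of (extW c (k + 1)) := cont_extW (k + 1)
    simp only [QM]
    refine ((cont_Dg h h' (k + 1) α).matrix_diagonal.matrix_mul ?_).matrix_mul (cont_Dg h h' (k + 1) β).matrix_diagonal
    split_ifs
    · exact continuous_const
    · exact ((h1.matrix_mul ih).matrix_mul h1.matrix_transpose).const_smul (d (k + 1) : ℝ)⁻¹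

lemma QM_norm_step {lam K : ℝ} (hl : ∀ x, |σ' x| ≤ lam) (c : Cfg d Lm) (α β : Fin n) (k : ℕ) (T : Matrix (Fin (d (k + 1))) (Fin (d (k + 1))) ℝ) (hT : ‖T‖ ≤ K) :
    ‖Matrix.diagonal (Dg σ σ' X0 c k α) * T * Matrix.diagonal (Dg σ σ' X0 c k β)‖ ≤ lam * K * lam := by
  have hl0 : 0 ≤ lam := (abs_nonneg _).trans (hl 0)
  have hD : ∀ α, ‖Matrix.diagonal (Dg σ σ' X0 c k α)‖ ≤ lam := fun α => nrm_diag _ _ hl0 fun i => hl _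
  refine (Matrix.l2_opNorm_mul _ _).trans (mul_le_mul ((Matrix.l2_opNorm_mul _ _).trans (mul_le_mul (hD α) hT (norm_nonneg _) hl0)) (hD β) (norm_nonneg _) ?_)
  exact mul_nonneg hl0 ((norm_nonneg _).trans hT)

lemma avg_Dg (c : Cfg d Lm) (k : ℕ) (α β : Fin n) : avgP σ' (colV (cL σ X0 c k) α) (colV (cL σ X0 c k) β) (extW c k) =
    (d (k + 1) : ℝ)⁻¹ * ∑ i, Dg σ σ' X0 c k α i * Dg σ σ' X0 c k β i := rfl

lemma tr_diag {e : ℕ} (u v : Fin e → ℝ) (T : Matrix (Fin e) (Fin e) ℝ) : (Matrix.diagonal u * T * Matrix.diagonal v).trace = ∑ i, u i * v i * T i i := by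
  simp only [Matrix.trace, Matrix.diag, Matrix.mul_diagonal, Matrix.diagonal_mul]
  exact Finset.sum_congr rfl fun i _ => by ring

lemma tr_step {lam δ : ℝ} (hl : ∀ x, |σ' x| ≤ lam) (c : Cfg d Lm) (ℓ : ℕ) (α β : Fin n) (k : ℕ) (hk : ℓ ≤ k) (hd : 0 < d (k + 1)) (hd2 : 0 < d (k + 2))
    (h : ∀ i, |extW c (k + 1) i ⬝ᵥ QM σ σ' X0 c ℓ α β k *ᵥ extW c (k + 1) i - (QM σ σ' X0 c ℓ α β k).trace| ≤ d (k + 1) * δ) :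
    |(d (k + 2) : ℝ)⁻¹ * (QM σ σ' X0 c ℓ α β (k + 1)).trace - ((d (k + 2) : ℝ)⁻¹ * ∑ i, Dg σ σ' X0 c (k + 1) α i * Dg σ σ' X0 c (k + 1) β i) *
      ((d (k + 1) : ℝ)⁻¹ * (QM σ σ' X0 c ℓ α β k).trace)| ≤ lam ^ 2 * δ := by
  have hd' : (0 : ℝ) < d (k + 1) := by exact_mod_cast hd
  have hd2' : (0 : ℝ) < d (k + 2) := by exact_mod_cast hd2
  rw [QM, tr_diag, if_neg (by omega), mul_assoc, ← mul_sub, Finset.sum_mul, ← Finset.sum_sub_distrib, abs_mul, abs_of_pos (by positivity), inv_mul_le_iff₀ hd2']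
  refine (Finset.abs_sum_le_sum_abs _ _).trans ?_
  refine (Finset.sum_le_sum (g := fun _ => lam ^ 2 * δ) fun i _ => ?_).trans (by simp)
  have e : ((d (k + 1) : ℝ)⁻¹ • (Matrix.of (extW c (k + 1)) * QM σ σ' X0 c ℓ α β k * (Matrix.of (extW c (k + 1)))ᵀ)) i i =
      (d (k + 1) : ℝ)⁻¹ * (extW c (k + 1) i ⬝ᵥ QM σ σ' X0 c ℓ α β k *ᵥ extW c (k + 1) i) := by
    rw [Matrix.dotProduct_mulVec]; rfl
  rw [e, ← mul_sub, ← mul_sub, abs_mul, abs_mul, abs_mul, abs_of_pos (inv_pos.mpr hd'), sq]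
  have hδ : (d (k + 1) : ℝ)⁻¹ * |extW c (k + 1) i ⬝ᵥ QM σ σ' X0 c ℓ α β k *ᵥ extW c (k + 1) i - (QM σ σ' X0 c ℓ α β k).trace| ≤ δ := by
    rw [inv_mul_le_iff₀ hd']; exact h i
  exact mul_le_mul (mul_le_mul (hl _) (hl _) (abs_nonneg _) ((abs_nonneg _).trans (hl 0))) hδ (by positivity) (mul_self_nonneg _)
end

/-- uniform convergence of Gram-type arrays -/
def UC {Ω : Type*} [MeasurableSpace Ω] (Pr : Measure Ω) (x : (n : ℕ) → Ω → Fin n → Fin n → ℝ) (r q : ℝ) : Prop :=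
  ∀ τ > 0, ∀ᵐ ω ∂Pr, ∀ᶠ n in atTop, ∀ α β, |x n ω α β - if α = β then r else q| ≤ τ

lemma UC.mul {Ω : Type*} [MeasurableSpace Ω] {Pr : Measure Ω} {x y : (n : ℕ) → Ω → Fin n → Fin n → ℝ} {r q r' q' : ℝ} (hx : UC Pr x r q) (hy : UC Pr y r' q') :
    UC Pr (fun n ω α β => x n ω α β * y n ω α β) (r * r') (q * q') := by
  intro τ hτ
  obtain ⟨M, hM, h1, h2, h3, h4⟩ : ∃ M : ℝ, 1 ≤ M ∧ |r| ≤ M ∧ |q| ≤ M ∧ |r'| ≤ M ∧ |q'| ≤ M :=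
    ⟨1 + |r| + |q| + |r'| + |q'|, by linarith [abs_nonneg r, abs_nonneg q, abs_nonneg r', abs_nonneg q'], by linarith [abs_nonneg r, abs_nonneg q, abs_nonneg r', abs_nonneg q'],
      by linarith [abs_nonneg r, abs_nonneg q, abs_nonneg r', abs_nonneg q'], by linarith [abs_nonneg r, abs_nonneg q, abs_nonneg r', abs_nonneg q'], by linarith [abs_nonneg r, abs_nonneg q, abs_nonneg r', abs_nonneg q']⟩
  have hp : 0 < min 1 (τ / (3 * M)) := by positivity
  filter_upwards [hx _ hp, hy _ hp] with ω a1 a2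
  filter_upwards [a1, a2] with n b1 b2 α β
  have e : (if α = β then r * r' else q * q') = (if α = β then r else q) * (if α = β then r' else q') := by split_ifs <;> rfl
  have hu : |if α = β then r else q| ≤ M := by split_ifs <;> assumption
  have hv : |if α = β then r' else q'| ≤ M := by split_ifs <;> assumption
  have c1 := b1 α β
  have c2 := b2 α β
  rw [e]
  generalize (if α = β then r else q) = u at *
  generalize (if α = β then r' else q') = v at *
  have hm1 : min 1 (τ / (3 * M)) ≤ 1 := min_le_left _ _
  have hm2 : min 1 (τ / (3 * M)) * (3 * M) ≤ τ := by rw [← le_div_iff₀ (by positivity)]; exact min_le_right _ _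
  generalize min 1 (τ / (3 * M)) = p at *
  have : x n ω α β * y n ω α β - u * v = (x n ω α β - u) * (y n ω α β - v) + u * (y n ω α β - v) + (x n ω α β - u) * v := by ring
  rw [this]
  refine (abs_add_three _ _ _).trans ?_
  rw [abs_mul, abs_mul, abs_mul]
  have k1 := mul_le_mul c1 c2 (abs_nonneg _) hp.le
  have k2 := mul_le_mul hu c2 (abs_nonneg _) (by linarith)
  have k3 := mul_le_mul c1 hv (abs_nonneg _) hp.le
  nlinarith

lemma UC.congr {Ω : Type*} [MeasurableSpace Ω] {Pr : Measure Ω} {x y : (n : ℕ) → Ω → Fin n → Fin n → ℝ} {r q : ℝ} (hx : UC Pr x r q)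
    (h : ∀ τ > 0, ∀ᵐ ω ∂Pr, ∀ᶠ n in atTop, ∀ α β, |y n ω α β - x n ω α β| ≤ τ) : UC Pr y r q := by
  intro τ hτ
  filter_upwards [hx _ (half_pos hτ), h _ (half_pos hτ)] with ω a1 a2
  filter_upwards [a1, a2] with n b1 b2 α β
  have := abs_add_le (y n ω α β - x n ω α β) (x n ω α β - if α = β then r else q)
  rw [sub_add_sub_cancel] at this
  linarith [b1 α β, b2 α β]

section
variable {Ω : Type*} [MeasurableSpace Ω] {Pr : Measure Ω} {Lm : ℕ} {d : ℕ → ℕ → ℕ} {σ σ' σ'' : ℝ → ℝ} {lam b a : ℝ}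
    {W : (n : ℕ) → (ℓ : ℕ) → Ω → Fin (d n (ℓ + 1)) → Fin (d n ℓ) → ℝ} {wOut : (n : ℕ) → Ω → Fin (d n (Lm + 1)) → ℝ}
    {X0 : (n : ℕ) → Matrix (Fin (d n 0)) (Fin n) ℝ} {ε : ℕ → ℝ} {B : ℝ} {γ : ℕ → ℝ}
    (N : Net Pr Lm d σ σ' σ'' lam b a W wOut X0 ε B γ)
include N

lemma Net.uc_avg (k : ℕ) (hk : k ≤ Lm) : UC Pr (fun n ω α β => (d n (k + 1) : ℝ)⁻¹ *
    ∑ i, Dg σ σ' (X0 n) (Zc W wOut n ω) k α i * Dg σ σ' (X0 n) (Zc W wOut n ω) k β i) a (b ^ 2) := by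
  intro τ hτ
  obtain ⟨εl, Bl, h1, h2⟩ := N.orth_as k (by omega)
  obtain ⟨K, hK, hd⟩ := N.dims
  obtain ⟨C, hC⟩ := avg_tail N.act.lipF' Bl K (by linarith)
  obtain ⟨C1, hC1, hm⟩ := N.act.mean_bounds
  have hn : Tendsto (fun n : ℕ => (n : ℝ) ^ (-(3 / 8) : ℝ)) atTop (𝓝 0) := (tendsto_rpow_neg_atTop (by norm_num)).comp tendsto_natCast_atTop_atTop
  have hc := fun (n : ℕ) (j : ℕ) => cont_cL (d := d n) (Lm := Lm) (X0 := X0 n) N.act.cont j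
  have hcD := fun (n : ℕ) => cont_Dg (d := d n) (Lm := Lm) (X0 := X0 n) N.act.cont N.act.cont' k
  have := N.as_step ⟨k, by omega⟩ (fun n => {c | IsOrthonormal (εl n) Bl (cL σ (X0 n) c k)})
    (fun n => {c | ∃ α β, τ < |(d n (k + 1) : ℝ)⁻¹ * ∑ i, Dg σ σ' (X0 n) c k α i * Dg σ σ' (X0 n) c k β i - if α = β then a else b ^ 2|})
    (fun n => ((closed_orth _ _).preimage (hc n k)).measurableSet) (fun n => ?_) C (fun n c w hw => ?_) h2 ?_
  · simpa using this
  · simp only [Set.ofPred_exists]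
    refine (isOpen_iUnion fun α => isOpen_iUnion fun β => isOpen_lt continuous_const ?_).measurableSet
    have := hcD n α
    have := hcD n β
    fun_prop
  · have e := cL_upd (σ := σ) (X0 := X0 n) c ⟨k, by omega⟩ w k le_rfl
    rwa [Set.mem_ofPred_eq, e] at hw
  · filter_upwards [hd (k + 1) (by omega) (by omega), eps_half h1 (min (1 / 2) (τ / (2 * C1))) (by positivity), hn.eventually (gt_mem_nhds (half_pos hτ))]
      with n ⟨d1, d2, d3, d4⟩ hε2 hn c ho
    refine (measure_mono ?_).trans (hC (d n k) n (d n (k + 1)) (cL σ (X0 n) c k) d1 d4 ho.2.2.1)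
    rintro w ⟨α, β, hw⟩
    refine ⟨α, β, ?_⟩
    have e := cL_upd (σ := σ) (X0 := X0 n) c ⟨k, by omega⟩ w k le_rfl
    have e' := extW_upd c ⟨k, by omega⟩ w
    simp only at e'
    rw [← avg_Dg, e, e'] at hw
    have hε3 := (le_abs_self _).trans (hε2.2.trans (min_le_left _ _))
    have hε4 : C1 * εl n ≤ τ / 2 := by
      have := (le_abs_self _).trans (hε2.2.trans (min_le_right _ _))
      rw [le_div_iff₀ (by positivity)] at this; linarith
    have hdg : ∀ α, |colV (cL σ (X0 n) c k) α ⬝ᵥ colV (cL σ (X0 n) c k) α - 1| ≤ εl n := fun α => by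
      rw [dot_colV]; simpa [sq] using ho.1 α
    have key : |meanP σ' (colV (cL σ (X0 n) c k) α) (colV (cL σ (X0 n) c k) β) - if α = β then a else b ^ 2| ≤ C1 * εl n := by
      split_ifs with hab
      · subst hab
        exact (hm _ _ (colV (cL σ (X0 n) c k) α) _ hε3 (hdg α)).2.1.trans (by gcongr; exact hdg α)
      · exact ((hm _ _ _ _ hε3 (hdg α)).2.2 (hdg β) (ho.2.1 α β hab)).2
    have := abs_add_le (avgP σ' (colV (cL σ (X0 n) c k) α) (colV (cL σ (X0 n) c k) β) w - meanP σ' (colV (cL σ (X0 n) c k) α) (colV (cL σ (X0 n) c k) β))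
      (meanP σ' (colV (cL σ (X0 n) c k) α) (colV (cL σ (X0 n) c k) β) - if α = β then a else b ^ 2)
    rw [sub_add_sub_cancel] at this
    linarith
end

lemma nrm_one_r {e : ℕ} : ‖(1 : Matrix (Fin e) (Fin e) ℝ)‖ ≤ 1 := by
  rw [← Matrix.diagonal_one]; exact nrm_diag _ _ zero_le_one fun i => by simp

section
variable {Ω : Type*} [MeasurableSpace Ω] {Pr : Measure Ω} {Lm : ℕ} {d : ℕ → ℕ → ℕ} {σ σ' σ'' : ℝ → ℝ} {lam b a : ℝ}
    {W : (n : ℕ) → (ℓ : ℕ) → Ω → Fin (d n (ℓ + 1)) → Fin (d n ℓ) → ℝ} {wOut : (n : ℕ) → Ω → Fin (d n (Lm + 1)) → ℝ}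
    {X0 : (n : ℕ) → Matrix (Fin (d n 0)) (Fin n) ℝ} {ε : ℕ → ℝ} {B : ℝ} {γ : ℕ → ℝ}
    (N : Net Pr Lm d σ σ' σ'' lam b a W wOut X0 ε B γ)
include N

lemma Net.wn_as (k : ℕ) (hk : k + 1 ≤ Lm) : ∃ B', 0 < B' ∧ ∀ᵐ ω ∂Pr, ∀ᶠ n in atTop, ‖Matrix.of (extW (Zc W wOut n ω) (k + 1))‖ ^ 2 ≤ B' * d n (k + 1) := by
  obtain ⟨K, hK, hd⟩ := N.dims
  obtain ⟨C, B', hB', h⟩ := wn_tail (K ^ 2) (by positivity)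
  refine ⟨B' ^ 2 * K ^ 2, by positivity, ?_⟩
  have hm := fun n : ℕ => cont_extW (d := d n) (Lm := Lm) (k + 1)
  have := N.as_step ⟨k + 1, by omega⟩ (fun n => Set.univ) (fun n => {c | B' * Real.sqrt (d n (k + 2)) < ‖Matrix.of (extW c (k + 1))‖})
    (fun n => MeasurableSet.univ) (fun n => ?_) (|C| * K ^ 2) (fun n c w _ => trivial) (by simp) ?_
  · filter_upwards [this] with ω a1
    filter_upwards [a1, hd (k + 1) (by omega) (by omega), hd (k + 2) (by omega) (by omega)] with n b1 ⟨d1, d2, d3, d4⟩ ⟨_, e2, e3, e4⟩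
    rw [not_lt] at b1
    calc ‖Matrix.of (extW (Zc W wOut n ω) (k + 1))‖ ^ 2 ≤ (B' * Real.sqrt (d n (k + 2))) ^ 2 := by gcongr
      _ = B' ^ 2 * d n (k + 2) := by rw [mul_pow, Real.sq_sqrt (by positivity)]
      _ ≤ B' ^ 2 * (K * (K * d n (k + 1))) := by gcongr; exact e3.trans (by gcongr)
      _ = _ := by ring
  · have h1 : Continuous fun c : Cfg (d n) Lm => Matrix.of (extW c (k + 1)) := hm n
    exact (isOpen_lt continuous_const h1.norm).measurableSet
  · filter_upwards [hd (k + 1) (by omega) (by omega), hd (k + 2) (by omega) (by omega)] with n ⟨d1, d2, d3, d4⟩ ⟨_, e2, e3, e4⟩ c _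
    have e' := extW_upd c (⟨k + 1, by omega⟩ : Fin (Lm + 1))
    simp only at e'
    simp only [e']
    refine (h (d n (k + 1)) (d n (k + 2)) d2 (d3.trans ?_)).trans (ENNReal.ofReal_le_ofReal ?_)
    · rw [sq, mul_assoc]; gcongr
    · have hd0 : (0 : ℝ) < d n (k + 1) := by exact_mod_cast d2
      have hn0 : (0 : ℝ) < n := by exact_mod_cast d1
      rw [div_le_div_iff₀ (by positivity) (by positivity)]
      have : (n : ℝ) ^ 2 ≤ K ^ 2 * (d n (k + 1) : ℝ) ^ 2 := by rw [← mul_pow]; gcongr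
      calc C * (n : ℝ) ^ 2 ≤ |C| * (K ^ 2 * (d n (k + 1) : ℝ) ^ 2) := mul_le_mul (le_abs_self _) this (by positivity) (abs_nonneg _)
        _ = _ := by ring

lemma Net.qm_norm (ℓ k : ℕ) (hk : k ≤ Lm) : ∃ K, 0 < K ∧ ∀ᵐ ω ∂Pr, ∀ᶠ n in atTop, ∀ α β, ‖QM σ σ' (X0 n) (Zc W wOut n ω) ℓ α β k‖ ≤ K := by
  have hl := N.act.b1
  have hl0 : 0 ≤ lam := N.act.lam0
  induction k with
  | zero =>
    exact ⟨lam * 1 * lam + 1, by nlinarith, Eventually.of_forall fun ω => Eventually.of_forall fun n α β => (QM_norm_step hl (Zc W wOut n ω) α β 0 1 nrm_one_r).trans (by linarith)⟩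
  | succ k ih =>
    obtain ⟨K, hK, h1⟩ := ih (by omega)
    obtain ⟨B', hB', h2⟩ := N.wn_as k hk
    obtain ⟨_, _, hd⟩ := N.dims
    refine ⟨lam * (1 + B' * K) * lam + 1, by positivity, ?_⟩
    filter_upwards [h1, h2] with ω a1 a2
    filter_upwards [a1, a2, hd (k + 1) (by omega) (by omega)] with n b1 b2 ⟨_, hd, _⟩ α β
    have hd : (0 : ℝ) < d n (k + 1) := by exact_mod_cast hd
    rw [QM]
    refine (QM_norm_step hl _ α β (k + 1) _ (K := 1 + B' * K) ?_).trans (by linarith)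
    split_ifs
    · exact nrm_one_r.trans (by linarith [mul_pos hB' hK])
    · rw [norm_smul, norm_inv, Real.norm_of_nonneg hd.le, inv_mul_le_iff₀ hd]
      have := mul_le_mul b2 (b1 α β) (norm_nonneg _) (by positivity)
      have h3 := (Matrix.l2_opNorm_mul (Matrix.of (extW (Zc W wOut n ω) (k + 1)) * QM σ σ' (X0 n) (Zc W wOut n ω) ℓ α β k) (Matrix.of (extW (Zc W wOut n ω) (k + 1)))ᵀ).trans
        (mul_le_mul_of_nonneg_right (Matrix.l2_opNorm_mul _ _) (norm_nonneg _))
      rw [nrm_transpose] at h3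
      nlinarith

lemma Net.qm_tr (ℓ k : ℕ) (hk : k ≤ Lm) : UC Pr (fun n ω α β => (d n (k + 1) : ℝ)⁻¹ * (QM σ σ' (X0 n) (Zc W wOut n ω) ℓ α β k).trace) (a ^ (k - ℓ + 1)) ((b ^ 2) ^ (k - ℓ + 1)) := by
  have hl0 : 0 ≤ lam := N.act.lam0
  have base : ∀ k ≤ Lm, k - ℓ = 0 → (∀ n ω α β, (QM σ σ' (X0 n) (Zc W wOut n ω) ℓ α β k) = Matrix.diagonal (Dg σ σ' (X0 n) (Zc W wOut n ω) k α) * 1 * Matrix.diagonal (Dg σ σ' (X0 n) (Zc W wOut n ω) k β)) →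
      UC Pr (fun n ω α β => (d n (k + 1) : ℝ)⁻¹ * (QM σ σ' (X0 n) (Zc W wOut n ω) ℓ α β k).trace) (a ^ (k - ℓ + 1)) ((b ^ 2) ^ (k - ℓ + 1)) := by
    intro k hk h0 h
    simp only [h, tr_diag, Matrix.one_apply_eq]
    simp only [mul_one, h0, zero_add, pow_one]
    exact N.uc_avg k hk
  induction k with
  | zero => exact base 0 hk (by omega) fun n ω α β => rfl
  | succ k ih =>
    by_cases hkl : k < ℓ
    · exact base (k + 1) hk (by omega) fun n ω α β => by rw [QM, if_pos hkl]
    have h1 := (N.uc_avg (k + 1) hk).mul (ih (by omega))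
    rw [← pow_succ', ← pow_succ', show k - ℓ + 1 = k + 1 - ℓ by omega] at h1
    refine h1.congr fun τ hτ => ?_
    obtain ⟨K, hK, hq⟩ := N.qm_norm ℓ k (by omega)
    obtain ⟨κ, hκ, hd⟩ := N.dims
    obtain ⟨C, hC, hg⟩ := gqm
    obtain ⟨δ, hδ, hδτ⟩ : ∃ δ : ℝ, 0 < δ ∧ lam ^ 2 * δ ≤ τ := ⟨τ / (lam ^ 2 + 1), by positivity, by rw [mul_div_assoc', div_le_iff₀ (by positivity)]; nlinarith⟩
    have hcQ := fun n α β => cont_QM (d := d n) (Lm := Lm) (X0 := X0 n) N.act.cont N.act.cont' ℓ α β k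
    have hcW := fun (n : ℕ) => cont_extW (d := d n) (Lm := Lm) (k + 1)
    have := N.as_step ⟨k + 1, by omega⟩ (fun n => {c | ∀ α β, ‖QM σ σ' (X0 n) c ℓ α β k‖ ≤ K})
      (fun n => {c | ∃ α β i, d n (k + 1) * δ ≤ |extW c (k + 1) i ⬝ᵥ QM σ σ' (X0 n) c ℓ α β k *ᵥ extW c (k + 1) i - (QM σ σ' (X0 n) c ℓ α β k).trace|})
      (fun n => ?_) (fun n => ?_) (κ ^ 6 * (C * K ^ 10 / δ ^ 10)) (fun n c w hw => ?_) hq ?_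
    · filter_upwards [this] with ω a1
      filter_upwards [a1, hd (k + 1) (by omega) (by omega), hd (k + 2) (by omega) (by omega)] with n b1 ⟨d1, d2, d3, d4⟩ ⟨_, e2, e3, e4⟩ α β
      refine le_trans ?_ hδτ
      refine tr_step N.act.b1 _ ℓ α β k (by omega) d2 e2 fun i => ?_
      simp only [not_exists, not_le] at b1
      exact (b1 α β i).le
    · simp only [Set.ofPred_forall]
      exact (isClosed_iInter fun α => isClosed_iInter fun β => isClosed_le (hcQ n α β).norm continuous_const).measurableSet
    · simp only [Set.ofPred_exists]
      refine MeasurableSet.iUnion fun α => MeasurableSet.iUnion fun β => MeasurableSet.iUnion fun i => (isClosed_le continuous_const ?_).measurableSet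
      have h1 : Continuous fun c : Cfg (d n) Lm => extW c (k + 1) i := (continuous_apply i).comp (hcW n)
      exact ((h1.dotProduct ((hcQ n α β).matrix_mulVec h1)).sub (hcQ n α β).matrix_trace).abs
    · intro α β
      have := hw α β
      rwa [QM_upd c ⟨k + 1, by omega⟩ w ℓ α β k (by simp)] at this
    · filter_upwards [hd (k + 1) (by omega) (by omega), hd (k + 2) (by omega) (by omega)] with n ⟨d1, d2, d3, d4⟩ ⟨_, e2, e3, e4⟩ c hc
      have e' := extW_upd c (⟨k + 1, by omega⟩ : Fin (Lm + 1))
      simp only at e'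
      have e2 := fun w α β => QM_upd (σ := σ) (σ' := σ') (X0 := X0 n) c (⟨k + 1, Nat.lt_succ_of_le hk⟩ : Fin (Lm + 1)) w ℓ α β k (Nat.lt_succ_self k)
      simp only [e', e2]
      refine (hg _ (d n (k + 2)) n δ K _ d2 hK hδ hc).trans (ENNReal.ofReal_le_ofReal ?_)
      have hd0 : (0 : ℝ) < d n (k + 1) := by exact_mod_cast d2
      have hn0 : (0 : ℝ) < n := by exact_mod_cast d1
      have h5 : (n : ℝ) ^ 5 ≤ κ ^ 5 * (d n (k + 1) : ℝ) ^ 5 := by rw [← mul_pow]; gcongr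
      calc (n : ℝ) * (n * (d n (k + 2) * (C * K ^ 10 / (δ ^ 10 * (d n (k + 1) : ℝ) ^ 5)))) ≤ n * (n * ((κ * n) * (C * K ^ 10 / (δ ^ 10 * (d n (k + 1) : ℝ) ^ 5)))) := by gcongr
        _ = κ * (C * K ^ 10 / δ ^ 10) * n ^ 5 / ((n : ℝ) ^ 2 * (d n (k + 1) : ℝ) ^ 5) := by field_simp
        _ ≤ κ * (C * K ^ 10 / δ ^ 10) * (κ ^ 5 * (d n (k + 1) : ℝ) ^ 5) / ((n : ℝ) ^ 2 * (d n (k + 1) : ℝ) ^ 5) := by gcongr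
        _ = _ := by field_simp

lemma Net.qf_out (ℓ : ℕ) : UC Pr (fun n ω α β => (d n (Lm + 1) : ℝ)⁻¹ * (wOut n ω ⬝ᵥ QM σ σ' (X0 n) (Zc W wOut n ω) ℓ α β Lm *ᵥ wOut n ω)) (a ^ (Lm - ℓ + 1)) ((b ^ 2) ^ (Lm - ℓ + 1)) := by
  refine (N.qm_tr ℓ Lm le_rfl).congr fun δ hδ => ?_
  obtain ⟨K, hK, hq⟩ := N.qm_norm ℓ Lm le_rfl
  obtain ⟨κ, hκ, hd⟩ := N.dims
  obtain ⟨C, hC, hg⟩ := gqm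
  have hcQ := fun n α β => cont_QM (d := d n) (Lm := Lm) (X0 := X0 n) N.act.cont N.act.cont' ℓ α β Lm
  have hQ2 : ∀ n α β (x : _) (y y' : Fin (d n (Lm + 1)) → ℝ), QM σ σ' (X0 n) ((x, y) : Cfg (d n) Lm) ℓ α β Lm = QM σ σ' (X0 n) ((x, y') : Cfg (d n) Lm) ℓ α β Lm := by
    intro n α β x y y'
    have hD : ∀ k α, Dg σ σ' (X0 n) ((x, y) : Cfg (d n) Lm) k α = Dg σ σ' (X0 n) ((x, y') : Cfg (d n) Lm) k α := fun _ _ => rfl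
    have : ∀ k, QM σ σ' (X0 n) ((x, y) : Cfg (d n) Lm) ℓ α β k = QM σ σ' (X0 n) ((x, y') : Cfg (d n) Lm) ℓ α β k := fun k => by
      induction k with
      | zero => rfl
      | succ k ih => rw [QM, QM, ih, hD, hD]; rfl
    exact this Lm
  have hE : ∀ n, MeasurableSet {c : Cfg (d n) Lm | (∀ α β, ‖QM σ σ' (X0 n) c ℓ α β Lm‖ ≤ K) ∧
      ∃ α β, d n (Lm + 1) * δ ≤ |c.2 ⬝ᵥ QM σ σ' (X0 n) c ℓ α β Lm *ᵥ c.2 - (QM σ σ' (X0 n) c ℓ α β Lm).trace|} := fun n => by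
    refine MeasurableSet.inter (s₁ := {c : Cfg (d n) Lm | ∀ α β, ‖QM σ σ' (X0 n) c ℓ α β Lm‖ ≤ K}) ?_ (s₂ := {c : Cfg (d n) Lm |
      ∃ α β, d n (Lm + 1) * δ ≤ |c.2 ⬝ᵥ QM σ σ' (X0 n) c ℓ α β Lm *ᵥ c.2 - (QM σ σ' (X0 n) c ℓ α β Lm).trace|}) ?_
    · simp only [Set.ofPred_forall]
      exact (isClosed_iInter fun α => isClosed_iInter fun β => isClosed_le (hcQ n α β).norm continuous_const).measurableSet
    · simp only [Set.ofPred_exists]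
      refine MeasurableSet.iUnion fun α => MeasurableSet.iUnion fun β => (isClosed_le continuous_const ?_).measurableSet
      exact ((continuous_snd.dotProduct ((hcQ n α β).matrix_mulVec continuous_snd)).sub (hcQ n α β).matrix_trace).abs
  have := N.as _ hE (κ ^ 6 * (C * K ^ 10 / δ ^ 10)) ?_
  · filter_upwards [this, hq] with ω a1 a2
    filter_upwards [a1, a2, hd (Lm + 1) (by omega) (by omega)] with n b1 b2 ⟨d1, d2, d3, d4⟩ α β
    have hd0 : (0 : ℝ) < d n (Lm + 1) := by exact_mod_cast d2
    simp only [not_and, not_exists, not_le] at b1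
    rw [← mul_sub, abs_mul, abs_of_pos (inv_pos.mpr hd0), inv_mul_le_iff₀ hd0]
    exact (b1 b2 α β).le
  · filter_upwards [hd (Lm + 1) (by omega) (by omega)] with n ⟨d1, d2, d3, d4⟩
    refine fub_snd _ _ _ (hE n) _ fun x => ?_
    by_cases hx : ∀ α β, ‖QM σ σ' (X0 n) ((x, 0) : Cfg (d n) Lm) ℓ α β Lm‖ ≤ K
    swap
    · rw [show {y | (x, y) ∈ {c : Cfg (d n) Lm | (∀ α β, ‖QM σ σ' (X0 n) c ℓ α β Lm‖ ≤ K) ∧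
        ∃ α β, d n (Lm + 1) * δ ≤ |c.2 ⬝ᵥ QM σ σ' (X0 n) c ℓ α β Lm *ᵥ c.2 - (QM σ σ' (X0 n) c ℓ α β Lm).trace|}} = ∅ from
          Set.eq_empty_iff_forall_notMem.mpr fun y hy => hx fun α β => by rw [hQ2 n α β x 0 y]; exact hy.1 α β, measure_empty]
      exact bot_le
    have hg1 := hg _ 1 n δ K _ d2 hK hδ hx
    have hg2 := (measurePreserving_eval (fun _ : Fin 1 => gaussianVec (d n (Lm + 1))) 0).measure_preimage (s := {y | ∃ α β, d n (Lm + 1) * δ ≤ |y ⬝ᵥ QM σ σ' (X0 n) ((x, 0) : Cfg (d n) Lm) ℓ α β Lm *ᵥ y - (QM σ σ' (X0 n) ((x, 0) : Cfg (d n) Lm) ℓ α β Lm).trace|}) ?_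
    swap
    · simp only [Set.ofPred_exists]
      refine (MeasurableSet.iUnion fun α => MeasurableSet.iUnion fun β => (isClosed_le continuous_const ?_).measurableSet).nullMeasurableSet
      unfold dotProduct mulVec dotProduct; fun_prop
    refine (measure_mono fun y hy => ?_).trans (hg2.symm.le.trans ((measure_mono fun Y hY => ?_).trans (hg1.trans (ENNReal.ofReal_le_ofReal ?_))))
    · obtain ⟨α, β, h⟩ := hy.2
      refine ⟨α, β, ?_⟩
      rw [hQ2 n α β x 0 y]; exact h
    · obtain ⟨α, β, h⟩ := hY
      exact ⟨α, β, 0, h⟩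
    · have hd0 : (0 : ℝ) < d n (Lm + 1) := by exact_mod_cast d2
      have hn0 : (0 : ℝ) < n := by exact_mod_cast d1
      have hn1 : (1 : ℝ) ≤ n := by exact_mod_cast d1
      have h5 : (n : ℝ) ^ 5 ≤ κ ^ 5 * (d n (Lm + 1) : ℝ) ^ 5 := by rw [← mul_pow]; gcongr
      have hone : (1 : ℝ) ≤ κ * n := one_le_mul_of_one_le_of_one_le hκ hn1
      calc (n : ℝ) * (n * ((1 : ℕ) * (C * K ^ 10 / (δ ^ 10 * (d n (Lm + 1) : ℝ) ^ 5)))) ≤ n * (n * ((κ * n) * (C * K ^ 10 / (δ ^ 10 * (d n (Lm + 1) : ℝ) ^ 5)))) := by gcongr; simpa using hone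
        _ = κ * (C * K ^ 10 / δ ^ 10) * n ^ 5 / ((n : ℝ) ^ 2 * (d n (Lm + 1) : ℝ) ^ 5) := by field_simp
        _ ≤ κ * (C * K ^ 10 / δ ^ 10) * (κ ^ 5 * (d n (Lm + 1) : ℝ) ^ 5) / ((n : ℝ) ^ 2 * (d n (Lm + 1) : ℝ) ^ 5) := by gcongr
        _ = _ := by field_simp
end

section
variable {d : ℕ → ℕ} {Lm n : ℕ} {σ σ' : ℝ → ℝ} {X0 : Matrix (Fin (d 0)) (Fin n) ℝ}

lemma QM_diag (c : Cfg d Lm) (ℓ : ℕ) (α β : Fin n) : QM σ σ' X0 c ℓ α β ℓ = Matrix.diagonal (Dg σ σ' X0 c ℓ α) * 1 * Matrix.diagonal (Dg σ σ' X0 c ℓ β) := by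
  cases ℓ with
  | zero => rfl
  | succ k => rw [QM, if_pos (Nat.lt_succ_self k)]

lemma back_gen (c : Cfg d Lm) (S : (ℓ : ℕ) → Matrix (Fin (d ℓ)) (Fin n) ℝ) (v : (k : ℕ) → Fin n → Fin (d (k + 1)) → ℝ)
    (hS : ∀ k ≤ Lm, ∀ α, (fun i => S (k + 1) i α) = (Real.sqrt (d (k + 1)))⁻¹ • (Matrix.diagonal (Dg σ σ' X0 c k α) *ᵥ v k α))
    (hv : ∀ k < Lm, ∀ α, v k α = (Matrix.of (extW c (k + 1)))ᵀ *ᵥ (fun i => S (k + 2) i α)) (ℓ k : ℕ) (hℓ : ℓ ≤ k) (hk : k ≤ Lm) (α β : Fin n) :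
    ((S (ℓ + 1))ᵀ * S (ℓ + 1)) α β = (d (k + 1) : ℝ)⁻¹ * (v k α ⬝ᵥ QM σ σ' X0 c ℓ α β k *ᵥ v k β) := by
  have hs : ∀ e : ℕ, (Real.sqrt e)⁻¹ * (Real.sqrt e)⁻¹ = (e : ℝ)⁻¹ := fun e => by rw [← mul_inv, Real.mul_self_sqrt (by positivity)]
  have hD : ∀ (k : ℕ) (T : Matrix (Fin (d (k + 1))) (Fin (d (k + 1))) ℝ), k ≤ Lm → (fun i => S (k + 1) i α) ⬝ᵥ T *ᵥ (fun i => S (k + 1) i β) =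
      (d (k + 1) : ℝ)⁻¹ * (v k α ⬝ᵥ (Matrix.diagonal (Dg σ σ' X0 c k α) * T * Matrix.diagonal (Dg σ σ' X0 c k β)) *ᵥ v k β) := by
    intro k T hk
    rw [hS k hk, hS k hk, Matrix.mulVec_smul, smul_dotProduct, dotProduct_smul, smul_smul, hs, smul_eq_mul, ← Matrix.mulVec_mulVec, ← Matrix.mulVec_mulVec,
      Matrix.dotProduct_mulVec _ (Matrix.diagonal _), ← Matrix.mulVec_transpose, Matrix.diagonal_transpose]
  induction k, hℓ using Nat.le_induction with
  | base =>
    rw [QM_diag, ← hD ℓ 1 hk, Matrix.one_mulVec]; rfl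
  | succ k hℓ ih =>
    rw [ih (by omega), hv k (by omega), hv k (by omega), QM, if_neg (by omega), ← hD (k + 1) _ hk, Matrix.smul_mulVec, dotProduct_smul, smul_eq_mul,
      ← Matrix.mulVec_mulVec, ← Matrix.mulVec_mulVec, Matrix.dotProduct_mulVec _ (Matrix.of _), ← Matrix.mulVec_transpose]

lemma back (c : Cfg d Lm) (S : (ℓ : ℕ) → Matrix (Fin (d ℓ)) (Fin n) ℝ)
    (h1 : ∀ i α, S (Lm + 1) i α = Dg σ σ' X0 c Lm α i * c.2 i * (Real.sqrt (d (Lm + 1)))⁻¹)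
    (h2 : ∀ k < Lm, ∀ i α, S (k + 1) i α = Dg σ σ' X0 c k α i * (Real.sqrt (d (k + 1)))⁻¹ * ∑ j, extW c (k + 1) j i * S (k + 2) j α) (ℓ : ℕ) (hℓ : ℓ ≤ Lm) (α β : Fin n) :
    ((S (ℓ + 1))ᵀ * S (ℓ + 1)) α β = (d (Lm + 1) : ℝ)⁻¹ * (c.2 ⬝ᵥ QM σ σ' X0 c ℓ α β Lm *ᵥ c.2) := by
  obtain ⟨v, hv1, hv2⟩ : ∃ v : (k : ℕ) → Fin n → Fin (d (k + 1)) → ℝ, (∀ α, v Lm α = c.2) ∧ ∀ k < Lm, ∀ α, v k α = (Matrix.of (extW c (k + 1)))ᵀ *ᵥ (fun i => S (k + 2) i α) :=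
    ⟨fun k α => if h : k = Lm then h ▸ c.2 else (Matrix.of (extW c (k + 1)))ᵀ *ᵥ (fun i => S (k + 2) i α), fun α => by simp, fun k hk α => dif_neg hk.ne⟩
  have := back_gen (σ := σ) (σ' := σ') (X0 := X0) c S v (fun k hk α => ?_) hv2 ℓ Lm hℓ le_rfl α β
  · rwa [hv1, hv1] at this
  · ext i
    rw [Pi.smul_apply, Matrix.mulVec_diagonal, smul_eq_mul]
    rcases hk.lt_or_eq with hk | rfl
    · rw [hv2 k hk, h2 k hk]
      simp only [mulVec, dotProduct, Matrix.transpose_apply, Matrix.of_apply]; ring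
    · rw [hv1, h1]; ring
end

/-- Hadamard products of Gram matrices -/
lemma had_norm {e f n : ℕ} (S : Matrix (Fin e) (Fin n) ℝ) (X : Matrix (Fin f) (Fin n) ℝ) (M : ℝ) (hM : 0 ≤ M) (hS : ∀ α, (Sᵀ * S) α α ≤ M) :
    ‖Matrix.hadamard (Sᵀ * S) (Xᵀ * X)‖ ≤ M * ‖X‖ ^ 2 := by
  obtain ⟨Y, hY⟩ : ∃ Y : Matrix (Fin e × Fin f) (Fin n) ℝ, Y = Matrix.of fun p α => S p.1 α * X p.2 α := ⟨_, rfl⟩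
  have e1 : Matrix.hadamard (Sᵀ * S) (Xᵀ * X) = Yᴴ * Y := by
    ext α β
    rw [Matrix.hadamard_apply, Matrix.mul_apply, Matrix.mul_apply, Matrix.mul_apply, Fintype.sum_prod_type, Finset.sum_mul_sum]
    refine Finset.sum_congr rfl fun i _ => Finset.sum_congr rfl fun j _ => ?_
    simp [hY]; ring
  rw [e1, Matrix.l2_opNorm_conjTranspose_mul_self, ← sq]
  have : ‖Y‖ ≤ Real.sqrt M * ‖X‖ := by
    refine nrm_le_r _ _ (by positivity) fun v => ?_
    rw [mul_pow, Real.sq_sqrt hM, Fintype.sum_prod_type]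
    have h1 : ∀ i, ∑ j, (Y *ᵥ v) (i, j) ^ 2 ≤ ‖X‖ ^ 2 * ∑ α, (S i α * v α) ^ 2 := fun i => by
      have := nrm_mulVec_r X (fun α => S i α * v α)
      refine le_trans (le_of_eq ?_) this
      refine Finset.sum_congr rfl fun j _ => ?_
      simp only [hY, mulVec, dotProduct, Matrix.of_apply]
      congr 1; exact Finset.sum_congr rfl fun α _ => by ring
    refine (Finset.sum_le_sum fun i _ => h1 i).trans ?_
    rw [← Finset.mul_sum, Finset.sum_comm, mul_comm M, mul_assoc]
    gcongr
    rw [Finset.mul_sum]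
    gcongr with α
    simp only [mul_pow, ← Finset.sum_mul]
    gcongr
    refine le_trans (le_of_eq ?_) (hS α)
    rw [Matrix.mul_apply]; exact Finset.sum_congr rfl fun i _ => by simp [sq]
  calc ‖Y‖ ^ 2 ≤ (Real.sqrt M * ‖X‖) ^ 2 := by gcongr
    _ = _ := by rw [mul_pow, Real.sq_sqrt hM]

lemma had_fro {f n : ℕ} (G : Matrix (Fin n) (Fin n) ℝ) (X : Matrix (Fin f) (Fin n) ℝ) (r q τ B : ℝ) (hG : ∀ α β, |G α β - if α = β then r else q| ≤ τ)
    (hP : ∀ α, |(Xᵀ * X) α α - 1| ≤ τ) (hX : ‖X‖ ≤ B) :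
    fro (Matrix.hadamard G (Xᵀ * X) - ((r - q) • 1 + q • (Xᵀ * X))) ≤ 2 * τ ^ 2 * (B ^ 4 + (r - q) ^ 2) * n := by
  have h0 : ‖Xᵀ * X‖ ≤ B ^ 2 := by
    refine (Matrix.l2_opNorm_mul _ _).trans ?_
    rw [nrm_transpose, sq]; gcongr; exact (norm_nonneg _).trans hX
  have h1 : fro (Xᵀ * X) ≤ n * B ^ 4 := by
    have := fro_le (Xᵀ * X)
    rw [Fintype.card_fin] at this
    refine this.trans ?_
    rw [show B ^ 4 = (B ^ 2) ^ 2 by ring]; gcongr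
  generalize Xᵀ * X = P at *
  have h2 : fro (Matrix.hadamard G P - ((r - q) • 1 + q • P)) ≤ ∑ α, ∑ β, (2 * τ ^ 2 * ‖P α β‖ ^ 2 + if α = β then 2 * (r - q) ^ 2 * τ ^ 2 else 0) := by
    unfold fro
    gcongr with α _ β _
    have e : ‖(Matrix.hadamard G P - ((r - q) • 1 + q • P)) α β‖ = |(G α β - if α = β then r else q) * P α β + if α = β then (r - q) * (P α α - 1) else 0| := by
      rw [Real.norm_eq_abs]; congr 1
      by_cases h : α = β
      · subst h; simp; ring
      · simp [h]; ring
    have k1 : ((G α β - if α = β then r else q) * P α β) ^ 2 ≤ τ ^ 2 * ‖P α β‖ ^ 2 := by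
      rw [mul_pow, Real.norm_eq_abs, sq_abs (P α β)]
      exact mul_le_mul_of_nonneg_right (sq_le_sq' (abs_le.mp (hG α β)).1 (abs_le.mp (hG α β)).2) (sq_nonneg _)
    have k2 : (if α = β then (r - q) * (P α α - 1) else 0) ^ 2 ≤ if α = β then (r - q) ^ 2 * τ ^ 2 else 0 := by
      split_ifs
      · rw [mul_pow]; exact mul_le_mul_of_nonneg_left (sq_le_sq' (abs_le.mp (hP α)).1 (abs_le.mp (hP α)).2) (sq_nonneg _)
      · simp
    have k3 : (if α = β then 2 * (r - q) ^ 2 * τ ^ 2 else 0) = 2 * (if α = β then (r - q) ^ 2 * τ ^ 2 else 0) := by split_ifs <;> ring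
    rw [e, sq_abs, k3]
    nlinarith [add_sq_le (a := (G α β - if α = β then r else q) * P α β) (b := if α = β then (r - q) * (P α α - 1) else 0)]
  refine h2.trans ?_
  simp only [Finset.sum_add_distrib, Finset.sum_ite_eq, Finset.mem_univ, if_true, ← Finset.mul_sum, Finset.sum_const, Finset.card_univ, Fintype.card_fin, nsmul_eq_mul]
  have : 2 * τ ^ 2 * fro P ≤ 2 * τ ^ 2 * (n * B ^ 4) := by gcongr
  unfold fro at this
  linarith

lemma fro_sum {n : ℕ} {ι : Type*} (s : Finset ι) (M : ι → Matrix (Fin n) (Fin n) ℝ) : fro (∑ i ∈ s, M i) ≤ s.card * ∑ i ∈ s, fro (M i) := by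
  unfold fro
  rw [Finset.sum_comm (s := s), Finset.mul_sum]
  refine Finset.sum_le_sum fun (α : Fin n) _ => ?_
  rw [Finset.sum_comm (s := s), Finset.mul_sum]
  refine Finset.sum_le_sum fun (β : Fin n) _ => ?_
  simp only [Real.norm_eq_abs, sq_abs, Matrix.sum_apply]
  exact sq_sum_le_card_mul_sum_sq

lemma NegI.herm {n : ℕ} {H : Matrix (Fin n) (Fin n) ℝ} (hH : H.IsHermitian) (z : ℂ) : NegI z.im ((-z) • 1 + cx H) := by
  intro v
  have h := NegI.smul_one (n := n) (-z) v
  rw [Complex.neg_im, neg_neg] at h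
  have hc : (cx H).IsHermitian := by
    rw [Matrix.IsHermitian, cx_conjT]; congr 1
  have := hc.im_star_dotProduct_mulVec_self v
  rw [Matrix.add_mulVec, dotProduct_add, Complex.add_im]
  change (star v ⬝ᵥ cx H *ᵥ v).im = 0 at this
  linarith

lemma res_cmp {n : ℕ} (hn : 0 < n) {H H' : Matrix (Fin n) (Fin n) ℝ} (hH : H.IsHermitian) (hH' : H'.IsHermitian) (z : ℂ) (hz : 0 < z.im) :
    ‖(n : ℂ)⁻¹ * ((-z) • 1 + cx H)⁻¹.trace - (n : ℂ)⁻¹ * ((-z) • 1 + cx H')⁻¹.trace‖ ^ 2 ≤ z.im⁻¹ ^ 4 * ((n : ℝ)⁻¹ * fro (H - H')) := by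
  have hn' : (0 : ℝ) < n := by exact_mod_cast hn
  have h1 := NegI.herm hH z
  have h2 := NegI.herm hH' z
  rw [← mul_sub, ← Matrix.trace_sub, minv_sub (h1.isUnit hz) (h2.isUnit hz), norm_mul, mul_pow, norm_inv, Complex.norm_natCast, Matrix.mul_assoc]
  have e : (-z) • 1 + cx H' - ((-z) • 1 + cx H) = cx (H' - H) := by ext i j; simp [Matrix.map_apply]
  have e2 : fro (cx (H' - H)) = fro (H - H') := by
    unfold fro
    refine Finset.sum_congr rfl fun i _ => Finset.sum_congr rfl fun j _ => ?_
    rw [cx, Matrix.map_apply, Complex.norm_real, ← neg_sub H H', Matrix.neg_apply, norm_neg]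
  rw [e]
  have k1 := tr_sq_le ((-z) • 1 + cx H)⁻¹ (cx (H' - H) * ((-z) • 1 + cx H')⁻¹)
  have k2 := fro_le ((-z) • 1 + cx H)⁻¹
  have k3 := fro_mul' (cx (H' - H)) ((-z) • 1 + cx H')⁻¹
  have k4 := h1.norm_inv hz
  have k5 := h2.norm_inv hz
  rw [Fintype.card_fin] at k2
  rw [e2] at k3
  have k6 : fro ((-z) • 1 + cx H)⁻¹ ≤ n * z.im⁻¹ ^ 2 := k2.trans (by gcongr)
  have k7 : fro (cx (H' - H) * ((-z) • 1 + cx H')⁻¹) ≤ fro (H - H') * z.im⁻¹ ^ 2 := k3.trans (by gcongr; exact fro_nonneg _)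
  have k8 := k1.trans (mul_le_mul k6 k7 (fro_nonneg _) (by positivity))
  calc (n : ℝ)⁻¹ ^ 2 * _ ≤ (n : ℝ)⁻¹ ^ 2 * (n * z.im⁻¹ ^ 2 * (fro (H - H') * z.im⁻¹ ^ 2)) := by gcongr
    _ = _ := by field_simp

/-- linear combination of Gram matrices -/
noncomputable def Lin {d : ℕ → ℕ} {n : ℕ} (X : (ℓ : ℕ) → Matrix (Fin (d ℓ)) (Fin n) ℝ) (L : ℕ) (zs : Fin (L + 2) → ℝ) : Matrix (Fin n) (Fin n) ℝ :=
  zs 0 • 1 + ∑ i : Fin (L + 1), zs i.succ • ((X i)ᵀ * X i)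

lemma gram_herm {e n : ℕ} (X : Matrix (Fin e) (Fin n) ℝ) : (Xᵀ * X).IsHermitian := Matrix.isHermitian_conjTranspose_mul_self X

lemma herm_sum {n : ℕ} {ι : Type*} (s : Finset ι) (M : ι → Matrix (Fin n) (Fin n) ℝ) (h : ∀ i ∈ s, (M i).IsHermitian) : (∑ i ∈ s, M i).IsHermitian := by
  rw [Matrix.IsHermitian, Matrix.conjTranspose_sum]; exact Finset.sum_congr rfl h

lemma herm_smul {n : ℕ} (c : ℝ) {M : Matrix (Fin n) (Fin n) ℝ} (h : M.IsHermitian) : (c • M).IsHermitian := by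
  rw [Matrix.IsHermitian, Matrix.conjTranspose_smul, h]; simp

section
variable {d : ℕ → ℕ} {n : ℕ} (X : (ℓ : ℕ) → Matrix (Fin (d ℓ)) (Fin n) ℝ) (L : ℕ) (zs : Fin (L + 2) → ℝ)
lemma Lin_herm : (Lin X L zs).IsHermitian :=
  (herm_smul _ Matrix.isHermitian_one).add (herm_sum _ _ fun _ _ => herm_smul _ (gram_herm _))

lemma Lin_Yv (z : ℂ) : (-z) • 1 + cx (Lin X L zs) = Yv X L (fun i => if i = 0 then (zs 0 : ℂ) - z else (zs i : ℂ)) := by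
  unfold Lin Yv
  have : ∀ s : Finset (Fin (L + 1)), cx (∑ i ∈ s, zs i.succ • ((X i)ᵀ * X i)) = ∑ i ∈ s, (zs i.succ : ℂ) • cx ((X i)ᵀ * X i) := fun s => by
    induction s using Finset.cons_induction with
    | empty => ext; simp
    | cons a s ha ih => rw [Finset.sum_cons, Finset.sum_cons, cx_add, ih, cx_smul]
  have h1 : cx (1 : Matrix (Fin n) (Fin n) ℝ) = 1 := by ext i j; simp [Matrix.one_apply, apply_ite]
  rw [cx_add, cx_smul, this, h1]
  simp only [if_true, Fin.succ_ne_zero, if_false, sub_smul, neg_smul]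
  abel

lemma Yv_one : Yv X L (fun i => if i = 0 then 1 else 0) = 1 := by simp [Yv]

lemma Lin_norm (B : ℝ) (h : ∀ i ≤ L, ‖X i‖ ≤ B) : ‖Lin X L zs‖ ≤ |zs 0| + ∑ i : Fin (L + 1), |zs i.succ| * B ^ 2 := by
  unfold Lin
  refine (norm_add_le _ _).trans (add_le_add ?_ ((norm_sum_le _ _).trans (Finset.sum_le_sum fun i _ => ?_)))
  · rw [norm_smul]; exact mul_le_of_le_one_right (norm_nonneg _) nrm_one_r
  · rw [norm_smul]
    refine mul_le_mul_of_nonneg_left ((Matrix.l2_opNorm_mul _ _).trans ?_) (norm_nonneg _)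
    have := h i (by omega)
    rw [nrm_transpose, sq]; gcongr; exact (norm_nonneg _).trans this
end

section
variable {Ω : Type*} [MeasurableSpace Ω] {Pr : Measure Ω} {Lm : ℕ} {d : ℕ → ℕ → ℕ} {σ σ' σ'' : ℝ → ℝ} {lam b a : ℝ}
    {W : (n : ℕ) → (ℓ : ℕ) → Ω → Fin (d n (ℓ + 1)) → Fin (d n ℓ) → ℝ} {wOut : (n : ℕ) → Ω → Fin (d n (Lm + 1)) → ℝ}
    {X0 : (n : ℕ) → Matrix (Fin (d n 0)) (Fin n) ℝ} {ε : ℕ → ℝ} {B : ℝ} {γ : ℕ → ℝ}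

/-- the NTK as a function of layers and backpropagation matrices -/
noncomputable def KN {d : ℕ → ℕ} {n : ℕ} (Lm : ℕ) (X S : (ℓ : ℕ) → Matrix (Fin (d ℓ)) (Fin n) ℝ) : Matrix (Fin n) (Fin n) ℝ :=
  (X (Lm + 1))ᵀ * X (Lm + 1) + ∑ ℓ ∈ Finset.range (Lm + 1), Matrix.hadamard ((S (ℓ + 1))ᵀ * S (ℓ + 1)) ((X ℓ)ᵀ * X ℓ)

/-- coefficients of the linearized NTK -/
noncomputable def qv (a b : ℝ) (Lm : ℕ) : Fin (Lm + 3) → ℝ := fun i =>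
  if i = 0 then ∑ ℓ ∈ Finset.range (Lm + 1), (a ^ (Lm + 1 - ℓ) - (b ^ 2) ^ (Lm + 1 - ℓ)) else
    if i = Fin.last (Lm + 2) then 1 else (b ^ 2) ^ (Lm + 2 - (i : ℕ))

lemma KN_sub {d : ℕ → ℕ} {n : ℕ} (Lm : ℕ) (X S : (ℓ : ℕ) → Matrix (Fin (d ℓ)) (Fin n) ℝ) (a b : ℝ) :
    KN Lm X S - Lin X (Lm + 1) (qv a b Lm) = ∑ ℓ ∈ Finset.range (Lm + 1), (Matrix.hadamard ((S (ℓ + 1))ᵀ * S (ℓ + 1)) ((X ℓ)ᵀ * X ℓ) -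
      ((a ^ (Lm + 1 - ℓ) - (b ^ 2) ^ (Lm + 1 - ℓ)) • 1 + (b ^ 2) ^ (Lm + 1 - ℓ) • ((X ℓ)ᵀ * X ℓ))) := by
  have h1 : ∀ i : Fin (Lm + 1), qv a b Lm i.castSucc.succ = (b ^ 2) ^ (Lm + 1 - (i : ℕ)) := fun i => by
    rw [qv, if_neg (Fin.succ_ne_zero _), if_neg]
    · congr 1; simp
    · intro h
      have := congrArg Fin.val h
      simp at this; omega
  have h2 : qv a b Lm (Fin.last (Lm + 1)).succ = 1 := by
    rw [qv, if_neg (Fin.succ_ne_zero _), if_pos (by simp)]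
  rw [KN, Lin, Fin.sum_univ_castSucc, h2, one_smul]
  simp only [h1, Fin.val_castSucc, Fin.val_last]
  rw [Fin.sum_univ_eq_sum_range (fun i => (b ^ 2) ^ (Lm + 1 - i) • ((X i)ᵀ * X i)) (Lm + 1), Finset.sum_sub_distrib, Finset.sum_add_distrib, ← Finset.sum_smul]
  rw [show qv a b Lm 0 = ∑ ℓ ∈ Finset.range (Lm + 1), (a ^ (Lm + 1 - ℓ) - (b ^ 2) ^ (Lm + 1 - ℓ)) from if_pos rfl]
  abel

lemma KN_herm {d : ℕ → ℕ} {n : ℕ} (Lm : ℕ) (X S : (ℓ : ℕ) → Matrix (Fin (d ℓ)) (Fin n) ℝ) : (KN Lm X S).IsHermitian := by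
  refine (gram_herm _).add (herm_sum _ _ fun ℓ _ => ?_)
  ext α β
  have h1 := (gram_herm (S (ℓ + 1))).apply α β
  have h2 := (gram_herm (X ℓ)).apply α β
  simp only [Matrix.conjTranspose_apply, Matrix.hadamard_apply, star_trivial] at h1 h2 ⊢
  rw [h1, h2]

variable (N : Net Pr Lm d σ σ' σ'' lam b a W wOut X0 ε B γ)
  {S : (n : ℕ) → Ω → (ℓ : ℕ) → Matrix (Fin (d n ℓ)) (Fin n) ℝ}
  (hS1 : ∀ n ω i α, S n ω (Lm + 1) i α = Dg σ σ' (X0 n) (Zc W wOut n ω) Lm α i * wOut n ω i * (Real.sqrt (d n (Lm + 1)))⁻¹)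
  (hS2 : ∀ n ω, ∀ k < Lm, ∀ i α, S n ω (k + 1) i α = Dg σ σ' (X0 n) (Zc W wOut n ω) k α i * (Real.sqrt (d n (k + 1)))⁻¹ * ∑ j, extW (Zc W wOut n ω) (k + 1) j i * S n ω (k + 2) j α)
include N hS1 hS2

lemma Net.uc_gram (ℓ : ℕ) (hℓ : ℓ ≤ Lm) : UC Pr (fun n ω α β => ((S n ω (ℓ + 1))ᵀ * S n ω (ℓ + 1)) α β) (a ^ (Lm + 1 - ℓ)) ((b ^ 2) ^ (Lm + 1 - ℓ)) := by
  have := N.qf_out ℓ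
  rw [show Lm - ℓ + 1 = Lm + 1 - ℓ by omega] at this
  refine this.congr fun τ hτ => Eventually.of_forall fun ω => Eventually.of_forall fun n α β => ?_
  rw [back (Zc W wOut n ω) (S n ω) (hS1 n ω) (hS2 n ω) ℓ hℓ]
  simpa [Zc] using hτ.le

lemma Net.kn_norm : ∃ K, 0 < K ∧ ∀ᵐ ω ∂Pr, ∀ᶠ n in atTop, ‖KN Lm (cL σ (X0 n) (Zc W wOut n ω)) (S n ω)‖ ≤ K := by
  obtain ⟨B1, hB1, h1⟩ := N.norm_as
  refine ⟨B1 ^ 2 + ∑ ℓ ∈ Finset.range (Lm + 1), (|a ^ (Lm + 1 - ℓ)| + 1) * B1 ^ 2, by positivity, ?_⟩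
  have h2 : ∀ᵐ ω ∂Pr, ∀ ℓ, ℓ ≤ Lm → ∀ᶠ n in atTop, ∀ α, ((S n ω (ℓ + 1))ᵀ * S n ω (ℓ + 1)) α α ≤ |a ^ (Lm + 1 - ℓ)| + 1 := by
    rw [ae_all_iff]; intro ℓ
    by_cases hℓ : ℓ ≤ Lm
    · filter_upwards [N.uc_gram hS1 hS2 ℓ hℓ 1 one_pos] with ω a1 _
      filter_upwards [a1] with n b1 α
      have := b1 α α
      rw [if_pos rfl] at this
      linarith [(abs_le.mp this).2, le_abs_self (a ^ (Lm + 1 - ℓ))]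
    · simp [hℓ]
  filter_upwards [h1, h2] with ω a1 a2
  have a3 := (eventually_all_finset (Finset.range (Lm + 1))).mpr fun ℓ hℓ => a2 ℓ (by rw [Finset.mem_range] at hℓ; omega)
  filter_upwards [a1, a3] with n b1 b2
  refine (norm_add_le _ _).trans (add_le_add ?_ ((norm_sum_le _ _).trans (Finset.sum_le_sum fun ℓ hℓ => ?_)))
  · refine (Matrix.l2_opNorm_mul _ _).trans ?_
    have := b1 (Lm + 1) le_rfl
    rw [nrm_transpose, sq]; gcongr
  · refine (had_norm _ _ _ (by positivity) (b2 ℓ hℓ)).trans ?_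
    have := b1 ℓ (by rw [Finset.mem_range] at hℓ; omega)
    gcongr

lemma Net.kn_fro : ∀ᵐ ω ∂Pr, Tendsto (fun n : ℕ => (n : ℝ)⁻¹ * fro (KN Lm (cL σ (X0 n) (Zc W wOut n ω)) (S n ω) - Lin (cL σ (X0 n) (Zc W wOut n ω)) (Lm + 1) (qv a b Lm))) atTop (𝓝 0) := by
  obtain ⟨B1, hB1, h1⟩ := N.norm_as
  obtain ⟨C, hC⟩ : ∃ C : ℝ, C = (Lm + 1) * ∑ ℓ ∈ Finset.range (Lm + 1), 2 * (B1 ^ 4 + (a ^ (Lm + 1 - ℓ) - (b ^ 2) ^ (Lm + 1 - ℓ)) ^ 2) := ⟨_, rfl⟩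
  have key : ∀ m : ℕ, ∀ᵐ ω ∂Pr, ∀ᶠ n : ℕ in atTop, (n : ℝ)⁻¹ * fro (KN Lm (cL σ (X0 n) (Zc W wOut n ω)) (S n ω) - Lin (cL σ (X0 n) (Zc W wOut n ω)) (Lm + 1) (qv a b Lm)) ≤ C * (1 / ((m : ℝ) + 1)) ^ 2 := by
    intro m
    obtain ⟨τ, hτ, hτ0⟩ : ∃ τ : ℝ, τ = 1 / ((m : ℝ) + 1) ∧ 0 < τ := ⟨_, rfl, by positivity⟩
    rw [← hτ]
    have h2 : ∀ᵐ ω ∂Pr, ∀ ℓ, ℓ ≤ Lm → ∀ᶠ n in atTop, (∀ α β, |((S n ω (ℓ + 1))ᵀ * S n ω (ℓ + 1)) α β - if α = β then a ^ (Lm + 1 - ℓ) else (b ^ 2) ^ (Lm + 1 - ℓ)| ≤ τ) ∧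
        ∀ α, |((cL σ (X0 n) (Zc W wOut n ω) ℓ)ᵀ * cL σ (X0 n) (Zc W wOut n ω) ℓ) α α - 1| ≤ τ := by
      rw [ae_all_iff]; intro ℓ
      by_cases hℓ : ℓ ≤ Lm
      · obtain ⟨εl, Bl, o1, o2⟩ := N.orth_as ℓ (by omega)
        filter_upwards [N.uc_gram hS1 hS2 ℓ hℓ τ hτ0, o2] with ω a1 a2 _
        filter_upwards [a1, a2, eps_half o1 τ hτ0] with n b1 b2 b3
        refine ⟨b1, fun α => ?_⟩
        have := (b2.1 α).trans ((le_abs_self _).trans b3.2)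
        rw [Matrix.mul_apply]; simpa [sq] using this
      · simp [hℓ]
    filter_upwards [h1, h2] with ω a1 a2
    have a3 := (eventually_all_finset (Finset.range (Lm + 1))).mpr fun ℓ hℓ => a2 ℓ (by rw [Finset.mem_range] at hℓ; omega)
    filter_upwards [a1, a3, eventually_gt_atTop 0] with n b1 b2 hn
    have hn' : (0 : ℝ) < n := by exact_mod_cast hn
    rw [KN_sub, inv_mul_le_iff₀ hn']
    refine (fro_sum _ _).trans ?_
    rw [Finset.card_range, hC]
    push_cast
    rw [mul_assoc, ← mul_assoc (n : ℝ), mul_comm (n : ℝ), mul_assoc, Finset.sum_mul]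
    refine mul_le_mul_of_nonneg_left ?_ (by positivity)
    rw [Finset.mul_sum]
    refine Finset.sum_le_sum fun ℓ hℓ => ?_
    refine (had_fro _ _ _ _ τ B1 (b2 ℓ hℓ).1 (b2 ℓ hℓ).2 (b1 ℓ (by rw [Finset.mem_range] at hℓ; omega))).trans (le_of_eq ?_)
    ring
  filter_upwards [ae_all_iff.mpr key] with ω hω
  have hlim : Tendsto (fun m : ℕ => C * (1 / ((m : ℝ) + 1)) ^ 2) atTop (𝓝 0) := by
    simpa using ((tendsto_one_div_add_atTop_nhds_zero_nat (𝕜 := ℝ)).pow 2).const_mul C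
  refine tendsto_order.mpr ⟨fun x hx => Eventually.of_forall fun n => hx.trans_le (mul_nonneg (by positivity) (fro_nonneg _)), fun x hx => ?_⟩
  obtain ⟨m, hm⟩ := (hlim.eventually (gt_mem_nhds hx)).exists
  filter_upwards [hω m] with n hn
  exact hn.trans_lt hm

lemma Net.kn_tr (m : ℂ) (z : ℂ) (hz : 0 < z.im) (h : ∀ᵐ ω ∂Pr, Tendsto (fun n : ℕ => (n : ℂ)⁻¹ * ((-z) • (1 : Matrix (Fin n) (Fin n) ℂ) + cx (Lin (cL σ (X0 n) (Zc W wOut n ω)) (Lm + 1) (qv a b Lm)))⁻¹.trace) atTop (𝓝 m)) :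
    ∀ᵐ ω ∂Pr, Tendsto (fun n : ℕ => (n : ℂ)⁻¹ * ((-z) • (1 : Matrix (Fin n) (Fin n) ℂ) + cx (KN Lm (cL σ (X0 n) (Zc W wOut n ω)) (S n ω)))⁻¹.trace) atTop (𝓝 m) := by
  filter_upwards [h, N.kn_fro hS1 hS2] with ω a1 a2
  refine a1.congr_dist ?_
  have h2 := (a2.const_mul (z.im⁻¹ ^ 4)).sqrt
  rw [mul_zero, Real.sqrt_zero] at h2
  refine squeeze_zero' (Eventually.of_forall fun n => dist_nonneg) ?_ h2
  filter_upwards [eventually_gt_atTop 0] with n hn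
  rw [dist_comm, dist_eq_norm]
  exact Real.le_sqrt_of_sq_le (res_cmp hn (KN_herm _ _ _) (Lin_herm _ _ _) z hz)
end

end Helpers

theorem ntk_spectrum
    -- the number of layers is `L = Lm + 1 ≥ 1`
    (Lm : ℕ)
    (d : ℕ → ℕ → ℕ)
    (σ σ' σ'' : ℝ → ℝ) (lamσ : ℝ)
    (hderiv1 : ∀ x, HasDerivAt σ (σ' x) x)
    (hderiv2 : ∀ x, HasDerivAt σ' (σ'' x) x)
    (hσ'bdd : ∀ x, |σ' x| ≤ lamσ) (hσ''bdd : ∀ x, |σ'' x| ≤ lamσ)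
    (hmean : (∫ x, σ x ∂stdGaussian) = 0)
    (hvar : (∫ x, (σ x) ^ 2 ∂stdGaussian) = 1)
    (bσ aσ : ℝ)
    (hbσ : bσ = ∫ x, σ' x ∂stdGaussian) (haσ : aσ = ∫ x, (σ' x) ^ 2 ∂stdGaussian)
    (hbσ0 : bσ ≠ 0)
    (Ω : Type*) [MeasurableSpace Ω] (Pr : Measure Ω) [IsProbabilityMeasure Pr]
    (W : (n : ℕ) → (ℓ : ℕ) → Ω → Fin (d n (ℓ + 1)) → Fin (d n ℓ) → ℝ)
    (wOut : (n : ℕ) → Ω → Fin (d n (Lm + 1)) → ℝ)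
    (hW : ∀ n : ℕ,
      Measure.map (fun ω => (fun ℓ : Fin (Lm + 1) => W n ℓ ω, wOut n ω)) Pr =
        (Measure.pi fun ℓ : Fin (Lm + 1) =>
          gaussianMat (d n ((ℓ : ℕ) + 1)) (d n (ℓ : ℕ))).prod
          (gaussianVec (d n (Lm + 1))))
    (X0 : (n : ℕ) → Matrix (Fin (d n 0)) (Fin n) ℝ)
    (ε : ℕ → ℝ) (B : ℝ)
    (hX0orth : ∀ n, IsOrthonormal (ε n) B (X0 n))
    (hε : Tendsto (fun n : ℕ => ε n * (n : ℝ) ^ ((1 : ℝ) / 4)) atTop (𝓝 0))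
    (γ : ℕ → ℝ) (hγ : ∀ ℓ, 1 ≤ ℓ → ℓ ≤ Lm + 1 → 0 < γ ℓ)
    (hdim : ∀ ℓ, 1 ≤ ℓ → ℓ ≤ Lm + 1 →
      Tendsto (fun n : ℕ => (n : ℝ) / (d n ℓ : ℝ)) atTop (𝓝 (γ ℓ)))
    (μ0 : Measure ℝ) (hμ0prob : IsProbabilityMeasure μ0)
    (hμ0supp : μ0 (Set.Iio 0) = 0)
    (hμ0conv : ∀ f : BoundedContinuousFunction ℝ ℝ,
      Tendsto (fun n : ℕ => esd ((X0 n)ᵀ * X0 n) f) atTop (𝓝 (∫ x, f x ∂μ0)))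
    -- the backpropagation matrices `S_ℓ`, defined by their recursion from layer `L` down
    (S : (n : ℕ) → Ω → (ℓ : ℕ) → Matrix (Fin (d n ℓ)) (Fin n) ℝ)
    (hStop : ∀ n ω (i : Fin (d n (Lm + 1))) (a : Fin n),
      S n ω (Lm + 1) i a =
        σ' (preact σ (d n) n (fun m => W n m ω) (X0 n) Lm i a) * wOut n ω i *
          (Real.sqrt (d n (Lm + 1)))⁻¹)
    (hSrec : ∀ n ω (ℓ : ℕ), ℓ < Lm → ∀ (i : Fin (d n (ℓ + 1))) (a : Fin n),
      S n ω (ℓ + 1) i a =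
        σ' (preact σ (d n) n (fun m => W n m ω) (X0 n) ℓ i a) *
          (Real.sqrt (d n (ℓ + 1)))⁻¹ *
          ∑ j, W n (ℓ + 1) ω j i * S n ω (ℓ + 2) j a)
    -- the recursively defined functions `t_ℓ` and `s_ℓ`
    (t : (ℓ : ℕ) → (Fin (ℓ + 2) → ℂ) → (Fin (ℓ + 2) → ℂ) → ℂ)
    (s : (ℓ : ℕ) → (Fin (ℓ + 2) → ℂ) → ℂ)
    (ht0 : ∀ zv : Fin 2 → ℂ, InDomZ zv → ∀ wv : Fin 2 → ℂ,
      t 0 zv wv = ∫ x, (wv 0 + wv 1 * x) / (zv 0 + zv 1 * x) ∂μ0)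
    (hs : ∀ ℓ : ℕ, ℓ ≤ Lm → ∀ zv : Fin (ℓ + 3) → ℂ, InDomZ zv →
      0 < (s (ℓ + 1) zv).im ∧
        s (ℓ + 1) zv = (zv (Fin.last (ℓ + 2)))⁻¹ +
          (γ (ℓ + 1) : ℂ) * t ℓ (zprevVec bσ (s (ℓ + 1) zv) zv) (eVec bσ ℓ))
    (ht : ∀ ℓ : ℕ, ℓ ≤ Lm → ∀ zv : Fin (ℓ + 3) → ℂ, InDomZ zv →
      ∀ wv : Fin (ℓ + 3) → ℂ,
        t (ℓ + 1) zv wv = wv (Fin.last (ℓ + 2)) / zv (Fin.last (ℓ + 2)) +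
          t ℓ (zprevVec bσ (s (ℓ + 1) zv) zv) (wprevVec zv wv)) :
    let XX := fun (n : ℕ) (ω : Ω) (ℓ : ℕ) => netLayer σ (d n) n (fun m => W n m ω) (X0 n) ℓ
    let KNTK := fun (n : ℕ) (ω : Ω) =>
      (XX n ω (Lm + 1))ᵀ * XX n ω (Lm + 1) +
        ∑ ℓ ∈ Finset.range (Lm + 1),
          Matrix.hadamard ((S n ω (ℓ + 1))ᵀ * S n ω (ℓ + 1)) ((XX n ω ℓ)ᵀ * XX n ω ℓ)
    let rplus := ∑ ℓ ∈ Finset.range (Lm + 1), (aσ ^ (Lm + 1 - ℓ) - (bσ ^ 2) ^ (Lm + 1 - ℓ))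
    -- the vector `(r₊, q₀, …, q_{L−1}, 1)`
    let qs := fun i : Fin (Lm + 3) =>
      if i = 0 then rplus else
        if i = Fin.last (Lm + 2) then 1 else (bσ ^ 2) ^ (Lm + 2 - (i : ℕ))
    -- first conclusion: spectra of arbitrary fixed linear combinations
    (∀ zs : Fin (Lm + 3) → ℝ, zs (Fin.last (Lm + 2)) ≠ 0 →
      ∃ ν : Measure ℝ, IsProbabilityMeasure ν ∧
        (∀ z : ℂ, 0 < z.im →
          stieltjesT ν z =
            t (Lm + 1) (fun i => if i = 0 then (zs 0 : ℂ) - z else (zs i : ℂ))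
              (fun i => if i = 0 then 1 else 0)) ∧
        ∀ᵐ ω ∂Pr, ∀ f : BoundedContinuousFunction ℝ ℝ,
          Tendsto
            (fun n : ℕ =>
              esd (zs 0 • (1 : Matrix (Fin n) (Fin n) ℝ) +
                ∑ i : Fin (Lm + 2), zs i.succ • ((XX n ω (i : ℕ))ᵀ * XX n ω (i : ℕ))) f)
            atTop (𝓝 (∫ x, f x ∂ν))) ∧
    -- second conclusion: the spectrum of the NTK itself
    (∃ ν : Measure ℝ, IsProbabilityMeasure ν ∧
      (∀ z : ℂ, 0 < z.im →
        stieltjesT ν z =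
          t (Lm + 1) (fun i => if i = 0 then (rplus : ℂ) - z else (qs i : ℂ))
            (fun i => if i = 0 then 1 else 0)) ∧
      (∀ᵐ ω ∂Pr, ∀ f : BoundedContinuousFunction ℝ ℝ,
        Tendsto (fun n : ℕ => esd (KNTK n ω) f) atTop (𝓝 (∫ x, f x ∂ν)))) ∧
    -- operator norm bound
    (∃ C : ℝ, 0 < C ∧ ∀ᵐ ω ∂Pr, ∀ᶠ n : ℕ in atTop, opNorm (KNTK n ω) ≤ C) := by
  intro XX KNTK rplus qs
  have N : Net Pr Lm d σ σ' σ'' lamσ bσ aσ W wOut X0 ε B γ :=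
    { prob := inferInstance, act := ⟨hderiv1, hderiv2, hσ'bdd, hσ''bdd, hmean, hvar, hbσ, haσ⟩, hW := hW, orth := hX0orth, hε := hε, hγ := hγ, hdim := hdim }
  have hext : ∀ n ω m, m < Lm + 1 → extW (Zc W wOut n ω) m = W n m ω := fun n ω m hm => by
    unfold extW; rw [dif_pos hm]; rfl
  have hXX : ∀ n ω ℓ, ℓ ≤ Lm + 1 → cL σ (X0 n) (Zc W wOut n ω) ℓ = XX n ω ℓ := fun n ω ℓ hℓ =>
    netLayer_congr ℓ fun m hm => hext n ω m (by omega)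
  have hDg : ∀ n ω k, k < Lm + 1 → ∀ i α, Dg σ σ' (X0 n) (Zc W wOut n ω) k α i = σ' (preact σ (d n) n (fun m => W n m ω) (X0 n) k i α) := fun n ω k hk i α => by
    unfold Dg preact; rw [hext n ω k hk, hXX n ω k (by omega)]
  have hS1 : ∀ n ω i α, S n ω (Lm + 1) i α = Dg σ σ' (X0 n) (Zc W wOut n ω) Lm α i * wOut n ω i * (Real.sqrt (d n (Lm + 1)))⁻¹ := fun n ω i α => by
    rw [hStop, hDg n ω Lm (by omega)]
  have hS2 : ∀ n ω, ∀ k < Lm, ∀ i α, S n ω (k + 1) i α = Dg σ σ' (X0 n) (Zc W wOut n ω) k α i * (Real.sqrt (d n (k + 1)))⁻¹ * ∑ j, extW (Zc W wOut n ω) (k + 1) j i * S n ω (k + 2) j α := fun n ω k hk i α => by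
    rw [hSrec n ω k hk, hDg n ω k (by omega), hext n ω (k + 1) (by omega)]
  have hKN : ∀ n ω, KN Lm (cL σ (X0 n) (Zc W wOut n ω)) (S n ω) = KNTK n ω := fun n ω => by
    unfold KN
    rw [hXX n ω _ le_rfl]
    refine congrArg₂ _ rfl (Finset.sum_congr rfl fun ℓ hℓ => ?_)
    rw [hXX n ω ℓ (by rw [Finset.mem_range] at hℓ; omega)]
  have hLin : ∀ n ω (zs : Fin (Lm + 3) → ℝ), Lin (cL σ (X0 n) (Zc W wOut n ω)) (Lm + 1) zs = zs 0 • (1 : Matrix (Fin n) (Fin n) ℝ) +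
      ∑ i : Fin (Lm + 2), zs i.succ • ((XX n ω (i : ℕ))ᵀ * XX n ω (i : ℕ)) := fun n ω zs => by
    unfold Lin
    refine congrArg₂ _ rfl (Finset.sum_congr rfl fun i _ => ?_)
    rw [hXX n ω i (by omega)]
  have hlt : ∀ zs : Fin (Lm + 3) → ℝ, zs (Fin.last (Lm + 2)) ≠ 0 → ∀ z : ℂ, 0 < z.im → ∀ᵐ ω ∂Pr,
      Tendsto (fun n : ℕ => (n : ℂ)⁻¹ * ((-z) • (1 : Matrix (Fin n) (Fin n) ℂ) + cx (Lin (cL σ (X0 n) (Zc W wOut n ω)) (Lm + 1) zs))⁻¹.trace) atTop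
        (𝓝 (t (Lm + 1) (fun i => if i = 0 then (zs 0 : ℂ) - z else (zs i : ℂ)) (fun i => if i = 0 then 1 else 0))) := by
    intro zs hzs z hz
    have hl : Fin.last (Lm + 1 + 1) ≠ 0 := by simp [Fin.ext_iff]
    have hd : InDomZ (ℓ := Lm + 1) (fun i => if i = 0 then (zs 0 : ℂ) - z else (zs i : ℂ)) := by
      refine ⟨by simpa using hz, fun i hi _ => by simp [hi], ?_, ?_⟩
      · simp [hl]
      · simp only [hl, if_false]; exact_mod_cast hzs
    have := N.de hbσ0 μ0 hμ0supp hμ0conv t s ht0 hs ht (Lm + 1) le_rfl _ hd (fun i => if i = 0 then 1 else 0)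
    filter_upwards [this] with ω hω
    refine hω.congr fun n => ?_
    rw [Lin_Yv, Yv_one, Matrix.mul_one]
  refine ⟨fun zs hzs => ?_, ?_, ?_⟩
  · obtain ⟨B1, hB1, h1⟩ := N.norm_as
    have := wc (Pr := Pr) (H := fun n ω => Lin (cL σ (X0 n) (Zc W wOut n ω)) (Lm + 1) zs) (fun n ω => Lin_herm _ _ _) _
      (by filter_upwards [h1] with ω a1
          filter_upwards [a1] with n b1
          exact Lin_norm _ _ zs B1 b1) _ (hlt zs hzs)
    simpa only [hLin] using this
  · obtain ⟨K, hK, h1⟩ := N.kn_norm hS1 hS2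
    have hq : qv aσ bσ Lm = qs := rfl
    have hq1 : qv aσ bσ Lm (Fin.last (Lm + 2)) ≠ 0 := by
      rw [qv, if_neg (by simp [Fin.ext_iff]), if_pos rfl]; exact one_ne_zero
    have := wc (Pr := Pr) (H := fun n ω => KN Lm (cL σ (X0 n) (Zc W wOut n ω)) (S n ω)) (fun n ω => KN_herm _ _ _) K h1 _
      (fun z hz => N.kn_tr hS1 hS2 _ z hz (hlt _ hq1 z hz))
    simp only [hKN] at this
    exact this
  · obtain ⟨K, hK, h1⟩ := N.kn_norm hS1 hS2
    simp only [hKN] at h1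
    exact ⟨K, hK, h1⟩
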